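/- There is an absolute constant C > 0 such that for all integers q ≥ 1, all real T ≥ 2, and all real σ, the following hold: if 1/2 ≤ σ ≤ 4/5 then ∑_{χ mod q} N(σ, T, χ) ≤ C (qT)^{3(1−σ)/(2−σ)} (log qT)^{9}, and if 4/5 ≤ σ ≤ 1 then ∑_{χ mod q} N(σ, T, χ) ≤ C (qT)^{2(1−σ)/σ} (log qT)^{14}, where the sums run over all Dirichlet characters χ modulo q. -/

import Mathlib

open scoped ENNReal

/-- The multiplicity of `z` as a zero of `f`: the smallest `n` such that the `n`-th iterated
derivative of `f` at `z` is nonzero (for an analytic function vanishing to finite order at `z`,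
this is exactly the order of vanishing). -/
noncomputable def zeroMultiplicity (f : ℂ → ℂ) (z : ℂ) : ℕ :=
  sInf {n : ℕ | iteratedDeriv n f z ≠ 0}

/-- `N(σ, T, χ)`: the number of zeros `ρ` of `L(s, χ)`, counted with multiplicity, in the
rectangle `{ s : Re s ≥ σ, |Im s| ≤ T }`, as an extended nonnegative real. -/
noncomputable def zeroCountingFunction {q : ℕ} [NeZero q] (χ : DirichletCharacter ℂ q)
    (σ T : ℝ) : ℝ≥0∞ :=
  ∑' ρ : {s : ℂ // DirichletCharacter.LFunction χ s = 0 ∧ σ ≤ s.re ∧ |s.im| ≤ T},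
    (zeroMultiplicity (DirichletCharacter.LFunction χ) ρ : ℝ≥0∞)

namespace ZeroDensity

open Complex MeasureTheory Set Filter Topology

/-- The kernel `exp (w ^ 2) / w` used in the smoothed Cauchy formula. -/
noncomputable def cauchyKernel (w : ℂ) : ℂ := cexp (w ^ 2) / w

lemma integrable_exp_mul_abs_sub_sq (A : ℝ) :
    Integrable (fun v : ℝ => Real.exp (A * |v| - v ^ 2)) := by
  have h1 : Integrable (fun v : ℝ => Real.exp (A ^ 2 / 2) * Real.exp (-(1/2) * v ^ 2)) :=
    (integrable_exp_neg_mul_sq (by norm_num)).const_mul _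
  refine h1.mono' (by fun_prop) (ae_of_all _ fun v => ?_)
  rw [Real.norm_eq_abs, abs_of_pos (Real.exp_pos _), ← Real.exp_add]
  apply Real.exp_le_exp.mpr
  nlinarith [sq_nonneg (A - |v|), sq_abs v]

lemma exp_mul_sub_sq_le (A y : ℝ) :
    Real.exp (A * |y| - y ^ 2) ≤ Real.exp ((A + 1) ^ 2 / 4) * Real.exp (-|y|) := by
  rw [← Real.exp_add]
  apply Real.exp_le_exp.mpr
  nlinarith [sq_nonneg ((A + 1) / 2 - |y|), sq_abs y]

lemma integrable_exp_neg_abs : Integrable (fun v : ℝ => Real.exp (-|v|)) := by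
  refine (integrable_inv_one_add_sq.const_mul 2).mono' (by fun_prop) (ae_of_all _ fun v => ?_)
  have := Real.quadratic_le_exp_of_nonneg (abs_nonneg v)
  rw [Real.norm_eq_abs, Real.abs_exp, Real.exp_neg, ← div_eq_mul_inv, inv_eq_one_div,
    div_le_div_iff₀ (Real.exp_pos _) (by positivity)]
  nlinarith [sq_abs v, abs_nonneg v]

/-- Shifting the line of integration of a rapidly decaying holomorphic function. -/
theorem integral_vertical_line_eq {g : ℂ → ℂ} {a b C : ℝ} (hab : a ≤ b)
    (hg : ∀ z : ℂ, a ≤ z.re → z.re ≤ b → DifferentiableAt ℂ g z)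
    (hC : ∀ z : ℂ, a ≤ z.re → z.re ≤ b → ‖g z‖ ≤ C * Real.exp (-|z.im|)) :
    ∫ v : ℝ, g (a + v * I) = ∫ v : ℝ, g (b + v * I) := by
  have hint : ∀ c : ℝ, a ≤ c → c ≤ b → Integrable (fun v : ℝ => g (c + v * I)) := by
    intro c hc1 hc2
    have h1 : Integrable (fun v : ℝ => C * Real.exp (-|v|)) := by
      refine Integrable.const_mul ?_ _
      exact integrable_exp_neg_abs
    refine h1.mono' ?_ (ae_of_all _ fun v => ?_)
    · apply Continuous.aestronglyMeasurable
      rw [continuous_iff_continuousAt]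
      intro v
      have := (hg (c + v * I) (by simpa) (by simpa)).continuousAt
      exact ContinuousAt.comp (f := fun v : ℝ => (c + v * I : ℂ)) this (by fun_prop)
    · simpa using hC (c + v * I) (by simpa) (by simpa)
  have hR : ∀ R : ℝ, 0 ≤ R → ‖(∫ y in (-R)..R, g (b + y * I)) - ∫ y in (-R)..R, g (a + y * I)‖
      ≤ 2 * (C * Real.exp (-R) * (b - a)) := by
    intro R hR0
    have H := Complex.integral_boundary_rect_eq_zero_of_differentiableOn g (a + ((-R : ℝ) : ℂ) * I)
      (b + (R : ℂ) * I) (by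
        intro z hz
        apply DifferentiableAt.differentiableWithinAt
        rw [mem_reProdIm] at hz
        have := hz.1
        simp [uIcc_of_le hab] at this
        exact hg z this.1 this.2)
    simp only [add_re, ofReal_re, mul_re, I_re, mul_zero, ofReal_im, I_im, mul_one, sub_self,
      add_zero, add_im, mul_im, zero_add] at H
    have hb : ∀ y : ℝ, |y| = R → ‖∫ x in a..b, g (x + y * I)‖ ≤ C * Real.exp (-R) * (b - a) := by
      intro y hy
      have := intervalIntegral.norm_integral_le_of_norm_le_const (a := a) (b := b)
        (C := C * Real.exp (-R)) (f := fun x : ℝ => g (x + y * I)) (by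
          intro x hx
          rw [uIoc_of_le hab] at hx
          have := hC (x + y * I) (by simpa using hx.1.le) (by simpa using hx.2)
          simpa [hy] using this)
      rwa [abs_of_nonneg (sub_nonneg.2 hab)] at this
    have h1 := hb (-R) (by rw [abs_neg, abs_of_nonneg hR0])
    have h2 := hb R (abs_of_nonneg hR0)
    have key : (∫ y in (-R)..R, g (b + y * I)) - ∫ y in (-R)..R, g (a + y * I)
      = I * ((∫ x in a..b, g (x + ((-R : ℝ) : ℂ) * I)) - ∫ x in a..b, g (x + (R : ℂ) * I)) := by
      simp only [smul_eq_mul] at H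
      linear_combination (-I) * H + ((∫ y in (-R)..R, g (b + y * I)) - ∫ y in (-R)..R, g (a + y * I)) * I_mul_I
    rw [key, norm_mul, norm_I, one_mul]
    refine (norm_sub_le _ _).trans (by linarith)
  have t1 := intervalIntegral_tendsto_integral (hint b hab le_rfl) tendsto_neg_atTop_atBot tendsto_id
  have t2 := intervalIntegral_tendsto_integral (hint a le_rfl hab) tendsto_neg_atTop_atBot tendsto_id
  have t3 := (t1.sub t2).norm
  have t4 : Tendsto (fun R : ℝ => 2 * (C * Real.exp (-R) * (b - a))) atTop (𝓝 0) := by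
    have := ((Real.tendsto_exp_neg_atTop_nhds_zero.const_mul C).mul_const (b - a)).const_mul 2
    simpa using this
  have := le_of_tendsto_of_tendsto t3 t4 (by
    filter_upwards [eventually_ge_atTop 0] with R hR0 using hR R hR0)
  exact (sub_eq_zero.1 (norm_le_zero_iff.1 this)).symm

lemma norm_exp_sq_vertical (c v : ℝ) :
    ‖cexp ((c + v * I : ℂ) ^ 2)‖ = Real.exp (c ^ 2 - v ^ 2) := by
  rw [Complex.norm_exp]
  congr 1
  simp [pow_two]

lemma abs_le_norm_vertical (c v : ℝ) : |c| ≤ ‖(c + v * I : ℂ)‖ := by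
  simpa using Complex.abs_re_le_norm (c + v * I)

lemma norm_cauchyKernel (c v : ℝ) :
    ‖cauchyKernel (c + v * I)‖ = Real.exp (c ^ 2 - v ^ 2) / ‖(c + v * I : ℂ)‖ := by
  rw [cauchyKernel, norm_div, norm_exp_sq_vertical]

lemma norm_cauchyKernel_le {c : ℝ} (hc : c ≠ 0) (v : ℝ) :
    ‖cauchyKernel (c + v * I)‖ ≤ Real.exp (c ^ 2) / |c| * Real.exp (-v ^ 2) := by
  rw [norm_cauchyKernel, div_mul_eq_mul_div, ← Real.exp_add, ← sub_eq_add_neg]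
  gcongr
  exact abs_le_norm_vertical c v

lemma vertical_ne_zero {c : ℝ} (hc : c ≠ 0) (v : ℝ) : (c + v * I : ℂ) ≠ 0 := by
  intro h
  have := congrArg re h
  simp at this
  exact hc this

lemma continuous_cauchyKernel_vertical {c : ℝ} (hc : c ≠ 0) :
    Continuous (fun v : ℝ => cauchyKernel (c + v * I)) := by
  unfold cauchyKernel
  exact Continuous.div (by fun_prop) (by fun_prop) (fun v => vertical_ne_zero hc v)

lemma integral_cauchyKernel_pos {c : ℝ} (hc : 0 < c) :
    ∫ v : ℝ, cauchyKernel (c + v * I) = Real.pi := by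
  have h1 : ∀ v : ℝ, cauchyKernel (c + v * I) =
      ∫ x in Ioi (0:ℝ), cexp ((c + v * I) ^ 2 + (-(c + v * I)) * x) := by
    intro v
    have := integral_exp_mul_complex_Ioi (a := -(c + v * I : ℂ)) (by simpa) 0
    simp only [Complex.exp_add, integral_const_mul]
    rw [this]
    simp only [ofReal_zero, mul_zero, Complex.exp_zero, cauchyKernel, div_neg]
    ring
  simp_rw [h1]
  rw [integral_integral_swap]
  · have h2 : ∀ x : ℝ, ∫ v : ℝ, cexp ((c + v * I) ^ 2 + (-(c + v * I)) * x) =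
        ((Real.sqrt Real.pi * Real.exp (-(1/4) * x ^ 2) : ℝ) : ℂ) := by
      intro x
      have := integral_cexp_quadratic (b := -1) (by simp) ((2 * c - x) * I) (c ^ 2 - c * x)
      have h3 : ∀ v : ℝ, ((c + v * I) ^ 2 + (-(c + v * I)) * x : ℂ) =
        -1 * v ^ 2 + (2 * c - x) * I * v + (c ^ 2 - c * x) := by
        intro v
        linear_combination (v : ℂ) ^ 2 * I_sq
      simp_rw [h3]
      rw [this]
      push_cast
      congr 1
      · rw [neg_neg, div_one, Real.sqrt_eq_rpow, ofReal_cpow Real.pi_pos.le]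
        simp
      · congr 1
        linear_combination ((2 * c - x : ℂ) ^ 2 / 4) * I_sq
    simp_rw [h2]
    rw [integral_complex_ofReal, integral_const_mul, integral_gaussian_Ioi]
    congr 1
    rw [show Real.pi / (1/4) = Real.pi * 2 ^ 2 by ring, Real.sqrt_mul Real.pi_pos.le,
      Real.sqrt_sq (by norm_num)]
    rw [mul_div_assoc, div_self (by norm_num), mul_one, Real.mul_self_sqrt Real.pi_pos.le]
  · have hv := integrable_exp_mul_abs_sub_sq 0
    have hx : IntegrableOn (fun x : ℝ => Real.exp (-c * x)) (Ioi 0) :=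
      integrableOn_exp_mul_Ioi (by linarith) 0
    have := (hv.mul_prod hx).const_mul (Real.exp (c ^ 2))
    refine this.mono' (by apply Continuous.aestronglyMeasurable; fun_prop)
      (ae_of_all _ fun p => ?_)
    simp only [Function.uncurry]
    rw [Complex.norm_exp, ← Real.exp_add, ← Real.exp_add]
    apply Real.exp_le_exp.2
    simp [pow_two]
    linarith

lemma integral_cauchyKernel_neg {c : ℝ} (hc : c < 0) :
    ∫ v : ℝ, cauchyKernel (c + v * I) = -Real.pi := by
  have h := integral_cauchyKernel_pos (c := -c) (by linarith)
  rw [← integral_neg_eq_self] at h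
  rw [← h, ← integral_neg]
  congr 1
  ext v
  simp only [cauchyKernel]
  rw [show ((-c : ℝ) + (-v : ℝ) * I : ℂ) = -(c + v * I) by push_cast; ring]
  rw [neg_sq, div_neg, neg_neg]

/-- Smoothed Cauchy formula on a vertical strip. -/
theorem strip_cauchy {f : ℂ → ℂ} {s : ℂ} {a b A C : ℝ} (ha : a < 0) (hb : 0 < b)
    (hf : ∀ z : ℂ, a ≤ z.re → z.re ≤ b → DifferentiableAt ℂ f (s + z))
    (hC : ∀ z : ℂ, a ≤ z.re → z.re ≤ b → ‖f (s + z)‖ ≤ C * Real.exp (A * |z.im|)) :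
    2 * Real.pi * f s = (∫ v : ℝ, f (s + (b + v * I)) * cauchyKernel (b + v * I)) -
      ∫ v : ℝ, f (s + (a + v * I)) * cauchyKernel (a + v * I) := by
  wlog hA : 0 ≤ A generalizing A
  · refine this (A := |A|) (fun z h1 h2 => (hC z h1 h2).trans ?_) (abs_nonneg A)
    have h0 : 0 ≤ C := by
      by_contra h
      have := (norm_nonneg _).trans (hC z h1 h2)
      nlinarith [Real.exp_pos (A * |z.im|)]
    gcongr
    exact le_abs_self A
  set F : ℂ → ℂ := fun z => f (s + z) with hF
  have hFd : ∀ z : ℂ, a ≤ z.re → z.re ≤ b → DifferentiableAt ℂ F z := by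
    intro z h1 h2
    exact DifferentiableAt.comp z (hf z h1 h2) (by fun_prop)
  have hC0 : 0 ≤ C := by
    by_contra h
    have := (norm_nonneg _).trans (hC 0 (by simpa using ha.le) (by simpa using hb.le))
    nlinarith [Real.exp_pos (A * |(0:ℂ).im|)]
  have hint : ∀ c : ℝ, a ≤ c → c ≤ b → c ≠ 0 →
      Integrable (fun v : ℝ => F (c + v * I) * cauchyKernel (c + v * I)) ∧
      Integrable (fun v : ℝ => cauchyKernel (c + v * I)) := by
    intro c h1 h2 h0
    have hcont : Continuous (fun v : ℝ => F (c + v * I)) := by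
      rw [continuous_iff_continuousAt]
      intro v
      have := (hFd (c + v * I) (by simpa) (by simpa)).continuousAt
      exact ContinuousAt.comp (f := fun v : ℝ => (c + v * I : ℂ)) this (by fun_prop)
    constructor
    · refine ((integrable_exp_mul_abs_sub_sq A).const_mul (C * (Real.exp (c ^ 2) / |c|))).mono'
        (hcont.mul (continuous_cauchyKernel_vertical h0)).aestronglyMeasurable
        (ae_of_all _ fun v => ?_)
      rw [norm_mul]
      have h3 := hC (c + v * I) (by simpa) (by simpa)
      have h4 := norm_cauchyKernel_le h0 v
      simp at h3
      calc _ ≤ C * Real.exp (A * |v|) * (Real.exp (c ^ 2) / |c| * Real.exp (-v ^ 2)) := by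
            simp only [hF]; gcongr
        _ = _ := by rw [sub_eq_add_neg, Real.exp_add]; ring
    · refine ((integrable_exp_mul_abs_sub_sq 0).const_mul (Real.exp (c ^ 2) / |c|)).mono'
        (continuous_cauchyKernel_vertical h0).aestronglyMeasurable
        (ae_of_all _ fun v => ?_)
      simpa using norm_cauchyKernel_le h0 v
  set G : ℂ → ℂ := fun z => dslope F 0 z * cexp (z ^ 2) with hG
  have hds : ∀ z : ℂ, a ≤ z.re → z.re ≤ b → DifferentiableAt ℂ (dslope F 0) z := by
    intro z h1 h2
    rcases eq_or_ne z 0 with rfl | hz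
    · have hnhds : {z : ℂ | a < z.re ∧ z.re < b} ∈ 𝓝 (0:ℂ) := by
        apply IsOpen.mem_nhds
        · exact (isOpen_lt continuous_const continuous_re).inter
            (isOpen_lt continuous_re continuous_const)
        · simp [ha, hb]
      have : DifferentiableOn ℂ (dslope F 0) {z : ℂ | a < z.re ∧ z.re < b} := by
        rw [Complex.differentiableOn_dslope hnhds]
        intro z hz
        exact (hFd z hz.1.le hz.2.le).differentiableWithinAt
      exact this.differentiableAt hnhds
    · exact (differentiableAt_dslope_of_ne hz).2 (hFd z h1 h2)
  obtain ⟨C', hC'⟩ : ∃ C', ∀ z : ℂ, a ≤ z.re → z.re ≤ b →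
      ‖dslope F 0 z‖ ≤ C' * Real.exp (A * |z.im|) := by
    have hcpt : IsCompact (uIcc a b ×ℂ uIcc (-1) 1) := isCompact_uIcc.reProdIm isCompact_uIcc
    obtain ⟨K, hK⟩ := hcpt.exists_bound_of_continuousOn (f := dslope F 0) (by
      intro z hz
      rw [mem_reProdIm, uIcc_of_le (ha.trans hb).le] at hz
      exact (hds z hz.1.1 hz.1.2).continuousAt.continuousWithinAt)
    refine ⟨max K 0 + (C + ‖F 0‖), fun z h1 h2 => ?_⟩
    have hE : 1 ≤ Real.exp (A * |z.im|) := Real.one_le_exp (by positivity)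
    by_cases him : |z.im| ≤ 1
    · have := hK z (by
        rw [mem_reProdIm, uIcc_of_le (ha.trans hb).le, uIcc_of_le (by norm_num)]
        exact ⟨⟨h1, h2⟩, abs_le.1 him⟩)
      have h5 : 0 ≤ max K 0 + (C + ‖F 0‖) := by positivity
      have h6 : K ≤ max K 0 + (C + ‖F 0‖) := by
        have := le_max_left K 0
        have := norm_nonneg (F 0)
        linarith
      nlinarith
    · push Not at him
      have hz : z ≠ 0 := by rintro rfl; simp at him; linarith
      have hn : 1 ≤ ‖z‖ := him.le.trans (Complex.abs_im_le_norm z)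
      rw [dslope_of_ne _ hz, slope_def_field, sub_zero, norm_div]
      have h7 := hC z h1 h2
      have h8 : ‖F z - F 0‖ ≤ C * Real.exp (A * |z.im|) + ‖F 0‖ :=
        (norm_sub_le _ _).trans (by gcongr)
      have h9 : ‖F z - F 0‖ / ‖z‖ ≤ ‖F z - F 0‖ := div_le_self (norm_nonneg _) hn
      have := le_max_right K 0
      nlinarith [norm_nonneg (F 0)]
  have hC'0 : 0 ≤ C' := by
    by_contra h
    have := (norm_nonneg _).trans (hC' 0 (by simpa using ha.le) (by simpa using hb.le))
    nlinarith [Real.exp_pos (A * |(0:ℂ).im|)]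
  have hshift := integral_vertical_line_eq (g := G) (a := a) (b := b)
    (C := C' * (Real.exp (a ^ 2 + b ^ 2)) * Real.exp ((A + 1) ^ 2 / 4)) (ha.trans hb).le
    (fun z h1 h2 => (hds z h1 h2).mul (by fun_prop)) (by
      intro z h1 h2
      have h3 : ‖cexp (z ^ 2)‖ = Real.exp (z.re ^ 2 - z.im ^ 2) := by
        rw [← norm_exp_sq_vertical, re_add_im]
      have h4 : z.re ^ 2 ≤ a ^ 2 + b ^ 2 := by
        rcases le_total 0 z.re with h | h <;> nlinarith
      calc ‖G z‖ ≤ (C' * Real.exp (A * |z.im|)) * Real.exp (z.re ^ 2 - z.im ^ 2) := by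
            rw [hG, norm_mul, h3]; gcongr; exact hC' z h1 h2
        _ = C' * Real.exp (z.re ^ 2) * Real.exp (A * |z.im| - z.im ^ 2) := by
            rw [sub_eq_add_neg, sub_eq_add_neg, Real.exp_add, Real.exp_add]; ring
        _ ≤ C' * Real.exp (a ^ 2 + b ^ 2) *
            (Real.exp ((A + 1) ^ 2 / 4) * Real.exp (-|z.im|)) := by
            gcongr; exact exp_mul_sub_sq_le _ _
        _ = _ := by ring)
  have hGc : ∀ c : ℝ, a ≤ c → c ≤ b → c ≠ 0 → ∫ v : ℝ, G (c + v * I) =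
      (∫ v : ℝ, F (c + v * I) * cauchyKernel (c + v * I)) -
        F 0 * ∫ v : ℝ, cauchyKernel (c + v * I) := by
    intro c h1 h2 h0
    rw [← integral_const_mul, ← integral_sub (hint c h1 h2 h0).1 ((hint c h1 h2 h0).2.const_mul _)]
    congr 1
    ext v
    have hz := vertical_ne_zero h0 v
    simp only [hG]
    rw [dslope_of_ne _ hz, slope_def_field, cauchyKernel]
    field_simp
    ring
  rw [hGc a le_rfl (ha.trans hb).le ha.ne, hGc b (ha.trans hb).le le_rfl hb.ne',
    integral_cauchyKernel_pos hb, integral_cauchyKernel_neg ha] at hshift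
  have hF0 : F 0 = f s := by simp [hF]
  rw [hF0] at hshift
  simp only [hF] at hshift
  linear_combination hshift

end ZeroDensity

namespace ZeroDensity

open Complex MeasureTheory Set Filter Topology

/-- Phragmén–Lindelöf for a function bounded in a closed strip. -/
lemma norm_le_of_bounded_strip {f : ℂ → ℂ} {a b C K : ℝ} (hab : a < b)
    (hf : ∀ z : ℂ, a ≤ z.re → z.re ≤ b → DifferentiableAt ℂ f z)
    (hK : ∀ z : ℂ, a ≤ z.re → z.re ≤ b → ‖f z‖ ≤ K)
    (ha : ∀ z : ℂ, z.re = a → ‖f z‖ ≤ C) (hb : ∀ z : ℂ, z.re = b → ‖f z‖ ≤ C)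
    {z : ℂ} (h1 : a ≤ z.re) (h2 : z.re ≤ b) : ‖f z‖ ≤ C := by
  refine PhragmenLindelof.vertical_strip (a := a) (b := b) ?_ ⟨0, by
    have := Real.pi_pos; have : 0 < b - a := by linarith
    positivity, 0, ?_⟩ ha hb h1 h2
  · refine DifferentiableOn.diffContOnCl ?_
    rw [closure_preimage_re, closure_Ioo hab.ne]
    exact fun z hz => (hf z hz.1 hz.2).differentiableWithinAt
  · refine Asymptotics.IsBigO.of_bound K ?_
    have : ∀ᶠ z in comap (_root_.abs ∘ im) atTop ⊓ 𝓟 (re ⁻¹' Ioo a b), z ∈ re ⁻¹' Ioo a b :=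
      eventually_inf_principal.2 (Eventually.of_forall fun z hz => hz)
    filter_upwards [this] with z hz
    simpa using hK z hz.1.le hz.2.le

lemma norm_Gamma_le {s : ℂ} (hs : 0 < s.re) : ‖Complex.Gamma s‖ ≤ Real.Gamma s.re := by
  rw [Complex.Gamma_eq_integral hs, Real.Gamma_eq_integral hs, Complex.GammaIntegral]
  refine (norm_integral_le_integral_norm _).trans (le_of_eq ?_)
  refine setIntegral_congr_fun measurableSet_Ioi fun x hx => ?_
  have hx : 0 < x := hx
  simp only [norm_mul]
  rw [Complex.norm_cpow_eq_rpow_re_of_pos hx, Complex.norm_real, Real.norm_eq_abs, Real.abs_exp]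
  simp

lemma norm_sq_Gamma_half (t : ℝ) :
    ‖Complex.Gamma (1 / 2 + t * I)‖ ^ 2 * Real.cosh (Real.pi * t) = Real.pi := by
  have h := Complex.Gamma_mul_Gamma_one_sub (1 / 2 + t * I)
  have h2 : (1 - (1 / 2 + t * I) : ℂ) = (starRingEnd ℂ) (1 / 2 + t * I) := by
    apply Complex.ext
    · simp; norm_num
    · simp
  rw [h2, Complex.Gamma_conj, Complex.mul_conj, mul_add, mul_one_div,
    add_comm (Real.pi / 2 : ℂ), Complex.sin_add_pi_div_two] at h
  have h3 : (Real.pi * (t * I) : ℂ) = ((Real.pi * t : ℝ) : ℂ) * I := by push_cast; ring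
  rw [h3, Complex.cos_mul_I, ← Complex.ofReal_cosh, eq_div_iff (by
    exact_mod_cast (Real.cosh_pos _).ne')] at h
  rw [Complex.normSq_eq_norm_sq] at h
  exact_mod_cast h

/-- The archimedean factor in the functional equation, up to a unimodular parameter `η`. -/
noncomputable def gammaPhase (η s : ℂ) : ℂ :=
  (2 * Real.pi) ^ (-s) * Complex.Gamma s * (cexp (Real.pi * I * s / 2) + η * cexp (-Real.pi * I * s / 2))

lemma norm_phase_le {η : ℂ} (hη : ‖η‖ = 1) (s : ℂ) :
    ‖cexp (Real.pi * I * s / 2) + η * cexp (-Real.pi * I * s / 2)‖ ≤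
      2 * Real.cosh (Real.pi * s.im / 2) := by
  refine (norm_add_le _ _).trans ?_
  rw [norm_mul, hη, one_mul, Complex.norm_exp, Complex.norm_exp, Real.cosh_eq]
  apply le_of_eq
  have h1 : (Real.pi * I * s / 2).re = -(Real.pi * s.im / 2) := by
    rw [show (Real.pi * I * s / 2 : ℂ) = ((Real.pi / 2 : ℝ) : ℂ) * (I * s) by push_cast; ring,
      re_ofReal_mul]
    simp; ring
  have h2 : (-Real.pi * I * s / 2).re = (Real.pi * s.im / 2) := by
    rw [show (-Real.pi * I * s / 2 : ℂ) = ((-Real.pi / 2 : ℝ) : ℂ) * (I * s) by push_cast; ring,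
      re_ofReal_mul]
    simp; ring
  rw [h1, h2]; ring

lemma norm_two_pi_cpow_le {s : ℂ} (hs : 0 ≤ s.re) : ‖(2 * Real.pi : ℂ) ^ (-s)‖ ≤ 1 := by
  have h : (2 * Real.pi : ℂ) = ((2 * Real.pi : ℝ) : ℂ) := by push_cast; rfl
  rw [h, Complex.norm_cpow_eq_rpow_re_of_pos (by positivity)]
  apply Real.rpow_le_one_of_one_le_of_nonpos
  · linarith [Real.pi_gt_three]
  · simpa

lemma norm_Gamma_mul_phase_half (t : ℝ) :
    ‖Complex.Gamma (1 / 2 + t * I)‖ * (2 * Real.cosh (Real.pi * t / 2)) ≤ 4 := by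
  apply le_of_sq_le_sq _ (by norm_num)
  have h := norm_sq_Gamma_half t
  have h2 : Real.cosh (Real.pi * t) = 2 * Real.cosh (Real.pi * t / 2) ^ 2 - 1 := by
    rw [show Real.pi * t = 2 * (Real.pi * t / 2) by ring, Real.cosh_two_mul]
    have := Real.cosh_sq (Real.pi * t / 2)
    rw [show 2 * (Real.pi * t / 2) / 2 = Real.pi * t / 2 by ring]
    linarith
  have h3 := Real.one_le_cosh (Real.pi * t)
  have := Real.pi_lt_d2
  calc _ = ‖Complex.Gamma (1 / 2 + t * I)‖ ^ 2 * (2 * Real.cosh (Real.pi * t) + 2) := by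
        rw [h2]; ring
    _ ≤ ‖Complex.Gamma (1 / 2 + t * I)‖ ^ 2 * (4 * Real.cosh (Real.pi * t)) := by
        gcongr; linarith
    _ = 4 * Real.pi := by linear_combination 4 * h
    _ ≤ 4 ^ 2 := by linarith

lemma norm_gammaPhase_half {η : ℂ} (hη : ‖η‖ = 1) {s : ℂ} (hs : s.re = 1 / 2) :
    ‖gammaPhase η s‖ ≤ 4 := by
  have hs' : s = 1 / 2 + s.im * I := by
    apply Complex.ext <;> simp [hs]
  have h1 := norm_phase_le hη s
  have h2 := norm_two_pi_cpow_le (s := s) (by rw [hs]; norm_num)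
  have h3 := norm_Gamma_mul_phase_half s.im
  rw [← hs'] at h3
  rw [gammaPhase, norm_mul, norm_mul]
  calc _ ≤ 1 * ‖Complex.Gamma s‖ * (2 * Real.cosh (Real.pi * s.im / 2)) := by gcongr
    _ ≤ 4 := by rwa [one_mul]

lemma norm_gammaPhase_three_half {η : ℂ} (hη : ‖η‖ = 1) {s : ℂ} (hs : s.re = 3 / 2) :
    ‖gammaPhase η s‖ ≤ 4 * (|s.im| + 1) := by
  have hs' : s - 1 = 1 / 2 + s.im * I := by
    apply Complex.ext <;> simp [hs]; norm_num
  have h1 := norm_phase_le hη s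
  have h2 := norm_two_pi_cpow_le (s := s) (by rw [hs]; norm_num)
  have h3 := norm_Gamma_mul_phase_half s.im
  rw [← hs'] at h3
  have h0 : s - 1 ≠ 0 := by
    intro h; have := congrArg re h; simp [hs] at this; norm_num at this
  have h4 : Complex.Gamma s = (s - 1) * Complex.Gamma (s - 1) := by
    rw [← Complex.Gamma_add_one _ h0]; simp
  have h5 : ‖s - 1‖ ≤ |s.im| + 1 := by
    refine (Complex.norm_le_abs_re_add_abs_im _).trans ?_
    simp [hs]
    rw [abs_of_nonneg (by norm_num)]
    linarith
  rw [gammaPhase, norm_mul, norm_mul, h4, norm_mul]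
  calc _ ≤ 1 * (‖s - 1‖ * ‖Complex.Gamma (s - 1)‖) * (2 * Real.cosh (Real.pi * s.im / 2)) := by gcongr
    _ = ‖s - 1‖ * (‖Complex.Gamma (s - 1)‖ * (2 * Real.cosh (Real.pi * s.im / 2))) := by ring
    _ ≤ (|s.im| + 1) * 4 := by gcongr
    _ = _ := by ring

lemma differentiableAt_gammaPhase (η : ℂ) {s : ℂ} (hs : 0 < s.re) :
    DifferentiableAt ℂ (gammaPhase η) s := by
  unfold gammaPhase
  have h1 : DifferentiableAt ℂ Complex.Gamma s := by
    apply Complex.differentiableAt_Gamma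
    intro m h
    rw [h] at hs
    simp at hs
    linarith [(Nat.cast_nonneg m : (0:ℝ) ≤ m)]
  have h2 : DifferentiableAt ℂ (fun s : ℂ => (2 * Real.pi : ℂ) ^ (-s)) s := by
    apply DifferentiableAt.const_cpow (by fun_prop)
    left
    exact_mod_cast (by positivity : (2 * Real.pi : ℝ) ≠ 0)
  fun_prop

lemma norm_gammaPhase_crude {η : ℂ} (hη : ‖η‖ = 1) :
    ∃ K : ℝ, ∀ s : ℂ, 1 / 2 ≤ s.re → s.re ≤ 3 / 2 →
      ‖gammaPhase η s‖ ≤ K * Real.exp (Real.pi / 2 * |s.im|) := by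
  have hc : ContinuousOn Real.Gamma (Icc (1 / 2) (3 / 2)) := by
    intro x hx
    refine (DifferentiableAt.continuousAt (𝕜 := ℝ) ?_).continuousWithinAt
    apply Real.differentiableAt_Gamma
    intro m h
    have := hx.1
    rw [h] at this
    linarith [(Nat.cast_nonneg m : (0:ℝ) ≤ m)]
  obtain ⟨K, hK⟩ := isCompact_Icc.exists_bound_of_continuousOn hc
  refine ⟨2 * K, fun s h1 h2 => ?_⟩
  have hg := (norm_Gamma_le (s := s) (by linarith)).trans
    ((le_abs_self _).trans (hK s.re ⟨h1, h2⟩))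
  have hK0 : 0 ≤ K := (norm_nonneg _).trans hg
  have hp := norm_phase_le hη s
  have h3 := norm_two_pi_cpow_le (s := s) (by linarith)
  have h4 : Real.cosh (Real.pi * s.im / 2) ≤ Real.exp (Real.pi / 2 * |s.im|) := by
    rw [← Real.cosh_abs, Real.cosh_eq, abs_div, abs_mul, abs_of_pos Real.pi_pos,
      abs_of_pos (by norm_num : (0:ℝ) < 2)]
    have : Real.exp (-(Real.pi * |s.im| / 2)) ≤ Real.exp (Real.pi * |s.im| / 2) := by
      apply Real.exp_le_exp.2
      have : 0 ≤ Real.pi * |s.im| / 2 := by have := Real.pi_pos; positivity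
      linarith
    rw [show Real.pi / 2 * |s.im| = Real.pi * |s.im| / 2 by ring]
    linarith
  rw [gammaPhase, norm_mul, norm_mul]
  calc _ ≤ 1 * K * (2 * Real.exp (Real.pi / 2 * |s.im|)) := by
        gcongr; exact hp.trans (by linarith)
    _ = _ := by ring

lemma one_add_abs_mul_exp_neg_sq_le (x : ℝ) : (1 + |x|) * Real.exp (-x ^ 2) ≤ 2 := by
  have h1 := Real.add_one_le_exp (x ^ 2)
  have h2 : 1 + |x| ≤ 2 * (x ^ 2 + 1) := by nlinarith [sq_abs x, sq_nonneg (|x| - 1), abs_nonneg x]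
  rw [Real.exp_neg, ← div_eq_mul_inv, div_le_iff₀ (Real.exp_pos _)]
  linarith

/-- Stirling-type bound for the archimedean factor. -/
theorem norm_gammaPhase_le {η : ℂ} (hη : ‖η‖ = 1) {s : ℂ} (h1 : 1 / 2 ≤ s.re) (h2 : s.re ≤ 3 / 2) :
    ‖gammaPhase η s‖ ≤ 8 * Real.exp 1 * (|s.im| + 2) ^ (s.re - 1 / 2) := by
  set B : ℝ := |s.im| + 2 with hB
  have hB0 : 0 < B := by positivity
  have hB1 : 1 ≤ B := by have := abs_nonneg s.im; linarith
  have hBc : (B : ℂ) ≠ 0 := by exact_mod_cast hB0.ne'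
  set h : ℂ → ℂ := fun z => gammaPhase η z * cexp ((z - s) ^ 2) * (B : ℂ) ^ (-(z - 1 / 2)) with hh
  have hnorm : ∀ z : ℂ, ‖h z‖ = ‖gammaPhase η z‖ * Real.exp ((z.re - s.re) ^ 2 - (z.im - s.im) ^ 2) *
      B ^ (-(z.re - 1 / 2)) := by
    intro z
    rw [hh]
    simp only [norm_mul]
    rw [Complex.norm_cpow_eq_rpow_re_of_pos hB0]
    congr 2
    · have := norm_exp_sq_vertical (z - s).re (z - s).im
      rw [re_add_im] at this
      simpa using this
    · simp
  have hexp : ∀ z : ℂ, 1 / 2 ≤ z.re → z.re ≤ 3 / 2 →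
      Real.exp ((z.re - s.re) ^ 2 - (z.im - s.im) ^ 2) ≤ Real.exp 1 * Real.exp (-(z.im - s.im) ^ 2) := by
    intro z h3 h4
    rw [← Real.exp_add]
    apply Real.exp_le_exp.2
    have : (z.re - s.re) ^ 2 ≤ 1 := by
      rw [sq_le_one_iff_abs_le_one, abs_le]
      constructor <;> linarith
    linarith
  have hBp : ∀ z : ℂ, 1 / 2 ≤ z.re → B ^ (-(z.re - 1 / 2)) ≤ 1 := fun z h3 =>
    Real.rpow_le_one_of_one_le_of_nonpos hB1 (by linarith)
  obtain ⟨K, hK⟩ := norm_gammaPhase_crude hη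
  have hK0 : 0 ≤ K := by
    by_contra hneg
    have := (norm_nonneg _).trans (hK s h1 h2)
    nlinarith [Real.exp_pos (Real.pi / 2 * |s.im|)]
  have key : ‖h s‖ ≤ 8 * Real.exp 1 := by
    refine norm_le_of_bounded_strip (a := 1 / 2) (b := 3 / 2)
      (K := K * Real.exp (Real.pi / 2 * |s.im|) * Real.exp 1 * Real.exp ((Real.pi / 2 + 1) ^ 2 / 4))
      (by norm_num) ?_ ?_ ?_ ?_ h1 h2
    · intro z h3 h4
      refine ((differentiableAt_gammaPhase η (by linarith)).mul (by fun_prop)).mul ?_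
      exact DifferentiableAt.const_cpow (by fun_prop) (Or.inl hBc)
    · intro z h3 h4
      rw [hnorm]
      have h5 : |z.im| ≤ |s.im| + |z.im - s.im| := by
        have := abs_add_le s.im (z.im - s.im)
        simpa using this
      calc _ ≤ (K * Real.exp (Real.pi / 2 * (|s.im| + |z.im - s.im|))) *
            (Real.exp 1 * Real.exp (-(z.im - s.im) ^ 2)) * 1 := by
              gcongr
              · refine (hK z h3 h4).trans ?_
                have := Real.pi_pos
                gcongr
              · exact hexp z h3 h4
              · exact hBp z h3
        _ = K * Real.exp (Real.pi / 2 * |s.im|) * Real.exp 1 *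
            Real.exp (Real.pi / 2 * |z.im - s.im| - (z.im - s.im) ^ 2) := by
              rw [mul_add, Real.exp_add, sub_eq_add_neg (Real.pi / 2 * _), Real.exp_add]; ring
        _ ≤ K * Real.exp (Real.pi / 2 * |s.im|) * Real.exp 1 *
            (Real.exp ((Real.pi / 2 + 1) ^ 2 / 4) * Real.exp (-|z.im - s.im|)) := by
              gcongr; exact exp_mul_sub_sq_le _ _
        _ ≤ K * Real.exp (Real.pi / 2 * |s.im|) * Real.exp 1 *
            (Real.exp ((Real.pi / 2 + 1) ^ 2 / 4) * 1) := by
              gcongr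
              exact Real.exp_le_one_iff.2 (by simp)
        _ = _ := by ring
    · intro z hz
      rw [hnorm]
      calc _ ≤ 4 * (Real.exp 1 * Real.exp (-(z.im - s.im) ^ 2)) * 1 := by
            gcongr
            · exact norm_gammaPhase_half hη hz
            · exact hexp z hz.ge (by rw [hz]; norm_num)
            · exact hBp z hz.ge
        _ ≤ 4 * (Real.exp 1 * 1) * 1 := by
            gcongr
            exact Real.exp_le_one_iff.2 (by nlinarith [sq_nonneg (z.im - s.im)])
        _ ≤ _ := by linarith [Real.exp_pos 1]
    · intro z hz
      rw [hnorm]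
      have h5 : |z.im| + 1 ≤ B * (1 + |z.im - s.im|) := by
        have h6 := abs_add_le s.im (z.im - s.im)
        have h7 : s.im + (z.im - s.im) = z.im := by ring
        rw [h7] at h6
        have := abs_nonneg (z.im - s.im)
        have := abs_nonneg s.im
        nlinarith
      have h8 : B ^ (-(z.re - 1 / 2)) = B⁻¹ := by
        rw [hz, show (-(3 / 2 - 1 / 2) : ℝ) = -1 by norm_num, Real.rpow_neg_one]
      rw [h8]
      calc _ ≤ 4 * (B * (1 + |z.im - s.im|)) * (Real.exp 1 * Real.exp (-(z.im - s.im) ^ 2)) * B⁻¹ := by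
            gcongr
            · exact (norm_gammaPhase_three_half hη hz).trans (by gcongr)
            · exact hexp z (by rw [hz]; norm_num) hz.le
        _ = 4 * Real.exp 1 * ((1 + |z.im - s.im|) * Real.exp (-(z.im - s.im) ^ 2)) := by
            field_simp
        _ ≤ 4 * Real.exp 1 * 2 := by gcongr; exact one_add_abs_mul_exp_neg_sq_le _
        _ = _ := by ring
  rw [hnorm] at key
  simp only [sub_self, ne_eq, OfNat.ofNat_ne_zero, not_false_eq_true, zero_pow, Real.exp_zero,
    mul_one] at key
  rw [Real.rpow_neg hB0.le, ← div_eq_mul_inv, div_le_iff₀ (Real.rpow_pos_of_pos hB0 _)] at key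
  exact key

end ZeroDensity

namespace ZeroDensity

open Complex MeasureTheory Set Filter Topology

lemma norm_mellin_le (P : WeakFEPair ℂ) (a b : ℝ) :
    ∃ C : ℝ, ∀ s : ℂ, a ≤ s.re → s.re ≤ b → ‖P.Λ₀ s‖ ≤ C := by
  have hc : ∀ s : ℂ, MellinConvergent P.f_modif s := fun s =>
    (P.isStrongFEPair_toStrongFEPair.hasMellin s).1
  have ha := (hc a).norm
  have hb := (hc b).norm
  refine ⟨(∫ x in Ioi (0:ℝ), (‖(x:ℂ) ^ ((a:ℂ) - 1) • P.f_modif x‖ +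
    ‖(x:ℂ) ^ ((b:ℂ) - 1) • P.f_modif x‖)),
    fun s h1 h2 => ?_⟩
  rw [WeakFEPair.Λ₀, mellin]
  refine norm_integral_le_of_norm_le (ha.add hb) ?_
  filter_upwards [ae_restrict_mem measurableSet_Ioi] with x hx
  have hx : 0 < x := hx
  simp only [norm_smul, Complex.norm_cpow_eq_rpow_re_of_pos hx]
  rw [← add_mul]
  gcongr
  simp only [sub_re, ofReal_re, one_re]
  rcases le_total 1 x with h | h
  · have := Real.rpow_le_rpow_of_exponent_le h (by linarith : s.re - 1 ≤ b - 1)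
    have := Real.rpow_nonneg hx.le (a - 1)
    linarith
  · have := Real.rpow_le_rpow_of_exponent_ge hx h (by linarith : a - 1 ≤ s.re - 1)
    have := Real.rpow_nonneg hx.le (b - 1)
    linarith

lemma norm_sin_le_exp (z : ℂ) : ‖Complex.sin z‖ ≤ Real.exp |z.im| := by
  rw [Complex.sin, norm_div, norm_mul, norm_I, mul_one, Complex.norm_ofNat]
  have h1 := norm_sub_le (cexp (-z * I)) (cexp (z * I))
  rw [Complex.norm_exp, Complex.norm_exp] at h1
  simp only [neg_mul, neg_re, mul_re, I_re, mul_zero, I_im, mul_one, zero_sub, neg_neg] at h1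
  have h2 := Real.exp_le_exp.2 (le_abs_self z.im)
  have h3 := Real.exp_le_exp.2 (neg_le_abs z.im)
  rw [div_le_iff₀ (by norm_num)]
  simp only [neg_mul]
  linarith

lemma norm_inv_Gamma_le : ∃ C : ℝ, 0 ≤ C ∧ ∀ w : ℂ, -1 ≤ w.re → w.re ≤ 3 / 2 → 1 / 2 ≤ |w.im| →
    ‖(Complex.Gamma w)⁻¹‖ ≤ C * Real.exp (4 * |w.im|) := by
  have hc : ContinuousOn Real.Gamma (Icc (1 / 2) 3) := by
    intro x hx
    refine (DifferentiableAt.continuousAt (𝕜 := ℝ) ?_).continuousWithinAt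
    apply Real.differentiableAt_Gamma
    intro m h
    have := hx.1
    rw [h] at this
    linarith [(Nat.cast_nonneg m : (0:ℝ) ≤ m)]
  obtain ⟨K, hK⟩ := isCompact_Icc.exists_bound_of_continuousOn hc
  have hK0 : 0 ≤ K := (norm_nonneg _).trans (hK 1 (by norm_num))
  refine ⟨K, hK0, fun w h1 h2 hw' => ?_⟩
  have hw : w.im ≠ 0 := by
    intro h; rw [h] at hw'; simp at hw'; linarith
  have hw1 : (1 - w) ≠ 0 := by
    intro h; have := congrArg im h; simp at this; exact hw this
  have hG : Complex.Gamma w ≠ 0 := by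
    apply Complex.Gamma_ne_zero
    intro m h; rw [h] at hw; simp at hw
  have h3 := Complex.Gamma_mul_Gamma_one_sub w
  have h4 : Complex.Gamma (2 - w) = (1 - w) * Complex.Gamma (1 - w) := by
    rw [← Complex.Gamma_add_one _ hw1]; ring_nf
  have hpi : (Real.pi : ℂ) ≠ 0 := by exact_mod_cast Real.pi_ne_zero
  have hsin : Complex.sin (Real.pi * w) ≠ 0 := by
    intro h
    rw [h, div_zero] at h3
    have hG2 : Complex.Gamma (1 - w) ≠ 0 := by
      apply Complex.Gamma_ne_zero
      intro m h; have := congrArg im h; simp at this; exact hw this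
    exact mul_ne_zero hG hG2 h3
  rw [eq_div_iff hsin] at h3
  have h5 : (Complex.Gamma w)⁻¹ * (Real.pi * (1 - w)) =
      Complex.Gamma (2 - w) * Complex.sin (Real.pi * w) := by
    rw [h4, inv_mul_eq_iff_eq_mul₀ hG]
    linear_combination (-(1 - w)) * h3
  have h8 : ‖Complex.Gamma (2 - w)‖ ≤ K :=
    (norm_Gamma_le (by simp; linarith)).trans ((le_abs_self _).trans
      (hK _ ⟨by simp; linarith, by simp; linarith⟩))
  have h9 : 1 ≤ ‖(Real.pi * (1 - w) : ℂ)‖ := by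
    rw [norm_mul, Complex.norm_real, Real.norm_eq_abs, abs_of_pos Real.pi_pos]
    have h10 := Complex.abs_im_le_norm (1 - w)
    simp only [sub_im, one_im, zero_sub, abs_neg] at h10
    nlinarith [Real.pi_gt_three]
  calc ‖(Complex.Gamma w)⁻¹‖ ≤ ‖(Complex.Gamma w)⁻¹‖ * ‖(Real.pi * (1 - w) : ℂ)‖ :=
        le_mul_of_one_le_right (norm_nonneg _) h9
    _ = ‖Complex.Gamma (2 - w)‖ * ‖Complex.sin (Real.pi * w)‖ := by rw [← norm_mul, h5, norm_mul]
    _ ≤ K * Real.exp (4 * |w.im|) := by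
        gcongr
        refine (norm_sin_le_exp _).trans ?_
        rw [Complex.im_ofReal_mul, abs_mul, abs_of_pos Real.pi_pos]
        gcongr
        exact Real.pi_le_four

lemma norm_inv_Gammaℝ_le : ∃ C : ℝ, 0 ≤ C ∧ ∀ s : ℂ, -2 ≤ s.re → s.re ≤ 3 → 1 ≤ |s.im| →
    ‖(Gammaℝ s)⁻¹‖ ≤ C * Real.exp (2 * |s.im|) := by
  obtain ⟨C, hC0, hC⟩ := norm_inv_Gamma_le
  refine ⟨Real.pi ^ (3 / 2 : ℝ) * C, by have := Real.pi_pos; positivity, fun s h1 h2 h3 => ?_⟩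
  have him : (s / 2).im = s.im / 2 := by simp
  have hre : (s / 2).re = s.re / 2 := by simp
  have h4 := hC (s / 2) (by rw [hre]; linarith) (by rw [hre]; linarith)
    (by rw [him, abs_div, abs_two]; linarith)
  rw [him, abs_div, abs_two] at h4
  rw [Gammaℝ_def, mul_inv, norm_mul, norm_inv, Complex.norm_cpow_eq_rpow_re_of_pos Real.pi_pos,
    ← Real.rpow_neg Real.pi_pos.le, mul_assoc]
  gcongr
  · linarith [Real.pi_gt_three]
  · simp; linarith
  · refine h4.trans (le_of_eq ?_); ring_nf

lemma norm_hurwitzZeta_le (a : UnitAddCircle) : ∃ C : ℝ, ∀ s : ℂ, -1 ≤ s.re → s.re ≤ 2 →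
    1 ≤ |s.im| → ‖HurwitzZeta.hurwitzZeta a s‖ ≤ C * Real.exp (2 * |s.im|) := by
  obtain ⟨G, hG0, hG⟩ := norm_inv_Gammaℝ_le
  obtain ⟨C1, hC1⟩ := norm_mellin_le (HurwitzZeta.hurwitzEvenFEPair a) (-1) 2
  obtain ⟨C2, hC2⟩ := norm_mellin_le (HurwitzZeta.hurwitzOddFEPair a) (-1) 2
  have hC10 : 0 ≤ C1 := (norm_nonneg _).trans (hC1 0 (by simp) (by simp))
  have hC20 : 0 ≤ C2 := (norm_nonneg _).trans (hC2 0 (by simp) (by simp))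
  refine ⟨(C1 + 2) * G + C2 * G, fun s h1 h2 h3 => ?_⟩
  have hs0 : s ≠ 0 := by rintro rfl; simp at h3; linarith
  have hs1 : 1 ≤ ‖s‖ := h3.trans (Complex.abs_im_le_norm s)
  have hs2 : 1 ≤ ‖1 - s‖ := by
    have := Complex.abs_im_le_norm (1 - s)
    simp at this; linarith
  have he : ‖HurwitzZeta.completedHurwitzZetaEven a s‖ ≤ C1 + 2 := by
    rw [HurwitzZeta.completedHurwitzZetaEven_eq]
    have h4 : ‖HurwitzZeta.completedHurwitzZetaEven₀ a s‖ ≤ C1 := by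
      rw [HurwitzZeta.completedHurwitzZetaEven₀, norm_div, Complex.norm_ofNat]
      have := hC1 (s / 2) (by simp; linarith) (by simp; linarith)
      linarith [norm_nonneg ((HurwitzZeta.hurwitzEvenFEPair a).Λ₀ (s / 2))]
    have h5 : ‖(if a = 0 then 1 else 0) / s‖ ≤ 1 := by
      rw [norm_div]
      apply div_le_one_of_le₀ _ (norm_nonneg _)
      split_ifs <;> simp [hs1]
    have h6 : ‖(1:ℂ) / (1 - s)‖ ≤ 1 := by
      rw [norm_div, norm_one]
      exact div_le_one_of_le₀ hs2 (norm_nonneg _)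
    refine (norm_sub_le _ _).trans ?_
    have := norm_sub_le (HurwitzZeta.completedHurwitzZetaEven₀ a s) ((if a = 0 then 1 else 0) / s)
    linarith
  have ho : ‖HurwitzZeta.completedHurwitzZetaOdd a s‖ ≤ C2 := by
    rw [HurwitzZeta.completedHurwitzZetaOdd, norm_div, Complex.norm_ofNat]
    have := hC2 ((s + 1) / 2) (by simp; linarith) (by simp; linarith)
    rw [WeakFEPair.Λ₀_eq] at this
    have h7 : (HurwitzZeta.hurwitzOddFEPair a).f₀ = 0 := (HurwitzZeta.isStrong_hurwitzOddFEPair a).hf₀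
    have h8 : (HurwitzZeta.hurwitzOddFEPair a).g₀ = 0 := (HurwitzZeta.isStrong_hurwitzOddFEPair a).hg₀
    rw [h7, h8, smul_zero, smul_zero, add_zero, add_zero] at this
    linarith [norm_nonneg ((HurwitzZeta.hurwitzOddFEPair a).Λ ((s + 1) / 2))]
  rw [HurwitzZeta.hurwitzZeta, HurwitzZeta.hurwitzZetaEven_def_of_ne_or_ne (Or.inr hs0),
    HurwitzZeta.hurwitzZetaOdd, div_eq_mul_inv, div_eq_mul_inv]
  refine (norm_add_le _ _).trans ?_
  rw [norm_mul, norm_mul]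
  have g1 := hG s (by linarith) (by linarith) h3
  have g2 := hG (s + 1) (by simp; linarith) (by simp; linarith) (by simpa)
  rw [show (s + 1).im = s.im by simp] at g2
  calc _ ≤ (C1 + 2) * (G * Real.exp (2 * |s.im|)) + C2 * (G * Real.exp (2 * |s.im|)) := by gcongr
    _ = _ := by ring

open DirichletCharacter

variable {q : ℕ} [NeZero q]

/-- The entire function `(s - 1) * L(s, χ)`. -/
noncomputable def entireL (χ : DirichletCharacter ℂ q) : ℂ → ℂ :=
  Function.update (fun s => (s - 1) * LFunction χ s) 1
    (if χ = 1 then ∏ p ∈ q.primeFactors, (1 - (p : ℂ)⁻¹) else 0)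

lemma entireL_of_ne (χ : DirichletCharacter ℂ q) {s : ℂ} (hs : s ≠ 1) :
    entireL χ s = (s - 1) * LFunction χ s := by
  simp [entireL, hs]

lemma differentiable_entireL (χ : DirichletCharacter ℂ q) : Differentiable ℂ (entireL χ) := by
  by_cases hχ : χ = 1
  · subst hχ
    have := differentiable_LFunctionTrivChar₁ q
    simpa [LFunctionTrivChar₁, LFunctionTrivChar, entireL] using this
  · have : entireL χ = fun s => (s - 1) * LFunction χ s := by
      rw [entireL, if_neg hχ, Function.update_eq_self_iff]
      simp
    rw [this]
    have := differentiable_LFunction hχ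
    fun_prop

lemma entireL_one_of_ne {χ : DirichletCharacter ℂ q} (hχ : χ ≠ 1) : entireL χ 1 = 0 := by
  simp [entireL, hχ]

lemma norm_entireL_one_le (χ : DirichletCharacter ℂ q) : ‖entireL χ 1‖ ≤ 1 := by
  by_cases hχ : χ = 1
  · simp only [entireL, hχ, if_true, Function.update_self, norm_prod]
    refine Finset.prod_le_one (fun _ _ => norm_nonneg _) fun p hp => ?_
    have hp := (Nat.prime_of_mem_primeFactors hp).one_le
    have h1 : (p : ℝ)⁻¹ ≤ 1 := inv_le_one_of_one_le₀ (by exact_mod_cast hp)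
    have h0 : 0 ≤ (p : ℝ)⁻¹ := by positivity
    rw [show (1 - (p : ℂ)⁻¹) = ((1 - (p : ℝ)⁻¹ : ℝ) : ℂ) by push_cast; rfl, Complex.norm_real,
      Real.norm_eq_abs, abs_of_nonneg (by linarith)]
    linarith
  · simp [entireL_one_of_ne hχ]

/-- Qualitative growth of `(s - 1) L(s, χ)` in vertical strips. -/
lemma norm_entireL_growth (χ : DirichletCharacter ℂ q) : ∃ C : ℝ, 0 ≤ C ∧
    ∀ s : ℂ, -1 ≤ s.re → s.re ≤ 2 → ‖entireL χ s‖ ≤ C * Real.exp (3 * |s.im|) := by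
  obtain ⟨K, hK⟩ := (isCompact_uIcc.reProdIm isCompact_uIcc :
    IsCompact (uIcc (-1 : ℝ) 2 ×ℂ uIcc (-1 : ℝ) 1)).exists_bound_of_continuousOn
    (differentiable_entireL χ).continuous.continuousOn
  choose C hC using norm_hurwitzZeta_le
  have hC0 : ∀ a, 0 ≤ C a := by
    intro a
    have := (norm_nonneg _).trans (hC a I (by simp) (by simp) (by simp))
    exact nonneg_of_mul_nonneg_left this (Real.exp_pos _)
  have hq1 : (1:ℝ) ≤ q := by exact_mod_cast NeZero.one_le
  set S : ℝ := ∑ j : ZMod q, C (ZMod.toAddCircle j) with hS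
  have hS0 : 0 ≤ S := Finset.sum_nonneg fun j _ => hC0 _
  refine ⟨|K| + 2 * (q * S), by positivity, fun s h1 h2 => ?_⟩
  by_cases him : |s.im| ≤ 1
  · have h3 := hK s (by
      rw [mem_reProdIm, uIcc_of_le (by norm_num), uIcc_of_le (by norm_num)]
      exact ⟨⟨h1, h2⟩, abs_le.1 him⟩)
    have h4 : 1 ≤ Real.exp (3 * |s.im|) := Real.one_le_exp (by positivity)
    have h5 : 0 ≤ 2 * (q * S) := by positivity
    have := le_abs_self K
    nlinarith [abs_nonneg K]
  · push Not at him
    have hs1 : s ≠ 1 := by rintro rfl; simp at him; linarith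
    rw [entireL_of_ne χ hs1, norm_mul, LFunction, ZMod.LFunction, norm_mul]
    have h3 : ‖(q : ℂ) ^ (-s)‖ ≤ q := by
      rw [← ofReal_natCast, Complex.norm_cpow_eq_rpow_re_of_pos (by linarith)]
      calc (q:ℝ) ^ (-s).re ≤ (q:ℝ) ^ (1:ℝ) :=
            Real.rpow_le_rpow_of_exponent_le hq1 (by simp; linarith)
        _ = q := Real.rpow_one _
    have h4 : ‖∑ j : ZMod q, χ j * HurwitzZeta.hurwitzZeta (ZMod.toAddCircle j) s‖ ≤
        S * Real.exp (2 * |s.im|) := by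
      refine (norm_sum_le _ _).trans ?_
      rw [hS, Finset.sum_mul]
      gcongr with j
      rw [norm_mul]
      have := hC (ZMod.toAddCircle j) s h1 h2 him.le
      calc _ ≤ 1 * ‖HurwitzZeta.hurwitzZeta (ZMod.toAddCircle j) s‖ := by
            gcongr; exact DirichletCharacter.norm_le_one χ j
        _ ≤ _ := by rwa [one_mul]
    have h5 : ‖s - 1‖ ≤ 2 * Real.exp |s.im| := by
      refine (Complex.norm_le_abs_re_add_abs_im _).trans ?_
      have h6 : |s.re - 1| ≤ 2 := abs_le.2 ⟨by linarith, by linarith⟩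
      have h7 := Real.add_one_le_exp |s.im|
      simp only [sub_re, one_re, sub_im, one_im, sub_zero]
      linarith [abs_nonneg s.im]
    calc _ ≤ 2 * Real.exp |s.im| * (q * (S * Real.exp (2 * |s.im|))) := by gcongr
      _ = 2 * (q * S) * Real.exp (3 * |s.im|) := by
          rw [show 3 * |s.im| = |s.im| + 2 * |s.im| by ring, Real.exp_add]; ring
      _ ≤ _ := by gcongr; linarith [abs_nonneg K]

/-- Functional equation for primitive characters, with explicit archimedean factor. -/
theorem exists_functional_equation {χ : DirichletCharacter ℂ q} (hχ : χ.IsPrimitive) :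
    ∃ η c : ℂ, ‖η‖ = 1 ∧ ‖c‖ = Real.sqrt q ∧ ∀ s : ℂ, 0 < s.re → s ≠ 1 →
      LFunction χ (1 - s) = (q : ℂ) ^ (s - 1) * c * gammaPhase η s * LFunction χ⁻¹ s := by
  have hq0 : (0:ℝ) < q := by exact_mod_cast NeZero.pos q
  set cc : DirichletCharacter ℂ q → ℂ := fun ψ => ψ⁻¹ (-1) * gaussSum ψ ZMod.stdAddChar with hcc
  have hft : ∀ ψ : DirichletCharacter ℂ q, ψ.IsPrimitive → 
      ZMod.dft (ψ : ZMod q → ℂ) = fun j => cc ψ * ψ⁻¹ j := by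
    intro ψ hψ
    ext j
    rw [hψ.fourierTransform_eq_inv_mul_gaussSum, ← neg_one_mul j, map_mul, mul_right_comm]
  have hprim : χ⁻¹.IsPrimitive := by
    rw [isPrimitive_def, conductor_inv]
    exact hχ
  have hn1 : ∀ ψ : DirichletCharacter ℂ q, ‖ψ (-1)‖ = 1 := fun ψ => by
    have := ψ.unit_norm_eq_one (-1)
    simpa using this
  have h1 : cc χ * (cc χ⁻¹ * χ (-1)) = q := by
    have h := congrFun (ZMod.dft_dft (χ : ZMod q → ℂ)) (-1)
    rw [hft χ hχ, ZMod.dft_const_mul, hft _ hprim] at h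
    simpa only [inv_inv, neg_neg, map_one, smul_eq_mul, mul_one] using h
  have h2 : ‖cc χ⁻¹‖ = ‖cc χ‖ := by
    have h := congrFun (hft χ hχ) 1
    have h' := congrFun (hft _ hprim) (-1)
    simp only [map_one, mul_one, inv_inv] at h h'
    have h3 : ‖ZMod.dft (fun j => χ⁻¹ j) (-1)‖ = ‖cc χ⁻¹‖ := by
      rw [show (fun j => χ⁻¹ j) = ⇑(χ⁻¹) from rfl, h', norm_mul, hn1, mul_one]
    rw [← h3, ← h, ← RCLike.norm_conj (ZMod.dft (χ : ZMod q → ℂ) 1), ZMod.dft_apply, ZMod.dft_apply,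
      map_sum]
    congr 1
    refine Finset.sum_congr rfl fun j _ => ?_
    rw [smul_eq_mul, smul_eq_mul, map_mul, ← AddChar.map_neg_eq_conj, ← MulChar.star_apply' χ]
    simp
  have h3 : ‖cc χ‖ = Real.sqrt q := by
    have h := congrArg norm h1
    rw [norm_mul (cc χ), norm_mul (cc χ⁻¹), hn1, h2, mul_one, Complex.norm_natCast] at h
    rw [← h, Real.sqrt_mul_self (norm_nonneg _)]
  refine ⟨χ (-1), cc χ, hn1 χ, h3, fun s hs hs1 => ?_⟩
  have h4 := ZMod.LFunction_one_sub (χ : ZMod q → ℂ) (s := s)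
    (fun n h => by rw [h] at hs; simp at hs; linarith [(Nat.cast_nonneg n : (0:ℝ) ≤ n)]) (Or.inr hs1)
  have h5 : (fun x => χ (-x)) = fun x => χ (-1) * χ x := by
    ext x; rw [← map_mul, neg_one_mul]
  have h6 : ∀ (a : ℂ) (f : ZMod q → ℂ), ZMod.LFunction (fun j => a * f j) s = a * ZMod.LFunction f s := by
    intro a f
    simp only [ZMod.LFunction, Finset.mul_sum]
    refine Finset.sum_congr rfl fun j _ => by ring
  rw [h5, ZMod.dft_const_mul, h6, hft χ hχ, h6] at h4
  rw [LFunction, h4, gammaPhase, LFunction]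
  ring

end ZeroDensity

namespace ZeroDensity

open Complex MeasureTheory Set Filter Topology DirichletCharacter

lemma summable_rpow_neg {a : ℝ} (ha : 0 < a) : Summable fun n : ℕ => (n : ℝ) ^ (-(1 + a)) := by
  rw [Real.summable_nat_rpow]; linarith

lemma tsum_rpow_neg_le {a : ℝ} (ha : 0 < a) : ∑' n : ℕ, (n : ℝ) ^ (-(1 + a)) ≤ 1 + 1 / a := by
  have h := ZetaAsymptotics.zeta_limit_aux1 (s := 1 + a) (by linarith)
  have h1 : 0 ≤ ZetaAsymptotics.termTSum (1 + a) :=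
    tsum_nonneg fun n => ZetaAsymptotics.term_nonneg _ _
  rw [(summable_rpow_neg ha).tsum_eq_zero_add]
  have h2 : ∀ n : ℕ, ((n + 1 : ℕ) : ℝ) ^ (-(1 + a)) = 1 / (n + 1 : ℝ) ^ (1 + a) := fun n => by
    rw [Real.rpow_neg (by positivity)]; push_cast; rw [one_div]
  simp only [h2]
  rw [Nat.cast_zero, Real.zero_rpow (by linarith), zero_add]
  have h3 : 0 ≤ (1 + a) * ZetaAsymptotics.termTSum (1 + a) := by positivity
  rw [add_sub_cancel_left] at h
  linarith

lemma norm_term_le {q : ℕ} (χ : DirichletCharacter ℂ q) {a : ℝ} {s : ℂ} (hs : 1 + a ≤ s.re) (n : ℕ) :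
    ‖LSeries.term (χ ·) s n‖ ≤ (n : ℝ) ^ (-(1 + a)) := by
  rcases Nat.eq_zero_or_pos n with rfl | hn
  · simp only [LSeries.term_zero, norm_zero]; positivity
  · rw [LSeries.term_of_ne_zero hn.ne', norm_div, ← ofReal_natCast,
      Complex.norm_cpow_eq_rpow_re_of_pos (by positivity), Real.rpow_neg (by positivity), ← one_div]
    gcongr
    · exact χ.norm_le_one _
    · exact_mod_cast hn

variable {q : ℕ} [NeZero q]

lemma norm_LFunction_le (χ : DirichletCharacter ℂ q) {a : ℝ} (ha : 0 < a) {s : ℂ}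
    (hs : 1 + a ≤ s.re) : ‖LFunction χ s‖ ≤ 1 + 1 / a := by
  rw [LFunction_eq_LSeries χ (by linarith), LSeries]
  refine (tsum_of_norm_bounded (summable_rpow_neg ha).hasSum (norm_term_le χ hs)).trans
    (tsum_rpow_neg_le ha)

lemma norm_natCast_cpow {n : ℕ} (hn : 0 < n) (s : ℂ) : ‖(n : ℂ) ^ s‖ = (n : ℝ) ^ s.re := by
  rw [← ofReal_natCast, Complex.norm_cpow_eq_rpow_re_of_pos (by positivity)]

/-- The functional equation in asymmetric form: `L(z, χ) = κ(z) L(1 - z, χ⁻¹)`. -/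
theorem exists_functional_factor : ∃ C : ℝ, 0 < C ∧ ∀ (q : ℕ) [NeZero q] (χ : DirichletCharacter ℂ q),
    χ.IsPrimitive → ∃ κ : ℂ → ℂ, (∀ z, z.re < 1 → DifferentiableAt ℂ κ z) ∧
    (∀ z, z.re < 1 → z ≠ 0 → LFunction χ z = κ z * LFunction χ⁻¹ (1 - z)) ∧
    (∀ z, -(1 / 2) ≤ z.re → z.re ≤ 1 / 2 → ‖κ z‖ ≤ C * (q * (|z.im| + 2)) ^ (1 / 2 - z.re)) := by
  refine ⟨8 * Real.exp 1, by positivity, fun q _ χ hχ => ?_⟩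
  have hq : 0 < q := NeZero.pos q
  have hqc : (q : ℂ) ≠ 0 := by exact_mod_cast hq.ne'
  obtain ⟨η, c, hη, hc, h⟩ := exists_functional_equation hχ
  refine ⟨fun z => (q : ℂ) ^ (-z) * c * gammaPhase η (1 - z), fun z hz => ?_, fun z hz hz0 => ?_,
    fun z h1 h2 => ?_⟩
  · have h1 : DifferentiableAt ℂ (fun z => gammaPhase η (1 - z)) z :=
      DifferentiableAt.comp z (differentiableAt_gammaPhase η (s := 1 - z) (by simp; linarith))
        (by fun_prop)
    have h2 : DifferentiableAt ℂ (fun z : ℂ => (q : ℂ) ^ (-z)) z :=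
      DifferentiableAt.const_cpow (by fun_prop) (Or.inl hqc)
    exact (h2.mul_const c).mul h1
  · have := h (1 - z) (by simp; linarith) (by simpa using hz0)
    rw [sub_sub_cancel] at this
    rw [this]
    ring_nf
  · have h3 := norm_gammaPhase_le hη (s := 1 - z) (by simp; linarith) (by simp; linarith)
    simp only [sub_re, one_re, sub_im, one_im, zero_sub, abs_neg] at h3
    rw [norm_mul, norm_mul, hc, norm_natCast_cpow hq, Real.sqrt_eq_rpow, ← Real.rpow_add (by positivity),
      Real.mul_rpow (by positivity) (by positivity), neg_re]
    calc _ ≤ (q : ℝ) ^ (-z.re + 1 / 2) * (8 * Real.exp 1 * (|z.im| + 2) ^ (1 - z.re - 1 / 2)) := by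
          gcongr
      _ = _ := by
          rw [show -z.re + 1 / 2 = 1 / 2 - z.re by ring,
            show 1 - z.re - 1 / 2 = 1 / 2 - z.re by ring]; ring

/-- Comparison of `L(s, χ)` with the primitive character inducing `χ`. -/
lemma norm_LFunction_changeLevel_le {d : ℕ} [NeZero d] (hd : d ∣ q) (ψ : DirichletCharacter ℂ d)
    {s : ℂ} (hs : s ≠ 1) : ‖LFunction (changeLevel hd ψ) s‖ ≤ ‖LFunction ψ s‖ *
      ∏ p ∈ (q / d).primeFactors, (1 + (p : ℝ) ^ (-s.re)) := by
  rw [LFunction_changeLevel hd ψ (Or.inr hs), norm_mul]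
  gcongr
  rw [norm_prod]
  have hsub : (q / d).primeFactors ⊆ q.primeFactors :=
    Nat.primeFactors_mono (Nat.div_dvd_of_dvd hd) (NeZero.ne q)
  rw [← Finset.prod_sdiff hsub]
  have h1 : ∏ p ∈ q.primeFactors \ (q / d).primeFactors,
      ‖1 - ψ p * (p : ℂ) ^ (-s)‖ = 1 := by
    refine Finset.prod_eq_one fun p hp => ?_
    rw [Finset.mem_sdiff] at hp
    have hpp := Nat.prime_of_mem_primeFactors hp.1
    have hpd : p ∣ d := by
      by_contra hnd
      apply hp.2
      rw [Nat.mem_primeFactors]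
      refine ⟨hpp, ?_, (Nat.div_pos (Nat.le_of_dvd (NeZero.pos q) hd) (NeZero.pos _)).ne'⟩
      have h2 : p ∣ d * (q / d) := by
        rw [Nat.mul_div_cancel' hd]; exact Nat.dvd_of_mem_primeFactors hp.1
      exact (hpp.dvd_mul.1 h2).resolve_left hnd
    have h2 : ψ (p : ZMod d) = 0 := by
      apply MulChar.map_nonunit
      rw [ZMod.isUnit_iff_coprime, Nat.Prime.coprime_iff_not_dvd hpp]
      exact not_not.2 hpd
    rw [h2, zero_mul, sub_zero, norm_one]
  rw [h1, one_mul]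
  refine Finset.prod_le_prod (fun _ _ => norm_nonneg _) fun p hp => ?_
  have hpp := Nat.prime_of_mem_primeFactors hp
  refine (norm_sub_le _ _).trans ?_
  rw [norm_one, norm_mul, norm_natCast_cpow hpp.pos, neg_re]
  gcongr
  have := ψ.norm_le_one p
  have h0 : (0:ℝ) ≤ (p:ℝ) ^ (-s.re) := by positivity
  nlinarith

lemma norm_LFunction_le_primitive (χ : DirichletCharacter ℂ q) [NeZero χ.conductor] {s : ℂ}
    (hs : s ≠ 1) : ‖LFunction χ s‖ ≤ ‖LFunction χ.primitiveCharacter s‖ *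
      ∏ p ∈ (q / χ.conductor).primeFactors, (1 + (p : ℝ) ^ (-s.re)) := by
  have h := norm_LFunction_changeLevel_le χ.conductor_dvd_level χ.primitiveCharacter hs
  rwa [changeLevel_primitiveCharacter] at h

lemma prod_primeFactors_le {e : ℕ} (he : e ≠ 0) : (∏ p ∈ e.primeFactors, (p : ℝ)) ≤ e := by
  have := Nat.le_of_dvd (Nat.pos_of_ne_zero he) (Nat.prod_primeFactors_dvd e)
  rw [← Nat.cast_prod]
  exact_mod_cast this

lemma prod_four_le {e : ℕ} (he : e ≠ 0) :
    (∏ _p ∈ e.primeFactors, (4 : ℝ)) ≤ 4 ^ 16 * (e : ℝ) ^ (1 / 2 : ℝ) := by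
  have h1 : ∏ _p ∈ e.primeFactors, (4 : ℝ) ≤
      ∏ p ∈ e.primeFactors, ((if p < 16 then 4 else 1) * (p : ℝ) ^ (1 / 2 : ℝ)) := by
    refine Finset.prod_le_prod (fun _ _ => by norm_num) fun p hp => ?_
    have hpp := (Nat.prime_of_mem_primeFactors hp).one_le
    have hp1 : (1:ℝ) ≤ p := by exact_mod_cast hpp
    split_ifs with h
    · have := Real.one_le_rpow hp1 (by norm_num : (0:ℝ) ≤ 1 / 2)
      linarith
    · push Not at h
      rw [one_mul, ← Real.sqrt_eq_rpow]
      apply Real.le_sqrt_of_sq_le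
      have : (16:ℝ) ≤ p := by exact_mod_cast h
      linarith
  refine h1.trans ?_
  rw [Finset.prod_mul_distrib, Real.finsetProd_rpow _ _ (fun _ _ => by positivity)]
  gcongr
  · rw [Finset.prod_ite, Finset.prod_const_one, mul_one, Finset.prod_const]
    refine pow_le_pow_right₀ (by norm_num) ?_
    calc _ ≤ (Finset.range 16).card := Finset.card_le_card fun p hp => by
          simp only [Finset.mem_filter] at hp; exact Finset.mem_range.2 hp.2
      _ = 16 := by simp
  · exact prod_primeFactors_le he

/-- Bound for primitive characters to the left of the critical strip. -/
lemma norm_LFunction_left_primitive : ∃ C : ℝ, 0 < C ∧ ∀ (q : ℕ) [NeZero q] (χ : DirichletCharacter ℂ q),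
    χ.IsPrimitive → ∀ (a : ℝ) (s : ℂ), 0 < a → a ≤ 1 / 2 → s.re = -a →
    ‖LFunction χ s‖ ≤ C * (q * (|s.im| + 2)) ^ (1 / 2 + a) * (1 + 1 / a) := by
  obtain ⟨C, hC, h⟩ := exists_functional_factor
  refine ⟨C, hC, fun q _ χ hχ a s ha ha2 hs => ?_⟩
  obtain ⟨κ, -, h1, h2⟩ := h q χ hχ
  rw [h1 s (by linarith) (by rintro rfl; simp at hs; linarith), norm_mul]
  have h3 := h2 s (by linarith) (by linarith)
  rw [hs, sub_neg_eq_add] at h3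
  gcongr
  exact norm_LFunction_le _ ha (by simp [hs])

instance neZero_conductor (χ : DirichletCharacter ℂ q) : NeZero χ.conductor :=
  ⟨fun h => NeZero.ne q (by simpa [h] using χ.conductor_dvd_level)⟩

/-- Bound for `L(s, χ)` on a line slightly to the left of the critical strip. -/
theorem norm_LFunction_left : ∃ C : ℝ, 0 < C ∧ ∀ (q : ℕ) [NeZero q] (χ : DirichletCharacter ℂ q)
    (a : ℝ) (s : ℂ), 0 < a → a ≤ 1 / 2 → (q : ℝ) ^ a ≤ 3 → s.re = -a →
    ‖LFunction χ s‖ ≤ C * (q * (|s.im| + 2)) ^ (1 / 2 : ℝ) * (|s.im| + 2) ^ a * (1 + 1 / a) := by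
  obtain ⟨C, hC, h⟩ := norm_LFunction_left_primitive
  refine ⟨C * 4 ^ 16 * 3, by positivity, fun q _ χ a s ha ha2 hqa hs => ?_⟩
  have hs1 : s ≠ 1 := by rintro rfl; simp at hs; linarith
  have hd := χ.conductor_dvd_level
  have hdq := Nat.le_of_dvd (NeZero.pos q) hd
  have he0 : q / χ.conductor ≠ 0 := (Nat.div_pos hdq (NeZero.pos _)).ne'
  have h1 := h χ.conductor χ.primitiveCharacter χ.primitiveCharacter_isPrimitive a s ha ha2 hs
  have h2 : ∏ p ∈ (q / χ.conductor).primeFactors, (1 + (p : ℝ) ^ (-s.re)) ≤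
      4 ^ 16 * ((q / χ.conductor : ℕ) : ℝ) ^ (1 / 2 : ℝ) := by
    refine le_trans (Finset.prod_le_prod (fun _ _ => by positivity) fun p hp => ?_)
      (prod_four_le he0)
    have hpq : p ≤ q := (Nat.le_of_mem_primeFactors hp).trans (Nat.div_le_self _ _)
    have h3 : (p:ℝ) ^ (-s.re) ≤ (q:ℝ) ^ a := by
      rw [hs, neg_neg]; gcongr
    linarith
  refine (norm_LFunction_le_primitive χ hs1).trans ?_
  have h4 : (χ.conductor : ℝ) * ((q / χ.conductor : ℕ) : ℝ) = q := by
    exact_mod_cast Nat.mul_div_cancel' hd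
  set d : ℝ := (χ.conductor : ℝ)
  set e : ℝ := ((q / χ.conductor : ℕ) : ℝ)
  have hd0 : 0 ≤ d := by positivity
  have he0 : 0 ≤ e := by positivity
  set B := |s.im| + 2 with hB
  have hB0 : 0 < B := by positivity
  have hdq' : d ≤ q := Nat.cast_le.2 hdq
  have hd3 : d ^ a ≤ 3 := (by gcongr : d ^ a ≤ (q:ℝ) ^ a).trans hqa
  calc _ ≤ (C * (d * B) ^ (1 / 2 + a) * (1 + 1 / a)) * (4 ^ 16 * e ^ (1 / 2 : ℝ)) := by
        gcongr
    _ = C * 4 ^ 16 * (d ^ a) * ((d * e) ^ (1 / 2 : ℝ) * B ^ (1 / 2 : ℝ)) * B ^ a * (1 + 1 / a) := by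
        rw [Real.rpow_add_of_nonneg (by positivity) (by norm_num) ha.le, Real.mul_rpow hd0 hB0.le,
          Real.mul_rpow hd0 hB0.le, Real.mul_rpow hd0 he0]
        ring
    _ ≤ C * 4 ^ 16 * 3 * ((d * e) ^ (1 / 2 : ℝ) * B ^ (1 / 2 : ℝ)) * B ^ a * (1 + 1 / a) := by
        gcongr
    _ = _ := by
        rw [h4, ← Real.mul_rpow (by positivity) hB0.le]

end ZeroDensity

namespace ZeroDensity

open Complex MeasureTheory Set Filter Topology DirichletCharacter

/-- A function bounded on the two edges of a strip is bounded inside. -/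
lemma exists_strip_bound : ∃ C : ℝ, 0 < C ∧ ∀ (f : ℂ → ℂ) (s : ℂ) (a b A K M : ℝ),
    -2 ≤ a → a ≤ -(1 / 2) → 1 / 2 ≤ b → b ≤ 2 →
    (∀ z : ℂ, a ≤ z.re → z.re ≤ b → DifferentiableAt ℂ f (s + z)) →
    (∀ z : ℂ, a ≤ z.re → z.re ≤ b → ‖f (s + z)‖ ≤ K * Real.exp (A * |z.im|)) →
    (∀ v : ℝ, ‖f (s + (a + v * I))‖ ≤ M * Real.exp (2 * |v|)) →
    (∀ v : ℝ, ‖f (s + (b + v * I))‖ ≤ M * Real.exp (2 * |v|)) → ‖f s‖ ≤ C * M := by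
  set J : ℝ := ∫ v : ℝ, Real.exp (2 * |v| - v ^ 2) with hJ
  have hJ0 : 0 ≤ J := integral_nonneg fun v => (Real.exp_pos _).le
  refine ⟨4 * Real.exp 4 * J + 1, by positivity, fun f s a b A K M h1 h2 h3 h4 hf hK ha hb => ?_⟩
  have hM : 0 ≤ M := by
    have := (norm_nonneg _).trans (ha 0); simpa using this
  have hc := strip_cauchy (by linarith) (by linarith) hf hK
  have key : ∀ c : ℝ, 1 / 2 ≤ |c| → |c| ≤ 2 →
      (∀ v : ℝ, ‖f (s + (c + v * I))‖ ≤ M * Real.exp (2 * |v|)) →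
      ‖∫ v : ℝ, f (s + (c + v * I)) * cauchyKernel (c + v * I)‖ ≤ M * (2 * Real.exp 4) * J := by
    intro c hc1 hc2 hfc
    have hc0 : c ≠ 0 := by rintro rfl; simp at hc1; linarith
    rw [hJ, ← integral_const_mul]
    refine norm_integral_le_of_norm_le ((integrable_exp_mul_abs_sub_sq 2).const_mul _)
      (ae_of_all _ fun v => ?_)
    rw [norm_mul]
    have h5 : Real.exp (c ^ 2) / |c| ≤ 2 * Real.exp 4 := by
      rw [div_le_iff₀ (by linarith)]
      have : Real.exp (c ^ 2) ≤ Real.exp 4 := by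
        apply Real.exp_le_exp.2
        rw [← sq_abs]; nlinarith
      nlinarith [Real.exp_pos 4]
    calc _ ≤ (M * Real.exp (2 * |v|)) * (Real.exp (c ^ 2) / |c| * Real.exp (-v ^ 2)) := by
          gcongr
          · exact hfc v
          · exact norm_cauchyKernel_le hc0 v
      _ ≤ (M * Real.exp (2 * |v|)) * ((2 * Real.exp 4) * Real.exp (-v ^ 2)) := by gcongr
      _ = _ := by rw [sub_eq_add_neg, Real.exp_add]; ring
  have k1 := key a (by rw [abs_of_neg] <;> linarith) (by rw [abs_of_neg] <;> linarith) ha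
  have k2 := key b (by rw [abs_of_pos] <;> linarith) (by rw [abs_of_pos] <;> linarith) hb
  have h6 := congrArg norm hc
  rw [norm_mul, norm_mul, Complex.norm_ofNat, Complex.norm_real, Real.norm_eq_abs,
    abs_of_pos Real.pi_pos] at h6
  have h7 := norm_sub_le (∫ v : ℝ, f (s + (b + v * I)) * cauchyKernel (b + v * I))
    (∫ v : ℝ, f (s + (a + v * I)) * cauchyKernel (a + v * I))
  have h8 : ‖f s‖ ≤ 2 * Real.pi * ‖f s‖ := by
    nlinarith [Real.pi_gt_three, norm_nonneg (f s)]
  nlinarith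

variable {q : ℕ} [NeZero q]

lemma one_le_natCast_level (q : ℕ) [NeZero q] : (1 : ℝ) ≤ q := by
  exact_mod_cast NeZero.one_le

lemma exists_norm_entireL_left : ∃ C : ℝ, 0 < C ∧ ∀ (q : ℕ) [NeZero q] (χ : DirichletCharacter ℂ q)
    (s : ℂ), s.re = -(1 / 2) → ‖entireL χ s‖ ≤ C * (q ^ 3 * (|s.im| + 2) ^ 2) := by
  obtain ⟨C, hC, h⟩ := norm_LFunction_left_primitive
  refine ⟨C * 3, by positivity, fun q _ χ s hs => ?_⟩
  have hs1 : s ≠ 1 := by rintro rfl; simp at hs; linarith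
  have hd := χ.conductor_dvd_level
  have hdq := Nat.le_of_dvd (NeZero.pos q) hd
  have he0 : q / χ.conductor ≠ 0 := (Nat.div_pos hdq (NeZero.pos _)).ne'
  have h1 := h χ.conductor χ.primitiveCharacter χ.primitiveCharacter_isPrimitive (1 / 2) s
    (by norm_num) le_rfl hs
  have h2 : ∏ p ∈ (q / χ.conductor).primeFactors, (1 + (p : ℝ) ^ (-s.re)) ≤ q ^ 2 := by
    calc _ ≤ ∏ p ∈ (q / χ.conductor).primeFactors, (p : ℝ) ^ 2 := by
          refine Finset.prod_le_prod (fun _ _ => by positivity) fun p hp => ?_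
          have hp2 : (2:ℝ) ≤ p := by exact_mod_cast (Nat.prime_of_mem_primeFactors hp).two_le
          have : (p:ℝ) ^ (-s.re) ≤ p := by
            calc (p:ℝ) ^ (-s.re) ≤ (p:ℝ) ^ (1:ℝ) :=
                  Real.rpow_le_rpow_of_exponent_le (by linarith) (by rw [hs]; norm_num)
              _ = p := Real.rpow_one _
          nlinarith
      _ = (∏ p ∈ (q / χ.conductor).primeFactors, (p : ℝ)) ^ 2 := Finset.prod_pow _ _ _
      _ ≤ _ := by
          have h5 := prod_primeFactors_le he0
          have h6 : ((q / χ.conductor : ℕ) : ℝ) ≤ q := by exact_mod_cast Nat.div_le_self _ _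
          gcongr
          exact h5.trans h6
  have h3 := norm_LFunction_le_primitive χ hs1
  have h4 : ‖s - 1‖ ≤ |s.im| + 2 := by
    refine (Complex.norm_le_abs_re_add_abs_im _).trans ?_
    simp only [sub_re, one_re, sub_im, one_im, sub_zero, hs]
    rw [abs_of_neg (by norm_num)]; linarith
  rw [entireL_of_ne χ hs1, norm_mul]
  have hdq' : (χ.conductor : ℝ) ≤ q := Nat.cast_le.2 hdq
  set B := |s.im| + 2
  have hB : 0 < B := by positivity
  rw [show (1:ℝ) / 2 + 1 / 2 = 1 by norm_num, Real.rpow_one] at h1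
  calc _ ≤ B * ((C * (q * B) * (1 + 1 / (1 / 2))) * q ^ 2) := by
        gcongr
        refine h3.trans ?_
        gcongr
        refine h1.trans ?_
        gcongr
    _ = _ := by ring

lemma norm_entireL_right (χ : DirichletCharacter ℂ q) {s : ℂ} (hs : 3 / 2 ≤ s.re) :
    ‖entireL χ s‖ ≤ 3 * (|s.re - 1| + |s.im|) := by
  have hs1 : s ≠ 1 := by rintro rfl; simp at hs; linarith
  rw [entireL_of_ne χ hs1, norm_mul, mul_comm]
  have h1 := norm_LFunction_le χ (a := 1 / 2) (by norm_num) (by linarith : 1 + 1 / 2 ≤ s.re)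
  have h2 := Complex.norm_le_abs_re_add_abs_im (s - 1)
  simp only [sub_re, one_re, sub_im, one_im, sub_zero] at h2
  gcongr
  linarith

lemma shift_abs_bound (t v : ℝ) : (|t + v| + 2) ^ 2 ≤ (|t| + 2) ^ 2 * Real.exp (2 * |v|) := by
  have h1 := abs_add_le t v
  have h2 := Real.add_one_le_exp |v|
  rw [show 2 * |v| = |v| + |v| by ring, Real.exp_add, ← sq, ← mul_pow]
  gcongr
  nlinarith [abs_nonneg t, abs_nonneg v]

/-- Polynomial growth of `(s - 1) L(s, χ)`, uniform in the character. -/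
theorem exists_norm_entireL_le : ∃ C : ℝ, 1 ≤ C ∧ ∀ (q : ℕ) [NeZero q] (χ : DirichletCharacter ℂ q)
    (s : ℂ), 1 / 4 ≤ s.re → s.re ≤ 4 → ‖entireL χ s‖ ≤ C * (q ^ 3 * (|s.im| + 2) ^ 2) := by
  obtain ⟨C1, hC1, h1⟩ := exists_norm_entireL_left
  obtain ⟨C2, hC2, h2⟩ := exists_strip_bound
  refine ⟨C2 * (C1 + 6) + 6, by nlinarith [mul_pos hC2 hC1], fun q _ χ s hs hs4 => ?_⟩
  have hq := one_le_natCast_level q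
  have hB := abs_nonneg s.im
  have hq3 : (1:ℝ) ≤ (q:ℝ) ^ 3 := one_le_pow₀ hq
  have base : ∀ z : ℂ, 3 / 2 ≤ z.re → z.re ≤ 4 → ‖entireL χ z‖ ≤ 6 * (q ^ 3 * (|z.im| + 2) ^ 2) := by
    intro z hz hz4
    refine (norm_entireL_right χ hz).trans ?_
    rw [abs_of_nonneg (by linarith)]
    have h5 : z.re - 1 + |z.im| ≤ 2 * (|z.im| + 2) ^ 2 := by nlinarith [abs_nonneg z.im]
    have h6 : (|z.im| + 2) ^ 2 ≤ q ^ 3 * (|z.im| + 2) ^ 2 := le_mul_of_one_le_left (by positivity) hq3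
    linarith
  have hpos : 0 ≤ C2 * (C1 + 6) := by positivity
  have hpos' : 0 ≤ (q:ℝ) ^ 3 * (|s.im| + 2) ^ 2 := by positivity
  rcases le_total (3 / 2) s.re with h3 | h3
  · refine (base s h3 hs4).trans ?_
    gcongr
    linarith
  · obtain ⟨G, hG0, hG⟩ := norm_entireL_growth χ
    have := h2 (entireL χ) s (-(1 / 2) - s.re) (2 - s.re) 3 (G * Real.exp (3 * |s.im|))
      ((C1 + 6) * (q ^ 3 * (|s.im| + 2) ^ 2)) (by linarith) (by linarith) (by linarith)
      (by linarith) (fun z _ _ => differentiable_entireL χ _) (fun z hz1 hz2 => ?_) (fun v => ?_)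
      (fun v => ?_)
    · refine this.trans ?_
      rw [← mul_assoc]
      gcongr
      linarith
    · refine (hG (s + z) (by simp; linarith) (by simp; linarith)).trans ?_
      rw [mul_assoc, ← Real.exp_add]
      gcongr
      have := abs_add_le s.im z.im
      simp only [add_im]; linarith
    · refine (h1 q χ _ (by simp)).trans ?_
      have h5 := shift_abs_bound s.im v
      rw [show (s + (((-(1 / 2) - s.re : ℝ) : ℂ) + v * I)).im = s.im + v by simp]
      calc _ ≤ C1 * (q ^ 3 * ((|s.im| + 2) ^ 2 * Real.exp (2 * |v|))) := by gcongr
        _ ≤ (C1 + 6) * (q ^ 3 * ((|s.im| + 2) ^ 2 * Real.exp (2 * |v|))) := by gcongr; linarith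
        _ = _ := by ring
    · refine (base _ (by simp; norm_num) (by simp; norm_num)).trans ?_
      have h5 := shift_abs_bound s.im v
      rw [show (s + (((2 - s.re : ℝ) : ℂ) + v * I)).im = s.im + v by simp]
      calc _ ≤ 6 * (q ^ 3 * ((|s.im| + 2) ^ 2 * Real.exp (2 * |v|))) := by gcongr
        _ ≤ (C1 + 6) * (q ^ 3 * ((|s.im| + 2) ^ 2 * Real.exp (2 * |v|))) := by gcongr; linarith
        _ = _ := by ring

end ZeroDensity

namespace ZeroDensity

open Complex MeasureTheory Set Filter Topology DirichletCharacter

variable {q : ℕ} [NeZero q]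

lemma analyticAt_LFunction (χ : DirichletCharacter ℂ q) {s : ℂ} (hs : s ≠ 1) :
    AnalyticAt ℂ (LFunction χ) s := by
  have : DifferentiableOn ℂ (LFunction χ) {1}ᶜ := fun z hz =>
    (differentiableAt_LFunction χ z (Or.inl hz)).differentiableWithinAt
  exact this.analyticAt (isOpen_compl_singleton.mem_nhds hs)

lemma entireL_one_one_ne_zero : entireL (1 : DirichletCharacter ℂ q) 1 ≠ 0 := by
  simp only [entireL, if_true, Function.update_self]
  refine Finset.prod_ne_zero_iff.2 fun p hp h => ?_
  have hp1 : (1:ℝ) < p := by exact_mod_cast (Nat.prime_of_mem_primeFactors hp).one_lt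
  have h1 : (p : ℂ) = 1 := by
    rw [sub_eq_zero] at h
    rw [← inv_inv (p : ℂ), ← h, inv_one]
  have h2 : (p : ℝ) = 1 := by exact_mod_cast h1
  linarith

/-- The pole at `s = 1` carries no multiplicity. -/
lemma zeroMultiplicity_one : zeroMultiplicity (LFunction (1 : DirichletCharacter ℂ q)) 1 = 0 := by
  set f := LFunction (1 : DirichletCharacter ℂ q) with hf
  suffices h : ∀ n, iteratedDeriv (n + 1) f 1 = 0 by
    rw [zeroMultiplicity, Nat.sInf_eq_zero]
    by_cases h0 : iteratedDeriv 0 f 1 = 0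
    · right
      ext n
      cases n with
      | zero => simpa using h0
      | succ n => simpa using h n
    · left; exact h0
  intro n
  by_contra hn
  rw [iteratedDeriv_succ] at hn
  have hc : ContinuousAt (iteratedDeriv n f) 1 := (differentiableAt_of_deriv_ne_zero hn).continuousAt
  obtain ⟨r, hr, hb⟩ := Metric.continuousAt_iff.1 hc 1 one_pos
  set H : Set ℂ := Metric.ball 1 r ∩ {z | 1 < z.re} with hH
  have hconv : Convex ℝ H := (convex_ball _ _).inter (convex_halfSpace_re_gt 1)
  have hne : ∀ z ∈ H, z ≠ 1 := by
    rintro z ⟨-, hz⟩ rfl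
    simp at hz
  have key : ∀ m, (∃ K : ℝ, ∀ z ∈ H, ‖iteratedDeriv m f z‖ ≤ K) → ∃ K : ℝ, ∀ z ∈ H, ‖f z‖ ≤ K := by
    intro m
    induction m with
    | zero => simp
    | succ m ih =>
      rintro ⟨K, hK⟩
      apply ih
      set z₀ : ℂ := ((1 + r / 2 : ℝ) : ℂ) with hz₀
      have hz₀H : z₀ ∈ H := by
        refine ⟨?_, ?_⟩
        · rw [Metric.mem_ball, hz₀, dist_eq_norm, ← ofReal_one, ← ofReal_sub, Complex.norm_real,
            Real.norm_eq_abs, add_sub_cancel_left, abs_of_pos (by linarith)]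
          linarith
        · simp only [hz₀, mem_ofPred_eq, ofReal_re]; linarith
      have hd : ∀ z ∈ H, DifferentiableAt ℂ (iteratedDeriv m f) z := fun z hz => by
        rw [iteratedDeriv_eq_iterate]
        exact ((analyticAt_LFunction 1 (hne z hz)).iterated_deriv m).differentiableAt
      have hK' : ∀ z ∈ H, ‖deriv (iteratedDeriv m f) z‖ ≤ K := fun z hz => by
        rw [← iteratedDeriv_succ]; exact hK z hz
      have hK0 : 0 ≤ K := (norm_nonneg _).trans (hK' z₀ hz₀H)
      refine ⟨‖iteratedDeriv m f z₀‖ + K * (2 * r), fun z hz => ?_⟩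
      have h1 := hconv.norm_image_sub_le_of_norm_deriv_le hd hK' hz₀H hz
      have h2 : ‖z - z₀‖ ≤ 2 * r := by
        have h3 := Metric.mem_ball.1 hz.1
        have h4 := Metric.mem_ball.1 hz₀H.1
        rw [← dist_eq_norm]
        have := dist_triangle_right z z₀ 1
        linarith
      have h5 := norm_le_norm_add_norm_sub' (iteratedDeriv m f z) (iteratedDeriv m f z₀)
      have h6 : K * ‖z - z₀‖ ≤ K * (2 * r) := by gcongr
      linarith
  obtain ⟨K, hK⟩ := key n ⟨‖iteratedDeriv n f 1‖ + 1, fun z hz => by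
    have h1 := hb (Metric.mem_ball.1 hz.1)
    rw [dist_eq_norm] at h1
    have h5 := norm_le_norm_add_norm_sub' (iteratedDeriv n f z) (iteratedDeriv n f 1)
    linarith⟩
  apply entireL_one_one_ne_zero (q := q)
  have ht : Tendsto (fun x : ℝ => ((1 + x : ℝ) : ℂ)) (𝓝[>] 0) (𝓝 1) := by
    refine tendsto_nhdsWithin_of_tendsto_nhds ?_
    have : Continuous (fun x : ℝ => ((1 + x : ℝ) : ℂ)) := by fun_prop
    simpa using this.tendsto 0
  have h1 : Tendsto (fun x : ℝ => entireL (1 : DirichletCharacter ℂ q) ((1 + x : ℝ) : ℂ)) (𝓝[>] 0)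
      (𝓝 (entireL 1 1)) := ((differentiable_entireL 1).continuous.tendsto 1).comp ht
  refine tendsto_nhds_unique h1 ?_
  have h2 : Tendsto (fun x : ℝ => x * K) (𝓝[>] 0) (𝓝 0) := by
    refine tendsto_nhdsWithin_of_tendsto_nhds ?_
    have : Continuous (fun x : ℝ => x * K) := by fun_prop
    simpa using this.tendsto 0
  refine squeeze_zero_norm' ?_ h2
  filter_upwards [Ioo_mem_nhdsGT hr] with x hx
  have hx1 : ((1 + x : ℝ) : ℂ) ∈ H := by
    refine ⟨?_, ?_⟩
    · rw [Metric.mem_ball, dist_eq_norm, ← ofReal_one, ← ofReal_sub, Complex.norm_real,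
        Real.norm_eq_abs, add_sub_cancel_left, abs_of_pos hx.1]
      exact hx.2
    · simp only [mem_ofPred_eq, ofReal_re]; linarith [hx.1]
  rw [entireL_of_ne _ (hne _ hx1), norm_mul, ← ofReal_one, ← ofReal_sub, Complex.norm_real,
    Real.norm_eq_abs, add_sub_cancel_left, abs_of_pos hx.1]
  exact mul_le_mul_of_nonneg_left (hK _ hx1) hx.1.le

lemma zeroMultiplicity_le_order (χ : DirichletCharacter ℂ q) {ρ : ℂ} (hρ : ρ ≠ 1) :
    (zeroMultiplicity (LFunction χ) ρ : ℕ∞) ≤ analyticOrderAt (entireL χ) ρ := by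
  have h1 : ((fun s => s - 1) * LFunction χ) =ᶠ[𝓝 ρ] entireL χ := by
    filter_upwards [isOpen_compl_singleton.mem_nhds hρ] with z hz
    rw [entireL_of_ne χ hz]; rfl
  have ha := analyticAt_LFunction χ hρ
  rw [← analyticOrderAt_congr h1, analyticOrderAt_mul (by fun_prop) ha]
  refine le_add_left ((natCast_le_analyticOrderAt_iff_iteratedDeriv_eq_zero ha).2 fun i hi => ?_)
  by_contra h
  exact absurd (Nat.sInf_le h : zeroMultiplicity (LFunction χ) ρ ≤ i) (not_le.2 hi)

lemma norm_LFunction_two_ge (χ : DirichletCharacter ℂ q) {s : ℂ} (hs : s.re = 2) :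
    1 / 4 ≤ ‖LFunction χ s‖ := by
  rw [LFunction_eq_LSeries χ (by linarith), LSeries]
  have hb : ∀ n : ℕ, ‖LSeries.term (χ ·) s n‖ ≤ 1 / (n : ℝ) ^ 2 := fun n => by
    have := norm_term_le χ (a := 1) (s := s) (by linarith) n
    refine this.trans (le_of_eq ?_)
    rw [Real.rpow_neg (by positivity), one_div]
    norm_num
  have hs2 : HasSum (fun n : ℕ => 1 / (n : ℝ) ^ 2) (Real.pi ^ 2 / 6) := hasSum_zeta_two
  have hsum : Summable (LSeries.term (χ ·) s) := Summable.of_norm_bounded hs2.summable hb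
  rw [hsum.tsum_eq_zero_add, LSeries.term_zero, zero_add,
    ((summable_nat_add_iff 1).2 hsum).tsum_eq_zero_add]
  have h1 : LSeries.term (χ ·) s (0 + 1) = 1 := by
    rw [LSeries.term_of_ne_zero (by norm_num)]; simp
  rw [h1]
  have h2 : ‖∑' n : ℕ, LSeries.term (χ ·) s (n + 1 + 1)‖ ≤ Real.pi ^ 2 / 6 - 1 := by
    have h3 := (hasSum_nat_add_iff 2).2 (by simpa [Finset.sum_range_succ] using hs2 :
      HasSum (fun n : ℕ => 1 / (n : ℝ) ^ 2) (Real.pi ^ 2 / 6 - 1 + ∑ i ∈ Finset.range 2, 1 / (i : ℝ) ^ 2))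
    exact tsum_of_norm_bounded h3 fun n => hb (n + 2)
  have h4 := norm_sub_le (1 + ∑' n : ℕ, LSeries.term (χ ·) s (n + 1 + 1))
    (∑' n : ℕ, LSeries.term (χ ·) s (n + 1 + 1))
  rw [add_sub_cancel_right, norm_one] at h4
  have := Real.pi_lt_d2
  have := Real.pi_pos
  nlinarith

/-- There are `O(log q(|k|+2))` zeros at height about `k`. -/
theorem exists_box_count : ∃ C : ℝ, 0 < C ∧ ∀ (q : ℕ) [NeZero q] (χ : DirichletCharacter ℂ q) (k : ℤ)
    (F : Finset ℂ), (∀ ρ ∈ F, ρ ≠ 1 ∧ 1 / 2 ≤ ρ.re ∧ ⌊ρ.im⌋ = k ∧ LFunction χ ρ = 0) →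
    ∑ ρ ∈ F, (zeroMultiplicity (LFunction χ) ρ : ℝ) ≤ C * Real.log (q * (|(k : ℝ)| + 2)) := by
  obtain ⟨C, hC, h⟩ := exists_norm_entireL_le
  set D := Real.log ((7 / 4) / (8 / 5)) with hD
  have hD0 : 0 < D := Real.log_pos (by norm_num)
  refine ⟨((Real.log (64 * C) / Real.log 2) + 3) / D, ?_, fun q _ χ k F hF => ?_⟩
  · have : 0 ≤ Real.log (64 * C) := Real.log_nonneg (by linarith)
    have := Real.log_pos (by norm_num : (1:ℝ) < 2)
    positivity
  have hq := one_le_natCast_level q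
  set c : ℂ := 2 + ((k : ℝ) + 1 / 2 : ℝ) * I with hc
  have hcre : c.re = 2 := by simp [hc]
  have hcim : c.im = k + 1 / 2 := by simp [hc]
  set B : ℝ := |(k : ℝ)| + 2 with hB
  have hB2 : 2 ≤ B := by rw [hB]; linarith [abs_nonneg (k : ℝ)]
  have han : ∀ r, AnalyticOnNhd ℂ (entireL χ) (Metric.closedBall c r) := fun r z _ =>
    (differentiable_entireL χ).analyticAt z
  have hc1 : c ≠ 1 := by intro h; rw [h] at hcre; simp at hcre
  have hEc : 1 / 4 ≤ ‖entireL χ c‖ := by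
    rw [entireL_of_ne χ hc1, norm_mul]
    have h1 := norm_LFunction_two_ge χ hcre
    have h2 : 1 ≤ ‖c - 1‖ := by
      have := Complex.abs_re_le_norm (c - 1)
      rw [sub_re, hcre, one_re] at this
      norm_num at this; exact this
    nlinarith
  have hc0 : entireL χ c ≠ 0 := by
    intro h0; rw [h0, norm_zero] at hEc; linarith
  have hbd : ∀ z ∈ Metric.sphere c |(7 / 4 : ℝ)|, ‖entireL χ z‖ ≤ 16 * C * (q ^ 3 * B ^ 2) := by
    intro z hz
    rw [abs_of_pos (by norm_num), mem_sphere_iff_norm] at hz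
    have h1 := Complex.abs_re_le_norm (z - c)
    have h2 := Complex.abs_im_le_norm (z - c)
    rw [hz, sub_re, hcre, abs_le] at h1
    rw [hz, sub_im, hcim] at h2
    have h4 : |z.im| + 2 ≤ 4 * B := by
      have h5 : |z.im| ≤ |z.im - (k + 1 / 2)| + |(k:ℝ)| + 1 / 2 := by
        have e1 := abs_add_le (z.im - (k + 1 / 2)) (k + 1 / 2)
        have e2 := abs_add_le (k : ℝ) (1 / 2)
        rw [sub_add_cancel] at e1
        rw [abs_of_pos (by norm_num : (0:ℝ) < 1 / 2)] at e2
        linarith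
      rw [hB]; linarith [abs_nonneg (k:ℝ)]
    refine (h q χ z (by linarith) (by linarith)).trans ?_
    calc _ ≤ C * (q ^ 3 * (4 * B) ^ 2) := by gcongr
      _ = _ := by ring
  have hq3 : (1:ℝ) ≤ (q:ℝ) ^ 3 := one_le_pow₀ hq
  have hM1 : (1:ℝ) ≤ 16 * C * (q ^ 3 * B ^ 2) := by
    have : 1 ≤ q ^ 3 * B ^ 2 := one_le_mul_of_one_le_of_one_le hq3 (one_le_pow₀ (by linarith))
    nlinarith
  have hJ := AnalyticOnNhd.sum_divisor_le (c := c) (r := 8 / 5) (R := 7 / 4) (by norm_num)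
    (by rw [abs_of_pos, abs_of_pos] <;> norm_num) hM1 (han _) hc0 hbd
  rw [← hD] at hJ
  set dv := MeromorphicOn.divisor (entireL χ) (Metric.closedBall c |(8 / 5 : ℝ)|) with hdv
  have hdv0 : 0 ≤ dv := MeromorphicOn.AnalyticOnNhd.divisor_nonneg (han _)
  have hfin : (Function.support dv).Finite := dv.finiteSupport (isCompact_closedBall ..)
  have hnt : ∀ z, analyticOrderAt (entireL χ) z ≠ ⊤ := fun z =>
    AnalyticOnNhd.analyticOrderAt_ne_top_of_isPreconnected (U := univ)
      (fun z _ => (differentiable_entireL χ).analyticAt z) isPreconnected_univ (mem_univ c) (mem_univ z)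
      (by rw [((differentiable_entireL χ).analyticAt c).analyticOrderAt_eq_zero.2 hc0]; simp)
  have hmem : ∀ ρ ∈ F, ((zeroMultiplicity (LFunction χ) ρ : ℕ) : ℤ) ≤ dv ρ := by
    intro ρ hρ
    obtain ⟨h1, h2, h3, h4⟩ := hF ρ hρ
    have hre1 : ρ.re < 1 := by
      by_contra! h5
      exact LFunction_ne_zero_of_one_le_re χ (Or.inr h1) h5 h4
    have hmemb : ρ ∈ Metric.closedBall c |(8 / 5 : ℝ)| := by
      rw [abs_of_pos (by norm_num), mem_closedBall_iff_norm]
      refine (sq_le_sq₀ (norm_nonneg _) (by norm_num)).1 ?_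
      rw [Complex.sq_norm, Complex.normSq_apply, sub_re, sub_im, hcre, hcim]
      have h5 := Int.floor_le ρ.im
      have h6 := Int.lt_floor_add_one ρ.im
      rw [h3] at h5 h6
      nlinarith
    rw [hdv, MeromorphicOn.AnalyticOnNhd.divisor_apply (han _) hmemb]
    have h5 := zeroMultiplicity_le_order χ h1
    obtain ⟨m, hm⟩ := ENat.ne_top_iff_exists.1 (hnt ρ)
    rw [← hm] at h5 ⊢
    simp only [ENat.map_natCast, WithTop.untop₀_coe]
    exact_mod_cast h5
  have hsum : ∑ ρ ∈ F, (zeroMultiplicity (LFunction χ) ρ : ℤ) ≤ ∑ᶠ u, dv u := by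
    calc _ ≤ ∑ ρ ∈ F, dv ρ := Finset.sum_le_sum hmem
      _ ≤ ∑ ρ ∈ F ∪ hfin.toFinset, dv ρ :=
          Finset.sum_le_sum_of_subset_of_nonneg Finset.subset_union_left fun _ _ _ => hdv0 _
      _ = _ := by
          rw [finsum_eq_sum_of_support_subset]
          intro u hu
          simp only [Finset.coe_union, Finite.coe_toFinset]
          exact Or.inr hu
  have hsum' : ∑ ρ ∈ F, (zeroMultiplicity (LFunction χ) ρ : ℝ) ≤ ((∑ᶠ u, dv u : ℤ) : ℝ) := by
    exact_mod_cast hsum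
  refine hsum'.trans (hJ.trans ?_)
  rw [div_mul_eq_mul_div]
  gcongr
  have hl2 := Real.log_pos (by norm_num : (1:ℝ) < 2)
  have hC1 : 0 ≤ Real.log (64 * C) := Real.log_nonneg (by linarith)
  have hqB : 2 ≤ q * B := by nlinarith
  have hlog2 : Real.log 2 ≤ Real.log (q * B) := Real.log_le_log (by norm_num) hqB
  calc Real.log (16 * C * (q ^ 3 * B ^ 2) / ‖entireL χ c‖) ≤ Real.log (64 * C * (q * B) ^ 3) := by
        apply Real.log_le_log (by positivity)
        rw [div_le_iff₀ (by linarith)]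
        have h7 : B ^ 2 ≤ B ^ 3 := pow_le_pow_right₀ (by linarith) (by norm_num)
        have h8 : 0 ≤ 64 * C * (q * B) ^ 3 := by positivity
        calc 16 * C * (q ^ 3 * B ^ 2) ≤ 16 * C * (q ^ 3 * B ^ 3) := by gcongr
          _ = 64 * C * (q * B) ^ 3 * (1 / 4) := by ring
          _ ≤ _ := by gcongr
    _ = Real.log (64 * C) + 3 * Real.log (q * B) := by
        rw [Real.log_mul (by positivity) (by positivity), Real.log_pow]; norm_num
    _ ≤ Real.log (64 * C) / Real.log 2 * Real.log (q * B) + 3 * Real.log (q * B) := by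
        gcongr
        rw [div_mul_eq_mul_div, le_div_iff₀ hl2]
        gcongr
    _ = _ := by ring

/-- `k` is the integer part of the ordinate of a zero of `L(s, χ)` counted by `N(σ, T, χ)`. -/
def HasZeroAt (χ : DirichletCharacter ℂ q) (σ T : ℝ) (k : ℤ) : Prop :=
  ∃ ρ : ℂ, LFunction χ ρ = 0 ∧ ρ ≠ 1 ∧ σ ≤ ρ.re ∧ |ρ.im| ≤ T ∧ ⌊ρ.im⌋ = k

open Classical in
/-- The heights of zeros counted by `N(σ, T, χ)`. -/
noncomputable def zeroBoxes (χ : DirichletCharacter ℂ q) (σ T : ℝ) : Finset ℤ :=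
  (Finset.Icc (-⌈T⌉) ⌈T⌉).filter (HasZeroAt χ σ T)

lemma mem_zeroBoxes {χ : DirichletCharacter ℂ q} {σ T : ℝ} {k : ℤ} :
    k ∈ zeroBoxes χ σ T ↔ HasZeroAt χ σ T k := by
  classical
  rw [zeroBoxes, Finset.mem_filter, and_iff_right_iff_imp, Finset.mem_Icc]
  rintro ⟨ρ, -, -, -, h, rfl⟩
  rw [abs_le] at h
  constructor
  · rw [Int.le_floor]
    push_cast
    linarith [Int.le_ceil T]
  · exact (Int.floor_mono h.2).trans (Int.floor_le_ceil T)

/-- The zero count is bounded by the number of occupied unit boxes. -/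
theorem exists_zeroCountingFunction_le : ∃ C : ℝ, 0 < C ∧ ∀ (q : ℕ) [NeZero q]
    (χ : DirichletCharacter ℂ q) (σ T : ℝ), 1 / 2 ≤ σ → 2 ≤ T →
    zeroCountingFunction χ σ T ≤ ENNReal.ofReal (C * Real.log (q * T) * (zeroBoxes χ σ T).card) := by
  obtain ⟨C, hC, h⟩ := exists_box_count
  refine ⟨C * 4, by positivity, fun q _ χ σ T hσ hT => ?_⟩
  have hq := one_le_natCast_level q
  have hqT : 2 ≤ q * T := by nlinarith
  classical
  rw [zeroCountingFunction, ENNReal.tsum_eq_iSup_sum]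
  refine iSup_le fun F => ?_
  have hcast : ∑ a ∈ F, ((zeroMultiplicity (LFunction χ) a : ℕ) : ENNReal) =
      ENNReal.ofReal (∑ a ∈ F, (zeroMultiplicity (LFunction χ) a : ℝ)) := by
    rw [ENNReal.ofReal_sum_of_nonneg (fun _ _ => by positivity)]
    simp
  rw [hcast]
  apply ENNReal.ofReal_le_ofReal
  set G : Finset ℂ := (F.map (Function.Embedding.subtype _)).filter (· ≠ 1) with hG
  have h1 : ∑ a ∈ F, (zeroMultiplicity (LFunction χ) a : ℝ) =
      ∑ ρ ∈ G, (zeroMultiplicity (LFunction χ) ρ : ℝ) := by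
    rw [hG, Finset.sum_filter, Finset.sum_map]
    refine Finset.sum_congr rfl fun a _ => ?_
    by_cases ha : (a : ℂ) ≠ 1
    · exact (if_pos ha).symm
    · refine Eq.trans ?_ (if_neg ha).symm
      push Not at ha
      rw [ha]
      have h2 := a.2.1
      rw [ha] at h2
      have h3 : χ = 1 := by
        by_contra h4
        exact LFunction_ne_zero_of_one_le_re χ (Or.inl h4) (by simp) h2
      rw [h3, zeroMultiplicity_one, Nat.cast_zero]
  have hGmem : ∀ ρ ∈ G, ρ ≠ 1 ∧ LFunction χ ρ = 0 ∧ σ ≤ ρ.re ∧ |ρ.im| ≤ T := by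
    intro ρ hρ
    rw [hG, Finset.mem_filter, Finset.mem_map] at hρ
    obtain ⟨⟨a, -, rfl⟩, h2⟩ := hρ
    exact ⟨h2, a.2⟩
  rw [h1, ← Finset.sum_fiberwise_of_maps_to (s := G) (t := zeroBoxes χ σ T) (g := fun ρ => ⌊ρ.im⌋)
    (fun ρ hρ => by
      obtain ⟨h2, h3, h4, h5⟩ := hGmem ρ hρ
      exact mem_zeroBoxes.2 ⟨ρ, h3, h2, h4, h5, rfl⟩)]
  calc _ ≤ ∑ k ∈ zeroBoxes χ σ T, C * 4 * Real.log (q * T) := by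
        refine Finset.sum_le_sum fun k hk => ?_
        refine (h q χ k _ fun ρ hρ => ?_).trans ?_
        · rw [Finset.mem_filter] at hρ
          obtain ⟨h2, h3, h4, h5⟩ := hGmem ρ hρ.1
          exact ⟨h2, hσ.trans h4, hρ.2, h3⟩
        · obtain ⟨ρ, -, -, -, h2, rfl⟩ := mem_zeroBoxes.1 hk
          have h3 : |((⌊ρ.im⌋ : ℤ) : ℝ)| ≤ T + 1 := by
            have h5 := Int.floor_le ρ.im
            have h6 := Int.lt_floor_add_one ρ.im
            rw [abs_le] at h2 ⊢
            constructor <;> linarith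
          rw [mul_assoc]
          gcongr
          calc Real.log (q * (|((⌊ρ.im⌋ : ℤ) : ℝ)| + 2)) ≤ Real.log ((q * T) ^ 4) := by
                apply Real.log_le_log (by positivity)
                have h8 : (8:ℝ) ≤ (q * T) ^ 3 := by
                  calc (8:ℝ) = 2 ^ 3 := by norm_num
                    _ ≤ _ := by gcongr
                calc q * (|((⌊ρ.im⌋ : ℤ) : ℝ)| + 2) ≤ q * (T * 8) := by gcongr; linarith
                  _ = (q * T) * 8 := by ring
                  _ ≤ (q * T) * (q * T) ^ 3 := by gcongr
                  _ = _ := by ring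
            _ = 4 * Real.log (q * T) := by rw [Real.log_pow]; norm_num
    _ = _ := by rw [Finset.sum_const, nsmul_eq_mul]; ring

end ZeroDensity

namespace ZeroDensity
open Complex MeasureTheory Set Filter Topology DirichletCharacter

variable {q : ℕ} [NeZero q]

lemma sum_apply_mul_conj_eq_zero {m n : ℕ} (h : (m : ZMod q) ≠ n) :
    ∑ χ : DirichletCharacter ℂ q, χ m * (starRingEnd ℂ) (χ n) = 0 := by
  by_cases hn : IsUnit (n : ZMod q)
  · have h1 := sum_char_inv_mul_char_eq ℂ hn (m : ZMod q)
    rw [if_neg (Ne.symm h)] at h1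
    rw [← h1]
    refine Finset.sum_congr rfl fun χ _ => ?_
    rw [mul_comm]
    congr 1
    rw [starRingEnd_apply, MulChar.star_apply', MulChar.inv_apply_eq_inv']
    obtain ⟨u, hu⟩ := hn
    rw [← hu, ZMod.inv_coe_unit, ← map_units_inv]
  · refine Finset.sum_eq_zero fun χ _ => ?_
    rw [MulChar.map_nonunit χ hn, map_zero, mul_zero]

lemma norm_sum_apply_mul_conj_le (m n : ℕ) :
    ‖∑ χ : DirichletCharacter ℂ q, χ m * (starRingEnd ℂ) (χ n)‖ ≤
      if (m : ZMod q) = n then (q : ℝ) else 0 := by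
  split_ifs with h
  · refine (norm_sum_le _ _).trans ?_
    calc _ ≤ ∑ _χ : DirichletCharacter ℂ q, (1 : ℝ) := by
          refine Finset.sum_le_sum fun χ _ => ?_
          rw [norm_mul, RCLike.norm_conj]
          exact mul_le_one₀ (norm_le_one χ _) (norm_nonneg _) (norm_le_one χ _)
      _ = (Nat.card (DirichletCharacter ℂ q) : ℝ) := by simp [Nat.card_eq_fintype_card]
      _ = (q.totient : ℝ) := by rw [card_eq_totient_of_hasEnoughRootsOfUnity ℂ q]
      _ ≤ q := Nat.cast_le.2 (Nat.totient_le q)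
  · rw [sum_apply_mul_conj_eq_zero h, norm_zero]

lemma abs_exp_sub_one_le_mul (l : ℝ) : |Real.exp l - 1| ≤ |l| * Real.exp |l| := by
  rcases le_total 0 l with h | h
  · rw [abs_of_nonneg h, abs_of_nonneg (by linarith [Real.add_one_le_exp l])]
    have h1 := Real.add_one_le_exp (-l)
    have h2 : Real.exp (-l) * Real.exp l = 1 := by rw [← Real.exp_add]; simp
    nlinarith [Real.exp_pos l]
  · rw [abs_of_nonpos h, abs_of_nonpos (by linarith [Real.exp_le_one_iff.2 h])]
    have h1 := Real.add_one_le_exp l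
    have h2 : 1 ≤ Real.exp (-l) := Real.one_le_exp (by linarith)
    nlinarith

lemma exp_neg_sq_log_le {T u : ℝ} (hT : 1 ≤ T) (hu : 0 < u) :
    Real.exp (-((T * Real.log u) ^ 2 / 4)) ≤ 3 * Real.exp 9 / (1 + T ^ 2 * (u - 1) ^ 2) := by
  set l := Real.log u with hl
  have hul : u = Real.exp l := (Real.exp_log hu).symm
  set x := T * |l| with hx
  have hx0 : 0 ≤ x := by positivity
  have hlx : |l| ≤ x := by rw [hx]; exact le_mul_of_one_le_left (abs_nonneg _) hT
  have h1 : T ^ 2 * (u - 1) ^ 2 ≤ (x * Real.exp x) ^ 2 := by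
    rw [← mul_pow, ← sq_abs, abs_mul, abs_of_pos (by linarith : 0 < T)]
    refine pow_le_pow_left₀ (by positivity) ?_ 2
    calc T * |u - 1| ≤ T * (|l| * Real.exp |l|) := by
          rw [hul]
          gcongr
          exact abs_exp_sub_one_le_mul l
      _ = x * Real.exp |l| := by rw [hx, mul_assoc]
      _ ≤ _ := by gcongr
  have h2 : (T * l) ^ 2 = x ^ 2 := by rw [hx, mul_pow, mul_pow, sq_abs]
  rw [h2, le_div_iff₀ (by positivity)]
  have h3 : x ^ 2 ≤ 2 * Real.exp x := by
    have := Real.quadratic_le_exp_of_nonneg hx0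
    nlinarith
  calc Real.exp (-(x ^ 2 / 4)) * (1 + T ^ 2 * (u - 1) ^ 2)
      ≤ Real.exp (-(x ^ 2 / 4)) * (3 * Real.exp (3 * x)) := by
        gcongr
        have h4 : (x * Real.exp x) ^ 2 ≤ 2 * Real.exp (3 * x) := by
          have : Real.exp (3 * x) = Real.exp x * Real.exp x ^ 2 := by
            rw [← pow_succ', ← Real.exp_nat_mul]; norm_num
          rw [this, mul_pow]
          nlinarith [sq_nonneg (Real.exp x)]
        have h5 : 1 ≤ Real.exp (3 * x) := Real.one_le_exp (by positivity)
        linarith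
    _ = 3 * Real.exp (-(x ^ 2 / 4) + 3 * x) := by rw [Real.exp_add]; ring
    _ ≤ _ := by
        gcongr
        nlinarith [sq_nonneg (x / 2 - 3)]

lemma sum_range_one_div_le {l : ℝ} (hl : 0 < l) (N : ℕ) :
    ∑ k ∈ Finset.range N, 1 / (1 + l ^ 2 * ((k : ℝ) + 1) ^ 2) ≤ 2 / l := by
  have h : ∀ k : ℕ, 1 / (1 + l ^ 2 * ((k : ℝ) + 1) ^ 2) ≤
      2 / l * (1 / (1 + l * k)) - 2 / l * (1 / (1 + l * ((k + 1 : ℕ) : ℝ))) := by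
    intro k
    have hk : (0:ℝ) ≤ k := Nat.cast_nonneg k
    have e : 2 / l * (1 / (1 + l * k)) - 2 / l * (1 / (1 + l * ((k + 1 : ℕ) : ℝ))) =
        2 / ((1 + l * k) * (1 + l * (k + 1))) := by
      push_cast
      have : 1 + l * k ≠ 0 := by positivity
      have : 1 + l * (k + 1) ≠ 0 := by positivity
      field_simp
      ring
    rw [e, div_le_div_iff₀ (by positivity) (by positivity)]
    have h0 : 0 ≤ l * k := by positivity
    nlinarith [sq_nonneg (1 - l * (k + 1))]
  calc _ ≤ ∑ k ∈ Finset.range N, (2 / l * (1 / (1 + l * k)) -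
        2 / l * (1 / (1 + l * ((k + 1 : ℕ) : ℝ)))) := Finset.sum_le_sum fun k _ => h k
    _ = 2 / l * (1 / (1 + l * (0 : ℕ))) - 2 / l * (1 / (1 + l * N)) :=
        Finset.sum_range_sub' (fun k : ℕ => 2 / l * (1 / (1 + l * (k : ℝ)))) N
    _ ≤ _ := by
        have : 0 ≤ 2 / l * (1 / (1 + l * N)) := by positivity
        simp only [Nat.cast_zero, mul_zero, add_zero, div_one, mul_one]
        linarith

lemma sum_int_one_div_le {l : ℝ} (hl : 0 < l) (F : Finset ℤ) :
    ∑ k ∈ F, 1 / (1 + l ^ 2 * (k : ℝ) ^ 2) ≤ 1 + 4 / l := by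
  obtain ⟨N, hN⟩ : ∃ N : ℕ, ∀ k ∈ F, k.natAbs ≤ N := by
    refine ⟨F.sup Int.natAbs, fun k hk => Finset.le_sup (f := Int.natAbs) hk⟩
  have h0 : ∀ k : ℤ, 0 ≤ 1 / (1 + l ^ 2 * (k : ℝ) ^ 2) := fun k => by positivity
  have hsub : F ⊆ insert 0 ((Finset.range N).image (fun k : ℕ => (k : ℤ) + 1) ∪
      (Finset.range N).image (fun k : ℕ => -((k : ℤ) + 1))) := by
    intro k hk
    have := hN k hk
    simp only [Finset.mem_insert, Finset.mem_union, Finset.mem_image, Finset.mem_range]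
    rcases lt_trichotomy k 0 with h | h | h
    · exact Or.inr (Or.inr ⟨k.natAbs - 1, by omega, by omega⟩)
    · exact Or.inl h
    · exact Or.inr (Or.inl ⟨k.natAbs - 1, by omega, by omega⟩)
  refine (Finset.sum_le_sum_of_subset_of_nonneg hsub fun _ _ _ => h0 _).trans ?_
  rw [Finset.sum_insert (by
    simp only [Finset.mem_union, Finset.mem_image, Finset.mem_range]
    rintro (⟨a, -, h⟩ | ⟨a, -, h⟩) <;> omega)]
  have hU := Finset.sum_union_inter (s₁ := (Finset.range N).image (fun k : ℕ => (k : ℤ) + 1))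
    (s₂ := (Finset.range N).image (fun k : ℕ => -((k : ℤ) + 1)))
    (f := fun k : ℤ => 1 / (1 + l ^ 2 * (k : ℝ) ^ 2))
  have hI : 0 ≤ ∑ k ∈ (Finset.range N).image (fun k : ℕ => (k : ℤ) + 1) ∩
    (Finset.range N).image (fun k : ℕ => -((k : ℤ) + 1)), 1 / (1 + l ^ 2 * (k : ℝ) ^ 2) :=
    Finset.sum_nonneg fun k _ => h0 k
  rw [Finset.sum_image (fun a _ b _ h => by simpa using h),
    Finset.sum_image (fun a _ b _ h => by simpa using h)] at hU
  have h1 := sum_range_one_div_le hl N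
  have e2 : ∑ k ∈ Finset.range N, 1 / (1 + l ^ 2 * (((-((k : ℤ) + 1) : ℤ)) : ℝ) ^ 2) =
      ∑ k ∈ Finset.range N, 1 / (1 + l ^ 2 * ((k : ℝ) + 1) ^ 2) := by
    refine Finset.sum_congr rfl fun k _ => ?_
    push_cast
    rw [neg_sq]
  rw [e2] at hU
  push_cast at hU ⊢
  have e3 : 4 / l = 2 / l + 2 / l := by ring
  simp only [ne_eq, OfNat.ofNat_ne_zero, not_false_eq_true, zero_pow, mul_zero, add_zero, div_one]
  linarith

lemma sum_congruent_le {T : ℝ} (hT : 1 ≤ T) {m : ℕ} (hm : 0 < m) (S : Finset ℕ)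
    (hS : ∀ n ∈ S, 0 < n) :
    ∑ n ∈ S, (if (m : ZMod q) = n then (q : ℝ) else 0) * (T * Real.exp (-((T * Real.log (n / m)) ^ 2 / 4))) ≤
      12 * Real.exp 9 * (q * T + m) := by
  have hq := one_le_natCast_level q
  have hm' : (0:ℝ) < m := Nat.cast_pos.2 hm
  set l : ℝ := q * T / m with hl
  have hl0 : 0 < l := by positivity
  have hex := Real.exp_pos 9
  classical
  calc _ = ∑ n ∈ S.filter (fun n : ℕ => (m : ZMod q) = n),
        q * (T * Real.exp (-((T * Real.log (n / m)) ^ 2 / 4))) := by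
        rw [Finset.sum_filter]
        refine Finset.sum_congr rfl fun n _ => ?_
        split_ifs <;> simp
    _ ≤ ∑ n ∈ S.filter (fun n : ℕ => (m : ZMod q) = n),
        q * (T * (3 * Real.exp 9 * (1 / (1 + l ^ 2 * ((((n : ℤ) - m) / q : ℤ) : ℝ) ^ 2)))) := by
        refine Finset.sum_le_sum fun n hn => ?_
        rw [Finset.mem_filter] at hn
        have hn0 : (0:ℝ) < n := Nat.cast_pos.2 (hS n hn.1)
        have hdvd : (q : ℤ) ∣ (n : ℤ) - m := by
          have := hn.2
          rw [← ZMod.intCast_zmod_eq_zero_iff_dvd]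
          push_cast
          rw [this, sub_self]
        gcongr
        refine (exp_neg_sq_log_le hT (by positivity)).trans (le_of_eq ?_)
        rw [mul_one_div]
        congr 2
        rw [Int.cast_div hdvd (by positivity), hl]
        push_cast
        field_simp
    _ = q * T * 3 * Real.exp 9 * ∑ k ∈ (S.filter (fun n : ℕ => (m : ZMod q) = n)).image
          (fun n : ℕ => ((n : ℤ) - m) / q), 1 / (1 + l ^ 2 * (k : ℝ) ^ 2) := by
        rw [Finset.sum_image, Finset.mul_sum]
        · refine Finset.sum_congr rfl fun n _ => by ring
        · intro a ha b hb hab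
          simp only [Finset.coe_filter, mem_ofPred_eq] at ha hb
          have hd : ∀ n : ℕ, (m : ZMod q) = n → (q : ℤ) ∣ (n : ℤ) - m := by
            intro n hn
            rw [← ZMod.intCast_zmod_eq_zero_iff_dvd]
            push_cast
            rw [hn, sub_self]
          have := Int.ediv_left_inj (hd a ha.2) (hd b hb.2) |>.1 hab
          omega
    _ ≤ q * T * 3 * Real.exp 9 * (1 + 4 / l) := by gcongr; exact sum_int_one_div_le hl0 _
    _ = 3 * Real.exp 9 * (q * T + 4 * m) := by rw [hl]; field_simp
    _ ≤ _ := by nlinarith [mul_pos hex (by positivity : 0 < q * T)]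

/-- The Gaussian-weighted correlation of `n ↦ n^{-it}` and `m ↦ m^{-it}`. -/
lemma integral_gaussian_mul_cexp {T : ℝ} (hT : 0 < T) (l : ℝ) :
    ∫ t : ℝ, cexp (I * l * t) * (Real.exp (-(t / T) ^ 2) : ℂ) =
      ((√Real.pi * (T * Real.exp (-((T * l) ^ 2 / 4))) : ℝ) : ℂ) := by
  have h := fourierIntegral_gaussian (b := ((1 / T ^ 2 : ℝ) : ℂ)) (by rw [ofReal_re]; positivity) l
  have e : (fun t : ℝ => cexp (I * l * t) * (Real.exp (-(t / T) ^ 2) : ℂ)) =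
      fun t : ℝ => cexp (I * l * t) * cexp (-((1 / T ^ 2 : ℝ) : ℂ) * t ^ 2) := by
    funext t
    rw [ofReal_exp]
    congr 2
    push_cast
    field_simp
  rw [e, h]
  have e1 : ((Real.pi : ℂ) / ((1 / T ^ 2 : ℝ) : ℂ)) ^ (1 / 2 : ℂ) = ((√Real.pi * T : ℝ) : ℂ) := by
    rw [← ofReal_div, show (1 / 2 : ℂ) = ((1 / 2 : ℝ) : ℂ) by push_cast; rfl,
      ← ofReal_cpow (by positivity), ← Real.sqrt_eq_rpow]
    congr 1
    rw [div_div_eq_mul_div, div_one, Real.sqrt_mul Real.pi_pos.le, Real.sqrt_sq hT.le]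
  rw [e1, ← mul_assoc, ofReal_mul (√Real.pi * T), ofReal_exp]
  congr 2
  push_cast
  field_simp

lemma integrable_cexp_mul_gaussian {T : ℝ} (hT : 0 < T) (l : ℝ) :
    Integrable fun t : ℝ => cexp (I * l * t) * (Real.exp (-(t / T) ^ 2) : ℂ) := by
  refine (integrable_cexp_quadratic (b := ((1 / T ^ 2 : ℝ) : ℂ)) (by rw [ofReal_re]; positivity)
    (I * l) 0).congr (Eventually.of_forall fun t => ?_)
  change cexp _ = cexp _ * ((Real.exp _ : ℝ) : ℂ)
  rw [ofReal_exp, ← Complex.exp_add]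
  congr 1
  push_cast
  field_simp
  ring

/-- A finite Dirichlet polynomial on the imaginary axis. -/
noncomputable def dirichletPoly (χ : DirichletCharacter ℂ q) (S : Finset ℕ) (b : ℕ → ℂ) (t : ℝ) : ℂ :=
  ∑ n ∈ S, b n * χ n * cexp (-(I * t * Real.log n))

/-- The large sieve type mean value theorem over all characters, with Gaussian weight. -/
theorem gaussian_mean_value : ∃ C : ℝ, 0 < C ∧ ∀ (q : ℕ) [NeZero q] (T : ℝ), 1 ≤ T →
    ∀ (S : Finset ℕ), (∀ n ∈ S, 0 < n) → ∀ b : ℕ → ℂ,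
    ∑ χ : DirichletCharacter ℂ q, ∫ t : ℝ, ‖dirichletPoly χ S b t‖ ^ 2 * Real.exp (-(t / T) ^ 2) ≤
      C * ∑ n ∈ S, (q * T + n) * ‖b n‖ ^ 2 := by
  refine ⟨√Real.pi * (12 * Real.exp 9), by positivity, fun q _ T hT S hS b => ?_⟩
  have hT0 : 0 < T := by linarith
  have key : ((∑ χ : DirichletCharacter ℂ q,
      ∫ t : ℝ, ‖dirichletPoly χ S b t‖ ^ 2 * Real.exp (-(t / T) ^ 2) : ℝ) : ℂ) =
      ∑ m ∈ S, ∑ n ∈ S, b m * (starRingEnd ℂ) (b n) *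
        (∑ χ : DirichletCharacter ℂ q, χ m * (starRingEnd ℂ) (χ n)) *
        ((√Real.pi * (T * Real.exp (-((T * Real.log (n / m)) ^ 2 / 4))) : ℝ) : ℂ) := by
    have h1 : ∀ χ : DirichletCharacter ℂ q,
        ((∫ t : ℝ, ‖dirichletPoly χ S b t‖ ^ 2 * Real.exp (-(t / T) ^ 2) : ℝ) : ℂ) =
        ∑ m ∈ S, ∑ n ∈ S, b m * (starRingEnd ℂ) (b n) * (χ m * (starRingEnd ℂ) (χ n)) *
        ((√Real.pi * (T * Real.exp (-((T * Real.log (n / m)) ^ 2 / 4))) : ℝ) : ℂ) := by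
      intro χ
      have h2 : ∀ t : ℝ, ((‖dirichletPoly χ S b t‖ ^ 2 * Real.exp (-(t / T) ^ 2) : ℝ) : ℂ) =
          ∑ m ∈ S, ∑ n ∈ S, b m * (starRingEnd ℂ) (b n) * (χ m * (starRingEnd ℂ) (χ n)) *
            (cexp (I * (Real.log (n / m) : ℝ) * t) * (Real.exp (-(t / T) ^ 2) : ℂ)) := by
        intro t
        rw [ofReal_mul, ofReal_pow, ← mul_conj', dirichletPoly, map_sum, Finset.sum_mul_sum,
          Finset.sum_mul]
        refine Finset.sum_congr rfl fun m hm => ?_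
        rw [Finset.sum_mul]
        refine Finset.sum_congr rfl fun n hn => ?_
        have hm0 : (m:ℝ) ≠ 0 := (Nat.cast_pos.2 (hS m hm)).ne'
        have hn0 : (n:ℝ) ≠ 0 := (Nat.cast_pos.2 (hS n hn)).ne'
        have e : cexp (I * (Real.log (n / m) : ℝ) * t) =
            cexp (-(I * t * Real.log m)) * (starRingEnd ℂ) (cexp (-(I * t * Real.log n))) := by
          rw [← exp_conj, ← Complex.exp_add, Real.log_div hn0 hm0]
          congr 1
          simp only [map_neg, map_mul, conj_I, conj_ofReal]
          push_cast
          ring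
        rw [e, map_mul, map_mul]
        ring
      rw [← integral_complex_ofReal]
      simp_rw [h2]
      rw [integral_finsetSum _ fun m _ => integrable_finsetSum _ fun n _ =>
        (integrable_cexp_mul_gaussian hT0 _).const_mul _]
      refine Finset.sum_congr rfl fun m _ => ?_
      rw [integral_finsetSum _ fun n _ => (integrable_cexp_mul_gaussian hT0 _).const_mul _]
      refine Finset.sum_congr rfl fun n _ => ?_
      rw [integral_const_mul, integral_gaussian_mul_cexp hT0]
    rw [ofReal_sum, Finset.sum_congr rfl fun χ _ => h1 χ, Finset.sum_comm]
    refine Finset.sum_congr rfl fun m _ => ?_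
    rw [Finset.sum_comm]
    refine Finset.sum_congr rfl fun n _ => ?_
    rw [Finset.mul_sum, Finset.sum_mul]
  set G : ℕ → ℕ → ℝ := fun m n => (if (m : ZMod q) = n then (q : ℝ) else 0) *
    (T * Real.exp (-((T * Real.log (n / m)) ^ 2 / 4))) with hG
  have hG0 : ∀ m n, 0 ≤ G m n := fun m n => by
    simp only [hG]
    split_ifs <;> positivity
  have hGs : ∀ m n, G m n = G n m := fun m n => by
    simp only [hG]
    rw [show ((n:ℝ) / m) = ((m:ℝ) / n)⁻¹ by rw [inv_div], Real.log_inv, mul_neg, neg_sq]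
    simp only [eq_comm]
  have hnorm := congrArg norm key
  rw [norm_real] at hnorm
  refine (Real.le_norm_self _).trans (hnorm.le.trans ?_)
  calc _ ≤ ∑ m ∈ S, ∑ n ∈ S, √Real.pi * ((‖b m‖ ^ 2 + ‖b n‖ ^ 2) / 2 * G m n) := by
        refine (norm_sum_le _ _).trans (Finset.sum_le_sum fun m _ => (norm_sum_le _ _).trans
          (Finset.sum_le_sum fun n _ => ?_))
        rw [norm_mul, norm_mul, norm_mul, RCLike.norm_conj, norm_real,
          Real.norm_of_nonneg (by positivity)]
        calc ‖b m‖ * ‖b n‖ * ‖∑ χ : DirichletCharacter ℂ q, χ m * (starRingEnd ℂ) (χ n)‖ *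
              (√Real.pi * (T * Real.exp (-((T * Real.log (n / m)) ^ 2 / 4))))
            ≤ (‖b m‖ ^ 2 + ‖b n‖ ^ 2) / 2 * (if (m : ZMod q) = n then (q : ℝ) else 0) *
              (√Real.pi * (T * Real.exp (-((T * Real.log (n / m)) ^ 2 / 4)))) := by
              gcongr
              · nlinarith [sq_nonneg (‖b m‖ - ‖b n‖)]
              · exact norm_sum_apply_mul_conj_le m n
          _ = _ := by simp only [hG]; ring
    _ = √Real.pi * ∑ m ∈ S, ‖b m‖ ^ 2 * ∑ n ∈ S, G m n := by
        have e1 : ∑ m ∈ S, ∑ n ∈ S, ‖b n‖ ^ 2 * G m n = ∑ m ∈ S, ∑ n ∈ S, ‖b m‖ ^ 2 * G m n := by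
          rw [Finset.sum_comm]
          exact Finset.sum_congr rfl fun m _ => Finset.sum_congr rfl fun n _ => by rw [hGs]
        have e2 : ∑ m ∈ S, ∑ n ∈ S, √Real.pi * ((‖b m‖ ^ 2 + ‖b n‖ ^ 2) / 2 * G m n) =
            √Real.pi / 2 * (∑ m ∈ S, ∑ n ∈ S, ‖b m‖ ^ 2 * G m n +
              ∑ m ∈ S, ∑ n ∈ S, ‖b n‖ ^ 2 * G m n) := by
          simp_rw [← Finset.sum_add_distrib, Finset.mul_sum]
          exact Finset.sum_congr rfl fun m _ => Finset.sum_congr rfl fun n _ => by ring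
        have e3 : ∑ m ∈ S, ‖b m‖ ^ 2 * ∑ n ∈ S, G m n = ∑ m ∈ S, ∑ n ∈ S, ‖b m‖ ^ 2 * G m n := by
          simp_rw [Finset.mul_sum]
        rw [e2, e1, e3]
        ring
    _ ≤ √Real.pi * ∑ m ∈ S, ‖b m‖ ^ 2 * (12 * Real.exp 9 * (q * T + m)) := by
        gcongr with m hm
        exact sum_congruent_le hT (hS m hm) S hS
    _ = _ := by
        rw [mul_assoc, Finset.mul_sum (a := 12 * Real.exp 9)]
        congr 1
        exact Finset.sum_congr rfl fun m _ => by ring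

lemma continuous_dirichletPoly {d : ℕ} (χ : DirichletCharacter ℂ d) (S : Finset ℕ) (b : ℕ → ℂ) :
    Continuous (dirichletPoly χ S b) := by
  unfold dirichletPoly
  fun_prop

lemma norm_dirichletPoly_le {d : ℕ} (χ : DirichletCharacter ℂ d) (S : Finset ℕ) (b : ℕ → ℂ) (t : ℝ) :
    ‖dirichletPoly χ S b t‖ ≤ ∑ n ∈ S, ‖b n‖ := by
  refine (norm_sum_le _ _).trans (Finset.sum_le_sum fun n _ => ?_)
  rw [norm_mul, norm_mul, Complex.norm_exp]
  have : (-(I * t * Real.log n)).re = 0 := by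
    rw [neg_re, re_mul_ofReal, re_mul_ofReal, I_re, zero_mul, zero_mul, neg_zero]
  rw [this, Real.exp_zero, mul_one]
  exact mul_le_of_le_one_right (norm_nonneg _) (norm_le_one χ _)

/-- The weight `e^{-|t|/T}`. -/
noncomputable def expWeight (T t : ℝ) : ENNReal := ENNReal.ofReal (Real.exp (-(|t| / T)))

lemma measurable_expWeight (T : ℝ) : Measurable (expWeight T) := by
  unfold expWeight
  fun_prop

lemma expWeight_le {T : ℝ} (hT : 0 < T) (t : ℝ) :
    expWeight T t ≤ ∑' j : ℕ, ENNReal.ofReal (Real.exp (1 - j)) *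
      ENNReal.ofReal (Real.exp (-(t / (T * (j + 1))) ^ 2)) := by
  refine le_trans ?_ (ENNReal.le_tsum ⌊|t| / T⌋₊)
  rw [← ENNReal.ofReal_mul (by positivity), ← Real.exp_add]
  apply ENNReal.ofReal_le_ofReal
  rw [Real.exp_le_exp]
  set x := |t| / T with hx
  have h1 := Nat.floor_le (by positivity : 0 ≤ x)
  have h2 := Nat.lt_floor_add_one x
  have h3 : (t / (T * ((⌊x⌋₊ : ℝ) + 1))) ^ 2 ≤ 1 := by
    rw [← sq_abs, abs_div, abs_of_pos (by positivity : 0 < T * ((⌊x⌋₊ : ℝ) + 1)), ← div_div, ← hx]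
    refine pow_le_one₀ (by positivity) ?_
    rw [div_le_one (by positivity)]
    exact h2.le
  linarith

/-- The mean value theorem for finite Dirichlet polynomials, with weight `e^{-|t|/T}`. -/
theorem mean_value_finite : ∃ C : ℝ, 0 < C ∧ ∀ (q : ℕ) [NeZero q] (T : ℝ), 1 ≤ T →
    ∀ (S : Finset ℕ), (∀ n ∈ S, 0 < n) → ∀ b : ℕ → ℂ,
    ∑ χ : DirichletCharacter ℂ q, ∫⁻ t : ℝ, ‖dirichletPoly χ S b t‖ₑ ^ 2 * expWeight T t ≤
      ENNReal.ofReal (C * ∑ n ∈ S, (q * T + n) * ‖b n‖ ^ 2) := by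
  obtain ⟨C, hC, h⟩ := gaussian_mean_value
  have hsum : Summable fun j : ℕ => Real.exp (1 - j) * ((j : ℝ) + 1) := by
    have h1 := (Real.summable_pow_mul_exp_neg_nat_mul 1 one_pos).add
      (Real.summable_pow_mul_exp_neg_nat_mul 0 one_pos)
    refine (h1.mul_left (Real.exp 1)).congr fun j => ?_
    rw [sub_eq_add_neg, Real.exp_add]
    simp only [pow_one, pow_zero, one_mul, neg_mul]
    ring
  have hpos : 0 < ∑' j : ℕ, Real.exp (1 - j) * ((j : ℝ) + 1) :=
    hsum.tsum_pos (fun j => by positivity) 0 (by positivity)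
  refine ⟨C * ∑' j : ℕ, Real.exp (1 - j) * ((j : ℝ) + 1), by positivity, fun q _ T hT S hS b => ?_⟩
  have hT0 : 0 < T := by linarith
  have hB : 0 ≤ ∑ n ∈ S, (q * T + n) * ‖b n‖ ^ 2 := by positivity
  have hint : ∀ (χ : DirichletCharacter ℂ q) (A : ℝ), 0 < A →
      Integrable fun t : ℝ => ‖dirichletPoly χ S b t‖ ^ 2 * Real.exp (-(t / A) ^ 2) := by
    intro χ A hA
    have h1 : Integrable fun t : ℝ => Real.exp (-(t / A) ^ 2) := by
      have := integrable_exp_neg_mul_sq (b := 1 / A ^ 2) (by positivity)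
      refine this.congr (Eventually.of_forall fun t => ?_)
      simp only
      congr 1
      field_simp
    refine h1.bdd_mul (c := (∑ n ∈ S, ‖b n‖) ^ 2)
      ((continuous_dirichletPoly χ S b).norm.pow 2).aestronglyMeasurable
      (Eventually.of_forall fun t => ?_)
    rw [norm_pow, norm_norm]
    gcongr
    exact norm_dirichletPoly_le χ S b t
  calc _ ≤ ∑ χ : DirichletCharacter ℂ q, ∫⁻ t : ℝ, ∑' j : ℕ, ENNReal.ofReal (Real.exp (1 - j)) *
        ENNReal.ofReal (‖dirichletPoly χ S b t‖ ^ 2 * Real.exp (-(t / (T * (j + 1))) ^ 2)) := by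
        gcongr with χ _ t
        refine (mul_le_mul_right (expWeight_le hT0 t) _).trans (le_of_eq ?_)
        rw [← ENNReal.tsum_mul_left]
        congr 1
        funext j
        rw [ENNReal.ofReal_mul (p := ‖dirichletPoly χ S b t‖ ^ 2) (by positivity),
          ENNReal.ofReal_pow (norm_nonneg _), ofReal_norm]
        ring
    _ = ∑ χ : DirichletCharacter ℂ q, ∑' j : ℕ, ENNReal.ofReal (Real.exp (1 - j)) *
        ENNReal.ofReal (∫ t : ℝ, ‖dirichletPoly χ S b t‖ ^ 2 *
          Real.exp (-(t / (T * (j + 1))) ^ 2)) := by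
        refine Finset.sum_congr rfl fun χ _ => ?_
        have hc := continuous_dirichletPoly χ S b
        rw [lintegral_tsum fun j => by fun_prop]
        congr 1
        funext j
        rw [lintegral_const_mul' _ _ ENNReal.ofReal_ne_top,
          ofReal_integral_eq_lintegral_ofReal (hint χ _ (by positivity))
            (Eventually.of_forall fun t => by positivity)]
    _ = ∑' j : ℕ, ENNReal.ofReal (Real.exp (1 - j)) * ENNReal.ofReal
        (∑ χ : DirichletCharacter ℂ q, ∫ t : ℝ, ‖dirichletPoly χ S b t‖ ^ 2 *
          Real.exp (-(t / (T * (j + 1))) ^ 2)) := by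
        rw [← Summable.tsum_finsetSum fun _ _ => ENNReal.summable]
        congr 1
        funext j
        rw [ENNReal.ofReal_sum_of_nonneg fun χ _ => integral_nonneg fun t => by positivity,
          Finset.mul_sum]
    _ ≤ ∑' j : ℕ, ENNReal.ofReal (Real.exp (1 - j) * ((j : ℝ) + 1) *
          (C * ∑ n ∈ S, (q * T + n) * ‖b n‖ ^ 2)) := by
        refine ENNReal.tsum_le_tsum fun j => ?_
        have hj : (1:ℝ) ≤ j + 1 := by linarith [Nat.cast_nonneg (α := ℝ) j]
        rw [mul_assoc, ENNReal.ofReal_mul (Real.exp_pos _).le]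
        gcongr
        refine (h q (T * (j + 1)) (by nlinarith) S hS b).trans ?_
        rw [mul_left_comm ((j : ℝ) + 1), Finset.mul_sum S _ ((j : ℝ) + 1)]
        refine mul_le_mul_of_nonneg_left ?_ hC.le
        refine Finset.sum_le_sum fun n _ => ?_
        rw [← mul_assoc ((j : ℝ) + 1)]
        refine mul_le_mul_of_nonneg_right ?_ (by positivity)
        have : (n : ℝ) ≤ (j + 1) * n := le_mul_of_one_le_left (Nat.cast_nonneg n) hj
        linarith
    _ = _ := by
        rw [← ENNReal.ofReal_tsum_of_nonneg (fun j => by positivity) (hsum.mul_right _),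
          tsum_mul_right]
        congr 1
        ring

lemma term_eq_cexp {d : ℕ} (a : ℕ → ℂ) (χ : DirichletCharacter ℂ d) (σ t : ℝ) {n : ℕ} (hn : 0 < n) :
    LSeries.term (fun n => a n * χ n) (σ + t * I) n =
      (a n * ((n : ℝ) ^ (-σ) : ℝ)) * χ n * cexp (-(I * t * Real.log n)) := by
  have hn0 : (n : ℂ) ≠ 0 := Nat.cast_ne_zero.2 hn.ne'
  have hn1 : (0:ℝ) < n := Nat.cast_pos.2 hn
  rw [LSeries.term_of_ne_zero hn.ne', cpow_add _ _ hn0, div_eq_mul_inv, mul_inv, Real.rpow_neg hn1.le,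
    ofReal_inv, ofReal_cpow hn1.le, ofReal_natCast, Complex.cpow_def_of_ne_zero hn0 (t * I),
    ← Complex.exp_neg]
  have : -(Complex.log n * (t * I)) = -(I * t * Real.log n) := by
    rw [← natCast_log]; ring
  rw [this]
  ring

/-- The mean value theorem for Dirichlet series, with weight `e^{-|t|/T}`. -/
theorem mean_value : ∃ C : ℝ, 0 < C ∧ ∀ (q : ℕ) [NeZero q] (T : ℝ), 1 ≤ T → ∀ (a : ℕ → ℂ) (σ : ℝ),
    LSeriesSummable a σ →
    ∑ χ : DirichletCharacter ℂ q,
      ∫⁻ t : ℝ, ‖LSeries (fun n => a n * χ n) (σ + t * I)‖ₑ ^ 2 * expWeight T t ≤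
    ENNReal.ofReal C * ∑' n : ℕ, ENNReal.ofReal ((q * T + n) * (‖a n‖ ^ 2 * (n : ℝ) ^ (-(2 * σ)))) := by
  obtain ⟨C, hC, h⟩ := mean_value_finite
  refine ⟨C, hC, fun q _ T hT a σ ha => ?_⟩
  have hT0 : 0 < T := by linarith
  set b : ℕ → ℂ := fun n => a n * ((n : ℝ) ^ (-σ) : ℝ) with hb
  set S : ℕ → Finset ℕ := fun N => (Finset.range N).filter (0 < ·) with hS
  have hsum : ∀ (χ : DirichletCharacter ℂ q) (t : ℝ),
      LSeriesSummable (fun n => a n * χ n) (σ + t * I) := by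
    intro χ t
    refine Summable.of_norm_bounded ha.norm fun n => ?_
    rcases Nat.eq_zero_or_pos n with rfl | hn
    · simp
    · rw [LSeries.term_of_ne_zero hn.ne', LSeries.term_of_ne_zero hn.ne', norm_div, norm_div,
        norm_natCast_cpow hn, norm_natCast_cpow hn, norm_mul]
      simp only [add_re, ofReal_re, mul_re, I_re, mul_zero, ofReal_im, I_im, mul_one, sub_self,
        add_zero]
      gcongr
      exact mul_le_of_le_one_right (norm_nonneg _) (norm_le_one χ _)
  have hpart : ∀ (χ : DirichletCharacter ℂ q) (t : ℝ) (N : ℕ),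
      ∑ n ∈ Finset.range N, LSeries.term (fun n => a n * χ n) (σ + t * I) n =
        dirichletPoly χ (S N) b t := by
    intro χ t N
    rw [dirichletPoly, hS, Finset.sum_filter]
    refine Finset.sum_congr rfl fun n _ => ?_
    split_ifs with hn
    · exact term_eq_cexp a χ σ t hn
    · rw [Nat.eq_zero_of_not_pos hn, LSeries.term_zero]
  have hlim : ∀ (χ : DirichletCharacter ℂ q) (t : ℝ),
      Tendsto (fun N => ‖dirichletPoly χ (S N) b t‖ₑ ^ 2 * expWeight T t) atTop
        (𝓝 (‖LSeries (fun n => a n * χ n) (σ + t * I)‖ₑ ^ 2 * expWeight T t)) := by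
    intro χ t
    have h1 := (hsum χ t).hasSum.tendsto_sum_nat
    simp_rw [hpart] at h1
    exact ENNReal.Tendsto.mul_const ((ENNReal.continuous_pow 2).tendsto _ |>.comp h1.enorm) (Or.inr ENNReal.ofReal_ne_top)
  have hmeas : ∀ (χ : DirichletCharacter ℂ q) (N : ℕ),
      Measurable fun t => ‖dirichletPoly χ (S N) b t‖ₑ ^ 2 * expWeight T t := fun χ N =>
    ((continuous_dirichletPoly χ (S N) b).measurable.enorm.pow_const 2).mul (measurable_expWeight T)
  have hfin : ∀ N, ∑ χ : DirichletCharacter ℂ q,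
      ∫⁻ t : ℝ, ‖dirichletPoly χ (S N) b t‖ₑ ^ 2 * expWeight T t ≤
      ENNReal.ofReal C * ∑' n : ℕ, ENNReal.ofReal ((q * T + n) * (‖a n‖ ^ 2 * (n : ℝ) ^ (-(2 * σ)))) := by
    intro N
    refine (h q T hT (S N) (fun n hn => (Finset.mem_filter.1 hn).2) b).trans ?_
    rw [ENNReal.ofReal_mul hC.le]
    gcongr
    rw [ENNReal.ofReal_sum_of_nonneg fun n _ => by positivity]
    refine le_trans (le_of_eq ?_) (ENNReal.sum_le_tsum (S N))
    refine Finset.sum_congr rfl fun n _ => ?_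
    congr 2
    rw [hb, norm_mul, mul_pow, norm_real, Real.norm_of_nonneg (by positivity),
      ← Real.rpow_natCast ((n : ℝ) ^ (-σ)), ← Real.rpow_mul (Nat.cast_nonneg n)]
    congr 2
    push_cast
    ring
  calc _ = ∑ χ : DirichletCharacter ℂ q,
        ∫⁻ t : ℝ, liminf (fun N => ‖dirichletPoly χ (S N) b t‖ₑ ^ 2 * expWeight T t) atTop :=
        Finset.sum_congr rfl fun χ _ => lintegral_congr fun t => (hlim χ t).liminf_eq.symm
    _ ≤ ∫⁻ t : ℝ, liminf (fun N => ∑ χ : DirichletCharacter ℂ q,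
          ‖dirichletPoly χ (S N) b t‖ₑ ^ 2 * expWeight T t) atTop := by
        rw [← lintegral_finsetSum' _ fun χ _ =>
          (Measurable.liminf fun N => hmeas χ N).aemeasurable]
        refine lintegral_mono fun t => le_of_eq ?_
        rw [(tendsto_finsetSum _ fun χ _ => hlim χ t).liminf_eq]
        exact Finset.sum_congr rfl fun χ _ => (hlim χ t).liminf_eq
    _ ≤ liminf (fun N => ∫⁻ t : ℝ, ∑ χ : DirichletCharacter ℂ q,
          ‖dirichletPoly χ (S N) b t‖ₑ ^ 2 * expWeight T t) atTop :=
        lintegral_liminf_le fun N => Finset.measurable_sum _ fun χ _ => hmeas χ N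
    _ ≤ _ := by
        refine liminf_le_of_le (by isBoundedDefault) fun b hb => ?_
        obtain ⟨N, hN⟩ := hb.exists
        refine hN.trans ?_
        rw [lintegral_finsetSum' _ fun χ _ => (hmeas χ N).aemeasurable]
        exact hfin N

end ZeroDensity

namespace ZeroDensity
open Complex MeasureTheory Set Filter Topology DirichletCharacter

/-- The divisor function, as a real number. -/
noncomputable def tau (n : ℕ) : ℝ := n.divisors.card

lemma tau_nonneg (n : ℕ) : 0 ≤ tau n := Nat.cast_nonneg _

lemma tau_eq_sum (n : ℕ) : tau n = ∑ _p ∈ n.divisorsAntidiagonal, (1 : ℝ) := by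
  rw [tau, ← Nat.map_div_right_divisors]
  simp

lemma tau_mul_le (m n : ℕ) : tau (m * n) ≤ tau m * tau n := by
  rw [tau, tau, tau, Nat.divisors_mul]
  exact_mod_cast Finset.card_mul_le

lemma tau_sq_le (n : ℕ) : tau n ^ 2 ≤ ∑ p ∈ n.divisorsAntidiagonal, tau p.1 * tau p.2 := by
  calc tau n ^ 2 = ∑ p ∈ n.divisorsAntidiagonal, tau n := by
        rw [sq, Finset.sum_congr rfl fun p _ => (one_mul (tau n)).symm, ← Finset.sum_mul,
          ← tau_eq_sum]
    _ ≤ _ := by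
        refine Finset.sum_le_sum fun p hp => ?_
        rw [← (Nat.mem_divisorsAntidiagonal.1 hp).1]
        exact tau_mul_le _ _

lemma term_ofReal {f : ℕ → ℝ} {σ : ℝ} (hσ : σ ≠ 0) (n : ℕ) :
    LSeries.term (fun n => (f n : ℂ)) σ n = ((f n * (n : ℝ) ^ (-σ) : ℝ) : ℂ) := by
  rcases Nat.eq_zero_or_pos n with rfl | hn
  · simp [Real.zero_rpow (neg_ne_zero.2 hσ)]
  · rw [LSeries.term_of_ne_zero hn.ne', Real.rpow_neg (Nat.cast_nonneg n), ofReal_mul, ofReal_inv,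
      ofReal_cpow (Nat.cast_nonneg n), ofReal_natCast, div_eq_mul_inv]

lemma lSeriesSummable_ofReal_iff {f : ℕ → ℝ} {σ : ℝ} (hσ : σ ≠ 0) :
    LSeriesSummable (fun n => (f n : ℂ)) σ ↔ Summable fun n => f n * (n : ℝ) ^ (-σ) := by
  rw [LSeriesSummable, funext (term_ofReal hσ), Complex.summable_ofReal]

lemma lSeries_ofReal {f : ℕ → ℝ} {σ : ℝ} (hσ : σ ≠ 0) :
    LSeries (fun n => (f n : ℂ)) σ = ((∑' n, f n * (n : ℝ) ^ (-σ) : ℝ) : ℂ) := by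
  rw [LSeries, funext (term_ofReal hσ), Complex.ofReal_tsum]

lemma real_convolution {f g : ℕ → ℝ} {σ : ℝ} (hσ : σ ≠ 0)
    (hf : Summable fun n => f n * (n : ℝ) ^ (-σ)) (hg : Summable fun n => g n * (n : ℝ) ^ (-σ)) :
    (Summable fun n : ℕ => (∑ p ∈ n.divisorsAntidiagonal, f p.1 * g p.2) * (n : ℝ) ^ (-σ)) ∧
    ∑' n : ℕ, (∑ p ∈ n.divisorsAntidiagonal, f p.1 * g p.2) * (n : ℝ) ^ (-σ) =
      (∑' n, f n * (n : ℝ) ^ (-σ)) * ∑' n, g n * (n : ℝ) ^ (-σ) := by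
  have hf' := (lSeriesSummable_ofReal_iff hσ).2 hf
  have hg' := (lSeriesSummable_ofReal_iff hσ).2 hg
  have e : LSeries.convolution (fun n => (f n : ℂ)) (fun n => (g n : ℂ)) =
      fun n => ((∑ p ∈ n.divisorsAntidiagonal, f p.1 * g p.2 : ℝ) : ℂ) := by
    rw [LSeries.convolution_def]
    funext n
    push_cast
    rfl
  constructor
  · rw [← lSeriesSummable_ofReal_iff (f := fun n => ∑ p ∈ n.divisorsAntidiagonal, f p.1 * g p.2) hσ,
      ← e]
    exact hf'.convolution hg'
  · have := LSeries_convolution' hf' hg'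
    rw [e, lSeries_ofReal hσ, lSeries_ofReal hσ, lSeries_ofReal hσ] at this
    exact_mod_cast this

lemma tau_series {a : ℝ} (ha : 0 < a) : (Summable fun n => tau n * (n : ℝ) ^ (-(1 + a))) ∧
    ∑' n, tau n * (n : ℝ) ^ (-(1 + a)) ≤ (1 + 1 / a) ^ 2 := by
  have h1 : Summable fun n : ℕ => (1 : ℝ) * (n : ℝ) ^ (-(1 + a)) := by
    simpa only [one_mul] using summable_rpow_neg ha
  obtain ⟨h2, h3⟩ := real_convolution (by linarith : (1 + a : ℝ) ≠ 0) h1 h1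
  simp only [mul_one, ← tau_eq_sum, one_mul] at h2 h3
  refine ⟨h2, ?_⟩
  rw [h3, ← sq]
  exact pow_le_pow_left₀ (tsum_nonneg fun n => by positivity) (tsum_rpow_neg_le ha) 2

/-- The mean square of the divisor function. -/
lemma tau_sq_series {a : ℝ} (ha : 0 < a) : (Summable fun n => tau n ^ 2 * (n : ℝ) ^ (-(1 + a))) ∧
    ∑' n, tau n ^ 2 * (n : ℝ) ^ (-(1 + a)) ≤ (1 + 1 / a) ^ 4 := by
  obtain ⟨h1, h2⟩ := tau_series ha
  obtain ⟨h3, h4⟩ := real_convolution (by linarith : (1 + a : ℝ) ≠ 0) h1 h1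
  have h5 : ∀ n : ℕ, tau n ^ 2 * (n : ℝ) ^ (-(1 + a)) ≤
      (∑ p ∈ n.divisorsAntidiagonal, tau p.1 * tau p.2) * (n : ℝ) ^ (-(1 + a)) := fun n => by
    gcongr
    exact tau_sq_le n
  have h6 : Summable fun n => tau n ^ 2 * (n : ℝ) ^ (-(1 + a)) :=
    Summable.of_nonneg_of_le (fun n => by positivity) h5 h3
  refine ⟨h6, (h6.tsum_le_tsum h5 h3).trans ?_⟩
  rw [h4, show (1 + 1 / a) ^ 4 = (1 + 1 / a) ^ 2 * (1 + 1 / a) ^ 2 by ring]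
  have : 0 ≤ ∑' n, tau n * (n : ℝ) ^ (-(1 + a)) :=
    tsum_nonneg fun n => mul_nonneg (tau_nonneg n) (by positivity)
  gcongr

/-- A truncated divisor sum is summed against a pointwise majorant of Rankin type. -/
lemma tsum_ofReal_le_tau_sq {a c : ℝ} (ha : 0 < a) (hc : 0 ≤ c) {f : ℕ → ℝ}
    (hf : ∀ n, f n ≤ c * (tau n ^ 2 * (n : ℝ) ^ (-(1 + a)))) :
    ∑' n, ENNReal.ofReal (f n) ≤ ENNReal.ofReal (c * (1 + 1 / a) ^ 4) := by
  obtain ⟨h1, h2⟩ := tau_sq_series ha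
  calc _ ≤ ∑' n, ENNReal.ofReal (c * (tau n ^ 2 * (n : ℝ) ^ (-(1 + a)))) :=
        ENNReal.tsum_le_tsum fun n => ENNReal.ofReal_le_ofReal (hf n)
    _ = ENNReal.ofReal (∑' n, c * (tau n ^ 2 * (n : ℝ) ^ (-(1 + a)))) :=
        (ENNReal.ofReal_tsum_of_nonneg (fun n => by positivity) (h1.mul_left c)).symm
    _ ≤ _ := by
        rw [tsum_mul_left]
        gcongr

lemma convolution_apply_eq_tau {q : ℕ} (χ : DirichletCharacter ℂ q) :
    LSeries.convolution (fun n => χ n) (fun n => χ n) = fun n => (tau n : ℂ) * χ n := by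
  funext n
  rw [LSeries.convolution_def]
  simp only
  rw [tau_eq_sum, ofReal_sum, Finset.sum_mul]
  refine Finset.sum_congr rfl fun p hp => ?_
  rw [← (Nat.mem_divisorsAntidiagonal.1 hp).1, Nat.cast_mul, map_mul, ofReal_one, one_mul]

lemma lSeriesSummable_tau {q : ℕ} (χ : DirichletCharacter ℂ q) {s : ℂ} (hs : 1 < s.re) :
    LSeriesSummable (fun n => (tau n : ℂ) * χ n) s := by
  rw [← convolution_apply_eq_tau]
  exact (LSeriesSummable_of_one_lt_re χ hs).convolution (LSeriesSummable_of_one_lt_re χ hs)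

lemma LFunction_sq_eq {q : ℕ} [NeZero q] (χ : DirichletCharacter ℂ q) {s : ℂ} (hs : 1 < s.re) :
    LFunction χ s ^ 2 = LSeries (fun n => (tau n : ℂ) * χ n) s := by
  rw [LFunction_eq_LSeries χ hs, sq, ← convolution_apply_eq_tau,
    ← LSeries_convolution' (LSeriesSummable_of_one_lt_re χ hs) (LSeriesSummable_of_one_lt_re χ hs)]

end ZeroDensity

namespace ZeroDensity
open Complex MeasureTheory Set Filter Topology DirichletCharacter

lemma lintegral_mul_sq_le {f g : ℝ → ENNReal} (hf : Measurable f) (hg : Measurable g) :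
    (∫⁻ v, f v * g v) ^ 2 ≤ (∫⁻ v, f v ^ 2) * ∫⁻ v, g v ^ 2 := by
  have h := ENNReal.lintegral_mul_le_Lp_mul_Lq volume Real.HolderConjugate.two_two
    hf.aemeasurable hg.aemeasurable
  simp only [Pi.mul_apply, ENNReal.rpow_two] at h
  calc (∫⁻ v, f v * g v) ^ 2
      ≤ ((∫⁻ v, f v ^ 2) ^ (1 / 2 : ℝ) * (∫⁻ v, g v ^ 2) ^ (1 / 2 : ℝ)) ^ 2 := by gcongr
    _ = _ := by
        rw [mul_pow, ← ENNReal.rpow_natCast, ← ENNReal.rpow_natCast, ← ENNReal.rpow_mul,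
          ← ENNReal.rpow_mul]
        norm_num

/-- The smoothing kernel dominating `cauchyKernel` on the vertical line `re w = ±η`. -/
noncomputable def smoothKernel (η v : ℝ) : ℝ := Real.exp (-v ^ 2 / 2) / √(η ^ 2 + v ^ 2)

lemma smoothKernel_nonneg (η v : ℝ) : 0 ≤ smoothKernel η v := by
  unfold smoothKernel; positivity

lemma measurable_smoothKernel (η : ℝ) : Measurable (smoothKernel η) := by
  unfold smoothKernel; fun_prop

lemma lintegral_inv_sq_add_sq {η : ℝ} (hη : 0 < η) :
    ∫⁻ v : ℝ, ENNReal.ofReal (1 / (η ^ 2 + v ^ 2)) = ENNReal.ofReal (Real.pi / η) := by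
  have h1 : ∀ v : ℝ, 1 / (η ^ 2 + v ^ 2) = (η ^ 2)⁻¹ * (1 + (v / η) ^ 2)⁻¹ := by
    intro v
    field_simp
  have hi : Integrable fun v : ℝ => (1 + (v / η) ^ 2)⁻¹ :=
    integrable_inv_one_add_sq.comp_div hη.ne'
  simp_rw [h1]
  rw [← ofReal_integral_eq_lintegral_ofReal (hi.const_mul _)
    (Eventually.of_forall fun v => by positivity), integral_const_mul,
    Measure.integral_comp_div (fun v : ℝ => (1 + v ^ 2)⁻¹) η, integral_univ_inv_one_add_sq,
    abs_of_pos hη, smul_eq_mul]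
  congr 1
  field_simp

lemma expWeight_shift {T : ℝ} (hT : 1 ≤ T) (t v : ℝ) :
    expWeight T t ≤ ENNReal.ofReal (Real.exp |v|) * expWeight T (t + v) := by
  unfold expWeight
  rw [← ENNReal.ofReal_mul (by positivity), ← Real.exp_add]
  refine ENNReal.ofReal_le_ofReal (Real.exp_le_exp.2 ?_)
  have h1 : |t + v| ≤ |t| + |v| := abs_add_le t v
  have h2 : |t + v| / T ≤ |t| / T + |v| / T := by
    rw [← add_div]; gcongr
  have h3 : |v| / T ≤ |v| := div_le_self (abs_nonneg v) hT
  linarith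

lemma integrable_exp_abs_sub_half_sq : Integrable fun v : ℝ => Real.exp (|v| - v ^ 2 / 2) := by
  have h := (integrable_exp_mul_abs_sub_sq (√2)).comp_div (g := fun v => Real.exp (√2 * |v| - v ^ 2))
    (R := √2) (by positivity)
  refine h.congr (Eventually.of_forall fun v => ?_)
  have h2 : (√2 : ℝ) ^ 2 = 2 := Real.sq_sqrt (by norm_num)
  have h3 : (0 : ℝ) < √2 := by positivity
  simp only [div_pow, h2, abs_div, abs_of_pos h3]
  congr 2
  field_simp

theorem smoothing : ∃ C : ℝ, 0 < C ∧ ∀ (F : ℝ → ENNReal), Measurable F → ∀ η T : ℝ, 0 < η → 1 ≤ T →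
    ∫⁻ t, (∫⁻ v, F (t + v) * ENNReal.ofReal (smoothKernel η v)) ^ 2 * expWeight T t ≤
      ENNReal.ofReal (C / η) * ∫⁻ t, F t ^ 2 * expWeight T t := by
  set J : ℝ := ∫ v : ℝ, Real.exp (|v| - v ^ 2 / 2) with hJ
  have hJ0 : 0 ≤ J := integral_nonneg fun v => (Real.exp_pos _).le
  refine ⟨Real.pi * (J + 1), by positivity, fun F hF η T hη hT => ?_⟩
  have hcs : ∀ t, (∫⁻ v, F (t + v) * ENNReal.ofReal (smoothKernel η v)) ^ 2 ≤
      ENNReal.ofReal (Real.pi / η) *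
        ∫⁻ v, F (t + v) ^ 2 * ENNReal.ofReal (Real.exp (-v ^ 2 / 2)) := by
    intro t
    have e1 : ∀ v, F (t + v) * ENNReal.ofReal (smoothKernel η v) =
        (F (t + v) * ENNReal.ofReal (Real.exp (-v ^ 2 / 4))) *
          ENNReal.ofReal (Real.exp (-v ^ 2 / 4) / √(η ^ 2 + v ^ 2)) := by
      intro v
      rw [mul_assoc, ← ENNReal.ofReal_mul (by positivity), smoothKernel, mul_div_assoc',
        ← Real.exp_add]
      ring_nf
    simp_rw [e1]
    refine (lintegral_mul_sq_le (by fun_prop) (by fun_prop)).trans ?_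
    rw [mul_comm, ← lintegral_inv_sq_add_sq hη]
    gcongr with v v
    · rw [← ENNReal.ofReal_pow (by positivity)]
      refine ENNReal.ofReal_le_ofReal ?_
      rw [div_pow, Real.sq_sqrt (by positivity), ← Real.exp_nat_mul]
      gcongr
      rw [Real.exp_le_one_iff]
      push_cast
      nlinarith [sq_nonneg v]
    · rw [mul_pow, ← ENNReal.ofReal_pow (by positivity), ← Real.exp_nat_mul]
      refine le_of_eq ?_
      congr 3
      push_cast
      ring
  have hm : Measurable (expWeight T) := measurable_expWeight T
  calc ∫⁻ t, (∫⁻ v, F (t + v) * ENNReal.ofReal (smoothKernel η v)) ^ 2 * expWeight T t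
      ≤ ∫⁻ t, ENNReal.ofReal (Real.pi / η) *
          ∫⁻ v, F (t + v) ^ 2 * ENNReal.ofReal (Real.exp (-v ^ 2 / 2)) * expWeight T t := by
        refine lintegral_mono fun t => ?_
        rw [lintegral_mul_const _ (by fun_prop), ← mul_assoc]
        gcongr
        exact hcs t
    _ = ENNReal.ofReal (Real.pi / η) *
          ∫⁻ v, ∫⁻ t, F (t + v) ^ 2 * ENNReal.ofReal (Real.exp (-v ^ 2 / 2)) * expWeight T t := by
        rw [lintegral_const_mul, lintegral_lintegral_swap]
        · exact Measurable.aemeasurable (by fun_prop)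
        · exact Measurable.lintegral_prod_right' (f := fun p : ℝ × ℝ =>
            F (p.1 + p.2) ^ 2 * ENNReal.ofReal (Real.exp (-p.2 ^ 2 / 2)) * expWeight T p.1)
            (by fun_prop)
    _ ≤ ENNReal.ofReal (Real.pi / η) *
          ∫⁻ v, ENNReal.ofReal (Real.exp (|v| - v ^ 2 / 2)) * ∫⁻ t, F t ^ 2 * expWeight T t := by
        refine mul_le_mul_right (lintegral_mono fun v => ?_) _
        rw [← lintegral_add_right_eq_self (fun t => F t ^ 2 * expWeight T t) v,
          ← lintegral_const_mul _ (by fun_prop)]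
        refine lintegral_mono fun t => ?_
        calc F (t + v) ^ 2 * ENNReal.ofReal (Real.exp (-v ^ 2 / 2)) * expWeight T t
            ≤ F (t + v) ^ 2 * ENNReal.ofReal (Real.exp (-v ^ 2 / 2)) *
              (ENNReal.ofReal (Real.exp |v|) * expWeight T (t + v)) := by
              gcongr; exact expWeight_shift hT t v
          _ = _ := by
              rw [show |v| - v ^ 2 / 2 = |v| + -v ^ 2 / 2 by ring, Real.exp_add,
                ENNReal.ofReal_mul (by positivity)]
              ring
    _ ≤ _ := by
        rw [lintegral_mul_const _ (by fun_prop), ← ofReal_integral_eq_lintegral_ofReal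
          integrable_exp_abs_sub_half_sq (Eventually.of_forall fun v => (Real.exp_pos _).le),
          ← mul_assoc, ← ENNReal.ofReal_mul (by positivity)]
        gcongr
        rw [div_mul_eq_mul_div]
        gcongr
        linarith

end ZeroDensity

namespace ZeroDensity
open Complex MeasureTheory Set Filter Topology DirichletCharacter

/-- The kernel of the smoothed approximate functional equation, centred at `s`. -/
noncomputable def afeKernel (U : ℝ) (s w : ℂ) : ℂ :=
  ((s + w - 1) / (s - 1)) ^ 2 * (U : ℂ) ^ w * cauchyKernel w

lemma differentiableAt_afeKernel {U : ℝ} (hU : 0 < U) (s : ℂ) {w : ℂ} (hw : w ≠ 0) :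
    DifferentiableAt ℂ (afeKernel U s) w := by
  unfold afeKernel cauchyKernel
  have hU' : (U : ℂ) ≠ 0 := ofReal_ne_zero.2 hU.ne'
  refine DifferentiableAt.mul (DifferentiableAt.mul (by fun_prop) ?_) ?_
  · exact DifferentiableAt.const_cpow differentiableAt_id (Or.inl hU')
  · exact DifferentiableAt.div (by fun_prop) (by fun_prop) hw

lemma norm_ratio_le {s : ℂ} (hs : s.re = 1 / 2) (w : ℂ) :
    ‖(s + w - 1) / (s - 1)‖ ≤ 1 + 2 * ‖w‖ := by
  have h1 : (1 / 2 : ℝ) ≤ ‖s - 1‖ := by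
    refine le_trans ?_ (abs_re_le_norm (s - 1))
    rw [sub_re, hs, one_re]
    norm_num [abs_of_neg]
  have h0 : 0 < ‖s - 1‖ := by linarith
  rw [norm_div, div_le_iff₀ h0]
  calc ‖s + w - 1‖ = ‖(s - 1) + w‖ := by ring_nf
    _ ≤ ‖s - 1‖ + ‖w‖ := norm_add_le _ _
    _ ≤ _ := by nlinarith [norm_nonneg w]

lemma sq_mul_exp_le (v : ℝ) :
    (3 + 2 * |v|) ^ 2 * Real.exp (1 - v ^ 2) ≤ 100 * Real.exp 4 * Real.exp (-v ^ 2 / 2) := by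
  have h1 : 3 + 2 * |v| ≤ 3 * Real.exp |v| := by
    have := Real.add_one_le_exp |v|
    have := abs_nonneg v
    nlinarith
  have h2 : (3 + 2 * |v|) ^ 2 ≤ (3 * Real.exp |v|) ^ 2 :=
    pow_le_pow_left₀ (by positivity) h1 2
  calc (3 + 2 * |v|) ^ 2 * Real.exp (1 - v ^ 2)
      ≤ (3 * Real.exp |v|) ^ 2 * Real.exp (1 - v ^ 2) := by gcongr
    _ = 9 * Real.exp (2 * |v| + (1 - v ^ 2)) := by
        rw [mul_pow, ← Real.exp_nat_mul, mul_assoc, ← Real.exp_add]; norm_num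
    _ ≤ 9 * Real.exp (4 + -v ^ 2 / 2) := by
        have : 2 * |v| + (1 - v ^ 2) ≤ 4 + -v ^ 2 / 2 := by
          nlinarith [sq_abs v, sq_nonneg (|v| - 2)]
        linarith [Real.exp_le_exp.2 this]
    _ ≤ _ := by
        rw [Real.exp_add, mul_assoc]
        gcongr
        norm_num

lemma norm_afeKernel_le {U : ℝ} (hU : 0 < U) {s : ℂ} (hs : s.re = 1 / 2) {c : ℝ} (hc : c ≠ 0)
    (hc1 : |c| ≤ 1) (v : ℝ) :
    ‖afeKernel U s (c + v * I)‖ ≤ 100 * Real.exp 4 * U ^ c * smoothKernel |c| v := by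
  have hw : ‖(c + v * I : ℂ)‖ = √(|c| ^ 2 + v ^ 2) := by
    rw [norm_add_mul_I, sq_abs]
  have hw1 : ‖(c + v * I : ℂ)‖ ≤ 1 + |v| := by
    refine (norm_add_le _ _).trans ?_
    simp only [norm_mul, norm_I, mul_one, norm_real, Real.norm_eq_abs]
    linarith
  have hw0 : 0 < ‖(c + v * I : ℂ)‖ := norm_pos_iff.2 (vertical_ne_zero hc v)
  rw [afeKernel, norm_mul, norm_mul, norm_pow, norm_cauchyKernel,
    norm_cpow_eq_rpow_re_of_pos hU, smoothKernel, ← hw]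
  have e1 : (c + v * I : ℂ).re = c := by simp
  rw [e1]
  have h1 : ‖(s + (c + v * I) - 1) / (s - 1)‖ ^ 2 ≤ (3 + 2 * |v|) ^ 2 := by
    refine pow_le_pow_left₀ (norm_nonneg _) ((norm_ratio_le hs _).trans ?_) 2
    linarith
  have hcs : c ^ 2 ≤ 1 := by rw [← sq_abs]; exact pow_le_one₀ (abs_nonneg c) hc1
  have h2 := sq_mul_exp_le v
  calc ‖(s + (c + v * I) - 1) / (s - 1)‖ ^ 2 * U ^ c *
        (Real.exp (c ^ 2 - v ^ 2) / ‖(c + v * I : ℂ)‖)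
      ≤ (3 + 2 * |v|) ^ 2 * U ^ c * (Real.exp (1 - v ^ 2) / ‖(c + v * I : ℂ)‖) := by gcongr
    _ = U ^ c * ((3 + 2 * |v|) ^ 2 * Real.exp (1 - v ^ 2)) / ‖(c + v * I : ℂ)‖ := by ring
    _ ≤ U ^ c * (100 * Real.exp 4 * Real.exp (-v ^ 2 / 2)) / ‖(c + v * I : ℂ)‖ := by gcongr
    _ = _ := by ring

lemma norm_mul_afeKernel_le {U : ℝ} (hU : 1 ≤ U) {s : ℂ} (hs : s.re = 1 / 2) {G : ℂ → ℂ} {m M : ℝ}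
    (hm : 0 < m) {w : ℂ} (h1 : m ≤ |w.re|) (h2 : |w.re| ≤ 1)
    (hM : ‖G (s + w)‖ ≤ M * Real.exp (2 * |(s + w).im|)) :
    ‖G (s + w) * afeKernel U s w‖ ≤ M * Real.exp (2 * |s.im|) * (100 * Real.exp 4 * U * (1 / m)) *
      (Real.exp 1 * Real.exp ((4 + 1) ^ 2 / 4)) * Real.exp (-|w.im|) := by
  have hU0 : 0 < U := by linarith
  have hM0 : 0 ≤ M := nonneg_of_mul_nonneg_left ((norm_nonneg _).trans hM) (Real.exp_pos _)
  have hc : w.re ≠ 0 := abs_pos.1 (hm.trans_le h1)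
  have hk : ‖afeKernel U s w‖ ≤ 100 * Real.exp 4 * U ^ w.re * smoothKernel |w.re| w.im := by
    have := norm_afeKernel_le hU0 hs hc h2 w.im
    rwa [re_add_im] at this
  have hg : ‖G (s + w)‖ ≤ M * Real.exp (2 * |s.im|) * Real.exp (2 * |w.im|) := by
    refine hM.trans ?_
    rw [mul_assoc, ← Real.exp_add, add_im]
    gcongr
    linarith [abs_add_le s.im w.im]
  have hU1 : U ^ w.re ≤ U := by
    simpa using Real.rpow_le_rpow_of_exponent_le hU ((le_abs_self _).trans h2)
  have hs1 : smoothKernel |w.re| w.im ≤ 1 / m * Real.exp (-w.im ^ 2 / 2) := by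
    rw [smoothKernel, div_eq_mul_one_div, mul_comm]
    gcongr
    refine Real.le_sqrt_of_sq_le ?_
    nlinarith [sq_nonneg w.im]
  have he : Real.exp (2 * |w.im|) * Real.exp (-w.im ^ 2 / 2) ≤
      Real.exp 1 * Real.exp ((4 + 1) ^ 2 / 4) * Real.exp (-|w.im|) := by
    rw [← Real.exp_add, ← Real.exp_add, ← Real.exp_add]
    refine Real.exp_le_exp.2 ?_
    nlinarith [sq_nonneg (|w.im| - 3), sq_abs w.im]
  rw [norm_mul]
  calc ‖G (s + w)‖ * ‖afeKernel U s w‖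
      ≤ (M * Real.exp (2 * |s.im|) * Real.exp (2 * |w.im|)) *
        (100 * Real.exp 4 * U * (1 / m * Real.exp (-w.im ^ 2 / 2))) := by
        refine mul_le_mul hg (hk.trans ?_) (norm_nonneg _) (by positivity)
        have := smoothKernel_nonneg |w.re| w.im
        gcongr
    _ = M * Real.exp (2 * |s.im|) * (100 * Real.exp 4 * U * (1 / m)) *
        (Real.exp (2 * |w.im|) * Real.exp (-w.im ^ 2 / 2)) := by ring
    _ ≤ M * Real.exp (2 * |s.im|) * (100 * Real.exp 4 * U * (1 / m)) *
        (Real.exp 1 * Real.exp ((4 + 1) ^ 2 / 4) * Real.exp (-|w.im|)) := by gcongr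
    _ = _ := by ring

lemma integrable_mul_afeKernel {U : ℝ} (hU : 1 ≤ U) {s : ℂ} (hs : s.re = 1 / 2) {G : ℂ → ℂ} {c M : ℝ}
    (hc : c ≠ 0) (hc1 : |c| ≤ 1) (hG : ∀ z : ℂ, z.re = 1 / 2 + c → DifferentiableAt ℂ G z)
    (hM : ∀ z : ℂ, z.re = 1 / 2 + c → ‖G z‖ ≤ M * Real.exp (2 * |z.im|)) :
    Integrable fun v : ℝ => G (s + (c + v * I)) * afeKernel U s (c + v * I) := by
  have hre : ∀ v : ℝ, (s + (c + v * I)).re = 1 / 2 + c := fun v => by simp [hs]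
  refine (integrable_exp_neg_abs.const_mul (M * Real.exp (2 * |s.im|) *
    (100 * Real.exp 4 * U * (1 / |c|)) * (Real.exp 1 * Real.exp ((4 + 1) ^ 2 / 4)))).mono'
    (Continuous.aestronglyMeasurable ?_) (Eventually.of_forall fun v => ?_)
  · rw [continuous_iff_continuousAt]
    intro v
    refine ContinuousAt.mul ?_ ?_
    · exact ContinuousAt.comp' (hG _ (hre v)).continuousAt (by fun_prop)
    · exact ContinuousAt.comp' (f := fun v : ℝ => (c + v * I : ℂ))
        (differentiableAt_afeKernel (by linarith) s (vertical_ne_zero hc v)).continuousAt (by fun_prop)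
  · have := norm_mul_afeKernel_le hU hs (G := G) (w := c + v * I) (abs_pos.2 hc) (by simp)
      (by simpa using hc1) (hM _ (hre v))
    simpa using this

lemma afeKernel_shift {U : ℝ} (hU : 1 ≤ U) {s : ℂ} (hs : s.re = 1 / 2) {G : ℂ → ℂ} {a b M : ℝ}
    (hab : a ≤ b) (h0 : 0 < a ∨ b < 0) (ha : -1 ≤ a) (hb : b ≤ 1)
    (hG : ∀ z : ℂ, 1 / 2 + a ≤ z.re → z.re ≤ 1 / 2 + b → DifferentiableAt ℂ G z)
    (hM : ∀ z : ℂ, 1 / 2 + a ≤ z.re → z.re ≤ 1 / 2 + b → ‖G z‖ ≤ M * Real.exp (2 * |z.im|)) :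
    ∫ v : ℝ, G (s + (a + v * I)) * afeKernel U s (a + v * I) =
      ∫ v : ℝ, G (s + (b + v * I)) * afeKernel U s (b + v * I) := by
  have hU0 : 0 < U := by linarith
  have hre : ∀ w : ℂ, (s + w).re = 1 / 2 + w.re := fun w => by rw [add_re, hs]
  obtain ⟨m, hm0, hm⟩ : ∃ m : ℝ, 0 < m ∧ ∀ x : ℝ, a ≤ x → x ≤ b → m ≤ |x| := by
    rcases h0 with h | h
    · exact ⟨a, h, fun x h1 _ => h1.trans (le_abs_self x)⟩
    · exact ⟨-b, by linarith, fun x _ h2 => by linarith [neg_abs_le x]⟩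
  refine integral_vertical_line_eq (g := fun w => G (s + w) * afeKernel U s w)
    hab (fun w h1 h2 => ?_) fun w h1 h2 => norm_mul_afeKernel_le hU hs hm0 (hm _ h1 h2)
      (abs_le.2 ⟨by linarith, by linarith⟩) (hM _ (by rw [hre]; linarith) (by rw [hre]; linarith))
  refine DifferentiableAt.mul ?_ (differentiableAt_afeKernel hU0 s ?_)
  · refine DifferentiableAt.comp w (hG _ ?_ ?_) (by fun_prop)
    · rw [hre]; linarith
    · rw [hre]; linarith
  · rintro rfl
    have := hm _ h1 h2
    simp at this
    linarith

/-- The weighted mean square of a contour integral against `afeKernel`. -/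
theorem exists_afeKernel_moment : ∃ C : ℝ, 0 < C ∧ ∀ (U c T : ℝ) (G : ℂ → ℂ), 0 < U → c ≠ 0 →
    |c| ≤ 1 → 1 ≤ T → Continuous (fun y : ℝ => G (1 / 2 + c + y * I)) →
    ∃ H : ℝ → ENNReal, Measurable H ∧ (∀ t : ℝ, ‖∫ v : ℝ, G (1 / 2 + t * I + (c + v * I)) *
      afeKernel U (1 / 2 + t * I) (c + v * I)‖ₑ ≤ H t) ∧ ∫⁻ t : ℝ, H t ^ 2 * expWeight T t ≤
    ENNReal.ofReal (C / |c| * (U ^ c) ^ 2) * ∫⁻ y : ℝ, ‖G (1 / 2 + c + y * I)‖ₑ ^ 2 * expWeight T y := by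
  obtain ⟨C, hC, h⟩ := smoothing
  refine ⟨C * (100 * Real.exp 4) ^ 2, by positivity, fun U c T G hU hc hc1 hT hG => ?_⟩
  set K : ℝ := 100 * Real.exp 4 * U ^ c with hK
  have hK0 : 0 ≤ K := by positivity
  have hc0 : 0 < |c| := abs_pos.2 hc
  set F : ℝ → ENNReal := fun y => ENNReal.ofReal K * ‖G (1 / 2 + c + y * I)‖ₑ with hF
  have hFm : Measurable F := (hG.measurable.enorm).const_mul _
  have key : ∀ t : ℝ, ‖∫ v : ℝ, G (1 / 2 + t * I + (c + v * I)) *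
      afeKernel U (1 / 2 + t * I) (c + v * I)‖ₑ ≤
      ∫⁻ v, F (t + v) * ENNReal.ofReal (smoothKernel |c| v) := by
    intro t
    refine (enorm_integral_le_lintegral_enorm _).trans (lintegral_mono fun v => ?_)
    have h1 := norm_afeKernel_le hU (s := 1 / 2 + t * I) (by simp) hc hc1 v
    have e1 : (1 / 2 + t * I + (c + v * I) : ℂ) = 1 / 2 + c + ((t + v : ℝ) : ℂ) * I := by
      push_cast; ring
    calc ‖G (1 / 2 + t * I + (c + v * I)) * afeKernel U (1 / 2 + t * I) (c + v * I)‖ₑ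
        = ‖G (1 / 2 + t * I + (c + v * I))‖ₑ * ‖afeKernel U (1 / 2 + t * I) (c + v * I)‖ₑ :=
          enorm_mul _ _
      _ ≤ ‖G (1 / 2 + t * I + (c + v * I))‖ₑ * ENNReal.ofReal (K * smoothKernel |c| v) := by
          gcongr
          rw [← ofReal_norm]
          exact ENNReal.ofReal_le_ofReal h1
      _ = F (t + v) * ENNReal.ofReal (smoothKernel |c| v) := by
          simp only [hF]
          rw [ENNReal.ofReal_mul hK0, e1]
          ring
  have hsm := measurable_smoothKernel |c|
  refine ⟨fun t => ∫⁻ v, F (t + v) * ENNReal.ofReal (smoothKernel |c| v),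
    Measurable.lintegral_prod_right' (f := fun p : ℝ × ℝ =>
      F (p.1 + p.2) * ENNReal.ofReal (smoothKernel |c| p.2)) (by fun_prop), key, ?_⟩
  calc _ ≤ _ := h F hFm |c| T hc0 hT
    _ = ENNReal.ofReal (C / |c|) * (ENNReal.ofReal K ^ 2 *
          ∫⁻ y : ℝ, ‖G (1 / 2 + c + y * I)‖ₑ ^ 2 * expWeight T y) := by
        have := measurable_expWeight T
        have h2 : Measurable fun y : ℝ => ‖G (1 / 2 + c + y * I)‖ₑ ^ 2 * expWeight T y :=
          (hG.measurable.enorm.pow_const 2).mul this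
        congr 1
        rw [← lintegral_const_mul _ h2]
        simp only [hF, mul_pow, mul_assoc]
    _ = _ := by
        rw [← mul_assoc, ← ENNReal.ofReal_pow hK0, ← ENNReal.ofReal_mul (by positivity)]
        congr 2
        rw [hK]; ring

end ZeroDensity

namespace ZeroDensity
open Complex MeasureTheory Set Filter Topology DirichletCharacter

/-- The divisor function cut off above `U`. -/
noncomputable def lowTau (U : ℝ) (n : ℕ) : ℝ := if (n : ℝ) ≤ U then tau n else 0

/-- The divisor function cut off below `U`. -/
noncomputable def highTau (U : ℝ) (n : ℕ) : ℝ := if (n : ℝ) ≤ U then 0 else tau n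

lemma lowTau_nonneg (U : ℝ) (n : ℕ) : 0 ≤ lowTau U n := by
  unfold lowTau; split_ifs <;> simp [tau_nonneg]

lemma highTau_nonneg (U : ℝ) (n : ℕ) : 0 ≤ highTau U n := by
  unfold highTau; split_ifs <;> simp [tau_nonneg]

lemma lowTau_add_highTau (U : ℝ) (n : ℕ) : lowTau U n + highTau U n = tau n := by
  unfold lowTau highTau; split_ifs <;> simp

lemma lowTau_eq_zero {U : ℝ} {n : ℕ} (hn : n ∉ Finset.range (⌊U⌋₊ + 1)) : lowTau U n = 0 := by
  rw [lowTau, if_neg]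
  intro h
  exact hn (Finset.mem_range.2 (Nat.lt_succ_of_le (Nat.le_floor h)))

lemma LSeriesSummable_of_finite {f : ℕ → ℂ} {S : Finset ℕ} (hf : ∀ n ∉ S, f n = 0) (s : ℂ) :
    LSeriesSummable f s := by
  refine summable_of_ne_finset_zero (s := S) fun n hn => ?_
  rw [LSeries.term_def, hf n hn]
  simp

lemma LSeries_eq_sum {f : ℕ → ℂ} {S : Finset ℕ} (hf : ∀ n ∉ S, f n = 0) (s : ℂ) :
    LSeries f s = ∑ n ∈ S, LSeries.term f s n := by
  refine tsum_eq_sum fun n hn => ?_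
  rw [LSeries.term_def, hf n hn]
  simp

lemma differentiable_LSeries_of_finite {f : ℕ → ℂ} {S : Finset ℕ} (hf : ∀ n ∉ S, f n = 0) :
    Differentiable ℂ (LSeries f) := by
  rw [show LSeries f = fun s => ∑ n ∈ S, LSeries.term f s n from funext (LSeries_eq_sum hf)]
  refine Differentiable.fun_sum fun n _ => ?_
  rcases eq_or_ne n 0 with rfl | hn
  · simp
  · have hn' : (n : ℂ) ≠ 0 := Nat.cast_ne_zero.2 hn
    simp only [LSeries.term_of_ne_zero hn]
    intro s
    refine DifferentiableAt.div (by fun_prop)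
      (DifferentiableAt.const_cpow differentiableAt_id (Or.inl hn')) ?_
    simp [cpow_eq_zero_iff, hn']

lemma norm_LSeries_of_finite_le {f : ℕ → ℂ} {S : Finset ℕ} (hf : ∀ n ∉ S, f n = 0) {s : ℂ}
    (hs : 0 ≤ s.re) : ‖LSeries f s‖ ≤ ∑ n ∈ S, ‖f n‖ := by
  rw [LSeries_eq_sum hf]
  refine (norm_sum_le _ _).trans (Finset.sum_le_sum fun n _ => ?_)
  rcases Nat.eq_zero_or_pos n with rfl | hn
  · simp
  · rw [LSeries.term_of_ne_zero hn.ne', norm_div, norm_natCast_cpow hn]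
    exact div_le_self (norm_nonneg _) (Real.one_le_rpow (by exact_mod_cast hn) hs)

/-- The part `n ≤ U` of the Dirichlet series of `L(s, χ)²`. -/
noncomputable def lowL {d : ℕ} (χ : DirichletCharacter ℂ d) (U : ℝ) : ℂ → ℂ :=
  LSeries fun n => (lowTau U n : ℂ) * χ n

/-- The part `n > U` of the Dirichlet series of `L(s, χ)²`. -/
noncomputable def highL {d : ℕ} (χ : DirichletCharacter ℂ d) (U : ℝ) : ℂ → ℂ :=
  LSeries fun n => (highTau U n : ℂ) * χ n

lemma lowCoeff_eq_zero {d : ℕ} (χ : DirichletCharacter ℂ d) (U : ℝ) :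
    ∀ n ∉ Finset.range (⌊U⌋₊ + 1), (lowTau U n : ℂ) * χ n = 0 := fun n hn => by
  rw [lowTau_eq_zero hn]; simp

lemma differentiable_lowL {d : ℕ} (χ : DirichletCharacter ℂ d) (U : ℝ) :
    Differentiable ℂ (lowL χ U) :=
  differentiable_LSeries_of_finite (lowCoeff_eq_zero χ U)

lemma norm_lowL_le {d : ℕ} (χ : DirichletCharacter ℂ d) (U : ℝ) :
    ∃ M : ℝ, 0 ≤ M ∧ ∀ s : ℂ, 0 ≤ s.re → ‖lowL χ U s‖ ≤ M :=
  ⟨_, by positivity, fun _ hs => norm_LSeries_of_finite_le (lowCoeff_eq_zero χ U) hs⟩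

lemma lowL_add_highL {d : ℕ} [NeZero d] (χ : DirichletCharacter ℂ d) (U : ℝ) {s : ℂ} (hs : 1 < s.re) :
    LFunction χ s ^ 2 = lowL χ U s + highL χ U s := by
  have h0 := lSeriesSummable_tau χ hs
  have h1 := LSeriesSummable_of_finite (lowCoeff_eq_zero χ U) s
  have e : ∀ n : ℕ, (highTau U n : ℂ) * χ n = (tau n : ℂ) * χ n - (lowTau U n : ℂ) * χ n := by
    intro n
    rw [← lowTau_add_highTau U n]; push_cast; ring
  rw [LFunction_sq_eq χ hs, lowL, highL, funext e]
  change _ = _ + LSeries ((fun n => (tau n : ℂ) * χ n) - fun n => (lowTau U n : ℂ) * χ n) s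
  rw [LSeries_sub h0 h1]
  ring

lemma differentiableAt_highL {d : ℕ} [NeZero d] (χ : DirichletCharacter ℂ d) (U : ℝ) {s : ℂ}
    (hs : 1 < s.re) : DifferentiableAt ℂ (highL χ U) s := by
  have h1 : DifferentiableAt ℂ (fun s => LFunction χ s ^ 2 - lowL χ U s) s := by
    refine DifferentiableAt.sub (DifferentiableAt.pow ?_ 2) (differentiable_lowL χ U s)
    exact differentiableAt_LFunction χ s (Or.inl (by rintro rfl; simp at hs))
  refine h1.congr_of_eventuallyEq ?_
  filter_upwards [(isOpen_lt continuous_const continuous_re).mem_nhds hs] with z hz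
  rw [lowL_add_highL χ U hz]
  ring

/-- The weighted second moment of a function on a vertical line. -/
noncomputable def lineMoment (D : ℂ → ℂ) (σ T : ℝ) : ENNReal :=
  ∫⁻ y : ℝ, ‖D (σ + y * I)‖ₑ ^ 2 * expWeight T y

lemma rpow_split {x : ℝ} (hx : 0 < x) (a b : ℝ) : x ^ (-(a + b)) = x ^ (-a) * x ^ (-b) := by
  rw [neg_add, Real.rpow_add hx]

lemma exists_lowL_moment : ∃ C : ℝ, 0 < C ∧ ∀ (d : ℕ) [NeZero d] (T δ : ℝ), 1 ≤ T → 0 < δ → δ ≤ 1 →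
    ∑ χ : DirichletCharacter ℂ d, lineMoment (lowL χ (d * T)) (1 / 2 + δ) (2 * T) ≤
      ENNReal.ofReal (C * (d * T) * (1 / δ) ^ 4) := by
  obtain ⟨C, hC, h⟩ := mean_value
  refine ⟨C * 48, by positivity, fun d _ T δ hT hδ hδ1 => ?_⟩
  have hd := one_le_natCast_level d
  set U : ℝ := d * T with hU
  have hU0 : 0 < U := by positivity
  refine (h d (2 * T) (by linarith) (fun n => (lowTau U n : ℂ)) (1 / 2 + δ)
    (LSeriesSummable_of_finite (S := Finset.range (⌊U⌋₊ + 1))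
      (fun n hn => by rw [lowTau_eq_zero hn]; simp) _)).trans ?_
  have h1 : ∀ n : ℕ, (d * (2 * T) + n) * (‖(lowTau U n : ℂ)‖ ^ 2 *
      (n : ℝ) ^ (-(2 * (1 / 2 + δ)))) ≤ 3 * U * (tau n ^ 2 * (n : ℝ) ^ (-(1 + δ))) := by
    intro n
    rw [norm_real, Real.norm_eq_abs, sq_abs, lowTau]
    split_ifs with hn
    · rcases Nat.eq_zero_or_pos n with rfl | hn0
      · simp [tau]
      · have hn1 : (1 : ℝ) ≤ n := by exact_mod_cast hn0
        gcongr
        · rw [hU] at hn ⊢; linarith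
        · linarith
    · have := tau_nonneg n
      simp only [ne_eq, OfNat.ofNat_ne_zero, not_false_eq_true, zero_pow, zero_mul, mul_zero]
      positivity
  refine (mul_le_mul_right (tsum_ofReal_le_tau_sq hδ (by positivity) h1) _).trans ?_
  rw [← ENNReal.ofReal_mul hC.le]
  refine ENNReal.ofReal_le_ofReal ?_
  have h2 : (1 + 1 / δ) ^ 4 ≤ (2 * (1 / δ)) ^ 4 := by
    have : 1 ≤ 1 / δ := by rw [le_div_iff₀ hδ]; linarith
    gcongr
    linarith
  calc C * (3 * U * (1 + 1 / δ) ^ 4) ≤ C * (3 * U * (2 * (1 / δ)) ^ 4) := by gcongr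
    _ = _ := by ring

lemma exists_highL_moment : ∃ C : ℝ, 0 < C ∧ ∀ (d : ℕ) [NeZero d] (T δ : ℝ), 1 ≤ T → 0 < δ → δ ≤ 1 →
    (d * T) ^ δ ≤ 3 →
    ∑ χ : DirichletCharacter ℂ d, ENNReal.ofReal ((d * T) ^ 2) *
      lineMoment (highL χ (d * T)) (3 / 2) (2 * T) ≤ ENNReal.ofReal (C * (d * T) * (1 / δ) ^ 4) := by
  obtain ⟨C, hC, h⟩ := mean_value
  refine ⟨C * 144, by positivity, fun d _ T δ hT hδ hδ1 hUδ => ?_⟩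
  have hd := one_le_natCast_level d
  set U : ℝ := d * T with hU
  have hU0 : 0 < U := by positivity
  have hsum : LSeriesSummable (fun n => (highTau U n : ℂ)) ((3 / 2 : ℝ) : ℂ) := by
    rw [lSeriesSummable_ofReal_iff (by norm_num)]
    refine Summable.of_nonneg_of_le
      (fun n => mul_nonneg (highTau_nonneg U n) (by positivity)) (fun n => ?_)
      (tau_series (a := 1 / 2) (by norm_num)).1
    rw [show (-(3 / 2) : ℝ) = -(1 + 1 / 2) by norm_num]
    gcongr
    have := lowTau_nonneg U n
    linarith [lowTau_add_highTau U n]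
  rw [← Finset.mul_sum]
  refine (mul_le_mul_right (h d (2 * T) (by linarith) _ (3 / 2) hsum) _).trans ?_
  have h1 : ∀ n : ℕ, (d * (2 * T) + n) * (‖(highTau U n : ℂ)‖ ^ 2 *
      (n : ℝ) ^ (-(2 * (3 / 2 : ℝ)))) ≤ 9 * U⁻¹ * (tau n ^ 2 * (n : ℝ) ^ (-(1 + δ))) := by
    intro n
    rw [norm_real, Real.norm_eq_abs, sq_abs, highTau]
    split_ifs with hn
    · have := tau_nonneg n
      simp only [ne_eq, OfNat.ofNat_ne_zero, not_false_eq_true, zero_pow, zero_mul, mul_zero]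
      positivity
    · push Not at hn
      have hn0 : (0 : ℝ) < n := hU0.trans hn
      have e1 : (n : ℝ) ^ (-(2 * (3 / 2 : ℝ))) = (n : ℝ)⁻¹ * ((n : ℝ) ^ (-(1 - δ)) * (n : ℝ) ^ (-(1 + δ))) := by
        rw [← rpow_split hn0, ← Real.rpow_neg_one, ← Real.rpow_add hn0]
        norm_num
      have e2 : (n : ℝ) ^ (-(1 - δ)) ≤ 3 * U⁻¹ := by
        calc (n : ℝ) ^ (-(1 - δ)) ≤ U ^ (-(1 - δ)) :=
              Real.rpow_le_rpow_of_nonpos hU0 hn.le (by linarith)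
          _ = U ^ δ * U⁻¹ := by
              rw [← Real.rpow_neg_one, ← Real.rpow_add hU0]; ring_nf
          _ ≤ _ := by gcongr
      rw [e1]
      have := tau_nonneg n
      calc (d * (2 * T) + n) * (tau n ^ 2 * ((n : ℝ)⁻¹ * ((n : ℝ) ^ (-(1 - δ)) * (n : ℝ) ^ (-(1 + δ)))))
          ≤ (3 * n) * (tau n ^ 2 * ((n : ℝ)⁻¹ * ((3 * U⁻¹) * (n : ℝ) ^ (-(1 + δ))))) := by
            gcongr
            rw [hU] at hn; linarith
        _ = _ := by field_simp; ring
  refine (mul_le_mul_right (mul_le_mul_right (tsum_ofReal_le_tau_sq hδ (by positivity) h1) _) _).trans ?_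
  rw [← ENNReal.ofReal_mul hC.le, ← ENNReal.ofReal_mul (by positivity)]
  refine ENNReal.ofReal_le_ofReal ?_
  have h2 : (1 + 1 / δ) ^ 4 ≤ (2 * (1 / δ)) ^ 4 := by
    have : 1 ≤ 1 / δ := by rw [le_div_iff₀ hδ]; linarith
    gcongr
    linarith
  calc U ^ 2 * (C * (9 * U⁻¹ * (1 + 1 / δ) ^ 4)) ≤ U ^ 2 * (C * (9 * U⁻¹ * (2 * (1 / δ)) ^ 4)) := by
        gcongr
    _ = _ := by field_simp; ring

end ZeroDensity

namespace ZeroDensity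
open Complex MeasureTheory Set Filter Topology DirichletCharacter

lemma one_add_pow_four_mul_expWeight {T : ℝ} (hT : 0 < T) (y : ℝ) :
    ENNReal.ofReal ((1 + |y| / T) ^ 4) * expWeight T y ≤
      ENNReal.ofReal (8 ^ 4) * expWeight (2 * T) y := by
  unfold expWeight
  set x : ℝ := |y| / T with hx
  have hx0 : 0 ≤ x := by positivity
  rw [← ENNReal.ofReal_mul (by positivity), ← ENNReal.ofReal_mul (by positivity)]
  refine ENNReal.ofReal_le_ofReal ?_
  have h1 : 1 + x ≤ 8 * Real.exp (x / 8) := by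
    have := Real.add_one_le_exp (x / 8)
    linarith
  have h2 : |y| / (2 * T) = x / 2 := by rw [hx]; field_simp
  calc (1 + x) ^ 4 * Real.exp (-x) ≤ (8 * Real.exp (x / 8)) ^ 4 * Real.exp (-x) := by gcongr
    _ = _ := by
        rw [mul_pow, ← Real.exp_nat_mul, mul_assoc, ← Real.exp_add, h2]
        ring_nf

lemma lineMoment_mono_weight (D : ℂ → ℂ) (σ : ℝ) {T T' : ℝ} (hT : 0 < T) (h : T ≤ T') :
    lineMoment D σ T ≤ lineMoment D σ T' := by
  refine lintegral_mono fun y => ?_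
  unfold expWeight
  gcongr

/-- Twisting by the functional equation factor changes the moment by a power of the conductor. -/
lemma factor_moment {d : ℕ} {T C c : ℝ} (hd : (1 : ℝ) ≤ d) (hT : 2 ≤ T) (hC : 0 ≤ C)
    (hc : c ≤ 0) (hc1 : -1 ≤ c) {κ D : ℂ → ℂ}
    (hκ : ∀ z : ℂ, -(1 / 2) ≤ z.re → z.re ≤ 1 / 2 → ‖κ z‖ ≤ C * (d * (|z.im| + 2)) ^ (1 / 2 - z.re)) :
    ENNReal.ofReal (((d * T) ^ c) ^ 2) *
      lineMoment (fun z => κ z ^ 2 * D (1 - z)) (1 / 2 + c) T ≤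
    ENNReal.ofReal (C ^ 4 * 8 ^ 4 * ((d * T) ^ (-c)) ^ 2) * lineMoment D (1 / 2 - c) (2 * T) := by
  have hT0 : 0 < T := by linarith
  set U : ℝ := d * T with hU
  have hU0 : 0 < U := by positivity
  have hm : ∀ (f : ℝ → ENNReal), ∫⁻ y, f (-y) = ∫⁻ y, f y := fun f => lintegral_neg_eq_self f
  have e1 : lineMoment D (1 / 2 - c) (2 * T) =
      ∫⁻ y : ℝ, ‖D (1 - (((1 / 2 + c : ℝ) : ℂ) + y * I))‖ₑ ^ 2 * expWeight (2 * T) y := by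
    rw [lineMoment, ← hm]
    refine lintegral_congr fun y => ?_
    rw [expWeight, expWeight, abs_neg]
    congr 5
    push_cast; ring
  rw [e1, lineMoment, ← lintegral_const_mul' _ _ ENNReal.ofReal_ne_top,
    ← lintegral_const_mul' _ _ ENNReal.ofReal_ne_top]
  refine lintegral_mono fun y => ?_
  set z : ℂ := ((1 / 2 + c : ℝ) : ℂ) + y * I with hz
  have hre : z.re = 1 / 2 + c := by simp [hz]
  have him : z.im = y := by simp [hz]
  have hk := hκ z (by linarith) (by linarith)
  rw [hre, him] at hk
  have hk2 : (U ^ c) ^ 2 * (‖κ z‖ ^ 2) ^ 2 ≤ C ^ 4 * (U ^ (-c)) ^ 2 * (1 + |y| / T) ^ 4 := by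
    have h1 : d * (|y| + 2) ≤ U * (1 + |y| / T) := by
      have : U * (1 + |y| / T) = d * (T + |y|) := by rw [hU]; field_simp
      rw [this]
      exact mul_le_mul_of_nonneg_left (by linarith) (by linarith)
    have h2 : ‖κ z‖ ≤ C * (U ^ (-c) * (1 + |y| / T)) := by
      refine hk.trans ?_
      rw [show (1 / 2 - (1 / 2 + c) : ℝ) = -c by ring]
      gcongr
      calc (d * (|y| + 2)) ^ (-c) ≤ (U * (1 + |y| / T)) ^ (-c) :=
            Real.rpow_le_rpow (by positivity) h1 (by linarith)
        _ = U ^ (-c) * (1 + |y| / T) ^ (-c) := Real.mul_rpow hU0.le (by positivity)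
        _ ≤ _ := by
            gcongr
            calc (1 + |y| / T) ^ (-c) ≤ (1 + |y| / T) ^ (1 : ℝ) := by
                  refine Real.rpow_le_rpow_of_exponent_le ?_ (by linarith)
                  have : 0 ≤ |y| / T := by positivity
                  linarith
              _ = _ := Real.rpow_one _
    have h3 : U ^ c * U ^ (-c) = 1 := by rw [← Real.rpow_add hU0]; simp
    calc (U ^ c) ^ 2 * (‖κ z‖ ^ 2) ^ 2
        ≤ (U ^ c) ^ 2 * ((C * (U ^ (-c) * (1 + |y| / T))) ^ 2) ^ 2 := by gcongr
      _ = (U ^ c * U ^ (-c)) ^ 2 * (C ^ 4 * (U ^ (-c)) ^ 2 * (1 + |y| / T) ^ 4) := by ring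
      _ = _ := by rw [h3]; ring
  calc ENNReal.ofReal ((U ^ c) ^ 2) * (‖κ z ^ 2 * D (1 - z)‖ₑ ^ 2 * expWeight T y)
      = ENNReal.ofReal ((U ^ c) ^ 2 * (‖κ z‖ ^ 2) ^ 2) * (‖D (1 - z)‖ₑ ^ 2 * expWeight T y) := by
        rw [ENNReal.ofReal_mul (by positivity), ENNReal.ofReal_pow (by positivity) (n := 2)
          (p := ‖κ z‖ ^ 2), ENNReal.ofReal_pow (norm_nonneg _), ofReal_norm, enorm_mul, enorm_pow]
        ring
    _ ≤ ENNReal.ofReal (C ^ 4 * (U ^ (-c)) ^ 2 * (1 + |y| / T) ^ 4) *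
          (‖D (1 - z)‖ₑ ^ 2 * expWeight T y) := by gcongr
    _ = ENNReal.ofReal (C ^ 4 * (U ^ (-c)) ^ 2) * ‖D (1 - z)‖ₑ ^ 2 *
          (ENNReal.ofReal ((1 + |y| / T) ^ 4) * expWeight T y) := by
        rw [ENNReal.ofReal_mul (by positivity) (q := (1 + |y| / T) ^ 4)]
        ring
    _ ≤ ENNReal.ofReal (C ^ 4 * (U ^ (-c)) ^ 2) * ‖D (1 - z)‖ₑ ^ 2 *
          (ENNReal.ofReal (8 ^ 4) * expWeight (2 * T) y) := by
        exact mul_le_mul_right (one_add_pow_four_mul_expWeight hT0 y) _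
    _ = _ := by
        rw [show C ^ 4 * 8 ^ 4 * (U ^ (-c)) ^ 2 = C ^ 4 * (U ^ (-c)) ^ 2 * 8 ^ 4 by ring,
          ENNReal.ofReal_mul (by positivity) (q := 8 ^ 4)]
        ring

/-- The smoothed approximate functional equation for `L(s, χ)²` on the critical line. -/
lemma LFunction_sq_eq_integrals {d : ℕ} [NeZero d] (χ : DirichletCharacter ℂ d) {U δ : ℝ} (hU : 1 ≤ U)
    (hδ : 0 < δ) (hδ1 : δ ≤ 1 / 4) {κ : ℂ → ℂ} {C : ℝ} (hC : 0 ≤ C)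
    (hκd : ∀ z : ℂ, z.re < 1 → DifferentiableAt ℂ κ z)
    (hκ : ∀ z : ℂ, z.re < 1 → z ≠ 0 → LFunction χ z = κ z * LFunction χ⁻¹ (1 - z))
    (hκb : ∀ z : ℂ, -(1 / 2) ≤ z.re → z.re ≤ 1 / 2 → ‖κ z‖ ≤ C * (d * (|z.im| + 2)) ^ (1 / 2 - z.re))
    (t : ℝ) :
    ‖LFunction χ (1 / 2 + t * I)‖ₑ ^ 2 ≤
      ‖∫ v : ℝ, lowL χ U (1 / 2 + t * I + ((δ : ℝ) + v * I)) *
        afeKernel U (1 / 2 + t * I) ((δ : ℝ) + v * I)‖ₑ +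
      ‖∫ v : ℝ, highL χ U (1 / 2 + t * I + ((1 : ℝ) + v * I)) *
        afeKernel U (1 / 2 + t * I) ((1 : ℝ) + v * I)‖ₑ +
      (‖∫ v : ℝ, (fun z => κ z ^ 2 * lowL χ⁻¹ U (1 - z)) (1 / 2 + t * I + ((-δ : ℝ) + v * I)) *
        afeKernel U (1 / 2 + t * I) ((-δ : ℝ) + v * I)‖ₑ +
      ‖∫ v : ℝ, (fun z => κ z ^ 2 * highL χ⁻¹ U (1 - z)) (1 / 2 + t * I + ((-1 : ℝ) + v * I)) *
        afeKernel U (1 / 2 + t * I) ((-1 : ℝ) + v * I)‖ₑ) := by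
  have hU0 : 0 < U := by linarith
  have hU' : (U : ℂ) ≠ 0 := ofReal_ne_zero.2 hU0.ne'
  have hd := one_le_natCast_level d
  set s : ℂ := 1 / 2 + t * I with hs
  have hsre : s.re = 1 / 2 := by simp [hs]
  have hs1 : s ≠ 1 := by intro h; rw [h] at hsre; norm_num at hsre
  have hre : ∀ w : ℂ, (s + w).re = 1 / 2 + w.re := fun w => by rw [add_re, hsre]
  have him : ∀ w : ℂ, |(s + w).im| ≤ |t| + |w.im| := fun w => by
    have : s.im = t := by simp [hs]
    rw [add_im, this]
    exact abs_add_le _ _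
  set f : ℂ → ℂ := fun z => entireL χ z ^ 2 * (U : ℂ) ^ (z - s) / (s - 1) ^ 2 with hf
  have hfs : f s = LFunction χ s ^ 2 := by
    simp only [hf, sub_self, cpow_zero, entireL_of_ne χ hs1]
    have := sub_ne_zero.2 hs1
    field_simp
  have hfk : ∀ w : ℂ, s + w ≠ 1 → f (s + w) * cauchyKernel w = LFunction χ (s + w) ^ 2 * afeKernel U s w := by
    intro w hw
    simp only [hf, entireL_of_ne χ hw, afeKernel, add_sub_cancel_left, div_pow]
    ring
  have hcauchy : 2 * Real.pi * f s = (∫ v : ℝ, f (s + ((1 : ℝ) + v * I)) * cauchyKernel ((1 : ℝ) + v * I)) -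
      ∫ v : ℝ, f (s + ((-1 : ℝ) + v * I)) * cauchyKernel ((-1 : ℝ) + v * I) := by
    obtain ⟨C₀, hC₀, hgr⟩ := norm_entireL_growth χ
    refine strip_cauchy (A := 6) (C := (C₀ * Real.exp (3 * |t|)) ^ 2 * U * ‖((s - 1) ^ 2)⁻¹‖)
      (by norm_num) one_pos (fun z h1 h2 => ?_) fun z h1 h2 => ?_
    · refine DifferentiableAt.div_const (DifferentiableAt.mul ?_ ?_) _
      · exact ((differentiable_entireL χ) _).pow 2
      · exact DifferentiableAt.const_cpow (by fun_prop) (Or.inl hU')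
    · have h3 := hgr (s + z) (by rw [hre]; linarith) (by rw [hre]; linarith)
      have h4 : ‖entireL χ (s + z)‖ ≤ C₀ * Real.exp (3 * |t|) * Real.exp (3 * |z.im|) := by
        refine h3.trans ?_
        rw [mul_assoc, ← Real.exp_add]
        gcongr
        linarith [him z]
      have h5 : ‖(U : ℂ) ^ (s + z - s)‖ ≤ U := by
        rw [add_sub_cancel_left, norm_cpow_eq_rpow_re_of_pos hU0]
        simpa using Real.rpow_le_rpow_of_exponent_le hU h2
      simp only [hf]
      rw [div_eq_mul_inv, norm_mul, norm_mul, norm_pow]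
      calc ‖entireL χ (s + z)‖ ^ 2 * ‖(U : ℂ) ^ (s + z - s)‖ * ‖((s - 1) ^ 2)⁻¹‖
          ≤ (C₀ * Real.exp (3 * |t|) * Real.exp (3 * |z.im|)) ^ 2 * U * ‖((s - 1) ^ 2)⁻¹‖ := by gcongr
        _ = (C₀ * Real.exp (3 * |t|)) ^ 2 * U * ‖((s - 1) ^ 2)⁻¹‖ * Real.exp (3 * |z.im|) ^ 2 := by
            ring
        _ = _ := by
            rw [← Real.exp_nat_mul]
            congr 2
            push_cast; ring
  -- growth of the pieces
  have hlow : ∀ ψ : DirichletCharacter ℂ d, ∃ M : ℝ, 0 ≤ M ∧ ∀ z : ℂ, 0 ≤ z.re → ‖lowL ψ U z‖ ≤ M :=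
    fun ψ => norm_lowL_le ψ U
  have hhigh : ∀ ψ : DirichletCharacter ℂ d, ∃ M : ℝ, 0 ≤ M ∧
      ∀ z : ℂ, 3 / 2 ≤ z.re → ‖highL ψ U z‖ ≤ M := by
    intro ψ
    obtain ⟨M, hM0, hM⟩ := hlow ψ
    refine ⟨(1 + 1 / (1 / 2)) ^ 2 + M, by positivity, fun z hz => ?_⟩
    have h1 := lowL_add_highL ψ U (s := z) (by linarith)
    rw [show highL ψ U z = LFunction ψ z ^ 2 - lowL ψ U z by rw [h1]; ring]
    refine (norm_sub_le _ _).trans (add_le_add ?_ (hM z (by linarith)))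
    rw [norm_pow]
    exact pow_le_pow_left₀ (norm_nonneg _) (norm_LFunction_le ψ (by norm_num) (by linarith)) 2
  have hκ2 : ∀ z : ℂ, -(1 / 2) ≤ z.re → z.re ≤ 1 / 2 →
      ‖κ z ^ 2‖ ≤ (C * (2 * d)) ^ 2 * Real.exp (2 * |z.im|) := by
    intro z h1 h2
    have hb : (1 : ℝ) ≤ d * (|z.im| + 2) := by nlinarith [abs_nonneg z.im]
    have h3 : ‖κ z‖ ≤ C * (2 * d) * Real.exp |z.im| := by
      refine (hκb z h1 h2).trans ?_
      rw [mul_assoc]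
      gcongr
      calc (d * (|z.im| + 2)) ^ (1 / 2 - z.re) ≤ (d * (|z.im| + 2)) ^ (1 : ℝ) :=
            Real.rpow_le_rpow_of_exponent_le hb (by linarith)
        _ = d * (|z.im| + 2) := Real.rpow_one _
        _ ≤ d * (2 * Real.exp |z.im|) := by
            gcongr
            linarith [Real.add_one_le_exp |z.im|, abs_nonneg z.im]
        _ = _ := by ring
    rw [norm_pow]
    refine (pow_le_pow_left₀ (norm_nonneg _) h3 2).trans (le_of_eq ?_)
    rw [mul_pow, ← Real.exp_nat_mul]
    norm_num
  have one_le_exp : ∀ x : ℝ, 1 ≤ Real.exp (2 * |x|) := fun x => Real.one_le_exp (by positivity)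
  obtain ⟨M₁, hM₁, hl⟩ := hlow χ
  obtain ⟨M₂, hM₂, hh⟩ := hhigh χ
  obtain ⟨M₃, hM₃, hl'⟩ := hlow χ⁻¹
  obtain ⟨M₄, hM₄, hh'⟩ := hhigh χ⁻¹
  have hsub : ∀ z : ℂ, (1 - z).re = 1 - z.re := fun z => by simp
  -- the right hand line
  have hR : ∫ v : ℝ, f (s + ((1 : ℝ) + v * I)) * cauchyKernel ((1 : ℝ) + v * I) =
      (∫ v : ℝ, lowL χ U (s + ((δ : ℝ) + v * I)) * afeKernel U s ((δ : ℝ) + v * I)) +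
      ∫ v : ℝ, highL χ U (s + ((1 : ℝ) + v * I)) * afeKernel U s ((1 : ℝ) + v * I) := by
    have hb : ∀ z : ℂ, 0 ≤ z.re → ‖lowL χ U z‖ ≤ M₁ * Real.exp (2 * |z.im|) := fun z hz =>
      (hl z hz).trans (le_mul_of_one_le_right hM₁ (one_le_exp _))
    rw [afeKernel_shift hU hsre (G := lowL χ U) (M := M₁) (a := δ) (b := 1) (by linarith) (Or.inl hδ)
      (by linarith) le_rfl (fun z _ _ => differentiable_lowL χ U z) (fun z h1 _ => hb z (by linarith)),
      ← integral_add]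
    · refine integral_congr_ae (Eventually.of_forall fun v => ?_)
      have h1 : (s + ((1 : ℝ) + v * I)).re = 3 / 2 := by rw [hre]; simp; norm_num
      simp only
      rw [hfk _ (by intro h; rw [h] at h1; norm_num at h1), lowL_add_highL χ U (by rw [h1]; norm_num)]
      ring
    · exact integrable_mul_afeKernel (G := lowL χ U) (M := M₁) hU hsre one_ne_zero (by simp)
        (fun z _ => differentiable_lowL χ U z) fun z hz => hb z (by linarith)
    · exact integrable_mul_afeKernel (M := M₂) hU hsre one_ne_zero (by simp)
        (fun z hz => differentiableAt_highL χ U (by linarith)) fun z hz =>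
          (hh z (by linarith)).trans (le_mul_of_one_le_right hM₂ (one_le_exp _))
  -- the left hand line
  have hL : ∫ v : ℝ, f (s + ((-1 : ℝ) + v * I)) * cauchyKernel ((-1 : ℝ) + v * I) =
      (∫ v : ℝ, (fun z => κ z ^ 2 * lowL χ⁻¹ U (1 - z)) (s + ((-δ : ℝ) + v * I)) *
        afeKernel U s ((-δ : ℝ) + v * I)) +
      ∫ v : ℝ, (fun z => κ z ^ 2 * highL χ⁻¹ U (1 - z)) (s + ((-1 : ℝ) + v * I)) *
        afeKernel U s ((-1 : ℝ) + v * I) := by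
    have hd1 : ∀ z : ℂ, z.re < 1 → DifferentiableAt ℂ (fun z => κ z ^ 2 * lowL χ⁻¹ U (1 - z)) z := by
      intro z hz
      refine DifferentiableAt.mul ((hκd z hz).pow 2) ?_
      exact DifferentiableAt.comp z (differentiable_lowL χ⁻¹ U _) (by fun_prop)
    have hb : ∀ z : ℂ, -(1 / 2) ≤ z.re → z.re ≤ 1 / 2 → ‖κ z ^ 2 * lowL χ⁻¹ U (1 - z)‖ ≤
        (C * (2 * d)) ^ 2 * M₃ * Real.exp (2 * |z.im|) := by
      intro z h1 h2
      rw [norm_mul, mul_right_comm]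
      exact mul_le_mul (hκ2 z h1 h2) (hl' _ (by rw [hsub]; linarith)) (norm_nonneg _) (by positivity)
    rw [← afeKernel_shift hU hsre (G := fun z => κ z ^ 2 * lowL χ⁻¹ U (1 - z))
      (M := (C * (2 * d)) ^ 2 * M₃) (a := -1) (b := -δ) (by linarith)
      (Or.inr (by linarith)) le_rfl (by linarith)
      (fun z _ h2 => hd1 z (by linarith)) (fun z h1 h2 => hb z (by linarith) (by linarith)),
      ← integral_add]
    · refine integral_congr_ae (Eventually.of_forall fun v => ?_)
      have h1 : (s + ((-1 : ℝ) + v * I)).re = -(1 / 2) := by rw [hre]; simp; norm_num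
      simp only
      rw [hfk _ (by intro h; rw [h] at h1; norm_num at h1),
        hκ _ (by rw [h1]; norm_num) (by intro h; rw [h] at h1; norm_num at h1), mul_pow,
        lowL_add_highL χ⁻¹ U (by rw [hsub, h1]; norm_num)]
      ring
    · exact integrable_mul_afeKernel (M := (C * (2 * d)) ^ 2 * M₃)
        (G := fun z => κ z ^ 2 * lowL χ⁻¹ U (1 - z)) hU hsre (by norm_num) (by simp)
        (fun z hz => hd1 z (by linarith)) fun z hz => hb z (by linarith) (by linarith)
    · refine integrable_mul_afeKernel (M := (C * (2 * d)) ^ 2 * M₄)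
        (G := fun z => κ z ^ 2 * highL χ⁻¹ U (1 - z)) hU hsre (by norm_num) (by simp)
        (fun z hz => ?_) fun z hz => ?_
      · refine DifferentiableAt.mul ((hκd z (by linarith)).pow 2) ?_
        exact DifferentiableAt.comp z (differentiableAt_highL χ⁻¹ U (by rw [hsub]; linarith))
          (by fun_prop)
      · rw [norm_mul, mul_right_comm]
        exact mul_le_mul (hκ2 z (by linarith) (by linarith)) (hh' _ (by rw [hsub]; linarith))
          (norm_nonneg _) (by positivity)
  rw [hfs, hR, hL] at hcauchy
  have hfin : ‖LFunction χ s‖ₑ ^ 2 ≤ ‖2 * (Real.pi : ℂ) * LFunction χ s ^ 2‖ₑ := by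
    rw [enorm_mul, enorm_pow]
    refine le_mul_of_one_le_left zero_le ?_
    rw [← ofReal_norm, ENNReal.one_le_ofReal, norm_mul, norm_real, Real.norm_eq_abs,
      abs_of_pos Real.pi_pos]
    norm_num
    linarith [Real.pi_gt_three]
  refine hfin.trans ?_
  rw [hcauchy]
  refine enorm_sub_le.trans (add_le_add (enorm_add_le _ _) (enorm_add_le _ _))

lemma enorm_add_sq_le (a b : ENNReal) : (a + b) ^ 2 ≤ 4 * (a ^ 2 + b ^ 2) := by
  rcases le_total a b with h | h
  · calc (a + b) ^ 2 ≤ (b + b) ^ 2 := by gcongr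
      _ = 4 * b ^ 2 := by ring
      _ ≤ _ := by gcongr; exact le_add_self
  · calc (a + b) ^ 2 ≤ (a + a) ^ 2 := by gcongr
      _ = 4 * a ^ 2 := by ring
      _ ≤ _ := by gcongr; exact le_self_add

/-- The mean squares of the two parts of the Dirichlet series of `L(s, χ)²`. -/
noncomputable def splitMoment {d : ℕ} (χ : DirichletCharacter ℂ d) (T δ : ℝ) : ENNReal :=
  lineMoment (lowL χ (d * T)) (1 / 2 + δ) (2 * T) +
    ENNReal.ofReal ((d * T) ^ 2) * lineMoment (highL χ (d * T)) (3 / 2) (2 * T)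

lemma exists_fourth_moment_le : ∃ C : ℝ, 0 < C ∧ ∀ (d : ℕ) [NeZero d] (χ : DirichletCharacter ℂ d)
    (T δ : ℝ), χ.IsPrimitive → 2 ≤ T → 0 < δ → δ ≤ 1 / 4 → (d * T) ^ δ ≤ 3 →
    ∫⁻ t : ℝ, ‖LFunction χ (1 / 2 + t * I)‖ₑ ^ 4 * expWeight T t ≤
      ENNReal.ofReal (C / δ) * (splitMoment χ T δ + splitMoment χ⁻¹ T δ) := by
  obtain ⟨C₁, hC₁, hker⟩ := exists_afeKernel_moment
  obtain ⟨C₂, hC₂, hfac⟩ := exists_functional_factor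
  refine ⟨16 * (C₁ * 9 + C₁ * (C₂ ^ 4 * 8 ^ 4 * 9)), by positivity,
    fun d _ χ T δ hχ hT hδ hδ1 hUδ => ?_⟩
  obtain ⟨κ, hκd, hκ, hκb⟩ := hfac d χ hχ
  have hd := one_le_natCast_level d
  have hT0 : 0 < T := by linarith
  have hT1 : 1 ≤ T := by linarith
  set U : ℝ := d * T with hU
  have hU1 : 1 ≤ U := by nlinarith
  have hU0 : 0 < U := by linarith
  have hδ' : |δ| = δ := abs_of_pos hδ
  have hne : ∀ c y : ℝ, c < 1 / 2 → ((1 / 2 + c + y * I : ℂ)).re < 1 := by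
    intro c y hc; simp; linarith
  have hcl : ∀ c : ℝ, c < 1 / 2 →
      Continuous fun y : ℝ => (fun z => κ z ^ 2 * lowL χ⁻¹ U (1 - z)) (1 / 2 + c + y * I) := by
    intro c hc
    refine Continuous.mul (Continuous.pow ?_ 2)
      ((differentiable_lowL χ⁻¹ U).continuous.comp' (by fun_prop))
    exact continuous_iff_continuousAt.2 fun y =>
      ContinuousAt.comp' (hκd _ (hne c y hc)).continuousAt (by fun_prop)
  obtain ⟨H₁, hm₁, hb₁, hi₁⟩ := hker U δ T (lowL χ U) hU0 hδ.ne' (by rw [hδ']; linarith) hT1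
    ((differentiable_lowL χ U).continuous.comp' (by fun_prop))
  obtain ⟨H₂, hm₂, hb₂, hi₂⟩ := hker U (1 : ℝ) T (highL χ U) hU0 one_ne_zero (by simp) hT1
    (continuous_iff_continuousAt.2 fun y => ContinuousAt.comp'
      (differentiableAt_highL χ U (by simp)).continuousAt (by fun_prop))
  obtain ⟨H₃, hm₃, hb₃, hi₃⟩ := hker U (-δ) T (fun z => κ z ^ 2 * lowL χ⁻¹ U (1 - z)) hU0
    (by linarith) (by rw [abs_neg, hδ']; linarith) hT1 (hcl _ (by linarith))
  obtain ⟨H₄, hm₄, hb₄, hi₄⟩ := hker U (-1 : ℝ) T (fun z => κ z ^ 2 * highL χ⁻¹ U (1 - z)) hU0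
    (by norm_num) (by simp) hT1 (by
      refine Continuous.mul (Continuous.pow ?_ 2) ?_
      · exact continuous_iff_continuousAt.2 fun y =>
          ContinuousAt.comp' (hκd _ (hne (-1) y (by norm_num))).continuousAt (by fun_prop)
      · exact continuous_iff_continuousAt.2 fun y => ContinuousAt.comp'
          (differentiableAt_highL χ⁻¹ U (by simp; norm_num)).continuousAt (by fun_prop))
  have hpt : ∀ t : ℝ, ‖LFunction χ (1 / 2 + t * I)‖ₑ ^ 4 ≤
      16 * (H₁ t ^ 2 + H₂ t ^ 2 + (H₃ t ^ 2 + H₄ t ^ 2)) := by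
    intro t
    have h1 := (LFunction_sq_eq_integrals χ hU1 hδ hδ1 hC₂.le hκd hκ hκb t).trans
      (add_le_add (add_le_add (hb₁ t) (hb₂ t)) (add_le_add (hb₃ t) (hb₄ t)))
    calc ‖LFunction χ (1 / 2 + t * I)‖ₑ ^ 4 = (‖LFunction χ (1 / 2 + t * I)‖ₑ ^ 2) ^ 2 := by ring
      _ ≤ (H₁ t + H₂ t + (H₃ t + H₄ t)) ^ 2 := by gcongr
      _ ≤ 4 * ((H₁ t + H₂ t) ^ 2 + (H₃ t + H₄ t) ^ 2) := enorm_add_sq_le _ _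
      _ ≤ 4 * (4 * (H₁ t ^ 2 + H₂ t ^ 2) + 4 * (H₃ t ^ 2 + H₄ t ^ 2)) := by
          gcongr <;> exact enorm_add_sq_le _ _
      _ = _ := by ring
  have hmono : ∀ (D : ℂ → ℂ) (σ : ℝ), lineMoment D σ T ≤ lineMoment D σ (2 * T) := fun D σ =>
    lineMoment_mono_weight D σ hT0 (by linarith)
  have e : ∀ (D : ℂ → ℂ) (c : ℝ), ∫⁻ y : ℝ, ‖D (1 / 2 + c + y * I)‖ₑ ^ 2 * expWeight T y =
      lineMoment D (1 / 2 + c) T := fun D c => by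
    unfold lineMoment; push_cast; rfl
  rw [e] at hi₁ hi₂
  have e₃ := e (fun z => κ z ^ 2 * lowL χ⁻¹ U (1 - z)) (-δ)
  have e₄ := e (fun z => κ z ^ 2 * highL χ⁻¹ U (1 - z)) (-1)
  rw [e₃] at hi₃
  rw [e₄] at hi₄
  have hUδ2 : (U ^ δ) ^ 2 ≤ 9 := by
    calc (U ^ δ) ^ 2 ≤ 3 ^ 2 := by gcongr
      _ = 9 := by norm_num
  have h1δ : 1 ≤ 1 / δ := by rw [le_div_iff₀ hδ]; linarith
  have b₁ : ∫⁻ t, H₁ t ^ 2 * expWeight T t ≤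
      ENNReal.ofReal (C₁ * 9 / δ) * lineMoment (lowL χ U) (1 / 2 + δ) (2 * T) := by
    refine hi₁.trans (mul_le_mul' (ENNReal.ofReal_le_ofReal ?_) (hmono _ _))
    rw [hδ', mul_div_right_comm]
    gcongr
  have b₂ : ∫⁻ t, H₂ t ^ 2 * expWeight T t ≤ ENNReal.ofReal (C₁ * 9 / δ) *
      (ENNReal.ofReal (U ^ 2) * lineMoment (highL χ U) (3 / 2) (2 * T)) := by
    rw [← mul_assoc, ← ENNReal.ofReal_mul (by positivity)]
    refine hi₂.trans (mul_le_mul' (ENNReal.ofReal_le_ofReal ?_) ?_)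
    · rw [abs_one, div_one, Real.rpow_one, mul_div_assoc, mul_assoc]
      refine mul_le_mul_of_nonneg_left (le_mul_of_one_le_left (by positivity) ?_) hC₁.le
      rw [le_div_iff₀ hδ]; linarith
    · rw [show (1 / 2 + 1 : ℝ) = 3 / 2 by norm_num]
      exact hmono _ _
  have b₃ : ∫⁻ t, H₃ t ^ 2 * expWeight T t ≤ ENNReal.ofReal (C₁ * (C₂ ^ 4 * 8 ^ 4 * 9) / δ) *
      lineMoment (lowL χ⁻¹ U) (1 / 2 + δ) (2 * T) := by
    refine hi₃.trans ?_
    rw [ENNReal.ofReal_mul (by positivity), mul_assoc, abs_neg, hδ']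
    refine (mul_le_mul_right (factor_moment hd hT hC₂.le (by linarith) (by linarith) hκb) _).trans ?_
    rw [← mul_assoc, ← ENNReal.ofReal_mul (by positivity), neg_neg, sub_neg_eq_add]
    gcongr
    rw [mul_div_right_comm, ← hU]
    gcongr
  have b₄ : ∫⁻ t, H₄ t ^ 2 * expWeight T t ≤ ENNReal.ofReal (C₁ * (C₂ ^ 4 * 8 ^ 4 * 9) / δ) *
      (ENNReal.ofReal (U ^ 2) * lineMoment (highL χ⁻¹ U) (3 / 2) (2 * T)) := by
    refine hi₄.trans ?_
    rw [ENNReal.ofReal_mul (by positivity), mul_assoc]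
    refine (mul_le_mul_right (factor_moment hd hT hC₂.le (by norm_num) le_rfl hκb) _).trans ?_
    rw [← mul_assoc, ← ENNReal.ofReal_mul (by positivity), neg_neg, sub_neg_eq_add, ← hU,
      ← mul_assoc (ENNReal.ofReal (C₁ * (C₂ ^ 4 * 8 ^ 4 * 9) / δ)),
      ← ENNReal.ofReal_mul (by positivity), show (1 / 2 + 1 : ℝ) = 3 / 2 by norm_num]
    refine mul_le_mul_left (ENNReal.ofReal_le_ofReal ?_) _
    rw [abs_neg, abs_one, div_one, Real.rpow_one]
    have : 0 < C₁ * (C₂ ^ 4 * 8 ^ 4) * U ^ 2 := by positivity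
    rw [show C₁ * (C₂ ^ 4 * 8 ^ 4 * 9) / δ * U ^ 2 = C₁ * (C₂ ^ 4 * 8 ^ 4) * U ^ 2 * (9 * (1 / δ)) by ring]
    nlinarith
  have hw := measurable_expWeight T
  calc ∫⁻ t : ℝ, ‖LFunction χ (1 / 2 + t * I)‖ₑ ^ 4 * expWeight T t
      ≤ ∫⁻ t, 16 * ((H₁ t ^ 2 * expWeight T t + H₂ t ^ 2 * expWeight T t) +
          (H₃ t ^ 2 * expWeight T t + H₄ t ^ 2 * expWeight T t)) := by
        refine lintegral_mono fun t => (mul_le_mul_left (hpt t) _).trans (le_of_eq ?_)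
        ring
    _ = 16 * ((∫⁻ t, H₁ t ^ 2 * expWeight T t) + (∫⁻ t, H₂ t ^ 2 * expWeight T t) +
          ((∫⁻ t, H₃ t ^ 2 * expWeight T t) + ∫⁻ t, H₄ t ^ 2 * expWeight T t)) := by
        rw [lintegral_const_mul _ (by fun_prop), lintegral_add_left (by fun_prop),
          lintegral_add_left (by fun_prop), lintegral_add_left (by fun_prop)]
    _ ≤ 16 * (ENNReal.ofReal (C₁ * 9 / δ) * splitMoment χ T δ +
          ENNReal.ofReal (C₁ * (C₂ ^ 4 * 8 ^ 4 * 9) / δ) * splitMoment χ⁻¹ T δ) := by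
        unfold splitMoment
        rw [mul_add (ENNReal.ofReal (C₁ * 9 / δ)),
          mul_add (ENNReal.ofReal (C₁ * (C₂ ^ 4 * 8 ^ 4 * 9) / δ))]
        exact mul_le_mul_right (add_le_add (add_le_add b₁ b₂) (add_le_add b₃ b₄)) _
    _ ≤ 16 * (ENNReal.ofReal ((C₁ * 9 + C₁ * (C₂ ^ 4 * 8 ^ 4 * 9)) / δ) *
          (splitMoment χ T δ + splitMoment χ⁻¹ T δ)) := by
        rw [mul_add (ENNReal.ofReal ((C₁ * 9 + C₁ * (C₂ ^ 4 * 8 ^ 4 * 9)) / δ))]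
        have p1 : 0 ≤ C₁ * 9 := by positivity
        have p2 : 0 ≤ C₁ * (C₂ ^ 4 * 8 ^ 4 * 9) := by positivity
        gcongr <;> linarith
    _ = _ := by
        rw [← mul_assoc, mul_div_assoc, ENNReal.ofReal_mul (by norm_num)]
        norm_num

open scoped Classical in
/-- The fourth moment on the critical line, over primitive characters. -/
theorem fourth_moment_primitive : ∃ C : ℝ, 0 < C ∧ ∀ (d : ℕ) [NeZero d] (T δ : ℝ),
    2 ≤ T → 0 < δ → δ ≤ 1 / 4 → (d * T) ^ δ ≤ 3 →
    ∑ χ : DirichletCharacter ℂ d with χ.IsPrimitive,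
      ∫⁻ t : ℝ, ‖LFunction χ (1 / 2 + t * I)‖ₑ ^ 4 * expWeight T t ≤
    ENNReal.ofReal (C * (d * T) * (1 / δ) ^ 5) := by
  obtain ⟨C, hC, h⟩ := exists_fourth_moment_le
  obtain ⟨C₁, hC₁, h₁⟩ := exists_lowL_moment
  obtain ⟨C₂, hC₂, h₂⟩ := exists_highL_moment
  refine ⟨2 * C * (C₁ + C₂), by positivity, fun d _ T δ hT hδ hδ1 hUδ => ?_⟩
  have hsum : ∑ χ : DirichletCharacter ℂ d, splitMoment χ T δ ≤
      ENNReal.ofReal ((C₁ + C₂) * (d * T) * (1 / δ) ^ 4) := by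
    unfold splitMoment
    rw [Finset.sum_add_distrib, add_mul, add_mul, ENNReal.ofReal_add (by positivity) (by positivity)]
    exact add_le_add (h₁ d T δ (by linarith) hδ (by linarith))
      (h₂ d T δ (by linarith) hδ (by linarith) hUδ)
  have hinv : ∑ χ : DirichletCharacter ℂ d, splitMoment χ⁻¹ T δ =
      ∑ χ : DirichletCharacter ℂ d, splitMoment χ T δ :=
    Equiv.sum_comp (Equiv.inv (DirichletCharacter ℂ d)) fun χ => splitMoment χ T δ
  calc _ ≤ ∑ χ : DirichletCharacter ℂ d with χ.IsPrimitive,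
          ENNReal.ofReal (C / δ) * (splitMoment χ T δ + splitMoment χ⁻¹ T δ) :=
        Finset.sum_le_sum fun χ hχ => h d χ T δ (Finset.mem_filter.1 hχ).2 hT hδ hδ1 hUδ
    _ ≤ ∑ χ : DirichletCharacter ℂ d,
          ENNReal.ofReal (C / δ) * (splitMoment χ T δ + splitMoment χ⁻¹ T δ) :=
        Finset.sum_le_sum_of_subset (Finset.filter_subset _ _)
    _ = ENNReal.ofReal (C / δ) * (2 * ∑ χ : DirichletCharacter ℂ d, splitMoment χ T δ) := by
        rw [← Finset.mul_sum, Finset.sum_add_distrib, hinv, two_mul]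
    _ ≤ ENNReal.ofReal (C / δ) * (ENNReal.ofReal 2 *
          ENNReal.ofReal ((C₁ + C₂) * (d * T) * (1 / δ) ^ 4)) := by
        rw [ENNReal.ofReal_ofNat]
        gcongr
    _ = _ := by
        rw [← ENNReal.ofReal_mul (by norm_num), ← ENNReal.ofReal_mul (by positivity)]
        congr 1
        ring

end ZeroDensity

namespace ZeroDensity
open Complex MeasureTheory Set Filter Topology DirichletCharacter

lemma prod_one_add_le_sum_divisors {e : ℕ} (he : e ≠ 0) (a : ℝ) :
    ∏ p ∈ e.primeFactors, (1 + (p : ℝ) ^ a) ≤ ∑ f ∈ e.divisors, (f : ℝ) ^ a := by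
  rw [Finset.prod_one_add]
  have hprime : ∀ t ∈ e.primeFactors.powerset, ∀ p ∈ t, p.Prime := fun t ht p hp =>
    Nat.prime_of_mem_primeFactors (Finset.mem_powerset.1 ht hp)
  have h1 : ∀ t ∈ e.primeFactors.powerset, ∏ p ∈ t, (p : ℝ) ^ a = ((∏ p ∈ t, p : ℕ) : ℝ) ^ a := by
    intro t _
    rw [Nat.cast_prod, Real.finsetProd_rpow _ _ fun _ _ => by positivity]
  rw [Finset.sum_congr rfl h1,
    ← Finset.sum_image (s := e.primeFactors.powerset) (g := fun t => ∏ p ∈ t, p)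
      (f := fun f : ℕ => (f : ℝ) ^ a)]
  · refine Finset.sum_le_sum_of_subset_of_nonneg ?_ fun _ _ _ => by positivity
    intro f hf
    obtain ⟨t, ht, rfl⟩ := Finset.mem_image.1 hf
    exact Nat.mem_divisors.2 ⟨(Finset.prod_dvd_prod_of_subset _ _ _ (Finset.mem_powerset.1 ht)).trans
      (Nat.prod_primeFactors_dvd e), he⟩
  · intro t ht u hu h
    simp only at h
    rw [← Nat.primeFactors_prod (hprime t ht), h, Nat.primeFactors_prod (hprime u hu)]

lemma exists_prod_pow_four_le : ∃ C : ℝ, 0 < C ∧ ∀ e : ℕ, e ≠ 0 →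
    (∏ p ∈ e.primeFactors, (1 + (p : ℝ) ^ (-(1 / 2) : ℝ))) ^ 4 ≤
      C * ∑ f ∈ e.divisors, (f : ℝ) ^ (-(1 / 4) : ℝ) := by
  obtain ⟨K, hK⟩ : ∃ K : ℕ, K = 50625 := ⟨_, rfl⟩
  refine ⟨16 ^ K, by positivity, fun e he => ?_⟩
  calc (∏ p ∈ e.primeFactors, (1 + (p : ℝ) ^ (-(1 / 2) : ℝ))) ^ 4
      = ∏ p ∈ e.primeFactors, (1 + (p : ℝ) ^ (-(1 / 2) : ℝ)) ^ 4 := (Finset.prod_pow _ _ _).symm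
    _ ≤ ∏ p ∈ e.primeFactors, ((if p < K then 16 else 1) * (1 + (p : ℝ) ^ (-(1 / 4) : ℝ))) := by
        refine Finset.prod_le_prod (fun _ _ => by positivity) fun p hp => ?_
        have hp1 : (1 : ℝ) ≤ p := by exact_mod_cast (Nat.prime_of_mem_primeFactors hp).one_le
        have hp0 : (0 : ℝ) < p := by linarith
        set x := (p : ℝ) ^ (-(1 / 4) : ℝ) with hx
        have hx0 : 0 < x := by positivity
        have hx1 : x ≤ 1 := Real.rpow_le_one_of_one_le_of_nonpos hp1 (by norm_num)
        have hsq : (p : ℝ) ^ (-(1 / 2) : ℝ) = x ^ 2 := by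
          rw [hx, ← Real.rpow_natCast, ← Real.rpow_mul hp0.le]; norm_num
        have h2 : x ^ 2 ≤ 1 := pow_le_one₀ hx0.le hx1
        rw [hsq]
        split_ifs with h
        · calc (1 + x ^ 2) ^ 4 ≤ (1 + 1) ^ 4 := by gcongr
            _ ≤ 16 * (1 + x) := by linarith
        · have hpK : (50625 : ℝ) ≤ p := by
            rw [hK] at h; push Not at h; exact_mod_cast h
          have hx15 : 15 * x ≤ 1 := by
            have h3 : x ≤ (50625 : ℝ) ^ (-(1 / 4) : ℝ) :=
              Real.rpow_le_rpow_of_nonpos (by norm_num) hpK (by norm_num)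
            have h4 : (50625 : ℝ) ^ (-(1 / 4) : ℝ) = 15⁻¹ := by
              rw [show (50625 : ℝ) = 15 ^ (4 : ℝ) by norm_num, ← Real.rpow_mul (by norm_num),
                ← Real.rpow_neg_one]
              norm_num
            rw [h4] at h3
            linarith
          have h5 : (1 + x ^ 2) ^ 4 ≤ 1 + 15 * x ^ 2 := by
            have h0 := sq_nonneg x
            generalize x ^ 2 = y at h0 h2
            have h6 : y ^ 2 ≤ y := by nlinarith
            have h7 : y ^ 3 ≤ y := by nlinarith
            have h8 : y ^ 4 ≤ y := by nlinarith
            nlinarith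
          nlinarith
    _ ≤ 16 ^ K * ∏ p ∈ e.primeFactors, (1 + (p : ℝ) ^ (-(1 / 4) : ℝ)) := by
        rw [Finset.prod_mul_distrib]
        gcongr
        rw [Finset.prod_ite, Finset.prod_const_one, mul_one, Finset.prod_const]
        refine pow_le_pow_right₀ (by norm_num) ?_
        calc _ ≤ (Finset.range K).card := Finset.card_le_card fun p hp => by
              simp only [Finset.mem_filter] at hp; exact Finset.mem_range.2 hp.2
          _ = K := by simp
    _ ≤ _ := by
        gcongr
        exact prod_one_add_le_sum_divisors he _

lemma sum_divisors_inv_le {q : ℕ} (hq : q ≠ 0) :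
    ∑ e ∈ q.divisors, (1 / (e : ℝ)) * ∑ f ∈ e.divisors, (f : ℝ) ^ (-(1 / 4) : ℝ) ≤
      5 * (1 + Real.log q) := by
  have hq0 : 0 < q := Nat.pos_of_ne_zero hq
  calc ∑ e ∈ q.divisors, (1 / (e : ℝ)) * ∑ f ∈ e.divisors, (f : ℝ) ^ (-(1 / 4) : ℝ)
      = ∑ e ∈ q.divisors, ∑ x ∈ e.divisorsAntidiagonal,
          (1 / (x.2 : ℝ)) * (x.1 : ℝ) ^ (-(1 + 1 / 4) : ℝ) := by
        refine Finset.sum_congr rfl fun e he => ?_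
        rw [← Nat.sum_divisorsAntidiagonal (fun f _ : ℕ => (f : ℝ) ^ (-(1 / 4) : ℝ)), Finset.mul_sum]
        refine Finset.sum_congr rfl fun x hx => ?_
        obtain ⟨h1, h2⟩ := Nat.mem_divisorsAntidiagonal.1 hx
        have hx1 : (0 : ℝ) < x.1 := by
          exact_mod_cast Nat.pos_of_ne_zero fun h => h2 (by rw [← h1, h, zero_mul])
        rw [← h1, show (-(1 + 1 / 4) : ℝ) = -(1 / 4) - 1 by ring, Real.rpow_sub_one hx1.ne',
          Nat.cast_mul]
        field_simp
    _ = ∑ y ∈ q.divisors.sigma fun e => e.divisorsAntidiagonal,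
          (1 / (y.2.2 : ℝ)) * (y.2.1 : ℝ) ^ (-(1 + 1 / 4) : ℝ) := by rw [Finset.sum_sigma]
    _ ≤ ∑ x ∈ Finset.Icc 1 q ×ˢ Finset.Icc 1 q,
          (1 / (x.2 : ℝ)) * (x.1 : ℝ) ^ (-(1 + 1 / 4) : ℝ) := by
        rw [← Finset.sum_image (s := q.divisors.sigma fun e => e.divisorsAntidiagonal)
          (g := fun y : (_ : ℕ) × (ℕ × ℕ) => y.2)
          (f := fun x : ℕ × ℕ => (1 / (x.2 : ℝ)) * (x.1 : ℝ) ^ (-(1 + 1 / 4) : ℝ))]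
        · refine Finset.sum_le_sum_of_subset_of_nonneg ?_ fun _ _ _ => by positivity
          intro x hx
          obtain ⟨y, hy, rfl⟩ := Finset.mem_image.1 hx
          obtain ⟨h1, h2⟩ := Finset.mem_sigma.1 hy
          obtain ⟨h3, h4⟩ := Nat.mem_divisorsAntidiagonal.1 h2
          have h5 := Nat.dvd_of_mem_divisors h1
          have ha : y.2.1 ∣ q := (Dvd.intro _ h3).trans h5
          have hb : y.2.2 ∣ q := (Dvd.intro_left _ h3).trans h5
          rw [Finset.mem_product, Finset.mem_Icc, Finset.mem_Icc]
          exact ⟨⟨Nat.pos_of_dvd_of_pos ha hq0, Nat.le_of_dvd hq0 ha⟩,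
            Nat.pos_of_dvd_of_pos hb hq0, Nat.le_of_dvd hq0 hb⟩
        · rintro ⟨e, x⟩ hy ⟨e', x'⟩ hy' h
          obtain ⟨-, h2⟩ := Finset.mem_sigma.1 hy
          obtain ⟨-, h2'⟩ := Finset.mem_sigma.1 hy'
          simp only at h h2 h2'
          subst h
          obtain ⟨h3, -⟩ := Nat.mem_divisorsAntidiagonal.1 h2
          obtain ⟨h4, -⟩ := Nat.mem_divisorsAntidiagonal.1 h2'
          rw [← h3, ← h4]
    _ = (∑ f ∈ Finset.Icc 1 q, (f : ℝ) ^ (-(1 + 1 / 4) : ℝ)) * ∑ g ∈ Finset.Icc 1 q, 1 / (g : ℝ) := by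
        rw [Finset.sum_product, Finset.sum_mul]
        refine Finset.sum_congr rfl fun f _ => ?_
        rw [Finset.mul_sum]
        exact Finset.sum_congr rfl fun g _ => mul_comm _ _
    _ ≤ 5 * (1 + Real.log q) := by
        have h1 : ∑ f ∈ Finset.Icc 1 q, (f : ℝ) ^ (-(1 + 1 / 4) : ℝ) ≤ 5 := by
          refine ((summable_rpow_neg (a := 1 / 4) (by norm_num)).sum_le_tsum _
            fun _ _ => by positivity).trans ?_
          refine (tsum_rpow_neg_le (a := 1 / 4) (by norm_num)).trans (by norm_num)
        have h2 : ∑ g ∈ Finset.Icc 1 q, 1 / (g : ℝ) ≤ 1 + Real.log q := by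
          have := harmonic_le_one_add_log q
          rw [harmonic_eq_sum_Icc] at this
          push_cast at this
          simpa [one_div] using this
        gcongr

open scoped Classical in
lemma sum_conductor_le {q : ℕ} [NeZero q] {d : ℕ} [NeZero d] (hd : d ∣ q)
    (F : DirichletCharacter ℂ q → ENNReal) :
    ∑ χ : DirichletCharacter ℂ q with χ.conductor = d, F χ ≤
      ∑ ψ : DirichletCharacter ℂ d with ψ.IsPrimitive, F (changeLevel hd ψ) := by
  rw [← Finset.sum_image (s := Finset.univ.filter fun ψ : DirichletCharacter ℂ d => ψ.IsPrimitive)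
    (g := changeLevel hd) (f := F) (changeLevel_injective hd).injOn]
  refine Finset.sum_le_sum_of_subset fun χ hχ => ?_
  obtain rfl := (Finset.mem_filter.1 hχ).2
  exact Finset.mem_image.2 ⟨χ.primitiveCharacter, Finset.mem_filter.2 ⟨Finset.mem_univ _,
    χ.primitiveCharacter_isPrimitive⟩, χ.changeLevel_primitiveCharacter⟩

/-- The fourth moment on the critical line over all characters modulo `q`. -/
theorem fourth_moment : ∃ C : ℝ, 0 < C ∧ ∀ (q : ℕ) [NeZero q] (T : ℝ), 2 ≤ T →
    ∑ χ : DirichletCharacter ℂ q, ∫⁻ t : ℝ, ‖LFunction χ (1 / 2 + t * I)‖ₑ ^ 4 * expWeight T t ≤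
    ENNReal.ofReal (C * (q * T) * Real.log (q * T) ^ 6) := by
  classical
  obtain ⟨C₁, hC₁, h₁⟩ := fourth_moment_primitive
  obtain ⟨C₂, hC₂, h₂⟩ := exists_prod_pow_four_le
  refine ⟨C₁ * C₂ * 5 * 3 * 10 ^ 5, by positivity, fun q _ T hT => ?_⟩
  have hq1 := one_le_natCast_level q
  have hU2 : 2 ≤ (q : ℝ) * T := by nlinarith
  have hlog2 : 1 / 2 ≤ Real.log (q * T) := by
    have := Real.log_le_log (by norm_num) hU2
    linarith [Real.log_two_gt_d9]
  set 𝓛 := Real.log (q * T) with h𝓛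
  set δ : ℝ := 1 / (𝓛 + 4) with hδ
  have hδ0 : 0 < δ := by positivity
  have hδ4 : δ ≤ 1 / 4 := by rw [hδ]; gcongr; linarith
  have hpow : ((q : ℝ) * T) ^ δ ≤ 3 := by
    rw [Real.rpow_def_of_pos (by linarith), ← h𝓛]
    have h1 : 𝓛 * δ ≤ 1 := by
      rw [hδ, mul_one_div, div_le_one (by linarith)]; linarith
    exact (Real.exp_le_exp.2 h1).trans (by linarith [Real.exp_one_lt_d9])
  let J : ∀ {n : ℕ} [NeZero n], DirichletCharacter ℂ n → ENNReal := fun {n} _ χ =>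
    ∫⁻ t : ℝ, ‖LFunction χ (1 / 2 + t * I)‖ₑ ^ 4 * expWeight T t
  have hJ : ∀ d ∈ q.divisors, ∑ χ : DirichletCharacter ℂ q with χ.conductor = d, J χ ≤
      ENNReal.ofReal (C₁ * (q * T) * (1 / δ) ^ 5 * (C₂ * ((1 / ((q / d : ℕ) : ℝ)) *
        ∑ f ∈ (q / d).divisors, (f : ℝ) ^ (-(1 / 4) : ℝ)))) := by
    intro d hd
    have hdq := Nat.dvd_of_mem_divisors hd
    have hd0 : 0 < d := Nat.pos_of_dvd_of_pos hdq (NeZero.pos q)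
    have : NeZero d := ⟨hd0.ne'⟩
    have hd1 := one_le_natCast_level d
    have he : q / d ≠ 0 := (Nat.div_pos (Nat.le_of_dvd (NeZero.pos q) hdq) hd0).ne'
    set w := (∏ p ∈ (q / d).primeFactors, (1 + (p : ℝ) ^ (-(1 / 2) : ℝ))) ^ 4 with hw
    have hw0 : 0 ≤ w := by positivity
    have hpt : ∀ ψ : DirichletCharacter ℂ d, J (changeLevel hdq ψ) ≤ ENNReal.ofReal w * J ψ := by
      intro ψ
      rw [← lintegral_const_mul' _ _ ENNReal.ofReal_ne_top]
      refine lintegral_mono fun t => ?_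
      rw [← mul_assoc]
      refine mul_le_mul_left ?_ _
      have hs : (1 / 2 + t * I : ℂ) ≠ 1 := by
        intro h; have := congrArg re h; norm_num at this
      have h3 := norm_LFunction_changeLevel_le hdq ψ hs
      rw [show (1 / 2 + t * I : ℂ).re = 1 / 2 by simp] at h3
      rw [← ofReal_norm, ← ofReal_norm, ← ENNReal.ofReal_pow (norm_nonneg _),
        ← ENNReal.ofReal_pow (norm_nonneg _), ← ENNReal.ofReal_mul hw0, hw, mul_comm (_ ^ 4) (_ ^ 4), ← mul_pow]
      exact ENNReal.ofReal_le_ofReal (pow_le_pow_left₀ (norm_nonneg _) h3 4)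
    refine (sum_conductor_le hdq J).trans ((Finset.sum_le_sum fun ψ _ => hpt ψ).trans ?_)
    rw [← Finset.mul_sum]
    refine (mul_le_mul_right (h₁ d T δ hT hδ0 hδ4 (le_trans ?_ hpow)) _).trans ?_
    · have : (d : ℝ) ≤ q := by exact_mod_cast Nat.le_of_dvd (NeZero.pos q) hdq
      gcongr
    · rw [← ENNReal.ofReal_mul hw0]
      refine ENNReal.ofReal_le_ofReal ?_
      have h5 : (d : ℝ) = q * (1 / ((q / d : ℕ) : ℝ)) := by
        rw [Nat.cast_div hdq (by positivity)]; field_simp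
      calc w * (C₁ * (d * T) * (1 / δ) ^ 5) = (C₁ * (q * T) * (1 / δ) ^ 5) *
            ((1 / ((q / d : ℕ) : ℝ)) * w) := by rw [h5]; ring
        _ ≤ (C₁ * (q * T) * (1 / δ) ^ 5) * ((1 / ((q / d : ℕ) : ℝ)) *
            (C₂ * ∑ f ∈ (q / d).divisors, (f : ℝ) ^ (-(1 / 4) : ℝ))) := by
            gcongr; exact h₂ _ he
        _ = _ := by ring
  have hlogq : Real.log q ≤ 𝓛 := Real.log_le_log (by linarith) (by nlinarith)
  calc ∑ χ : DirichletCharacter ℂ q, J χ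
      = ∑ d ∈ q.divisors, ∑ χ : DirichletCharacter ℂ q with χ.conductor = d, J χ :=
        (Finset.sum_fiberwise_of_maps_to (fun χ _ => Nat.mem_divisors.2
          ⟨χ.conductor_dvd_level, NeZero.ne q⟩) _).symm
    _ ≤ ∑ d ∈ q.divisors, ENNReal.ofReal (C₁ * (q * T) * (1 / δ) ^ 5 * (C₂ *
          ((1 / ((q / d : ℕ) : ℝ)) * ∑ f ∈ (q / d).divisors, (f : ℝ) ^ (-(1 / 4) : ℝ)))) :=
        Finset.sum_le_sum hJ
    _ = ENNReal.ofReal (C₁ * (q * T) * (1 / δ) ^ 5 * (C₂ * ∑ e ∈ q.divisors,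
          ((1 / (e : ℝ)) * ∑ f ∈ e.divisors, (f : ℝ) ^ (-(1 / 4) : ℝ)))) := by
        rw [← ENNReal.ofReal_sum_of_nonneg fun _ _ => by positivity, ← Finset.mul_sum,
          ← Finset.mul_sum]
        congr 3
        exact Nat.sum_div_divisors q
          (fun e => (1 / (e : ℝ)) * ∑ f ∈ e.divisors, (f : ℝ) ^ (-(1 / 4) : ℝ))
    _ ≤ _ := by
        refine ENNReal.ofReal_le_ofReal ?_
        have h6 := sum_divisors_inv_le (NeZero.ne q)
        have h7 : 1 / δ ≤ 10 * 𝓛 := by rw [hδ, one_div_one_div]; linarith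
        calc _ ≤ C₁ * (q * T) * (10 * 𝓛) ^ 5 * (C₂ * (5 * (3 * 𝓛))) := by
              gcongr
              exact h6.trans (by gcongr; linarith)
          _ = _ := by ring

end ZeroDensity

namespace ZeroDensity
open Complex MeasureTheory Set Filter Topology DirichletCharacter

/-- The smooth weight concentrated on `n` of size `N` on the logarithmic scale. -/
noncomputable def logGauss (N x : ℝ) : ℝ := Real.exp (-(Real.log (x / N)) ^ 2 / 4)

lemma logGauss_pos (N x : ℝ) : 0 < logGauss N x := Real.exp_pos _

/-- The Mellin kernel whose vertical integrals produce `logGauss`. -/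
noncomputable def logKernel (N : ℝ) (w : ℂ) : ℂ := cexp (Real.log N * w + w ^ 2)

lemma norm_logKernel (N : ℝ) (w : ℂ) :
    ‖logKernel N w‖ = Real.exp (Real.log N * w.re + w.re ^ 2) * Real.exp (-w.im ^ 2) := by
  rw [logKernel, Complex.norm_exp, ← Real.exp_add]
  congr 1
  simp [sq]
  ring

lemma continuous_logKernel (N : ℝ) : Continuous (logKernel N) := by
  unfold logKernel; fun_prop

lemma integral_logKernel {N : ℝ} (hN : 0 < N) (s : ℂ) (c : ℝ) {n : ℕ} (hn : 0 < n) :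
    ∫ v : ℝ, (n : ℂ) ^ (-(c + v * I)) * logKernel N (c + v * I - s) =
      √Real.pi * ((n : ℂ) ^ (-s) * logGauss N n) := by
  have hn0 : (n : ℂ) ≠ 0 := Nat.cast_ne_zero.2 hn.ne'
  have hn1 : (0 : ℝ) < n := Nat.cast_pos.2 hn
  set l : ℝ := Real.log n - Real.log N with hl
  set k : ℝ := c - s.re with hk
  have hpt : ∀ v : ℝ, (n : ℂ) ^ (-(c + v * I)) * logKernel N (c + v * I - s) =
      (n : ℂ) ^ (-s) * (cexp (k ^ 2 - k * l) * (fun x : ℝ => cexp (I * ((2 * k - l : ℝ) : ℂ) * x) *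
        (Real.exp (-(x / 1) ^ 2) : ℂ)) (v - s.im)) := by
    intro v
    simp only [div_one]
    rw [Complex.cpow_def_of_ne_zero hn0, Complex.cpow_def_of_ne_zero hn0, logKernel, ofReal_exp,
      ← Complex.exp_add, ← Complex.exp_add, ← Complex.exp_add, ← Complex.exp_add]
    congr 1
    have hs : s = s.re + s.im * I := (re_add_im s).symm
    rw [show Complex.log n = (Real.log n : ℂ) by rw [ofReal_log hn1.le, ofReal_natCast]]
    have hc : (c : ℂ) = k + s.re := by rw [hk]; push_cast; ring
    have hN' : (Real.log N : ℂ) = Real.log n - l := by rw [hl]; push_cast; ring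
    rw [hc, hN']
    conv_lhs => rw [hs]
    conv_rhs => rw [hs]
    simp only [add_re, ofReal_re, mul_re, I_re, mul_zero, ofReal_im, I_im, mul_one, sub_self, add_zero,
      add_im, mul_im, zero_add]
    push_cast
    linear_combination ((v : ℂ) - s.im) ^ 2 * I_sq
  simp_rw [hpt]
  rw [integral_const_mul, integral_const_mul,
    integral_sub_right_eq_self (fun x : ℝ => cexp (I * ((2 * k - l : ℝ) : ℂ) * x) *
        (Real.exp (-(x / 1) ^ 2) : ℂ)) s.im, integral_gaussian_mul_cexp one_pos]
  have h1 : Real.log (n / N) = l := Real.log_div hn1.ne' hN.ne'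
  have h2 : cexp (k ^ 2 - k * l) * ((√Real.pi * (1 * Real.exp (-((1 * (2 * k - l)) ^ 2 / 4))) : ℝ) : ℂ)
      = √Real.pi * (logGauss N n : ℂ) := by
    rw [logGauss, h1]
    push_cast
    rw [mul_left_comm, one_mul, ← Complex.exp_add]
    congr 2
    ring
  rw [h2]
  ring

lemma integrable_exp_neg_sq_sub (t : ℝ) : Integrable fun v : ℝ => Real.exp (-(v - t) ^ 2) := by
  have h := (integrable_exp_neg_mul_sq (b := 1) one_pos).comp_sub_right t
  simpa using h

lemma hasSum_logGauss {q : ℕ} [NeZero q] (χ : DirichletCharacter ℂ q) {N : ℝ} (hN : 0 < N) {s : ℂ}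
    (hs : s ≠ 0) :
    HasSum (fun n : ℕ => √Real.pi * (χ n * ((n : ℂ) ^ (-s) * logGauss N n)))
      (∫ v : ℝ, LFunction χ ((2 : ℝ) + v * I) * logKernel N ((2 : ℝ) + v * I - s)) := by
  set F : ℕ → ℝ → ℂ := fun n v => LSeries.term (fun n => χ n) ((2 : ℝ) + v * I) n *
    logKernel N ((2 : ℝ) + v * I - s) with hF
  have hterm : ∀ (n : ℕ) (v : ℝ), 0 < n → F n v = χ n *
      ((n : ℂ) ^ (-((2 : ℝ) + v * I)) * logKernel N ((2 : ℝ) + v * I - s)) := by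
    intro n v hn
    simp only [hF]
    rw [LSeries.term_of_ne_zero hn.ne', cpow_neg]
    ring
  have h0 : ∀ v, F 0 v = 0 := fun v => by simp [hF]
  set G : ℝ := Real.exp (Real.log N * (2 - s.re) + (2 - s.re) ^ 2) with hG
  have hnorm : ∀ (n : ℕ) (v : ℝ), ‖F n v‖ ≤ (n : ℝ) ^ (-(1 + 1 : ℝ)) *
      (G * Real.exp (-(v - s.im) ^ 2)) := by
    intro n v
    simp only [hF]
    rw [norm_mul, norm_logKernel]
    refine mul_le_mul (norm_term_le χ (a := 1) (by simp; norm_num) n) (le_of_eq ?_) (by positivity)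
      (by positivity)
    simp [hG]
  have hcont : ∀ n, Continuous (F n) := by
    intro n
    rcases Nat.eq_zero_or_pos n with rfl | hn
    · rw [show F 0 = fun _ => 0 from funext h0]; exact continuous_const
    · rw [show F n = _ from funext fun v => hterm n v hn]
      have hn0 : (n : ℂ) ≠ 0 := Nat.cast_ne_zero.2 hn.ne'
      refine continuous_const.mul (Continuous.mul ?_ ((continuous_logKernel N).comp' (by fun_prop)))
      exact Continuous.const_cpow (by fun_prop) (Or.inl hn0)
  have hint : ∀ n, Integrable (F n) := fun n =>
    (((integrable_exp_neg_sq_sub s.im).const_mul G).const_mul _).mono'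
      (hcont n).aestronglyMeasurable (ae_of_all _ (hnorm n))
  have hsum : Summable fun n => ∫ v, ‖F n v‖ := by
    refine Summable.of_nonneg_of_le (fun n => integral_nonneg fun _ => norm_nonneg _)
      (fun n => (integral_mono (hint n).norm
        (((integrable_exp_neg_sq_sub s.im).const_mul G).const_mul _) (hnorm n)).trans_eq
        (integral_const_mul _ _)) ((summable_rpow_neg one_pos).mul_right _)
  have h := hasSum_integral_of_summable_integral_norm hint hsum
  have e1 : ∀ v : ℝ, ∑' n, F n v =
      LFunction χ ((2 : ℝ) + v * I) * logKernel N ((2 : ℝ) + v * I - s) := by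
    intro v
    simp only [hF]
    rw [tsum_mul_right, LFunction_eq_LSeries χ (by simp)]
    rfl
  simp_rw [e1] at h
  refine Eq.mp (congrArg (HasSum · _) (funext fun n => ?_)) h
  rcases Nat.eq_zero_or_pos n with rfl | hn
  · simp [h0, hs]
  · simp_rw [hterm n _ hn]
    rw [integral_const_mul, integral_logKernel hN s 2 hn]
    ring

lemma integral_shifted_gaussian_le {K t : ℝ} (hK : 0 ≤ K) {f : ℝ → ℂ}
    (hf : ∀ v, ‖f v‖ ≤ K * ((1 + |v - t|) * Real.exp (-(v - t) ^ 2))) :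
    ‖∫ v, f v‖ ≤ K * (2 * Real.exp 1 * √Real.pi * 2) := by
  have hb : ∀ v, ‖f v‖ ≤ K * (2 * Real.exp 1) * Real.exp (-(1 / 2) * (v - t) ^ 2) := by
    intro v
    refine (hf v).trans ?_
    rw [mul_assoc K]
    refine mul_le_mul_of_nonneg_left ?_ hK
    set x := v - t
    have h1 : 1 + |x| ≤ 2 * Real.exp (1 / 2 * x ^ 2 + 1) := by
      have := Real.add_one_le_exp (1 / 2 * x ^ 2 + 1)
      have h2 := sq_nonneg (|x| - 1)
      rw [sub_sq, sq_abs] at h2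
      nlinarith
    calc (1 + |x|) * Real.exp (-x ^ 2) ≤ 2 * Real.exp (1 / 2 * x ^ 2 + 1) * Real.exp (-x ^ 2) :=
          mul_le_mul_of_nonneg_right h1 (Real.exp_nonneg _)
      _ = 2 * Real.exp 1 * Real.exp (-(1 / 2) * x ^ 2) := by
        rw [mul_assoc, ← Real.exp_add, mul_assoc, ← Real.exp_add]; ring_nf
  have hi : Integrable fun v : ℝ => Real.exp (-(1 / 2) * (v - t) ^ 2) :=
    (integrable_exp_neg_mul_sq (b := 1 / 2) (by norm_num)).comp_sub_right t
  refine (norm_integral_le_of_norm_le (hi.const_mul _) (ae_of_all _ hb)).trans ?_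
  rw [integral_const_mul, integral_sub_right_eq_self (fun v : ℝ => Real.exp (-(1 / 2) * v ^ 2)) t,
    integral_gaussian]
  have : √(Real.pi / (1 / 2)) ≤ √Real.pi * 2 := by
    rw [show √Real.pi * 2 = √(Real.pi * 4) by
      rw [Real.sqrt_mul Real.pi_pos.le, show (4 : ℝ) = 2 ^ 2 by norm_num]; simp]
    apply Real.sqrt_le_sqrt
    linarith [Real.pi_pos]
  calc _ ≤ K * (2 * Real.exp 1) * (√Real.pi * 2) := by gcongr
    _ = _ := by ring

/-- Smoothed character sums are small, apart from the contribution of the principal character. -/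
theorem exists_logGauss_sum_le : ∃ C : ℝ, 0 < C ∧ ∀ (q : ℕ) [NeZero q] (χ : DirichletCharacter ℂ q)
    (s : ℂ) (N δ : ℝ), 1 ≤ s.re → s.re ≤ 2 → 1 ≤ N → 0 < δ → δ ≤ 1 / 2 → (q : ℝ) ^ δ ≤ 3 →
    (|s.im| + 2) ^ δ ≤ 3 → ∃ B : ℂ, HasSum (fun n : ℕ => χ n * ((n : ℂ) ^ (-s) * logGauss N n)) B ∧
      ‖B‖ ≤ C * (‖entireL χ 1‖ * (N ^ (1 - s.re) * Real.exp (-s.im ^ 2)) +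
        N ^ (-s.re) * (q * (|s.im| + 2)) ^ (1 / 2 : ℝ) / δ) := by
  obtain ⟨C₁, hC₁, hleft⟩ := norm_LFunction_left
  set K₀ : ℝ := 2 * Real.exp 1 * √Real.pi * 2 with hK₀
  have hK₀0 : 0 < K₀ := by positivity
  refine ⟨2 * Real.pi * Real.exp 1 + C₁ * 6 * Real.exp 9 * K₀, by positivity,
    fun q _ χ s N δ hs1 hs2 hN hδ hδ2 hqδ htδ => ?_⟩
  have hN0 : 0 < N := by linarith
  have hs0 : s ≠ 0 := by rintro rfl; simp at hs1; linarith
  set f : ℂ → ℂ := fun z => entireL χ z * (cexp (Real.log N * (z - s)) *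
    cexp ((1 - s) * (2 * z - s - 1))) with hf
  have hfK : ∀ z : ℂ, z ≠ 0 → f (1 + z) * cauchyKernel z =
      LFunction χ (1 + z) * logKernel N (1 + z - s) := by
    intro z hz
    have h1 : (1 + z : ℂ) ≠ 1 := by simpa using hz
    simp only [hf, cauchyKernel, logKernel]
    rw [entireL_of_ne χ h1, Complex.exp_add, show (1 + z - s) ^ 2 =
      (1 - s) * (2 * (1 + z) - s - 1) + z ^ 2 by ring, Complex.exp_add]
    field_simp
    ring
  obtain ⟨C₂, hC₂, hgrow⟩ := norm_entireL_growth χ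
  have hcauchy := strip_cauchy (f := f) (s := 1) (a := -1 - δ) (b := 1)
    (A := 3 + 2 * |s.im|)
    (C := C₂ * (Real.exp (Real.log N * 2) * Real.exp (20 + s.im ^ 2))) (by linarith) one_pos
    (fun z _ _ => by
      have := (differentiable_entireL χ) (1 + z)
      simp only [hf]
      fun_prop)
    (fun z h1 h2 => by
      simp only [hf]
      rw [norm_mul, norm_mul, Complex.norm_exp, Complex.norm_exp]
      have hg := hgrow (1 + z) (by simp; linarith) (by simp; linarith)
      rw [show (1 + z).im = z.im by simp] at hg
      have e1 : ((Real.log N : ℂ) * (1 + z - s)).re ≤ Real.log N * 2 := by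
        rw [re_ofReal_mul]
        have := Real.log_nonneg hN
        gcongr
        simp; linarith
      have e2 : ((1 - s) * (2 * (1 + z) - s - 1)).re ≤ 20 + s.im ^ 2 + 2 * |s.im| * |z.im| := by
        simp only [mul_re, sub_re, one_re, add_re, sub_im, one_im, add_im, mul_im,
          re_ofNat, im_ofNat]
        have h3 : s.im * z.im ≤ |s.im| * |z.im| := by rw [← abs_mul]; exact le_abs_self _
        nlinarith
      calc _ ≤ C₂ * Real.exp (3 * |z.im|) * (Real.exp (Real.log N * 2) *
            Real.exp (20 + s.im ^ 2 + 2 * |s.im| * |z.im|)) := by gcongr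
        _ = _ := by
          rw [Real.exp_add (20 + s.im ^ 2), show (3 + 2 * |s.im|) * |z.im| =
            3 * |z.im| + 2 * |s.im| * |z.im| by ring, Real.exp_add (3 * |z.im|)]
          ring)
  have hR : ∀ v : ℝ, f (1 + (((1 : ℝ) : ℂ) + v * I)) * cauchyKernel (((1 : ℝ) : ℂ) + v * I) =
      LFunction χ ((2 : ℝ) + v * I) * logKernel N ((2 : ℝ) + v * I - s) := by
    intro v
    rw [hfK _ (vertical_ne_zero one_ne_zero v)]
    rw [show (1 : ℂ) + (((1 : ℝ) : ℂ) + v * I) = (2 : ℝ) + v * I by push_cast; ring]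
  have hL : ∀ v : ℝ, f (1 + (((-1 - δ : ℝ) : ℂ) + v * I)) * cauchyKernel (((-1 - δ : ℝ) : ℂ) + v * I) =
      LFunction χ ((-δ : ℝ) + v * I) * logKernel N ((-δ : ℝ) + v * I - s) := by
    intro v
    rw [hfK _ (vertical_ne_zero (by linarith) v)]
    rw [show (1 : ℂ) + (((-1 - δ : ℝ) : ℂ) + v * I) = (-δ : ℝ) + v * I by push_cast; ring]
  simp_rw [hR, hL] at hcauchy
  have hS := hasSum_logGauss χ hN0 hs0
  set IR := ∫ v : ℝ, LFunction χ ((2 : ℝ) + v * I) * logKernel N ((2 : ℝ) + v * I - s) with hIR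
  set IL := ∫ v : ℝ, LFunction χ ((-δ : ℝ) + v * I) * logKernel N ((-δ : ℝ) + v * I - s) with hIL
  have hπ : (√Real.pi : ℂ) ≠ 0 := by
    rw [Ne, ofReal_eq_zero, Real.sqrt_eq_zero Real.pi_pos.le]; exact Real.pi_ne_zero
  have hπ1 : 1 ≤ √Real.pi := Real.one_le_sqrt.2 (by linarith [Real.pi_gt_three])
  refine ⟨IR / √Real.pi, ?_, ?_⟩
  · have := hS.div_const (√Real.pi : ℂ)
    simpa only [mul_div_cancel_left₀ _ hπ] using this
  have hf1 : ‖f 1‖ ≤ ‖entireL χ 1‖ * (N ^ (1 - s.re) * Real.exp (-s.im ^ 2)) * Real.exp 1 := by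
    simp only [hf]
    rw [norm_mul, norm_mul, Complex.norm_exp, Complex.norm_exp, mul_assoc, re_ofReal_mul, sub_re, one_re,
      Real.rpow_def_of_pos hN0, mul_assoc, ← Real.exp_add (-s.im ^ 2)]
    gcongr
    simp only [mul_re, sub_re, one_re, sub_im, one_im, mul_im, re_ofNat, im_ofNat]
    nlinarith
  have hIL' : ‖IL‖ ≤ C₁ * 6 * Real.exp 9 * (N ^ (-s.re) * (q * (|s.im| + 2)) ^ (1 / 2 : ℝ) / δ) * K₀ := by
    refine integral_shifted_gaussian_le (t := s.im) (by positivity) fun v => ?_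
    rw [norm_mul, norm_logKernel]
    have hq1 := one_le_natCast_level q
    have h1 := hleft q χ δ ((-δ : ℝ) + v * I) hδ hδ2 hqδ (by simp)
    rw [show ((-δ : ℝ) + v * I : ℂ).im = v by simp] at h1
    have hv : |v| + 2 ≤ (|s.im| + 2) * (1 + |v - s.im|) := by
      have : |v| ≤ |s.im| + |v - s.im| := by
        have := abs_add_le s.im (v - s.im); simpa using this
      have h2 := abs_nonneg s.im
      have h3 := abs_nonneg (v - s.im)
      nlinarith
    have hv1 : 1 ≤ 1 + |v - s.im| := by linarith [abs_nonneg (v - s.im)]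
    have h2 : (q * (|v| + 2)) ^ (1 / 2 : ℝ) * (|v| + 2) ^ δ ≤
        (q * (|s.im| + 2)) ^ (1 / 2 : ℝ) * 3 * (1 + |v - s.im|) := by
      calc (q * (|v| + 2)) ^ (1 / 2 : ℝ) * (|v| + 2) ^ δ
          ≤ (q * ((|s.im| + 2) * (1 + |v - s.im|))) ^ (1 / 2 : ℝ) *
            ((|s.im| + 2) * (1 + |v - s.im|)) ^ δ := by gcongr
        _ = (q * (|s.im| + 2)) ^ (1 / 2 : ℝ) * (|s.im| + 2) ^ δ *
            ((1 + |v - s.im|) ^ (1 / 2 : ℝ) * (1 + |v - s.im|) ^ δ) := by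
            rw [← mul_assoc (q : ℝ),
              Real.mul_rpow (x := q * (|s.im| + 2)) (y := 1 + |v - s.im|) (by positivity) (by positivity),
              Real.mul_rpow (x := |s.im| + 2) (y := 1 + |v - s.im|) (by positivity) (by positivity)]
            ring
        _ ≤ (q * (|s.im| + 2)) ^ (1 / 2 : ℝ) * 3 * (1 + |v - s.im|) := by
            gcongr
            rw [← Real.rpow_add (by linarith)]
            exact (Real.rpow_le_rpow_of_exponent_le hv1 (by linarith)).trans_eq (Real.rpow_one _)
    have h3 : 1 + 1 / δ ≤ 2 / δ := by
      rw [show 2 / δ = 1 / δ + 1 / δ by ring]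
      have : 1 ≤ 1 / δ := by rw [le_div_iff₀ hδ]; linarith
      linarith
    have h4 : Real.exp (Real.log N * ((-δ : ℝ) + v * I - s : ℂ).re + ((-δ : ℝ) + v * I - s : ℂ).re ^ 2) ≤
        N ^ (-s.re) * Real.exp 9 := by
      rw [show ((-δ : ℝ) + v * I - s : ℂ).re = -δ - s.re by simp, Real.exp_add,
        ← Real.rpow_def_of_pos hN0]
      exact mul_le_mul (Real.rpow_le_rpow_of_exponent_le hN (by linarith))
        (Real.exp_le_exp.2 (by nlinarith)) (by positivity) (by positivity)
    have h5 : ((-δ : ℝ) + v * I - s : ℂ).im = v - s.im := by simp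
    rw [h5]
    calc _ ≤ (C₁ * (q * (|v| + 2)) ^ (1 / 2 : ℝ) * (|v| + 2) ^ δ * (1 + 1 / δ)) *
          (N ^ (-s.re) * Real.exp 9 * Real.exp (-(v - s.im) ^ 2)) := by gcongr
      _ = C₁ * ((q * (|v| + 2)) ^ (1 / 2 : ℝ) * (|v| + 2) ^ δ) * (1 + 1 / δ) *
          (N ^ (-s.re) * Real.exp 9 * Real.exp (-(v - s.im) ^ 2)) := by ring
      _ ≤ C₁ * ((q * (|s.im| + 2)) ^ (1 / 2 : ℝ) * 3 * (1 + |v - s.im|)) * (2 / δ) *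
          (N ^ (-s.re) * Real.exp 9 * Real.exp (-(v - s.im) ^ 2)) := by gcongr
      _ = _ := by ring
  have hIR' : IR = 2 * Real.pi * f 1 + IL := by rw [hcauchy]; ring
  rw [norm_div, norm_real, Real.norm_of_nonneg (by positivity)]
  refine (div_le_self (norm_nonneg _) hπ1).trans ?_
  rw [hIR']
  refine (norm_add_le _ _).trans ?_
  rw [norm_mul, norm_mul, norm_real, Real.norm_of_nonneg Real.pi_pos.le, RCLike.norm_ofNat]
  have p1 : 0 ≤ ‖entireL χ 1‖ * (N ^ (1 - s.re) * Real.exp (-s.im ^ 2)) := by positivity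
  have p2 : 0 ≤ N ^ (-s.re) * (q * (|s.im| + 2)) ^ (1 / 2 : ℝ) / δ := by positivity
  generalize ‖entireL χ 1‖ * (N ^ (1 - s.re) * Real.exp (-s.im ^ 2)) = x at *
  generalize N ^ (-s.re) * (q * (|s.im| + 2)) ^ (1 / 2 : ℝ) / δ = y at *
  calc 2 * Real.pi * ‖f 1‖ + ‖IL‖ ≤ 2 * Real.pi * (x * Real.exp 1) + C₁ * 6 * Real.exp 9 * y * K₀ := by
        gcongr
    _ ≤ _ := by
        have q1 : 0 ≤ 2 * Real.pi * Real.exp 1 * y := by positivity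
        have q2 : 0 ≤ C₁ * 6 * Real.exp 9 * K₀ * x := by positivity
        nlinarith

end ZeroDensity

namespace ZeroDensity
open Complex MeasureTheory Set Filter Topology DirichletCharacter

lemma conj_natCast_cpow (n : ℕ) (s : ℂ) :
    (starRingEnd ℂ) ((n : ℂ) ^ s) = (n : ℂ) ^ (starRingEnd ℂ) s := by
  have h : (n : ℂ).arg ≠ Real.pi := by
    rw [← ofReal_natCast, arg_ofReal_of_nonneg n.cast_nonneg]
    exact Real.pi_pos.ne
  have := conj_cpow (n : ℂ) s h
  rw [Complex.conj_natCast] at this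
  rw [cpow_conj (n : ℂ) s h, Complex.conj_natCast]

lemma twist_mul_conj {q : ℕ} (χ ψ : DirichletCharacter ℂ q) {s w : ℂ} (hs : s.re ≠ 0)
    (hsw : (s + (starRingEnd ℂ) w).re ≠ 0) (n : ℕ) :
    (χ n * (n : ℂ) ^ (-s)) * (starRingEnd ℂ) (ψ n * (n : ℂ) ^ (-w)) =
      (χ * ψ⁻¹) n * (n : ℂ) ^ (-(s + (starRingEnd ℂ) w)) := by
  rcases Nat.eq_zero_or_pos n with rfl | hn
  · have h1 : -s ≠ 0 := fun h => hs (by rw [neg_eq_zero.1 h]; simp)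
    have h2 : -(s + (starRingEnd ℂ) w) ≠ 0 := fun h => hsw (by rw [neg_eq_zero.1 h]; simp)
    rw [Nat.cast_zero, Nat.cast_zero, zero_cpow h1, zero_cpow h2]; simp
  · have hn0 : (n : ℂ) ≠ 0 := Nat.cast_ne_zero.2 hn.ne'
    have h1 : (starRingEnd ℂ) (ψ n) = ψ⁻¹ n := by
      rw [starRingEnd_apply, MulChar.star_apply']
    rw [map_mul, conj_natCast_cpow, map_neg, h1, neg_add, cpow_add _ _ hn0, MulChar.mul_apply]
    ring

/-- The weight attached to a family of scales. -/
noncomputable def scaleWeight (J : Finset ℕ) (N u : ℕ → ℝ) (n : ℕ) : ℝ :=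
  ∑ j ∈ J, u j * N j * logGauss (N j) n

lemma duality_bound {ι : Type*} (R : Finset ι) (S : Finset ℕ) (c : ℕ → ℂ) (g : ι → ℕ → ℂ)
    (β : ℕ → ℝ) (hβ : ∀ n, 0 ≤ β n) (hβS : ∀ n ∈ S, 0 < β n) (B : ι → ι → ℂ)
    (hB : ∀ r ∈ R, ∀ r' ∈ R,
      HasSum (fun n => g r n * (starRingEnd ℂ) (g r' n) * β n) (B r r')) :
    (∑ r ∈ R, ‖∑ n ∈ S, c n * g r n‖) ^ 2 ≤
      (∑ n ∈ S, ‖c n‖ ^ 2 / β n) * ∑ r ∈ R, ∑ r' ∈ R, ‖B r r'‖ := by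
  have hη : ∀ z : ℂ, ∃ η : ℂ, ‖η‖ ≤ 1 ∧ η * z = ‖z‖ := by
    intro z
    rcases eq_or_ne z 0 with rfl | hz
    · exact ⟨0, by simp, by simp⟩
    · refine ⟨‖z‖ / z, ?_, by field_simp⟩
      rw [norm_div, norm_real, norm_norm, div_self (norm_ne_zero_iff.2 hz)]
  choose η hη1 hη2 using hη
  set e : ι → ℂ := fun r => η (∑ n ∈ S, c n * g r n) with he
  set G : ℕ → ℂ := fun n => ∑ r ∈ R, e r * g r n with hG
  have hsum : HasSum (fun n => ((‖G n‖ ^ 2 * β n : ℝ) : ℂ))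
      (∑ r ∈ R, ∑ r' ∈ R, e r * (starRingEnd ℂ) (e r') * B r r') := by
    have h := hasSum_sum fun r hr => hasSum_sum fun r' hr' =>
      (hB r hr r' hr').mul_left (e r * (starRingEnd ℂ) (e r'))
    refine Eq.mp (congrArg (HasSum · _) (funext fun n => ?_)) h
    have : ((‖G n‖ ^ 2 * β n : ℝ) : ℂ) = G n * (starRingEnd ℂ) (G n) * β n := by
      rw [mul_conj, normSq_eq_norm_sq]; push_cast; ring
    rw [this]
    simp only [hG]
    rw [map_sum, Finset.sum_mul_sum, Finset.sum_mul]
    refine Finset.sum_congr rfl fun r _ => ?_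
    rw [Finset.sum_mul]
    refine Finset.sum_congr rfl fun r' _ => ?_
    rw [map_mul]; ring
  have hle : ∑ n ∈ S, ‖G n‖ ^ 2 * β n ≤ ∑ r ∈ R, ∑ r' ∈ R, ‖B r r'‖ := by
    have h1 := Complex.hasSum_re hsum
    simp only [ofReal_re] at h1
    refine (sum_le_hasSum S (fun n _ => mul_nonneg (by positivity) (hβ n)) h1).trans ?_
    refine (re_le_norm _).trans ((norm_sum_le _ _).trans (Finset.sum_le_sum fun r _ =>
      (norm_sum_le _ _).trans (Finset.sum_le_sum fun r' _ => ?_)))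
    rw [norm_mul, norm_mul, RCLike.norm_conj]
    calc _ ≤ 1 * 1 * ‖B r r'‖ := by
          gcongr
          · exact hη1 _
          · exact hη1 _
      _ = _ := by ring
  have hlin : ((∑ r ∈ R, ‖∑ n ∈ S, c n * g r n‖ : ℝ) : ℂ) = ∑ n ∈ S, c n * G n := by
    push_cast
    rw [Finset.sum_congr rfl fun r _ => (hη2 (∑ n ∈ S, c n * g r n)).symm]
    simp only [hG, Finset.mul_sum]
    rw [Finset.sum_comm]
    refine Finset.sum_congr rfl fun n _ => Finset.sum_congr rfl fun r _ => ?_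
    simp only [he]; ring
  have hle2 : ∑ r ∈ R, ‖∑ n ∈ S, c n * g r n‖ ≤ ∑ n ∈ S, ‖c n‖ * ‖G n‖ := by
    have h1 := congrArg norm hlin
    rw [norm_real, Real.norm_of_nonneg (Finset.sum_nonneg fun _ _ => norm_nonneg _)] at h1
    rw [h1]
    exact (norm_sum_le _ _).trans_eq (Finset.sum_congr rfl fun n _ => norm_mul _ _)
  calc (∑ r ∈ R, ‖∑ n ∈ S, c n * g r n‖) ^ 2 ≤ (∑ n ∈ S, ‖c n‖ * ‖G n‖) ^ 2 := by gcongr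
    _ = (∑ n ∈ S, (‖c n‖ / √(β n)) * (‖G n‖ * √(β n))) ^ 2 := by
        congr 1
        refine Finset.sum_congr rfl fun n hn => ?_
        have := (Real.sqrt_pos.2 (hβS n hn)).ne'
        field_simp
    _ ≤ (∑ n ∈ S, (‖c n‖ / √(β n)) ^ 2) * ∑ n ∈ S, (‖G n‖ * √(β n)) ^ 2 :=
        Finset.sum_mul_sq_le_sq_mul_sq _ _ _
    _ = (∑ n ∈ S, ‖c n‖ ^ 2 / β n) * ∑ n ∈ S, ‖G n‖ ^ 2 * β n := by
        simp only [div_pow, mul_pow, Real.sq_sqrt (hβ _)]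
    _ ≤ _ := mul_le_mul_of_nonneg_left hle
        (Finset.sum_nonneg fun n _ => div_nonneg (by positivity) (hβ n))

open scoped Classical in
/-- A mean value estimate of Halász–Montgomery type for well-spaced points. -/
theorem exists_large_values_bound : ∃ C : ℝ, 0 < C ∧ ∀ (q : ℕ) [NeZero q] {ι : Type}
    (R : Finset ι) (χ : ι → DirichletCharacter ℂ q) (s : ι → ℂ) (σ H δ P : ℝ), 1 / 2 ≤ σ →
    (∀ r ∈ R, σ ≤ (s r).re ∧ (s r).re ≤ 1 ∧ |(s r).im| ≤ H) →
    (∀ r ∈ R, ∑ r' ∈ R with χ r' = χ r, Real.exp (-((s r).im - (s r').im) ^ 2) ≤ P) →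
    0 < δ → δ ≤ 1 / 2 → (q : ℝ) ^ δ ≤ 3 → (2 * H + 2) ^ δ ≤ 3 →
    ∀ (J : Finset ℕ) (N u : ℕ → ℝ), (∀ j ∈ J, 1 ≤ N j) → (∀ j ∈ J, 0 ≤ u j) →
    ∀ (S : Finset ℕ) (c : ℕ → ℂ), (∀ n ∈ S, 0 < scaleWeight J N u n) →
    (∑ r ∈ R, ‖∑ n ∈ S, c n * (χ r n * (n : ℂ) ^ (-s r))‖) ^ 2 ≤
      C * (∑ n ∈ S, ‖c n‖ ^ 2 / scaleWeight J N u n) *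
      (R.card * P * (∑ j ∈ J, u j * N j ^ (2 - 2 * σ)) +
        (R.card : ℝ) ^ 2 * ((q * (2 * H + 2)) ^ (1 / 2 : ℝ) / δ) *
          ∑ j ∈ J, u j * N j ^ (1 - 2 * σ)) := by
  obtain ⟨C, hC, hb⟩ := exists_logGauss_sum_le
  refine ⟨C, hC, fun q _ ι R χ s σ H δ P hσ hs hP hδ hδ2 hqδ hHδ J N u hN hu S c hS => ?_⟩
  have hpair : ∀ r ∈ R, ∀ r' ∈ R, ∃ B : ℂ,
      HasSum (fun n : ℕ => (χ r n * (n : ℂ) ^ (-s r)) * (starRingEnd ℂ) (χ r' n * (n : ℂ) ^ (-s r')) *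
        scaleWeight J N u n) B ∧ ‖B‖ ≤ C * ((if χ r' = χ r then
          Real.exp (-((s r).im - (s r').im) ^ 2) else 0) * (∑ j ∈ J, u j * N j ^ (2 - 2 * σ)) +
        (q * (2 * H + 2)) ^ (1 / 2 : ℝ) / δ * ∑ j ∈ J, u j * N j ^ (1 - 2 * σ)) := by
    intro r hr r' hr'
    obtain ⟨a1, a2, a3⟩ := hs r hr
    obtain ⟨b1, b2, b3⟩ := hs r' hr'
    set w := s r + (starRingEnd ℂ) (s r') with hw
    have hwre : w.re = (s r).re + (s r').re := by simp [hw]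
    have hwim : w.im = (s r).im - (s r').im := by simp [hw]; ring
    have hwabs : |w.im| ≤ 2 * H := by
      rw [hwim]; exact (abs_sub _ _).trans (by linarith)
    have hH : 0 ≤ H := (abs_nonneg _).trans a3
    have hj : ∀ j ∈ J, ∃ B : ℂ, HasSum (fun n : ℕ => (χ r * (χ r')⁻¹) n *
        ((n : ℂ) ^ (-w) * logGauss (N j) n)) B ∧
        ‖B‖ ≤ C * (‖entireL (χ r * (χ r')⁻¹) 1‖ * (N j ^ (1 - w.re) * Real.exp (-w.im ^ 2)) +
          N j ^ (-w.re) * (q * (|w.im| + 2)) ^ (1 / 2 : ℝ) / δ) := fun j hj =>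
      hb q (χ r * (χ r')⁻¹) w (N j) δ (by rw [hwre]; linarith) (by rw [hwre]; linarith) (hN j hj) hδ
        hδ2 hqδ ((Real.rpow_le_rpow (by positivity) (by linarith) hδ.le).trans hHδ)
    choose! B hB1 hB2 using hj
    refine ⟨∑ j ∈ J, (u j * N j : ℝ) * B j, ?_, ?_⟩
    · have h := hasSum_sum fun j hj => (hB1 j hj).mul_left ((u j * N j : ℝ) : ℂ)
      refine Eq.mp (congrArg (HasSum · _) (funext fun n => ?_)) h
      rw [twist_mul_conj (χ r) (χ r') (by linarith) (by rw [← hw, hwre]; linarith), scaleWeight,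
        ofReal_sum, Finset.mul_sum]
      refine Finset.sum_congr rfl fun j _ => ?_
      push_cast; ring
    · refine (norm_sum_le _ _).trans ?_
      rw [Finset.mul_sum, Finset.mul_sum, ← Finset.sum_add_distrib, Finset.mul_sum]
      refine Finset.sum_le_sum fun j hj => ?_
      have hNj := hN j hj
      have hN0 : 0 < N j := by linarith
      have huj := hu j hj
      rw [norm_mul, norm_real, Real.norm_of_nonneg (by positivity)]
      have e1 : ‖entireL (χ r * (χ r')⁻¹) 1‖ * Real.exp (-w.im ^ 2) ≤
          if χ r' = χ r then Real.exp (-((s r).im - (s r').im) ^ 2) else 0 := by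
        split_ifs with h
        · rw [← hwim]
          exact mul_le_of_le_one_left (Real.exp_nonneg _) (norm_entireL_one_le _)
        · have : χ r * (χ r')⁻¹ ≠ 1 := fun h' => h (mul_inv_eq_one.1 h').symm
          rw [entireL_one_of_ne this]; simp
      have e2 : N j * N j ^ (1 - w.re) ≤ N j ^ (2 - 2 * σ) := by
        nth_rewrite 1 [← Real.rpow_one (N j)]
        rw [← Real.rpow_add hN0]
        exact Real.rpow_le_rpow_of_exponent_le hNj (by linarith)
      have e3 : N j * N j ^ (-w.re) ≤ N j ^ (1 - 2 * σ) := by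
        nth_rewrite 1 [← Real.rpow_one (N j)]
        rw [← Real.rpow_add hN0]
        exact Real.rpow_le_rpow_of_exponent_le hNj (by linarith)
      have e4 : (q * (|w.im| + 2) : ℝ) ^ (1 / 2 : ℝ) ≤ (q * (2 * H + 2)) ^ (1 / 2 : ℝ) := by gcongr
      calc u j * N j * ‖B j‖ ≤ u j * N j * (C * (‖entireL (χ r * (χ r')⁻¹) 1‖ *
            (N j ^ (1 - w.re) * Real.exp (-w.im ^ 2)) +
            N j ^ (-w.re) * (q * (|w.im| + 2)) ^ (1 / 2 : ℝ) / δ)) := by gcongr; exact hB2 j hj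
        _ = C * ((‖entireL (χ r * (χ r')⁻¹) 1‖ * Real.exp (-w.im ^ 2)) *
            (u j * (N j * N j ^ (1 - w.re))) +
            (q * (|w.im| + 2)) ^ (1 / 2 : ℝ) / δ * (u j * (N j * N j ^ (-w.re)))) := by ring
        _ ≤ _ := by
            gcongr
  choose! B hB1 hB2 using hpair
  have hw0 : ∀ n, 0 ≤ scaleWeight J N u n := fun n => Finset.sum_nonneg fun j hj =>
    mul_nonneg (mul_nonneg (hu j hj) (by linarith [hN j hj])) (logGauss_pos _ _).le
  refine (duality_bound R S c (fun r n => χ r n * (n : ℂ) ^ (-s r)) (scaleWeight J N u) hw0 hS B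
    hB1).trans ?_
  rw [mul_comm C, mul_assoc _ C]
  refine mul_le_mul_of_nonneg_left ?_
    (Finset.sum_nonneg fun n _ => div_nonneg (by positivity) (hw0 n))
  have hA : 0 ≤ ∑ j ∈ J, u j * N j ^ (2 - 2 * σ) := Finset.sum_nonneg fun j hj =>
    mul_nonneg (hu j hj) (Real.rpow_nonneg (by linarith [hN j hj]) _)
  calc ∑ r ∈ R, ∑ r' ∈ R, ‖B r r'‖ ≤ ∑ r ∈ R, C * (P * (∑ j ∈ J, u j * N j ^ (2 - 2 * σ)) +
        R.card * ((q * (2 * H + 2)) ^ (1 / 2 : ℝ) / δ * ∑ j ∈ J, u j * N j ^ (1 - 2 * σ))) := by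
        refine Finset.sum_le_sum fun r hr => (Finset.sum_le_sum fun r' hr' =>
          hB2 r hr r' hr').trans ?_
        rw [← Finset.mul_sum, Finset.sum_add_distrib, ← Finset.sum_mul, Finset.sum_const,
          nsmul_eq_mul, ← Finset.sum_filter]
        gcongr
        exact hP r hr
    _ = _ := by
        rw [Finset.sum_const, nsmul_eq_mul]; ring

end ZeroDensity

namespace ZeroDensity
open Complex MeasureTheory Set Filter Topology DirichletCharacter

/-- The Möbius function cut off above `X`. -/
noncomputable def mobCut (X : ℝ) (n : ℕ) : ℝ :=
  if (n : ℝ) ≤ X then (ArithmeticFunction.moebius n : ℝ) else 0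

lemma abs_mobCut_le (X : ℝ) (n : ℕ) : |mobCut X n| ≤ 1 := by
  unfold mobCut
  split_ifs
  · exact_mod_cast ArithmeticFunction.abs_moebius_le_one (n := n)
  · simp

lemma mobCut_zero (X : ℝ) : mobCut X 0 = 0 := by simp [mobCut]

lemma mobCut_eq_zero {X : ℝ} {n : ℕ} (hn : n ∉ Finset.Icc 1 ⌊X⌋₊) : mobCut X n = 0 := by
  rcases Nat.eq_zero_or_pos n with rfl | h
  · exact mobCut_zero X
  · rw [mobCut, if_neg]
    intro h'
    exact hn (Finset.mem_Icc.2 ⟨h, Nat.le_floor h'⟩)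

/-- The Dirichlet polynomial approximating `1 / L(s, χ)`. -/
noncomputable def mollifier {q : ℕ} (χ : DirichletCharacter ℂ q) (X : ℝ) : ℂ → ℂ :=
  LSeries fun n => (mobCut X n : ℂ) * χ n

lemma mobCoeff_eq_zero {q : ℕ} (χ : DirichletCharacter ℂ q) (X : ℝ) :
    ∀ n ∉ Finset.Icc 1 ⌊X⌋₊, (mobCut X n : ℂ) * χ n = 0 := fun n hn => by
  rw [mobCut_eq_zero hn]; simp

lemma differentiable_mollifier {q : ℕ} (χ : DirichletCharacter ℂ q) (X : ℝ) :
    Differentiable ℂ (mollifier χ X) :=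
  differentiable_LSeries_of_finite (mobCoeff_eq_zero χ X)

lemma norm_mollifier_le {q : ℕ} (χ : DirichletCharacter ℂ q) (X : ℝ) :
    ∃ M : ℝ, 0 ≤ M ∧ ∀ s : ℂ, 0 ≤ s.re → ‖mollifier χ X s‖ ≤ M :=
  ⟨_, Finset.sum_nonneg fun _ _ => norm_nonneg _,
    fun _ hs => norm_LSeries_of_finite_le (mobCoeff_eq_zero χ X) hs⟩

lemma mollifier_eq_sum {q : ℕ} (χ : DirichletCharacter ℂ q) (X : ℝ) (s : ℂ) :
    mollifier χ X s = ∑ n ∈ Finset.Icc 1 ⌊X⌋₊, (mobCut X n : ℂ) * (χ n * (n : ℂ) ^ (-s)) := by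
  rw [mollifier, LSeries_eq_sum (mobCoeff_eq_zero χ X)]
  refine Finset.sum_congr rfl fun n hn => ?_
  rw [LSeries.term_of_ne_zero (by have := (Finset.mem_Icc.1 hn).1; omega), cpow_neg, div_eq_mul_inv,
    mul_assoc]

/-- The coefficients of the mollified Dirichlet series. -/
noncomputable def detCoeff (X : ℝ) (n : ℕ) : ℝ := ∑ p ∈ n.divisorsAntidiagonal, mobCut X p.2

lemma abs_detCoeff_le (X : ℝ) (n : ℕ) : |detCoeff X n| ≤ tau n := by
  rw [detCoeff, tau_eq_sum]
  exact (Finset.abs_sum_le_sum_abs _ _).trans (Finset.sum_le_sum fun p _ => abs_mobCut_le _ _)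

lemma detCoeff_one {X : ℝ} (hX : 1 ≤ X) : detCoeff X 1 = 1 := by
  simp [detCoeff, mobCut, hX]

lemma detCoeff_eq_zero {X : ℝ} {n : ℕ} (hn : 1 < n) (hX : (n : ℝ) ≤ X) : detCoeff X n = 0 := by
  have h := congrArg (fun f : ArithmeticFunction ℤ => f n) ArithmeticFunction.coe_zeta_mul_moebius
  simp only [ArithmeticFunction.mul_apply, ArithmeticFunction.one_apply_ne hn.ne'] at h
  rw [detCoeff]
  have h2 : ∑ p ∈ n.divisorsAntidiagonal, mobCut X p.2 = ((∑ p ∈ n.divisorsAntidiagonal,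
      ((ArithmeticFunction.zeta : ArithmeticFunction ℤ) p.1) * ArithmeticFunction.moebius p.2 : ℤ) : ℝ) := by
    push_cast
    refine Finset.sum_congr rfl fun p hp => ?_
    obtain ⟨h1, h2⟩ := Nat.mem_divisorsAntidiagonal.1 hp
    have hp1 : p.1 ≠ 0 := by rintro h0; rw [h0, zero_mul] at h1; exact h2 h1.symm
    have hp2 : p.2 ≤ n := Nat.le_of_dvd (by omega) ⟨p.1, by rw [← h1, mul_comm]⟩
    rw [mobCut, if_pos ((Nat.cast_le.2 hp2).trans hX)]
    simp [ArithmeticFunction.zeta_apply, hp1]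
  rw [h2, h]; simp

lemma LFunction_mul_mollifier {q : ℕ} [NeZero q] (χ : DirichletCharacter ℂ q) (X : ℝ) {s : ℂ}
    (hs : 1 < s.re) :
    LFunction χ s * mollifier χ X s = LSeries (fun n => (detCoeff X n : ℂ) * χ n) s := by
  have h : LSeries.convolution (fun n => χ n) (fun n => (mobCut X n : ℂ) * χ n) =
      fun n => (detCoeff X n : ℂ) * χ n := by
    funext n
    rw [LSeries.convolution_def]
    simp only
    rw [detCoeff, ofReal_sum, Finset.sum_mul]
    refine Finset.sum_congr rfl fun p hp => ?_
    rw [← (Nat.mem_divisorsAntidiagonal.1 hp).1, Nat.cast_mul, map_mul]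
    ring
  rw [LFunction_eq_LSeries χ hs, mollifier, ← h,
    ← LSeries_convolution' (LSeriesSummable_of_one_lt_re χ hs)
      (LSeriesSummable_of_finite (mobCoeff_eq_zero χ X) s)]

/-- The kernel `w ^ i * exp (w ^ 2) / w` for `i ∈ {0, 1}`. -/
noncomputable def detKernel (i : Bool) (w : ℂ) : ℂ := if i then w * cauchyKernel w else cauchyKernel w

lemma norm_detKernel_le (i : Bool) {c : ℝ} (hc : |c| = 1) (v : ℝ) :
    ‖detKernel i (c + v * I)‖ ≤ Real.exp 1 * Real.exp (-v ^ 2) := by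
  have hc0 : c ≠ 0 := by rintro rfl; simp at hc
  have hc2 : c ^ 2 = 1 := by rw [← sq_abs, hc]; norm_num
  cases i
  · have := norm_cauchyKernel_le hc0 v
    rw [hc, hc2, div_one] at this
    simpa [detKernel] using this
  · have h0 := vertical_ne_zero hc0 v
    simp only [detKernel, if_true, cauchyKernel]
    rw [mul_div_cancel₀ _ h0, norm_exp_sq_vertical, ← Real.exp_add, hc2]
    rfl

lemma continuous_detKernel (i : Bool) {c : ℝ} (hc : c ≠ 0) :
    Continuous fun v : ℝ => detKernel i (c + v * I) := by
  have h := continuous_cauchyKernel_vertical hc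
  cases i
  · simpa [detKernel] using h
  · simp only [detKernel, if_true]; fun_prop

/-- The cutoff functions of the zero detecting sums. -/
noncomputable def cutoff (i : Bool) (y : ℝ) : ℂ :=
  (2 * Real.pi : ℂ)⁻¹ * ∫ v : ℝ, cexp (Real.log y * ((1 : ℝ) + v * I)) * detKernel i ((1 : ℝ) + v * I)

lemma integrable_exp_neg_sq : Integrable fun v : ℝ => Real.exp (-v ^ 2) := by
  simpa using integrable_exp_neg_mul_sq (b := 1) one_pos

lemma norm_line_integral_le (i : Bool) {c y : ℝ} (hc : |c| = 1) (hy : 0 < y) :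
    ‖(2 * Real.pi : ℂ)⁻¹ * ∫ v : ℝ, cexp (Real.log y * (c + v * I)) * detKernel i (c + v * I)‖ ≤
      y ^ c := by
  have hb : ∀ v : ℝ, ‖cexp (Real.log y * (c + v * I)) * detKernel i (c + v * I)‖ ≤
      y ^ c * Real.exp 1 * Real.exp (-v ^ 2) := by
    intro v
    rw [norm_mul, Complex.norm_exp, re_ofReal_mul, Real.rpow_def_of_pos hy,
      show (c + v * I : ℂ).re = c by simp, mul_assoc]
    gcongr
    exact norm_detKernel_le i hc v
  have h := norm_integral_le_of_norm_le (integrable_exp_neg_sq.const_mul _) (ae_of_all _ hb)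
  have hg : ∫ v : ℝ, Real.exp (-v ^ 2) = √Real.pi := by simpa using integral_gaussian 1
  rw [integral_const_mul, hg] at h
  rw [norm_mul, norm_inv, norm_mul, norm_real, Real.norm_of_nonneg Real.pi_pos.le, RCLike.norm_ofNat]
  have hpi : Real.exp 1 * √Real.pi ≤ 2 * Real.pi := by
    have h1 : √Real.pi ^ 2 = Real.pi := Real.sq_sqrt Real.pi_pos.le
    have h2 : (3 / 2 : ℝ) ≤ √Real.pi := Real.le_sqrt_of_sq_le (by linarith [Real.pi_gt_three])
    have h3 := Real.exp_one_lt_d9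
    nlinarith
  have hy' := Real.rpow_nonneg hy.le c
  calc _ ≤ (2 * Real.pi)⁻¹ * (y ^ c * Real.exp 1 * √Real.pi) := by gcongr
    _ = y ^ c * ((Real.exp 1 * √Real.pi) / (2 * Real.pi)) := by ring
    _ ≤ y ^ c * 1 := by
        gcongr
        rw [div_le_one (by positivity)]; exact hpi
    _ = _ := mul_one _

lemma norm_cutoff_le (i : Bool) {y : ℝ} (hy : 0 < y) : ‖cutoff i y‖ ≤ y := by
  have := norm_line_integral_le i (c := 1) (by simp) hy
  rwa [Real.rpow_one] at this

lemma norm_cutoff_sub_le (i : Bool) {y : ℝ} (hy : 0 < y) :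
    ‖cutoff i y - (if i then 0 else 1)‖ ≤ y⁻¹ := by
  have h := norm_line_integral_le i (c := -1) (by simp) hy
  rw [Real.rpow_neg_one] at h
  refine le_trans (le_of_eq (congrArg norm ?_)) h
  have hbd : ∀ z : ℂ, -1 ≤ z.re → z.re ≤ 1 → ‖cexp (Real.log y * z)‖ ≤ Real.exp |Real.log y| := by
    intro z h1 h2
    rw [Complex.norm_exp, re_ofReal_mul]
    refine Real.exp_le_exp.2 ((le_abs_self _).trans ?_)
    rw [abs_mul]
    exact mul_le_of_le_one_right (abs_nonneg _) (abs_le.2 ⟨h1, h2⟩)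
  have hpi : (2 * Real.pi : ℂ) ≠ 0 := by
    simp [Real.pi_ne_zero]
  cases i
  · have hc := strip_cauchy (f := fun z => cexp (Real.log y * z)) (s := 0) (a := -1) (b := 1)
      (A := 0) (C := Real.exp |Real.log y|) (by norm_num) one_pos (fun z _ _ => by fun_prop)
      (fun z h1 h2 => by rw [zero_mul, Real.exp_zero, mul_one, zero_add]; exact hbd z h1 h2)
    simp only [zero_add, mul_zero, Complex.exp_zero, mul_one] at hc
    simp only [cutoff, detKernel, Bool.false_eq_true, if_false]
    rw [sub_eq_iff_eq_add]
    linear_combination inv_mul_cancel₀ hpi - (2 * Real.pi : ℂ)⁻¹ * hc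
  · have hc := integral_vertical_line_eq (g := fun z => cexp (Real.log y * z) * cexp (z ^ 2))
      (a := -1) (b := 1) (C := Real.exp |Real.log y| * (Real.exp 1 * Real.exp ((0 + 1) ^ 2 / 4)))
      (by norm_num) (fun z _ _ => by fun_prop) (fun z h1 h2 => by
        have e := exp_mul_sub_sq_le 0 z.im
        rw [norm_mul, mul_assoc]
        refine mul_le_mul (hbd z h1 h2) ?_ (norm_nonneg _) (Real.exp_nonneg _)
        have hz := norm_exp_sq_vertical z.re z.im
        rw [re_add_im] at hz
        rw [hz, mul_assoc, sub_eq_add_neg, Real.exp_add]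
        refine mul_le_mul (Real.exp_le_exp.2 ?_) ?_ (Real.exp_nonneg _) (Real.exp_nonneg _)
        · rw [← sq_abs]
          have := abs_le.2 ⟨h1, h2⟩
          nlinarith [abs_nonneg z.re]
        · simpa using e)
    have hk : ∀ z : ℂ, z ≠ 0 → z * cauchyKernel z = cexp (z ^ 2) := fun z hz => by
      rw [cauchyKernel, mul_div_cancel₀ _ hz]
    simp only [cutoff, detKernel, if_true, sub_zero]
    simp_rw [hk _ (vertical_ne_zero one_ne_zero _),
      hk _ (vertical_ne_zero (neg_ne_zero.2 (one_ne_zero (α := ℝ))) _), hc]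

lemma norm_cutoff_le_min (i : Bool) {y : ℝ} (hy : 0 < y) : ‖cutoff i y‖ ≤ 2 * min 1 y := by
  rcases le_total y 1 with h | h
  · rw [min_eq_right h]; linarith [norm_cutoff_le i hy]
  · rw [min_eq_left h]
    have h1 := norm_cutoff_sub_le i hy
    have h2 : y⁻¹ ≤ 1 := inv_le_one_of_one_le₀ h
    have h3 : ‖cutoff i y‖ ≤ ‖cutoff i y - (if i then 0 else 1)‖ + ‖(if i then 0 else 1 : ℂ)‖ := by
      simpa using norm_add_le (cutoff i y - (if i then 0 else 1)) (if i then 0 else 1 : ℂ)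
    have h4 : ‖(if i then 0 else 1 : ℂ)‖ ≤ 1 := by cases i <;> simp
    linarith

end ZeroDensity

namespace ZeroDensity
open Complex MeasureTheory Set Filter Topology DirichletCharacter

lemma norm_LFunction_growth {q : ℕ} [NeZero q] {χ : DirichletCharacter ℂ q} (hχ : χ ≠ 1) :
    ∃ C : ℝ, 0 ≤ C ∧ ∀ s : ℂ, -1 ≤ s.re → s.re ≤ 2 → ‖LFunction χ s‖ ≤ C * Real.exp (3 * |s.im|) := by
  obtain ⟨K, hK⟩ := (isCompact_uIcc.reProdIm isCompact_uIcc :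
    IsCompact (uIcc (-1 : ℝ) 2 ×ℂ uIcc (-1 : ℝ) 1)).exists_bound_of_continuousOn
    (differentiable_LFunction hχ).continuous.continuousOn
  obtain ⟨C, hC, hgrow⟩ := norm_entireL_growth χ
  refine ⟨|K| + C, by positivity, fun s h1 h2 => ?_⟩
  by_cases him : |s.im| ≤ 1
  · have h3 := hK s (by
      rw [mem_reProdIm, uIcc_of_le (by norm_num), uIcc_of_le (by norm_num)]
      exact ⟨⟨h1, h2⟩, abs_le.1 him⟩)
    have h4 : 1 ≤ Real.exp (3 * |s.im|) := Real.one_le_exp (by positivity)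
    have := le_abs_self K
    nlinarith [abs_nonneg K]
  · push Not at him
    have hs1 : s ≠ 1 := by rintro rfl; simp at him; linarith
    have h3 := hgrow s h1 h2
    rw [entireL_of_ne χ hs1, norm_mul] at h3
    have h4 : 1 ≤ ‖s - 1‖ := by
      have := abs_im_le_norm (s - 1)
      rw [sub_im, one_im, sub_zero] at this
      linarith
    have h5 : 0 ≤ |K| * Real.exp (3 * |s.im|) := by positivity
    nlinarith [norm_nonneg (LFunction χ s)]

lemma exists_damped {q : ℕ} [NeZero q] (χ : DirichletCharacter ℂ q) {ρ : ℂ}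
    (h1 : χ = 1 → 1 ≤ ‖ρ - 1‖) : ∃ (θ : ℂ) (F : ℂ → ℂ) (C : ℝ), ‖θ‖ ≤ 1 ∧ Differentiable ℂ F ∧
      (∀ z, z ≠ 1 → F z = LFunction χ z * (1 + θ * (z - ρ))) ∧
      ∀ z : ℂ, -1 ≤ z.re → z.re ≤ 2 → ‖F z‖ ≤ C * Real.exp (3 * |z.im|) := by
  by_cases hχ : χ = 1
  · have h := h1 hχ
    have h0 : ρ - 1 ≠ 0 := norm_pos_iff.1 (by linarith)
    obtain ⟨C, hC, hgrow⟩ := norm_entireL_growth χ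
    refine ⟨(ρ - 1)⁻¹, fun z => entireL χ z * (ρ - 1)⁻¹, C, ?_, (differentiable_entireL χ).mul_const _,
      fun z hz => ?_, fun z hz1 hz2 => ?_⟩
    · rw [norm_inv]; exact inv_le_one_of_one_le₀ h
    · simp only
      rw [entireL_of_ne χ hz]
      field_simp
      ring
    · simp only
      rw [norm_mul, norm_inv]
      exact (mul_le_of_le_one_right (norm_nonneg _) (inv_le_one_of_one_le₀ h)).trans (hgrow z hz1 hz2)
  · obtain ⟨C, hC, hgrow⟩ := norm_LFunction_growth hχ
    exact ⟨0, LFunction χ, C, by simp, differentiable_LFunction hχ, fun z _ => by simp, hgrow⟩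

/-- The coefficients of the zero detecting sums. -/
noncomputable def cutCoeff (X Y : ℝ) (i : Bool) (n : ℕ) : ℂ := detCoeff X n * cutoff i (Y / n)

lemma norm_cutCoeff_le {X Y : ℝ} (hY : 0 < Y) (i : Bool) {n : ℕ} (hn : 0 < n) :
    ‖cutCoeff X Y i n‖ ≤ 2 * tau n * min 1 (Y / n) := by
  have hn' : (0 : ℝ) < n := Nat.cast_pos.2 hn
  rw [cutCoeff, norm_mul, norm_real, Real.norm_eq_abs]
  calc _ ≤ tau n * (2 * min 1 (Y / n)) :=
        mul_le_mul (abs_detCoeff_le X n) (norm_cutoff_le_min i (by positivity)) (norm_nonneg _)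
          (tau_nonneg n)
    _ = _ := by ring

/-- The range of summation of the zero detecting sums. -/
noncomputable def detRange (X Y : ℝ) : Finset ℕ := (Finset.Icc 1 ⌊Y ^ 5⌋₊).filter fun n => X < n

/-- The zero detecting sums. -/
noncomputable def detSum {q : ℕ} (χ : DirichletCharacter ℂ q) (X Y : ℝ) (i : Bool) (s : ℂ) : ℂ :=
  ∑ n ∈ detRange X Y, cutCoeff X Y i n * (χ n * (n : ℂ) ^ (-s))

lemma integrable_cexp_mul_detKernel (i : Bool) {y : ℝ} (hy : 0 < y) :
    Integrable fun v : ℝ => cexp (Real.log y * ((1 : ℝ) + v * I)) * detKernel i ((1 : ℝ) + v * I) := by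
  refine (integrable_exp_neg_sq.const_mul (y * Real.exp 1)).mono' ?_ (ae_of_all _ fun v => ?_)
  · exact (Continuous.mul (by fun_prop) (continuous_detKernel i one_ne_zero)).aestronglyMeasurable
  · rw [norm_mul, Complex.norm_exp, re_ofReal_mul,
      show (((1 : ℝ) : ℂ) + v * I).re = 1 by simp, mul_one, Real.exp_log hy, mul_assoc]
    gcongr
    exact norm_detKernel_le i (by simp) v

lemma hasSum_detCoeff {q : ℕ} [NeZero q] (χ : DirichletCharacter ℂ q) {X Y : ℝ} (hY : 1 ≤ Y) {ρ θ : ℂ}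
    (hρ : 1 / 2 ≤ ρ.re) (hθ : ‖θ‖ ≤ 1) :
    HasSum (fun n : ℕ => 2 * Real.pi * ((detCoeff X n * (χ n * (n : ℂ) ^ (-ρ))) *
        (cutoff false (Y / n) + θ * cutoff true (Y / n))))
      (∫ v : ℝ, (LFunction χ (ρ + ((1 : ℝ) + v * I)) * (1 + θ * ((1 : ℝ) + v * I)) *
        mollifier χ X (ρ + ((1 : ℝ) + v * I)) * cexp (Real.log Y * ((1 : ℝ) + v * I))) *
        cauchyKernel ((1 : ℝ) + v * I)) := by
  have hY0 : 0 < Y := by linarith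
  set k : ℝ → ℂ := fun v => detKernel false ((1 : ℝ) + v * I) + θ * detKernel true ((1 : ℝ) + v * I)
    with hk
  have hkn : ∀ v, ‖k v‖ ≤ 2 * Real.exp 1 * Real.exp (-v ^ 2) := by
    intro v
    have h1 := norm_detKernel_le false (c := 1) (by simp) v
    have h2 := norm_detKernel_le true (c := 1) (by simp) v
    refine (norm_add_le _ _).trans ?_
    rw [norm_mul]
    nlinarith [norm_nonneg (detKernel true ((1 : ℝ) + v * I))]
  have hkc : Continuous k := (continuous_detKernel false one_ne_zero).add
    (continuous_const.mul (continuous_detKernel true one_ne_zero))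
  set F : ℕ → ℝ → ℂ := fun n v => LSeries.term (fun n => (detCoeff X n : ℂ) * χ n)
    (ρ + ((1 : ℝ) + v * I)) n * (cexp (Real.log Y * ((1 : ℝ) + v * I)) * k v) with hF
  have hterm : ∀ (n : ℕ) (v : ℝ), 0 < n → F n v = (detCoeff X n * (χ n * (n : ℂ) ^ (-ρ))) *
      (cexp (Real.log (Y / n) * ((1 : ℝ) + v * I)) * k v) := by
    intro n v hn
    have hn0 : (n : ℂ) ≠ 0 := Nat.cast_ne_zero.2 hn.ne'
    have hn1 : (0 : ℝ) < n := Nat.cast_pos.2 hn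
    simp only [hF]
    rw [LSeries.term_of_ne_zero hn.ne', div_eq_mul_inv, ← cpow_neg, neg_add, cpow_add _ _ hn0,
      Real.log_div hY0.ne' hn1.ne', ofReal_sub, sub_mul, sub_eq_add_neg, Complex.exp_add,
      cpow_def_of_ne_zero hn0 (-((1 : ℝ) + v * I)), mul_neg,
      show Complex.log n = (Real.log n : ℂ) by rw [ofReal_log hn1.le, ofReal_natCast]]
    ring
  have h0 : ∀ v, F 0 v = 0 := fun v => by simp [hF]
  set G : ℝ := Y * (2 * Real.exp 1) with hG
  have hnorm : ∀ (n : ℕ) (v : ℝ),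
      ‖F n v‖ ≤ tau n * (n : ℝ) ^ (-(1 + 1 / 2) : ℝ) * (G * Real.exp (-v ^ 2)) := by
    intro n v
    rcases Nat.eq_zero_or_pos n with rfl | hn
    · rw [h0, norm_zero]
      have := tau_nonneg 0
      positivity
    have hn1 : (1 : ℝ) ≤ n := by exact_mod_cast hn
    simp only [hF]
    rw [norm_mul, LSeries.term_of_ne_zero hn.ne', div_eq_mul_inv, ← cpow_neg, norm_mul,
      norm_natCast_cpow hn, norm_mul, norm_mul, norm_real, Real.norm_eq_abs, Complex.norm_exp,
      re_ofReal_mul, show (((1 : ℝ) : ℂ) + v * I).re = 1 by simp, mul_one, Real.exp_log hY0]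
    have e1 : |detCoeff X n| * ‖χ n‖ ≤ tau n := by
      nlinarith [abs_detCoeff_le X n, χ.norm_le_one n, abs_nonneg (detCoeff X n), norm_nonneg (χ n)]
    have e2 : (n : ℝ) ^ (-(ρ + ((1 : ℝ) + v * I))).re ≤ (n : ℝ) ^ (-(1 + 1 / 2) : ℝ) :=
      Real.rpow_le_rpow_of_exponent_le hn1 (by simp; linarith)
    have e3 : Y * ‖k v‖ ≤ G * Real.exp (-v ^ 2) := by
      rw [hG, mul_assoc]; exact mul_le_mul_of_nonneg_left (hkn v) hY0.le
    exact mul_le_mul (mul_le_mul e1 e2 (by positivity) (tau_nonneg n)) e3 (by positivity)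
      (mul_nonneg (tau_nonneg n) (by positivity))
  have hcont : ∀ n, Continuous (F n) := by
    intro n
    rcases Nat.eq_zero_or_pos n with rfl | hn
    · rw [show F 0 = fun _ => 0 from funext h0]; exact continuous_const
    · rw [show F n = _ from funext fun v => hterm n v hn]
      exact continuous_const.mul (Continuous.mul (by fun_prop) hkc)
  have hint : ∀ n, Integrable (F n) := fun n =>
    ((integrable_exp_neg_sq.const_mul G).const_mul _).mono'
      (hcont n).aestronglyMeasurable (ae_of_all _ (hnorm n))
  have hsum : Summable fun n => ∫ v, ‖F n v‖ := by
    refine Summable.of_nonneg_of_le (fun n => integral_nonneg fun _ => norm_nonneg _)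
      (fun n => (integral_mono (hint n).norm
        ((integrable_exp_neg_sq.const_mul G).const_mul _) (hnorm n)).trans_eq
        (integral_const_mul _ _)) ((tau_series (a := 1 / 2) (by norm_num)).1.mul_right _)
  have h := hasSum_integral_of_summable_integral_norm hint hsum
  have e1 : ∀ v : ℝ, ∑' n, F n v = (LFunction χ (ρ + ((1 : ℝ) + v * I)) * (1 + θ * ((1 : ℝ) + v * I)) *
        mollifier χ X (ρ + ((1 : ℝ) + v * I)) * cexp (Real.log Y * ((1 : ℝ) + v * I))) *
        cauchyKernel ((1 : ℝ) + v * I) := by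
    intro v
    simp only [hF, hk, detKernel]
    rw [tsum_mul_right]
    change LSeries _ _ * _ = _
    rw [← LFunction_mul_mollifier χ X (by simp; linarith)]
    simp only [Bool.false_eq_true, if_false, if_true]
    ring
  simp_rw [e1] at h
  refine Eq.mp (congrArg (HasSum · _) (funext fun n => ?_)) h
  rcases Nat.eq_zero_or_pos n with rfl | hn
  · simp [h0, detCoeff]
  · have hy : 0 < Y / n := div_pos hY0 (Nat.cast_pos.2 hn)
    simp_rw [hterm n _ hn]
    rw [integral_const_mul]
    have e2 : ∀ v : ℝ, cexp (Real.log (Y / n) * ((1 : ℝ) + v * I)) * k v =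
        cexp (Real.log (Y / n) * ((1 : ℝ) + v * I)) * detKernel false ((1 : ℝ) + v * I) +
        θ * (cexp (Real.log (Y / n) * ((1 : ℝ) + v * I)) * detKernel true ((1 : ℝ) + v * I)) := by
      intro v; simp only [hk]; ring
    simp_rw [e2]
    rw [integral_add (integrable_cexp_mul_detKernel _ hy)
      ((integrable_cexp_mul_detKernel _ hy).const_mul θ), integral_const_mul, cutoff, cutoff]
    have hpi : (2 * Real.pi : ℂ) ≠ 0 := by simp [Real.pi_ne_zero]
    have := mul_inv_cancel₀ hpi
    set A := ∫ v : ℝ, cexp (Real.log (Y / n) * ((1 : ℝ) + v * I)) * detKernel false ((1 : ℝ) + v * I)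
    set B := ∫ v : ℝ, cexp (Real.log (Y / n) * ((1 : ℝ) + v * I)) * detKernel true ((1 : ℝ) + v * I)
    linear_combination (-(detCoeff X n * (χ n * (n : ℂ) ^ (-ρ))) * (A + θ * B)) * this

end ZeroDensity

namespace ZeroDensity
open Complex MeasureTheory Set Filter Topology DirichletCharacter

lemma norm_tsum_sub_detSum_le {q : ℕ} [NeZero q] (χ : DirichletCharacter ℂ q) {X Y : ℝ} (hX : 1 ≤ X)
    (hY : (400 : ℝ) ^ 4 ≤ Y) {ρ θ : ℂ} (hρ : 1 / 2 ≤ ρ.re) (hθ : ‖θ‖ ≤ 1) {A : ℂ}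
    (hA : HasSum (fun n : ℕ => (detCoeff X n * (χ n * (n : ℂ) ^ (-ρ))) *
        (cutoff false (Y / n) + θ * cutoff true (Y / n))) A) :
    ‖A - 1 - (detSum χ X Y false ρ + θ * detSum χ X Y true ρ)‖ ≤ 1 / 4 := by
  have hY1 : 1 ≤ Y := le_trans (by norm_num) hY
  have hY0 : 0 < Y := by linarith
  set f : ℕ → ℂ := fun n : ℕ => (detCoeff X n * (χ n * (n : ℂ) ^ (-ρ))) *
        (cutoff false (Y / n) + θ * cutoff true (Y / n)) with hf
  set K : ℕ := ⌊Y ^ 5⌋₊ + 1 with hK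
  have hzero : ∀ n ∈ Finset.range K, n ∉ insert 1 (detRange X Y) → f n = 0 := by
    intro n hn hn'
    rw [Finset.mem_insert, not_or, detRange, Finset.mem_filter, Finset.mem_Icc, not_and_or] at hn'
    rw [Finset.mem_range] at hn
    rcases Nat.eq_zero_or_pos n with rfl | h0
    · simp [hf, detCoeff]
    · have h1 : (n : ℝ) ≤ X := by
        rcases hn'.2 with h | h
        · exact absurd ⟨h0, by omega⟩ h
        · exact not_lt.1 h
      simp only [hf]
      rw [detCoeff_eq_zero (lt_of_le_of_ne h0 (Ne.symm hn'.1)) h1]; simp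
  have h1mem : 1 ∉ detRange X Y := by
    rw [detRange, Finset.mem_filter, not_and_or, not_lt, Nat.cast_one]; exact Or.inr hX
  have hsub : insert 1 (detRange X Y) ⊆ Finset.range K := by
    intro n hn
    rw [Finset.mem_insert] at hn
    rw [Finset.mem_range]
    rcases hn with rfl | hn
    · have : 1 ≤ ⌊Y ^ 5⌋₊ := Nat.le_floor (by simpa using one_le_pow₀ hY1)
      omega
    · have := (Finset.mem_Icc.1 (Finset.mem_filter.1 hn).1).2
      omega
  have hfin : ∑ n ∈ Finset.range K, f n =
      f 1 + (detSum χ X Y false ρ + θ * detSum χ X Y true ρ) := by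
    rw [← Finset.sum_subset hsub hzero, Finset.sum_insert h1mem, detSum, detSum, Finset.mul_sum,
      ← Finset.sum_add_distrib]
    congr 1
    refine Finset.sum_congr rfl fun n _ => ?_
    simp only [hf, cutCoeff]
    ring
  have hf1 : ‖f 1 - 1‖ ≤ 2 / Y := by
    have e : f 1 = cutoff false Y + θ * cutoff true Y := by
      simp [hf, detCoeff_one hX]
    rw [e, show cutoff false Y + θ * cutoff true Y - 1 =
      (cutoff false Y - 1) + θ * cutoff true Y by ring]
    have h1 := norm_cutoff_sub_le false hY0
    have h2 := norm_cutoff_sub_le true hY0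
    simp only [Bool.false_eq_true, if_false, if_true, sub_zero] at h1 h2
    refine (norm_add_le _ _).trans ?_
    rw [norm_mul, show 2 / Y = Y⁻¹ + 1 * Y⁻¹ by ring]
    exact add_le_add h1 (mul_le_mul hθ h2 (norm_nonneg _) one_pos.le)
  obtain ⟨hts, htl⟩ := tau_series (a := 1 / 4) (by norm_num)
  have hbound : ∀ n : ℕ, K ≤ n → ‖f n‖ ≤ 1 / 200 * (tau n * (n : ℝ) ^ (-(1 + 1 / 4) : ℝ)) := by
    intro n hn
    have hn0 : 0 < n := by omega
    have hn1 : (1 : ℝ) ≤ n := by exact_mod_cast hn0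
    have hn2 : (0 : ℝ) < n := by linarith
    have hYn : Y ^ 5 ≤ n := (Nat.lt_floor_add_one (Y ^ 5)).le.trans (by exact_mod_cast hn)
    have hy : 0 < Y / n := by positivity
    have e1 : |detCoeff X n| * ‖χ n‖ ≤ tau n := by
      nlinarith [abs_detCoeff_le X n, χ.norm_le_one n, abs_nonneg (detCoeff X n), norm_nonneg (χ n)]
    have e2 : (n : ℝ) ^ (-ρ).re ≤ (n : ℝ) ^ (-(1 / 2) : ℝ) :=
      Real.rpow_le_rpow_of_exponent_le hn1 (by simp; linarith)
    have e3 : ‖cutoff false (Y / n) + θ * cutoff true (Y / n)‖ ≤ 2 * (Y / n) := by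
      refine (norm_add_le _ _).trans ?_
      rw [norm_mul]
      have h1 := norm_cutoff_le false hy
      have h2 := norm_cutoff_le true hy
      nlinarith [norm_nonneg (cutoff true (Y / n))]
    have e4 : Y * (n : ℝ) ^ (-(1 / 4) : ℝ) ≤ 1 / 400 := by
      calc Y * (n : ℝ) ^ (-(1 / 4) : ℝ) ≤ Y * (Y ^ 5) ^ (-(1 / 4) : ℝ) := by
            refine mul_le_mul_of_nonneg_left ?_ hY0.le
            exact Real.rpow_le_rpow_of_nonpos (by positivity) hYn (by norm_num)
        _ = Y ^ (-(1 / 4) : ℝ) := by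
            rw [← Real.rpow_natCast, ← Real.rpow_mul hY0.le]
            nth_rewrite 1 [← Real.rpow_one Y]
            rw [← Real.rpow_add hY0]; norm_num
        _ ≤ ((400 : ℝ) ^ 4) ^ (-(1 / 4) : ℝ) :=
            Real.rpow_le_rpow_of_nonpos (by positivity) hY (by norm_num)
        _ = 1 / 400 := by
            rw [← Real.rpow_natCast, ← Real.rpow_mul (by norm_num)]
            norm_num [Real.rpow_neg]
    have e5 : (n : ℝ) ^ (-(1 / 2) : ℝ) * (Y / n) =
        Y * (n : ℝ) ^ (-(1 / 4) : ℝ) * (n : ℝ) ^ (-(1 + 1 / 4) : ℝ) := by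
      have h : Y / n = Y * (n : ℝ) ^ (-1 : ℝ) := by rw [Real.rpow_neg_one, div_eq_mul_inv]
      rw [h, mul_assoc Y, ← Real.rpow_add hn2, mul_left_comm, ← Real.rpow_add hn2]
      norm_num
    simp only [hf]
    rw [norm_mul, norm_mul, norm_mul, norm_natCast_cpow hn0, norm_real, Real.norm_eq_abs]
    calc |detCoeff X n| * (‖χ n‖ * (n : ℝ) ^ (-ρ).re) *
          ‖cutoff false (Y / n) + θ * cutoff true (Y / n)‖
        = (|detCoeff X n| * ‖χ n‖) * ((n : ℝ) ^ (-ρ).re *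
          ‖cutoff false (Y / n) + θ * cutoff true (Y / n)‖) := by ring
      _ ≤ tau n * ((n : ℝ) ^ (-(1 / 2) : ℝ) * (2 * (Y / n))) :=
          mul_le_mul e1 (mul_le_mul e2 e3 (norm_nonneg _) (by positivity)) (by positivity) (tau_nonneg n)
      _ = 2 * (Y * (n : ℝ) ^ (-(1 / 4) : ℝ)) * (tau n * (n : ℝ) ^ (-(1 + 1 / 4) : ℝ)) := by
          rw [mul_left_comm _ 2, e5]; ring
      _ ≤ 2 * (1 / 400) * (tau n * (n : ℝ) ^ (-(1 + 1 / 4) : ℝ)) :=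
          mul_le_mul_of_nonneg_right (by linarith) (mul_nonneg (tau_nonneg n) (by positivity))
      _ = _ := by ring
  have htail : ‖∑' n, f (n + K)‖ ≤ 1 / 8 := by
    have hs1 : Summable fun n : ℕ => 1 / 200 * (tau (n + K) * ((n + K : ℕ) : ℝ) ^ (-(1 + 1 / 4) : ℝ)) :=
      ((summable_nat_add_iff K).2 hts).mul_left _
    refine (tsum_of_norm_bounded hs1.hasSum fun n => hbound _ (Nat.le_add_left K n)).trans ?_
    rw [tsum_mul_left]
    have h1 : ∑' n : ℕ, (tau (n + K) * ((n + K : ℕ) : ℝ) ^ (-(1 + 1 / 4) : ℝ)) ≤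
        ∑' n, tau n * (n : ℝ) ^ (-(1 + 1 / 4) : ℝ) := by
      rw [← hts.sum_add_tsum_nat_add K]
      exact le_add_of_nonneg_left (Finset.sum_nonneg fun n _ =>
        mul_nonneg (tau_nonneg n) (by positivity))
    exact (mul_le_mul_of_nonneg_left (h1.trans htl) (by norm_num)).trans (by norm_num)
  have hsplit : A = f 1 + (detSum χ X Y false ρ + θ * detSum χ X Y true ρ) + ∑' n, f (n + K) := by
    rw [← hfin, hA.summable.sum_add_tsum_nat_add K, hA.tsum_eq]
  rw [hsplit, show f 1 + (detSum χ X Y false ρ + θ * detSum χ X Y true ρ) + ∑' n, f (n + K) - 1 -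
    (detSum χ X Y false ρ + θ * detSum χ X Y true ρ) = (f 1 - 1) + ∑' n, f (n + K) by ring]
  have hY8 : 2 / Y ≤ 1 / 8 := by
    rw [div_le_iff₀ hY0]; norm_num at hY; linarith
  refine (norm_add_le _ _).trans ?_
  linarith

/-- A zero makes either a zero detecting sum or a mollified integral over the critical line large. -/
theorem zero_detection {q : ℕ} [NeZero q] (χ : DirichletCharacter ℂ q) {ρ : ℂ} {X Y σ : ℝ}
    (hσ : 1 / 2 < σ) (hσρ : σ ≤ ρ.re) (hρ1 : ρ.re ≤ 1) (hL : LFunction χ ρ = 0) (hρ : ρ ≠ 1)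
    (h1 : χ = 1 → 1 ≤ ‖ρ - 1‖) (hX : 1 ≤ X) (hY : (400 : ℝ) ^ 4 ≤ Y) :
    (∃ i, 1 / 12 ≤ ‖detSum χ X Y i ρ‖) ∨
      ENNReal.ofReal (Y ^ (σ - 1 / 2) / (1 + 1 / (σ - 1 / 2))) ≤
        ∫⁻ v : ℝ, ‖LFunction χ (1 / 2 + (ρ.im + v : ℝ) * I)‖ₑ *
          ‖mollifier χ X (1 / 2 + (ρ.im + v : ℝ) * I)‖ₑ * ENNReal.ofReal (Real.exp (-v ^ 2)) := by
  have hY1 : 1 ≤ Y := le_trans (by norm_num) hY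
  have hY0 : 0 < Y := by linarith
  by_cases hsmall : ∃ i, 1 / 12 ≤ ‖detSum χ X Y i ρ‖
  · exact Or.inl hsmall
  push Not at hsmall
  right
  obtain ⟨θ, F, C, hθ, hFd, hF, hFC⟩ := exists_damped χ h1
  obtain ⟨M, hM0, hM⟩ := norm_mollifier_le χ X
  set a : ℝ := 1 / 2 - ρ.re with ha
  have ha0 : a < 0 := by linarith
  set f : ℂ → ℂ := fun z => F z * mollifier χ X z * cexp (Real.log Y * (z - ρ)) with hf
  have hlog : 0 ≤ Real.log Y := Real.log_nonneg hY1
  have hcauchy := strip_cauchy (f := f) (s := ρ) (a := a) (b := 1) (A := 3)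
    (C := C * Real.exp (3 * |ρ.im|) * M * Real.exp (Real.log Y * 1)) ha0 one_pos
    (fun z _ _ => by
      have := hFd (ρ + z)
      have := differentiable_mollifier χ X (ρ + z)
      simp only [hf]
      fun_prop)
    (fun z h1 h2 => by
      simp only [hf]
      rw [norm_mul, norm_mul, Complex.norm_exp, add_sub_cancel_left, re_ofReal_mul]
      have e1 := hFC (ρ + z) (by simp; linarith) (by simp; linarith)
      have e2 := hM (ρ + z) (by simp; linarith)
      have hC : 0 ≤ C := nonneg_of_mul_nonneg_left ((norm_nonneg _).trans e1) (Real.exp_pos _)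
      have e3 : Real.exp (3 * |(ρ + z).im|) ≤ Real.exp (3 * |ρ.im|) * Real.exp (3 * |z.im|) := by
        rw [← Real.exp_add, add_im]
        exact Real.exp_le_exp.2 (by linarith [abs_add_le ρ.im z.im])
      calc _ ≤ (C * (Real.exp (3 * |ρ.im|) * Real.exp (3 * |z.im|))) * M *
            Real.exp (Real.log Y * 1) := by
            gcongr
            exact e1.trans (by gcongr)
        _ = _ := by ring)
  have hfρ : f ρ = 0 := by simp [hf, hF ρ hρ, hL]
  have hR : ∀ v : ℝ, f (ρ + ((1 : ℝ) + v * I)) * cauchyKernel ((1 : ℝ) + v * I) =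
      (LFunction χ (ρ + ((1 : ℝ) + v * I)) * (1 + θ * ((1 : ℝ) + v * I)) *
        mollifier χ X (ρ + ((1 : ℝ) + v * I)) * cexp (Real.log Y * ((1 : ℝ) + v * I))) *
        cauchyKernel ((1 : ℝ) + v * I) := by
    intro v
    have : ρ + ((1 : ℝ) + v * I) ≠ 1 := by
      intro h; have := congrArg re h; simp at this; linarith
    simp only [hf]
    rw [hF _ this, add_sub_cancel_left]
  simp_rw [hR] at hcauchy
  rw [hfρ, mul_zero] at hcauchy
  have hpi : (2 * Real.pi : ℂ) ≠ 0 := by simp [Real.pi_ne_zero]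
  have hS := (hasSum_detCoeff χ (X := X) hY1 (by linarith) hθ).mul_left (2 * Real.pi : ℂ)⁻¹
  simp only [inv_mul_cancel_left₀ hpi] at hS
  have hA := norm_tsum_sub_detSum_le χ hX hY (by linarith) hθ hS
  rw [sub_eq_zero.1 hcauchy.symm] at hA
  set IL := ∫ v : ℝ, f (ρ + (a + v * I)) * cauchyKernel (a + v * I) with hIL
  have hlow : 2 ≤ ‖IL‖ := by
    have h2 := hsmall false
    have h3 := hsmall true
    have h4 : ‖detSum χ X Y false ρ + θ * detSum χ X Y true ρ‖ ≤ 1 / 12 + 1 * (1 / 12) := by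
      refine (norm_add_le _ _).trans ?_
      rw [norm_mul]
      gcongr
    set D := detSum χ X Y false ρ + θ * detSum χ X Y true ρ
    have h5 : 1 ≤ ‖(2 * Real.pi : ℂ)⁻¹ * IL‖ + ‖D‖ + ‖(2 * Real.pi : ℂ)⁻¹ * IL - 1 - D‖ := by
      have e : (1 : ℂ) = ((2 * Real.pi : ℂ)⁻¹ * IL - D) - ((2 * Real.pi : ℂ)⁻¹ * IL - 1 - D) := by ring
      calc (1 : ℝ) = ‖(1 : ℂ)‖ := by simp
        _ ≤ ‖(2 * Real.pi : ℂ)⁻¹ * IL - D‖ + ‖(2 * Real.pi : ℂ)⁻¹ * IL - 1 - D‖ := by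
            nth_rewrite 1 [e]; exact norm_sub_le _ _
        _ ≤ _ := add_le_add_left (norm_sub_le _ _) _
    rw [norm_mul (2 * Real.pi : ℂ)⁻¹, norm_inv, norm_mul, norm_real,
      Real.norm_of_nonneg Real.pi_pos.le, RCLike.norm_ofNat] at h5
    have h6 : 1 / 2 ≤ (2 * Real.pi)⁻¹ * ‖IL‖ := by linarith
    rw [inv_mul_eq_div, le_div_iff₀ (by positivity)] at h6
    linarith [Real.pi_gt_three]
  set κ : ℝ := 1 + 1 / (σ - 1 / 2) with hκ
  have hσ0 : 0 < σ - 1 / 2 := by linarith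
  have hκ0 : 0 < κ := by positivity
  set c : ℝ := 2 * κ * Y ^ (-(σ - 1 / 2)) with hc
  have hpt : ∀ v : ℝ, ‖f (ρ + (a + v * I)) * cauchyKernel (a + v * I)‖ ≤
      c * (‖LFunction χ (1 / 2 + (ρ.im + v : ℝ) * I)‖ *
        ‖mollifier χ X (1 / 2 + (ρ.im + v : ℝ) * I)‖ * Real.exp (-v ^ 2)) := by
    intro v
    have hz : ρ + (a + v * I) = 1 / 2 + (ρ.im + v : ℝ) * I := by
      apply Complex.ext <;> simp [ha]
    have hz1 : (1 / 2 + (ρ.im + v : ℝ) * I : ℂ) ≠ 1 := by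
      intro h; have := congrArg re h; simp at this
    simp only [hf]
    rw [add_sub_cancel_left, hz, hF _ hz1, ← hz, add_sub_cancel_left, hz]
    set w : ℂ := a + v * I with hw
    have hw0 : w ≠ 0 := vertical_ne_zero ha0.ne v
    have hwre : w.re = a := by simp [hw]
    have hwn : σ - 1 / 2 ≤ ‖w‖ := by
      have := abs_le_norm_vertical a v
      rw [abs_of_neg ha0] at this
      linarith
    have hwp : 0 < ‖w‖ := norm_pos_iff.2 hw0
    have e1 : ‖1 + θ * w‖ * ‖cauchyKernel w‖ ≤ κ * (2 * Real.exp (-v ^ 2)) := by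
      rw [hw, norm_cauchyKernel, ← hw]
      have e2 : ‖1 + θ * w‖ ≤ 1 + ‖w‖ := by
        refine (norm_add_le _ _).trans ?_
        rw [norm_mul, norm_one]
        linarith [mul_le_mul_of_nonneg_right hθ (norm_nonneg w)]
      have e3 : Real.exp (a ^ 2 - v ^ 2) ≤ 2 * Real.exp (-v ^ 2) := by
        rw [sub_eq_add_neg, Real.exp_add]
        gcongr
        have : a ^ 2 ≤ 1 / 4 := by nlinarith
        have h2 : Real.exp (a ^ 2) ≤ Real.exp (1 / 4) := Real.exp_le_exp.2 this
        have h3 : Real.exp (1 / 4) ^ 4 = Real.exp 1 := by rw [← Real.exp_nat_mul]; norm_num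
        have h4 := Real.exp_one_lt_d9
        by_contra h5
        push Not at h5
        have h6 : (2 : ℝ) ^ 4 < Real.exp (1 / 4) ^ 4 :=
          pow_lt_pow_left₀ (by linarith) (by norm_num) (by norm_num)
        rw [h3] at h6
        linarith
      calc ‖1 + θ * w‖ * (Real.exp (a ^ 2 - v ^ 2) / ‖w‖) ≤
            (1 + ‖w‖) * (2 * Real.exp (-v ^ 2) / ‖w‖) := by gcongr
        _ = (1 + 1 / ‖w‖) * (2 * Real.exp (-v ^ 2)) := by field_simp; ring
        _ ≤ _ := by rw [hκ]; gcongr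
    have e4 : ‖cexp (Real.log Y * w)‖ ≤ Y ^ (-(σ - 1 / 2)) := by
      rw [Complex.norm_exp, re_ofReal_mul, hwre, ← Real.rpow_def_of_pos hY0]
      exact Real.rpow_le_rpow_of_exponent_le hY1 (by linarith)
    rw [norm_mul, norm_mul, norm_mul, norm_mul]
    calc _ = ‖LFunction χ (1 / 2 + (ρ.im + v : ℝ) * I)‖ *
          ‖mollifier χ X (1 / 2 + (ρ.im + v : ℝ) * I)‖ * ((‖1 + θ * w‖ * ‖cauchyKernel w‖) *
          ‖cexp (Real.log Y * w)‖) := by ring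
      _ ≤ ‖LFunction χ (1 / 2 + (ρ.im + v : ℝ) * I)‖ *
          ‖mollifier χ X (1 / 2 + (ρ.im + v : ℝ) * I)‖ * ((κ * (2 * Real.exp (-v ^ 2))) *
          Y ^ (-(σ - 1 / 2))) := by gcongr
      _ = _ := by rw [hc]; ring
  set J := ∫⁻ v : ℝ, ‖LFunction χ (1 / 2 + (ρ.im + v : ℝ) * I)‖ₑ *
          ‖mollifier χ X (1 / 2 + (ρ.im + v : ℝ) * I)‖ₑ * ENNReal.ofReal (Real.exp (-v ^ 2)) with hJ
  have hc0 : 0 < c := by positivity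
  have hfinal : ENNReal.ofReal 2 ≤ ENNReal.ofReal c * J := by
    calc ENNReal.ofReal 2 ≤ ENNReal.ofReal ‖IL‖ := ENNReal.ofReal_le_ofReal hlow
      _ = ‖IL‖ₑ := ofReal_norm _
      _ ≤ ∫⁻ v : ℝ, ‖f (ρ + (a + v * I)) * cauchyKernel (a + v * I)‖ₑ :=
          enorm_integral_le_lintegral_enorm _
      _ ≤ ∫⁻ v : ℝ, ENNReal.ofReal c * (‖LFunction χ (1 / 2 + (ρ.im + v : ℝ) * I)‖ₑ *
          ‖mollifier χ X (1 / 2 + (ρ.im + v : ℝ) * I)‖ₑ * ENNReal.ofReal (Real.exp (-v ^ 2))) := by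
          refine lintegral_mono fun v => ?_
          rw [← ofReal_norm, ← ofReal_norm, ← ofReal_norm, ← ENNReal.ofReal_mul (norm_nonneg _),
            ← ENNReal.ofReal_mul (by positivity), ← ENNReal.ofReal_mul hc0.le]
          exact ENNReal.ofReal_le_ofReal (hpt v)
      _ = _ := lintegral_const_mul' _ _ ENNReal.ofReal_ne_top
  have hval : Y ^ (σ - 1 / 2) / κ = c⁻¹ * 2 := by
    rw [hc, Real.rpow_neg hY0.le]; field_simp
  rw [hval, ENNReal.ofReal_mul (by positivity)]
  calc _ ≤ ENNReal.ofReal c⁻¹ * (ENNReal.ofReal c * J) := by gcongr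
    _ = J := by
        rw [← mul_assoc, ← ENNReal.ofReal_mul (by positivity), inv_mul_cancel₀ hc0.ne',
          ENNReal.ofReal_one, one_mul]

end ZeroDensity

namespace ZeroDensity

open Complex MeasureTheory Set Filter Topology DirichletCharacter

lemma sum_int_exp_neg_abs_le {M : ℝ} (hM : 1 ≤ M) (K : Finset ℤ) :
    ∑ k ∈ K, Real.exp (-|(k : ℝ)| / M) ≤ 4 * M := by
  have hM0 : 0 < M := by linarith
  set x : ℝ := Real.exp (-1 / M) with hx
  have hx0 : 0 < x := Real.exp_pos _
  have hx1 : x < 1 := by rw [hx, Real.exp_lt_one_iff]; exact div_neg_of_neg_of_pos (by norm_num) hM0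
  have hxM : (1 - x)⁻¹ ≤ 2 * M := by
    have h1 : x * (1 + 1 / M) ≤ 1 := by
      calc x * (1 + 1 / M) ≤ x * Real.exp (1 / M) := by
            gcongr
            linarith [Real.add_one_le_exp (1 / M)]
        _ = 1 := by rw [hx, ← Real.exp_add, neg_div, neg_add_cancel, Real.exp_zero]
    rw [inv_le_comm₀ (by linarith) (by positivity)]
    have h2 : x * (M + 1) ≤ M := by
      have := mul_le_mul_of_nonneg_right h1 hM0.le
      field_simp at this
      linarith
    rw [inv_le_iff_one_le_mul₀ (by positivity)]
    nlinarith
  have hg := hasSum_geometric_of_lt_one hx0.le hx1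
  have hpow : ∀ n : ℕ, Real.exp (-(n : ℝ) / M) = x ^ n := fun n => by
    rw [hx, ← Real.exp_nat_mul]; ring_nf
  have h1 : HasSum (fun n : ℕ => Real.exp (-|((n : ℤ) : ℝ)| / M)) (1 - x)⁻¹ := by
    refine Eq.mp (congrArg (HasSum · _) (funext fun n => ?_)) hg
    rw [← hpow]; simp
  have h2 : HasSum (fun n : ℕ => Real.exp (-|((-(n + 1 : ℤ) : ℤ) : ℝ)| / M)) (x * (1 - x)⁻¹) := by
    refine Eq.mp (congrArg (HasSum · _) (funext fun n => ?_)) (hg.mul_left x)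
    have h := hpow (n + 1)
    rw [pow_succ'] at h
    rw [← h]
    congr 2
    push_cast
    rw [abs_neg, abs_of_nonneg (by positivity)]
  have h3 := HasSum.of_nat_of_neg_add_one
    (f := fun k : ℤ => Real.exp (-|(k : ℝ)| / M)) h1 h2
  refine (sum_le_hasSum K (fun _ _ => (Real.exp_pos _).le) h3).trans ?_
  have : x * (1 - x)⁻¹ ≤ 1 * (1 - x)⁻¹ := by
    gcongr
  linarith

lemma sum_int_exp_neg_abs_sub_le {M : ℝ} (hM : 1 ≤ M) (K : Finset ℤ) (m : ℤ) :
    ∑ k ∈ K, Real.exp (-|(k : ℝ) - m| / M) ≤ 4 * M := by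
  classical
  have h := sum_int_exp_neg_abs_le hM (K.image (· - m))
  rw [Finset.sum_image (fun _ _ _ _ h => sub_left_injective h)] at h
  simpa using h

variable {q : ℕ} [NeZero q]

/-- The ordinates `γ` lie within `M` of the integer labels of the points of `R`. -/
def WellSpaced (R : Finset (DirichletCharacter ℂ q × ℤ)) (γ : DirichletCharacter ℂ q × ℤ → ℝ)
    (M : ℝ) : Prop :=
  ∀ r ∈ R, |γ r - r.2| ≤ M

open scoped Classical in
lemma sum_fiber_exp_neg_abs_sub_le {M : ℝ} (hM : 1 ≤ M) (R : Finset (DirichletCharacter ℂ q × ℤ))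
    (χ : DirichletCharacter ℂ q) (m : ℤ) :
    ∑ r ∈ R with r.1 = χ, Real.exp (-|(r.2 : ℝ) - m| / M) ≤ 4 * M := by
  have h := sum_int_exp_neg_abs_sub_le hM ((R.filter (·.1 = χ)).image Prod.snd) m
  rwa [Finset.sum_image] at h
  intro r hr r' hr' h
  simp only [Finset.coe_filter, mem_ofPred_eq] at hr hr'
  exact Prod.ext (hr.2.trans hr'.2.symm) h

open scoped Classical in
lemma WellSpaced.sum_exp_neg_sq_le {R : Finset (DirichletCharacter ℂ q × ℤ)}
    {γ : DirichletCharacter ℂ q × ℤ → ℝ} {M : ℝ} (h : WellSpaced R γ M) (hM : 1 ≤ M) :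
    ∀ r ∈ R, ∑ r' ∈ R with r'.1 = r.1, Real.exp (-(γ r - γ r') ^ 2) ≤ 8 * Real.exp 2 * M := by
  intro r hr
  calc ∑ r' ∈ R with r'.1 = r.1, Real.exp (-(γ r - γ r') ^ 2)
      ≤ ∑ r' ∈ R with r'.1 = r.1, Real.exp 2 * Real.exp (-|(r'.2 : ℝ) - r.2| / (2 * M)) := by
        refine Finset.sum_le_sum fun r' hr' => ?_
        have h1 := h r hr
        have h2 := h r' (Finset.mem_filter.1 hr').1
        rw [← Real.exp_add, Real.exp_le_exp]
        set j : ℝ := |(r'.2 : ℝ) - r.2| with hj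
        have hj0 : 0 ≤ j := abs_nonneg _
        have h3 : j ≤ |γ r - γ r'| + 2 * M := by
          have e : (r'.2 : ℝ) - r.2 = (γ r - r.2) - (γ r' - r'.2) - (γ r - γ r') := by ring
          rw [hj, e]
          have a1 := abs_sub ((γ r - r.2) - (γ r' - r'.2)) (γ r - γ r')
          have a2 := abs_sub (γ r - r.2) (γ r' - r'.2)
          linarith
        rw [← sq_abs (γ r - γ r')]
        set x := |γ r - γ r'|
        have hx0 : 0 ≤ x := abs_nonneg _
        rcases le_total j (4 * M) with h4 | h4
        · have : j / (2 * M) ≤ 2 := by rw [div_le_iff₀ (by positivity)]; linarith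
          rw [neg_div]
          nlinarith
        · have h5 : j / (2 * M) ≤ j / 2 := by gcongr; linarith
          rw [neg_div]
          nlinarith
    _ ≤ Real.exp 2 * (4 * (2 * M)) := by
        rw [← Finset.mul_sum]
        gcongr
        exact sum_fiber_exp_neg_abs_sub_le (by linarith) R r.1 r.2
    _ = _ := by ring

/-- Local Gaussian means around well-spaced points are controlled by a global mean. -/
theorem WellSpaced.sum_lintegral_le {R : Finset (DirichletCharacter ℂ q × ℤ)}
    {γ : DirichletCharacter ℂ q × ℤ → ℝ} {T : ℝ} (h : WellSpaced R γ 1) (hT : 1 ≤ T)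
    (hγ : ∀ r ∈ R, |γ r| ≤ T) (F : DirichletCharacter ℂ q → ℝ → ENNReal)
    (hF : ∀ χ, Measurable (F χ)) :
    ∑ r ∈ R, ∫⁻ v : ℝ, F r.1 (γ r + v) * ENNReal.ofReal (Real.exp (-v ^ 2 / 2)) ≤
      ENNReal.ofReal (4 * Real.exp 5) * ∑ χ, ∫⁻ t : ℝ, F χ t * expWeight T t := by
  classical
  have hT0 : 0 < T := by linarith
  have hshift : ∀ r, ∫⁻ v : ℝ, F r.1 (γ r + v) * ENNReal.ofReal (Real.exp (-v ^ 2 / 2)) =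
      ∫⁻ t : ℝ, F r.1 t * ENNReal.ofReal (Real.exp (-(t - γ r) ^ 2 / 2)) := by
    intro r
    have := lintegral_add_left_eq_self (μ := volume)
      (fun t => F r.1 t * ENNReal.ofReal (Real.exp (-(t - γ r) ^ 2 / 2))) (γ r)
    simpa only [add_sub_cancel_left] using this
  simp_rw [hshift]
  rw [← Finset.sum_fiberwise R Prod.fst, Finset.mul_sum]
  refine Finset.sum_le_sum fun χ _ => ?_
  rw [← lintegral_const_mul (μ := volume) (f := fun t => F χ t * expWeight T t) _
      ((hF χ).mul (measurable_expWeight T)), ← lintegral_finsetSum _ fun r _ => (hF r.1).mul (by fun_prop)]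
  refine lintegral_mono fun t => ?_
  have e : ∀ r ∈ R.filter (fun r => r.1 = χ),
      F r.1 t * ENNReal.ofReal (Real.exp (-(t - γ r) ^ 2 / 2)) ≤
      F χ t * (expWeight T t * ENNReal.ofReal (Real.exp 5 * Real.exp (-|(r.2 : ℝ) - ⌊t⌋| / 1))) := by
    intro r hr
    obtain ⟨hrR, rfl⟩ := Finset.mem_filter.1 hr
    gcongr
    rw [expWeight, ← ENNReal.ofReal_mul (Real.exp_pos _).le, ← Real.exp_add, ← Real.exp_add]
    refine ENNReal.ofReal_le_ofReal (Real.exp_le_exp.2 ?_)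
    have h1 := h r hrR
    have h2 := hγ r hrR
    have h3 : |(r.2 : ℝ) - ⌊t⌋| ≤ |t - γ r| + 2 := by
      have h4 := Int.floor_le t
      have h5 := Int.lt_floor_add_one t
      rw [abs_le] at h1 ⊢
      have h6 := le_abs_self (t - γ r)
      have h7 := neg_abs_le (t - γ r)
      constructor <;> linarith
    have h4 : |t| / T ≤ |t - γ r| + 1 := by
      rw [div_le_iff₀ hT0]
      have : |t| ≤ |t - γ r| + |γ r| := by
        have := abs_add_le (t - γ r) (γ r)
        simpa using this
      nlinarith [abs_nonneg (t - γ r)]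
    rw [← sq_abs (t - γ r), div_one]
    nlinarith [sq_nonneg (|t - γ r| - 2)]
  calc _ ≤ ∑ r ∈ R with r.1 = χ, F χ t * (expWeight T t *
        ENNReal.ofReal (Real.exp 5 * Real.exp (-|(r.2 : ℝ) - ⌊t⌋| / 1))) := Finset.sum_le_sum e
    _ = F χ t * expWeight T t * ENNReal.ofReal (∑ r ∈ R with r.1 = χ,
          Real.exp 5 * Real.exp (-|(r.2 : ℝ) - ⌊t⌋| / 1)) := by
        rw [← Finset.mul_sum, ← Finset.mul_sum, mul_assoc,
          ENNReal.ofReal_sum_of_nonneg fun _ _ => by positivity]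
    _ ≤ F χ t * expWeight T t * ENNReal.ofReal (4 * Real.exp 5) := by
        gcongr
        rw [← Finset.mul_sum]
        have := sum_fiber_exp_neg_abs_sub_le le_rfl R χ ⌊t⌋
        nlinarith [Real.exp_pos 5]
    _ = _ := mul_comm _ _

/-- `ρ` selects, for every labelled unit box in `R`, a zero in that box. -/
structure ZeroFamily (R : Finset (DirichletCharacter ℂ q × ℤ))
    (ρ : DirichletCharacter ℂ q × ℤ → ℂ) (σ T : ℝ) : Prop where
  zero : ∀ r ∈ R, LFunction r.1 (ρ r) = 0
  ne_one : ∀ r ∈ R, ρ r ≠ 1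
  le_re : ∀ r ∈ R, σ ≤ (ρ r).re
  re_le : ∀ r ∈ R, (ρ r).re ≤ 1
  abs_im_le : ∀ r ∈ R, |(ρ r).im| ≤ T
  floor_im : ∀ r ∈ R, ⌊(ρ r).im⌋ = r.2
  one_le_norm : ∀ r ∈ R, r.1 = 1 → 1 ≤ ‖ρ r - 1‖

lemma ZeroFamily.subset {R R' : Finset (DirichletCharacter ℂ q × ℤ)}
    {ρ : DirichletCharacter ℂ q × ℤ → ℂ} {σ T : ℝ} (h : ZeroFamily R ρ σ T) (hR : R' ⊆ R) :
    ZeroFamily R' ρ σ T :=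
  ⟨fun r hr => h.zero r (hR hr), fun r hr => h.ne_one r (hR hr), fun r hr => h.le_re r (hR hr),
    fun r hr => h.re_le r (hR hr), fun r hr => h.abs_im_le r (hR hr),
    fun r hr => h.floor_im r (hR hr), fun r hr => h.one_le_norm r (hR hr)⟩

lemma ZeroFamily.wellSpaced {R : Finset (DirichletCharacter ℂ q × ℤ)}
    {ρ : DirichletCharacter ℂ q × ℤ → ℂ} {σ T : ℝ} (h : ZeroFamily R ρ σ T) :
    WellSpaced R (fun r => (ρ r).im) 1 := by
  intro r hr
  rw [← h.floor_im r hr, abs_le]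
  constructor <;> linarith [Int.floor_le (ρ r).im, Int.lt_floor_add_one (ρ r).im]

lemma ZeroFamily.card_le {R : Finset (DirichletCharacter ℂ q × ℤ)}
    {ρ : DirichletCharacter ℂ q × ℤ → ℂ} {σ T : ℝ} (h : ZeroFamily R ρ σ T) (hT : 2 ≤ T) :
    (R.card : ℝ) ≤ 4 * (q * T) := by
  have hsub : R ⊆ Finset.univ ×ˢ Finset.Icc (⌊-T⌋) (⌊T⌋) := by
    intro r hr
    rw [Finset.mem_product, Finset.mem_Icc, ← h.floor_im r hr]
    have := abs_le.1 (h.abs_im_le r hr)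
    exact ⟨Finset.mem_univ _, Int.floor_mono this.1, Int.floor_mono this.2⟩
  have h1 := Finset.card_le_card hsub
  rw [Finset.card_product, Int.card_Icc, Finset.card_univ] at h1
  have h2 : Fintype.card (DirichletCharacter ℂ q) ≤ q := by
    rw [← Nat.card_eq_fintype_card, DirichletCharacter.card_eq_totient_of_hasEnoughRootsOfUnity]
    exact Nat.totient_le q
  have h3 : (((⌊T⌋ + 1 - ⌊-T⌋).toNat : ℕ) : ℝ) ≤ 4 * T := by
    have h4 : 0 ≤ ⌊T⌋ + 1 - ⌊-T⌋ := by
      have := Int.floor_mono (show -T ≤ T by linarith)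
      linarith
    have h5 : (((⌊T⌋ + 1 - ⌊-T⌋).toNat : ℕ) : ℝ) = ((⌊T⌋ + 1 - ⌊-T⌋ : ℤ) : ℝ) := by
      exact_mod_cast Int.toNat_of_nonneg h4
    rw [h5]
    push_cast
    linarith [Int.floor_le T, Int.lt_floor_add_one (-T)]
  calc (R.card : ℝ) ≤ Fintype.card (DirichletCharacter ℂ q) * ((⌊T⌋ + 1 - ⌊-T⌋).toNat : ℕ) := by
        exact_mod_cast h1
    _ ≤ q * (4 * T) := by gcongr
    _ = _ := by ring

/-- The zero count over all characters is controlled by the sizes of zero families. -/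
theorem exists_sum_zeroCountingFunction_le : ∃ C : ℝ, 0 < C ∧ ∀ (q : ℕ) [NeZero q] (σ T B : ℝ),
    1 / 2 ≤ σ → 2 ≤ T →
    (∀ (R : Finset (DirichletCharacter ℂ q × ℤ)) (ρ : DirichletCharacter ℂ q × ℤ → ℂ),
      ZeroFamily R ρ σ T → (R.card : ℝ) ≤ B) →
    ∑ χ : DirichletCharacter ℂ q, zeroCountingFunction χ σ T ≤
      ENNReal.ofReal (C * Real.log (q * T) * (B + 2)) := by
  obtain ⟨C, hC, h⟩ := exists_zeroCountingFunction_le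
  refine ⟨C, hC, fun q _ σ T B hσ hT hB => ?_⟩
  classical
  have hlog : 0 ≤ Real.log (q * T) := Real.log_nonneg (by nlinarith [one_le_natCast_level q])
  set R₀ : Finset (DirichletCharacter ℂ q × ℤ) :=
    (Finset.univ.sigma fun χ => zeroBoxes χ σ T).map
      (Equiv.sigmaEquivProd (DirichletCharacter ℂ q) ℤ).toEmbedding with hR₀
  have hmem : ∀ r ∈ R₀, HasZeroAt r.1 σ T r.2 := by
    intro r hr
    rw [hR₀, Finset.mem_map_equiv, Finset.mem_sigma] at hr
    exact mem_zeroBoxes.1 hr.2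
  choose! ρ hρ using hmem
  set E : Finset (DirichletCharacter ℂ q × ℤ) := {(1, 0), (1, -1)} with hE
  have hE2 : E.card ≤ 2 := Finset.card_le_two
  have hfam : ZeroFamily (R₀ \ E) ρ σ T := by
    have hz : ∀ r ∈ R₀ \ E, r ∈ R₀ := fun r hr => (Finset.mem_sdiff.1 hr).1
    refine ⟨fun r hr => (hρ r (hz r hr)).1, fun r hr => (hρ r (hz r hr)).2.1,
      fun r hr => (hρ r (hz r hr)).2.2.1, fun r hr => ?_, fun r hr => (hρ r (hz r hr)).2.2.2.1,
      fun r hr => (hρ r (hz r hr)).2.2.2.2, fun r hr hr1 => ?_⟩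
    · by_contra hlt
      push Not at hlt
      exact LFunction_ne_zero_of_one_le_re r.1 (Or.inr (hρ r (hz r hr)).2.1) hlt.le
        (hρ r (hz r hr)).1
    · have h1 := (Finset.mem_sdiff.1 hr).2
      have h2 := (hρ r (hz r hr)).2.2.2.2
      have h0 : r.2 ≠ 0 := fun h0 => h1 (by rw [hE, ← hr1, ← h0]; simp)
      have h3 : r.2 ≠ -1 := fun h0 => h1 (by rw [hE, ← hr1, ← h0]; simp)
      have h4 : 1 ≤ |(ρ r).im| := by
        have a1 := Int.floor_le (ρ r).im
        have a2 := Int.lt_floor_add_one (ρ r).im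
        rw [h2] at a1 a2
        rcases (by omega : 1 ≤ r.2 ∨ r.2 ≤ -2) with h5 | h5
        · have : (1 : ℝ) ≤ r.2 := by exact_mod_cast h5
          exact le_abs.2 (Or.inl (by linarith))
        · have : (r.2 : ℝ) ≤ -2 := by exact_mod_cast h5
          exact le_abs.2 (Or.inr (by linarith))
      exact h4.trans (by simpa using Complex.abs_im_le_norm (ρ r - 1))
  have hcard : (R₀.card : ℝ) ≤ B + 2 := by
    have h1 := hB _ _ hfam
    have h2 : R₀.card ≤ (R₀ \ E).card + 2 := by
      have := Finset.card_sdiff_add_card R₀ E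
      have := Finset.card_le_card (Finset.subset_union_left : R₀ ⊆ R₀ ∪ E)
      omega
    have h3 : (R₀.card : ℝ) ≤ (R₀ \ E).card + 2 := by exact_mod_cast h2
    linarith
  calc _ ≤ ∑ χ : DirichletCharacter ℂ q,
        ENNReal.ofReal (C * Real.log (q * T) * (zeroBoxes χ σ T).card) :=
        Finset.sum_le_sum fun χ _ => h q χ σ T hσ hT
    _ = ENNReal.ofReal (C * Real.log (q * T) * R₀.card) := by
        rw [← ENNReal.ofReal_sum_of_nonneg fun _ _ => by positivity, ← Finset.mul_sum, hR₀,
          Finset.card_map, Finset.card_sigma]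
        push_cast
        rfl
    _ ≤ _ := by gcongr

end ZeroDensity

namespace ZeroDensity

open Complex MeasureTheory Set Filter Topology DirichletCharacter

lemma sum_eq_dirichletPoly {d : ℕ} (χ : DirichletCharacter ℂ d) {S : Finset ℕ} (hS : ∀ n ∈ S, 0 < n)
    (c : ℕ → ℂ) (σ t : ℝ) :
    ∑ n ∈ S, c n * (χ n * (n : ℂ) ^ (-(σ + t * I))) =
      dirichletPoly χ S (fun n => c n * ((n : ℝ) ^ (-σ) : ℝ)) t := by
  refine Finset.sum_congr rfl fun n hn => ?_
  rw [← term_eq_cexp c χ σ t (hS n hn), LSeries.term_of_ne_zero (hS n hn).ne', cpow_neg]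
  ring

lemma lintegral_exp_neg_sq_le : ∫⁻ v : ℝ, ENNReal.ofReal (Real.exp (-v ^ 2)) ≤ ENNReal.ofReal 2 := by
  rw [← ofReal_integral_eq_lintegral_ofReal integrable_exp_neg_sq
    (ae_of_all _ fun _ => (Real.exp_pos _).le)]
  have h := integral_gaussian 1
  simp only [neg_mul, one_mul, div_one] at h
  rw [h]
  refine ENNReal.ofReal_le_ofReal ?_
  rw [Real.sqrt_le_left (by norm_num)]
  linarith [Real.pi_lt_four]

lemma lintegral_exp_neg_half_sq_le :
    ∫⁻ v : ℝ, ENNReal.ofReal (Real.exp (-v ^ 2 / 2)) ≤ ENNReal.ofReal 3 := by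
  have hi : Integrable fun v : ℝ => Real.exp (-v ^ 2 / 2) := by
    have h := integrable_exp_neg_mul_sq (b := 1 / 2) (by norm_num)
    refine h.congr (ae_of_all _ fun v => ?_)
    ring_nf
  rw [← ofReal_integral_eq_lintegral_ofReal hi (ae_of_all _ fun _ => (Real.exp_pos _).le)]
  have h := integral_gaussian (1 / 2)
  have e : ∀ v : ℝ, -(1 / 2) * v ^ 2 = -v ^ 2 / 2 := fun v => by ring
  simp_rw [e] at h
  rw [h]
  refine ENNReal.ofReal_le_ofReal ?_
  rw [Real.sqrt_le_left (by norm_num)]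
  linarith [Real.pi_lt_four]

lemma continuous_LFunction_critical {q : ℕ} [NeZero q] (χ : DirichletCharacter ℂ q) :
    Continuous fun t : ℝ => LFunction χ (1 / 2 + t * I) := by
  rw [continuous_iff_continuousAt]
  intro t
  have h : DifferentiableAt ℂ (LFunction χ) (1 / 2 + t * I) :=
    differentiableAt_LFunction χ _ (Or.inl fun h => by
      have := congrArg re h
      norm_num at this)
  exact ContinuousAt.comp (f := fun t : ℝ => (1 / 2 + t * I : ℂ)) h.continuousAt (by fun_prop)

/-- The discrete fourth moment at well-spaced points. -/
theorem exists_sum_fourth_le : ∃ C : ℝ, 0 < C ∧ ∀ (q : ℕ) [NeZero q] (T : ℝ), 2 ≤ T →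
    ∀ (R : Finset (DirichletCharacter ℂ q × ℤ)) (γ : DirichletCharacter ℂ q × ℤ → ℝ),
    WellSpaced R γ 1 → (∀ r ∈ R, |γ r| ≤ T) →
    ∑ r ∈ R, ∫⁻ v : ℝ, ‖LFunction r.1 (1 / 2 + (γ r + v : ℝ) * I)‖ₑ ^ 4 *
      ENNReal.ofReal (Real.exp (-v ^ 2 / 2)) ≤ ENNReal.ofReal (C * (q * T * Real.log (q * T) ^ 6)) := by
  obtain ⟨C, hC, h⟩ := fourth_moment
  refine ⟨4 * Real.exp 5 * C, by positivity, fun q _ T hT R γ hR hγ => ?_⟩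
  have h1 := hR.sum_lintegral_le (by linarith) hγ
    (fun χ t => ‖LFunction χ (1 / 2 + t * I)‖ₑ ^ 4)
    (fun χ => (continuous_LFunction_critical χ).enorm.measurable.pow_const 4)
  refine h1.trans ?_
  rw [mul_assoc _ C, ENNReal.ofReal_mul (p := 4 * Real.exp 5) (by positivity)]
  gcongr
  exact (h q T hT).trans_eq (by ring_nf)

/-- The discrete second moment of the mollifier at well-spaced points. -/
theorem exists_sum_mollifier_sq_le : ∃ C : ℝ, 0 < C ∧ ∀ (q : ℕ) [NeZero q] (T X : ℝ), 2 ≤ T → 1 ≤ X →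
    ∀ (R : Finset (DirichletCharacter ℂ q × ℤ)) (γ : DirichletCharacter ℂ q × ℤ → ℝ),
    WellSpaced R γ 1 → (∀ r ∈ R, |γ r| ≤ T) →
    ∑ r ∈ R, ∫⁻ v : ℝ, ‖mollifier r.1 X (1 / 2 + (γ r + v : ℝ) * I)‖ₑ ^ 2 *
      ENNReal.ofReal (Real.exp (-v ^ 2 / 2)) ≤
        ENNReal.ofReal (C * ((q * T + X) * (1 + Real.log X))) := by
  obtain ⟨C, hC, h⟩ := mean_value_finite
  refine ⟨4 * Real.exp 5 * C, by positivity, fun q _ T X hT hX R γ hR hγ => ?_⟩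
  have hq := one_le_natCast_level q
  have hlog : 0 ≤ Real.log X := Real.log_nonneg hX
  have h1 := hR.sum_lintegral_le (by linarith) hγ
    (fun χ t => ‖mollifier χ X (1 / 2 + t * I)‖ₑ ^ 2)
    (fun χ => by
      have : Continuous fun t : ℝ => mollifier χ X (1 / 2 + t * I) :=
        (differentiable_mollifier χ X).continuous.comp (by fun_prop)
      exact (this.enorm.measurable.pow_const 2))
  refine h1.trans ?_
  rw [mul_assoc _ C, ENNReal.ofReal_mul (p := 4 * Real.exp 5) (by positivity)]
  gcongr
  have hpos : ∀ n ∈ Finset.Icc 1 ⌊X⌋₊, 0 < n := fun n hn => (Finset.mem_Icc.1 hn).1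
  have e : ∀ (χ : DirichletCharacter ℂ q) (t : ℝ), mollifier χ X (1 / 2 + t * I) =
      dirichletPoly χ (Finset.Icc 1 ⌊X⌋₊)
        (fun n => (mobCut X n : ℂ) * ((n : ℝ) ^ (-(1 / 2 : ℝ)) : ℝ)) t := by
    intro χ t
    rw [← sum_eq_dirichletPoly χ hpos, mollifier_eq_sum]
    push_cast
    rfl
  simp_rw [e]
  refine (h q T (by linarith) _ hpos _).trans (ENNReal.ofReal_le_ofReal ?_)
  gcongr
  calc _ ≤ ∑ n ∈ Finset.Icc 1 ⌊X⌋₊, (q * T + X) * (n : ℝ)⁻¹ := by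
        refine Finset.sum_le_sum fun n hn => ?_
        have hn0 : (0 : ℝ) < n := by exact_mod_cast hpos n hn
        have hnX : (n : ℝ) ≤ X := (Nat.le_floor_iff (by linarith)).1 (Finset.mem_Icc.1 hn).2
        have e1 : ‖(mobCut X n : ℂ) * ((n : ℝ) ^ (-(1 / 2 : ℝ)) : ℝ)‖ ^ 2 ≤ (n : ℝ)⁻¹ := by
          rw [norm_mul, norm_real, norm_real, mul_pow, Real.norm_eq_abs, Real.norm_eq_abs, sq_abs,
            sq_abs, ← Real.rpow_natCast ((n : ℝ) ^ _), ← Real.rpow_mul hn0.le]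
          have : mobCut X n ^ 2 ≤ 1 := by
            rw [← sq_abs]; exact pow_le_one₀ (abs_nonneg _) (abs_mobCut_le X n)
          norm_num [Real.rpow_neg_one]
          exact mul_le_of_le_one_left (by positivity) this
        gcongr
    _ = (q * T + X) * (harmonic ⌊X⌋₊ : ℝ) := by
        rw [← Finset.mul_sum, harmonic_eq_sum_Icc]; push_cast; rfl
    _ ≤ _ := by
        have h2 := harmonic_le_one_add_log ⌊X⌋₊
        have h3 : Real.log ⌊X⌋₊ ≤ Real.log X :=
          Real.log_le_log (by exact_mod_cast Nat.floor_pos.2 hX) (Nat.floor_le (by linarith))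
        gcongr
        linarith

lemma mul_le_pow_four_add {x y a : ℝ} (ha : 0 < a) : x * y ≤ a * x ^ 4 + a * y ^ 2 + (a ^ 3)⁻¹ := by
  have h1 : a ^ 2 * x ^ 2 ≤ a ^ 4 * x ^ 4 + 1 := by nlinarith [sq_nonneg (a ^ 2 * x ^ 2 - 1)]
  have h2 : a ^ 3 * (x * y) ≤ a ^ 3 * (a * x ^ 4 + a * y ^ 2 + (a ^ 3)⁻¹) := by
    rw [mul_add, mul_inv_cancel₀ (by positivity)]
    have h3 : 0 ≤ (a ^ 2 * y - a * x) ^ 2 := sq_nonneg _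
    nlinarith [sq_nonneg (a * x), sq_nonneg (a ^ 2 * y)]
  exact le_of_mul_le_mul_left h2 (by positivity)

lemma le_pow_four_add {x a : ℝ} (hx : 0 ≤ x) (ha : 0 < a) : x ≤ (a ^ 3)⁻¹ * x ^ 4 + a := by
  rcases le_total x a with h | h
  · have : 0 ≤ (a ^ 3)⁻¹ * x ^ 4 := by positivity
    linarith
  · have h1 : a ^ 3 ≤ x ^ 3 := by gcongr
    have h2 : x = (a ^ 3)⁻¹ * (x * a ^ 3) := by field_simp
    have h3 : (a ^ 3)⁻¹ * (x * a ^ 3) ≤ (a ^ 3)⁻¹ * x ^ 4 := by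
      gcongr
      calc x * a ^ 3 ≤ x * x ^ 3 := by gcongr
        _ = _ := by ring
    linarith

/-- Points where a mollified mean of `L` on the critical line is large are rare. -/
theorem exists_card_le_of_large_product : ∃ C : ℝ, 0 < C ∧ ∀ (q : ℕ) [NeZero q] (T X A : ℝ), 2 ≤ T →
    1 ≤ X → 0 < A →
    ∀ (R : Finset (DirichletCharacter ℂ q × ℤ)) (γ : DirichletCharacter ℂ q × ℤ → ℝ),
    WellSpaced R γ 1 → (∀ r ∈ R, |γ r| ≤ T) →
    (∀ r ∈ R, ENNReal.ofReal A ≤ ∫⁻ v : ℝ, ‖LFunction r.1 (1 / 2 + (γ r + v : ℝ) * I)‖ₑ *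
      ‖mollifier r.1 X (1 / 2 + (γ r + v : ℝ) * I)‖ₑ * ENNReal.ofReal (Real.exp (-v ^ 2))) →
    (R.card : ℝ) ≤ C * (A ^ (-(4 / 3) : ℝ) *
      (q * T * Real.log (q * T) ^ 6 + (q * T + X) * (1 + Real.log X))) := by
  obtain ⟨C₁, hC₁, h₁⟩ := exists_sum_fourth_le
  obtain ⟨C₂, hC₂, h₂⟩ := exists_sum_mollifier_sq_le
  refine ⟨4 * (C₁ + C₂), by positivity, fun q _ T X A hT hX hA R γ hR hγ hlarge => ?_⟩
  have hq := one_le_natCast_level q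
  have hlog : 0 ≤ Real.log X := Real.log_nonneg hX
  set a : ℝ := (A / 4) ^ (-(1 / 3) : ℝ) with ha
  have ha0 : 0 < a := by positivity
  have ha3 : (a ^ 3)⁻¹ = A / 4 := by
    rw [ha, ← Real.rpow_natCast, ← Real.rpow_mul (by positivity)]
    norm_num [Real.rpow_neg_one]
  set B₁ := C₁ * (q * T * Real.log (q * T) ^ 6) with hB₁
  set B₂ := C₂ * ((q * T + X) * (1 + Real.log X)) with hB₂
  have hB₁0 : 0 ≤ B₁ := by rw [hB₁]; positivity
  have hB₂0 : 0 ≤ B₂ := by rw [hB₂]; positivity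
  have key : ENNReal.ofReal (R.card * A) ≤ ENNReal.ofReal (a * B₁ + a * B₂ + R.card * (A / 4 * 2)) := by
    calc ENNReal.ofReal (R.card * A) = ∑ r ∈ R, ENNReal.ofReal A := by
          rw [Finset.sum_const, nsmul_eq_mul, ENNReal.ofReal_mul (by positivity), ENNReal.ofReal_natCast]
      _ ≤ ∑ r ∈ R, (ENNReal.ofReal a * (∫⁻ v : ℝ, ‖LFunction r.1 (1 / 2 + (γ r + v : ℝ) * I)‖ₑ ^ 4 *
            ENNReal.ofReal (Real.exp (-v ^ 2 / 2))) +
          ENNReal.ofReal a * (∫⁻ v : ℝ, ‖mollifier r.1 X (1 / 2 + (γ r + v : ℝ) * I)‖ₑ ^ 2 *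
            ENNReal.ofReal (Real.exp (-v ^ 2 / 2))) + ENNReal.ofReal (A / 4 * 2)) := by
          refine Finset.sum_le_sum fun r hr => (hlarge r hr).trans ?_
          have hm1 : Measurable fun v : ℝ => ‖LFunction r.1 (1 / 2 + (γ r + v : ℝ) * I)‖ₑ ^ 4 *
              ENNReal.ofReal (Real.exp (-v ^ 2 / 2)) := by
            have : Continuous fun v : ℝ => LFunction r.1 (1 / 2 + (γ r + v : ℝ) * I) :=
              (continuous_LFunction_critical r.1).comp (by fun_prop)
            exact (this.enorm.measurable.pow_const 4).mul (by fun_prop)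
          have hm2 : Measurable fun v : ℝ => ‖mollifier r.1 X (1 / 2 + (γ r + v : ℝ) * I)‖ₑ ^ 2 *
              ENNReal.ofReal (Real.exp (-v ^ 2 / 2)) := by
            have : Continuous fun v : ℝ => mollifier r.1 X (1 / 2 + (γ r + v : ℝ) * I) :=
              (differentiable_mollifier r.1 X).continuous.comp (by fun_prop)
            exact (this.enorm.measurable.pow_const 2).mul (by fun_prop)
          have h3 : ENNReal.ofReal (A / 4) * ∫⁻ v : ℝ, ENNReal.ofReal (Real.exp (-v ^ 2)) ≤
              ENNReal.ofReal (A / 4 * 2) := by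
            rw [ENNReal.ofReal_mul (by positivity)]
            exact mul_le_mul_right lintegral_exp_neg_sq_le _
          refine le_trans ?_ (add_le_add_right h3 _)
          rw [← lintegral_const_mul _ hm1, ← lintegral_const_mul _ hm2, ← lintegral_const_mul _
            (by fun_prop), ← lintegral_add_left (hm1.const_mul _),
            ← lintegral_add_right _ (by fun_prop)]
          refine lintegral_mono fun v => ?_
          set x := LFunction r.1 (1 / 2 + (γ r + v : ℝ) * I)
          set y := mollifier r.1 X (1 / 2 + (γ r + v : ℝ) * I)
          have hxy := mul_le_pow_four_add (x := ‖x‖) (y := ‖y‖) ha0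
          rw [ha3] at hxy
          simp only [← ofReal_norm]
          rw [← ENNReal.ofReal_mul (by positivity), ← ENNReal.ofReal_mul (by positivity),
            ← ENNReal.ofReal_pow (by positivity), ← ENNReal.ofReal_pow (by positivity),
            ← ENNReal.ofReal_mul (by positivity), ← ENNReal.ofReal_mul (by positivity),
            ← ENNReal.ofReal_mul (by positivity), ← ENNReal.ofReal_mul (by positivity),
            ← ENNReal.ofReal_mul (by positivity), ← ENNReal.ofReal_add (by positivity) (by positivity),
            ← ENNReal.ofReal_add (by positivity) (by positivity)]
          refine ENNReal.ofReal_le_ofReal ?_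
          have he : Real.exp (-v ^ 2) ≤ Real.exp (-v ^ 2 / 2) :=
            Real.exp_le_exp.2 (by nlinarith [sq_nonneg v])
          calc ‖x‖ * ‖y‖ * Real.exp (-v ^ 2)
              ≤ (a * ‖x‖ ^ 4 + a * ‖y‖ ^ 2 + A / 4) * Real.exp (-v ^ 2) := by gcongr
            _ = a * (‖x‖ ^ 4 * Real.exp (-v ^ 2)) + a * (‖y‖ ^ 2 * Real.exp (-v ^ 2)) +
                A / 4 * Real.exp (-v ^ 2) := by ring
            _ ≤ _ := by gcongr
      _ ≤ ENNReal.ofReal a * ENNReal.ofReal B₁ + ENNReal.ofReal a * ENNReal.ofReal B₂ +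
          R.card * ENNReal.ofReal (A / 4 * 2) := by
          rw [Finset.sum_add_distrib, Finset.sum_add_distrib, ← Finset.mul_sum, ← Finset.mul_sum,
            Finset.sum_const, nsmul_eq_mul]
          gcongr
          · exact h₁ q T hT R γ hR hγ
          · exact h₂ q T X hT hX R γ hR hγ
      _ = _ := by
          rw [ENNReal.ofReal_add (by positivity) (by positivity),
            ENNReal.ofReal_add (by positivity) (by positivity), ENNReal.ofReal_mul ha0.le,
            ENNReal.ofReal_mul ha0.le, ENNReal.ofReal_mul (Nat.cast_nonneg R.card), ENNReal.ofReal_natCast]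
  rw [ENNReal.ofReal_le_ofReal_iff (by positivity)] at key
  have h3 : (R.card : ℝ) * A ≤ 2 * a * (B₁ + B₂) := by linarith
  have h4 : a / A ≤ 2 * A ^ (-(4 / 3) : ℝ) := by
    have e1 : a = A ^ (-(1 / 3) : ℝ) * (4 : ℝ) ^ (1 / 3 : ℝ) := by
      rw [ha, Real.div_rpow hA.le (by norm_num), Real.rpow_neg (show (0 : ℝ) ≤ 4 by norm_num),
        div_inv_eq_mul]
    have e2 : (4 : ℝ) ^ (1 / 3 : ℝ) ≤ 2 := by
      calc (4 : ℝ) ^ (1 / 3 : ℝ) ≤ (4 : ℝ) ^ (1 / 2 : ℝ) := by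
            exact Real.rpow_le_rpow_of_exponent_le (by norm_num) (by norm_num)
        _ = 2 := by
            rw [show (4 : ℝ) = 2 ^ (2 : ℝ) by norm_num, ← Real.rpow_mul (by norm_num)]; norm_num
    have e3 : A ^ (-(1 / 3) : ℝ) / A = A ^ (-(4 / 3) : ℝ) := by
      nth_rewrite 2 [← Real.rpow_one A]
      rw [← Real.rpow_sub hA]; norm_num
    rw [e1, mul_div_right_comm, e3, mul_comm]
    gcongr
  calc (R.card : ℝ) = R.card * A / A := by field_simp
    _ ≤ 2 * a * (B₁ + B₂) / A := by gcongr
    _ = 2 * (a / A) * (B₁ + B₂) := by ring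
    _ ≤ 2 * (2 * A ^ (-(4 / 3) : ℝ)) * (B₁ + B₂) := by gcongr
    _ ≤ 2 * (2 * A ^ (-(4 / 3) : ℝ)) * ((C₁ + C₂) * (q * T * Real.log (q * T) ^ 6) +
        (C₁ + C₂) * ((q * T + X) * (1 + Real.log X))) := by
        rw [hB₁, hB₂]
        gcongr <;> linarith
    _ = _ := by ring

/-- Points where a local mean of `L` on the critical line is large are rare. -/
theorem exists_card_le_of_large_mean : ∃ C : ℝ, 0 < C ∧ ∀ (q : ℕ) [NeZero q] (T A : ℝ), 2 ≤ T → 0 < A →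
    ∀ (R : Finset (DirichletCharacter ℂ q × ℤ)) (γ : DirichletCharacter ℂ q × ℤ → ℝ),
    WellSpaced R γ 1 → (∀ r ∈ R, |γ r| ≤ T) →
    (∀ r ∈ R, ENNReal.ofReal A ≤ ∫⁻ v : ℝ, ‖LFunction r.1 (1 / 2 + (γ r + v : ℝ) * I)‖ₑ *
      ENNReal.ofReal (Real.exp (-v ^ 2 / 2))) →
    (R.card : ℝ) ≤ C * ((A ^ 4)⁻¹ * (q * T * Real.log (q * T) ^ 6)) := by
  obtain ⟨C₁, hC₁, h₁⟩ := exists_sum_fourth_le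
  refine ⟨432 * C₁, by positivity, fun q _ T A hT hA R γ hR hγ hlarge => ?_⟩
  set B₁ := C₁ * (q * T * Real.log (q * T) ^ 6) with hB₁
  have hB₁0 : 0 ≤ B₁ := by rw [hB₁]; positivity
  set a : ℝ := ((A / 6) ^ 3)⁻¹ with ha
  have ha0 : 0 < a := by positivity
  have key : ENNReal.ofReal (R.card * A) ≤ ENNReal.ofReal (a * B₁ + R.card * (A / 6 * 3)) := by
    calc ENNReal.ofReal (R.card * A) = ∑ r ∈ R, ENNReal.ofReal A := by
          rw [Finset.sum_const, nsmul_eq_mul, ENNReal.ofReal_mul (by positivity), ENNReal.ofReal_natCast]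
      _ ≤ ∑ r ∈ R, (ENNReal.ofReal a * (∫⁻ v : ℝ, ‖LFunction r.1 (1 / 2 + (γ r + v : ℝ) * I)‖ₑ ^ 4 *
            ENNReal.ofReal (Real.exp (-v ^ 2 / 2))) + ENNReal.ofReal (A / 6 * 3)) := by
          refine Finset.sum_le_sum fun r hr => (hlarge r hr).trans ?_
          have hm1 : Measurable fun v : ℝ => ‖LFunction r.1 (1 / 2 + (γ r + v : ℝ) * I)‖ₑ ^ 4 *
              ENNReal.ofReal (Real.exp (-v ^ 2 / 2)) := by
            have : Continuous fun v : ℝ => LFunction r.1 (1 / 2 + (γ r + v : ℝ) * I) :=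
              (continuous_LFunction_critical r.1).comp (by fun_prop)
            exact (this.enorm.measurable.pow_const 4).mul (by fun_prop)
          have h3 : ENNReal.ofReal (A / 6) * ∫⁻ v : ℝ, ENNReal.ofReal (Real.exp (-v ^ 2 / 2)) ≤
              ENNReal.ofReal (A / 6 * 3) := by
            rw [ENNReal.ofReal_mul (by positivity)]
            exact mul_le_mul_right lintegral_exp_neg_half_sq_le _
          refine le_trans ?_ (add_le_add_right h3 _)
          rw [← lintegral_const_mul _ hm1, ← lintegral_const_mul _ (by fun_prop),
            ← lintegral_add_left (hm1.const_mul _)]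
          refine lintegral_mono fun v => ?_
          set x := LFunction r.1 (1 / 2 + (γ r + v : ℝ) * I)
          have hx := le_pow_four_add (norm_nonneg x) (by positivity : 0 < A / 6)
          simp only [← ofReal_norm]
          rw [← ENNReal.ofReal_mul (by positivity), ← ENNReal.ofReal_pow (by positivity),
            ← ENNReal.ofReal_mul (by positivity), ← ENNReal.ofReal_mul (by positivity),
            ← ENNReal.ofReal_mul (by positivity), ← ENNReal.ofReal_add (by positivity) (by positivity)]
          refine ENNReal.ofReal_le_ofReal ?_
          calc ‖x‖ * Real.exp (-v ^ 2 / 2) ≤ (a * ‖x‖ ^ 4 + A / 6) * Real.exp (-v ^ 2 / 2) := by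
                gcongr
            _ = _ := by ring
      _ ≤ ENNReal.ofReal a * ENNReal.ofReal B₁ + R.card * ENNReal.ofReal (A / 6 * 3) := by
          rw [Finset.sum_add_distrib, ← Finset.mul_sum, Finset.sum_const, nsmul_eq_mul]
          gcongr
          exact h₁ q T hT R γ hR hγ
      _ = _ := by
          rw [ENNReal.ofReal_add (by positivity) (by positivity), ENNReal.ofReal_mul ha0.le,
            ENNReal.ofReal_mul (Nat.cast_nonneg R.card), ENNReal.ofReal_natCast]
  rw [ENNReal.ofReal_le_ofReal_iff (by positivity)] at key
  have h3 : (R.card : ℝ) * A ≤ 2 * a * B₁ := by linarith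
  calc (R.card : ℝ) = R.card * A / A := by field_simp
    _ ≤ 2 * a * B₁ / A := by gcongr
    _ = _ := by rw [ha, hB₁]; field_simp; ring

end ZeroDensity

namespace ZeroDensity

open Complex MeasureTheory Set Filter Topology DirichletCharacter

lemma pos_of_mem_detRange {X Y : ℝ} {n : ℕ} (hn : n ∈ detRange X Y) : 0 < n :=
  (Finset.mem_Icc.1 (Finset.mem_filter.1 hn).1).1

lemma differentiable_detSum {q : ℕ} (χ : DirichletCharacter ℂ q) (X Y : ℝ) (i : Bool) :
    Differentiable ℂ (detSum χ X Y i) := by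
  intro s
  have : detSum χ X Y i = fun s => ∑ n ∈ detRange X Y, cutCoeff X Y i n * (χ n * (n : ℂ) ^ (-s)) := rfl
  rw [this]
  refine DifferentiableAt.fun_sum fun n hn => ?_
  have hn0 : (n : ℂ) ≠ 0 := Nat.cast_ne_zero.2 (pos_of_mem_detRange hn).ne'
  refine DifferentiableAt.const_mul (DifferentiableAt.const_mul ?_ _) _
  exact differentiableAt_id.neg.const_cpow (Or.inl hn0)

lemma norm_detSum_le {q : ℕ} (χ : DirichletCharacter ℂ q) (X Y : ℝ) (i : Bool) {s : ℂ}
    (hs : 0 ≤ s.re) : ‖detSum χ X Y i s‖ ≤ ∑ n ∈ detRange X Y, ‖cutCoeff X Y i n‖ := by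
  refine (norm_sum_le _ _).trans (Finset.sum_le_sum fun n hn => ?_)
  have hn0 := pos_of_mem_detRange hn
  have hn1 : (1 : ℝ) ≤ n := by exact_mod_cast hn0
  rw [norm_mul, norm_mul, norm_natCast_cpow hn0]
  have h1 : (n : ℝ) ^ (-s).re ≤ 1 := Real.rpow_le_one_of_one_le_of_nonpos hn1 (by simpa using hs)
  have h2 := χ.norm_le_one n
  exact mul_le_of_le_one_right (norm_nonneg _) (mul_le_one₀ h2 (by positivity) h1)

lemma lintegral_line_sq_le {g : ℝ → ℂ} (hg : Measurable g) {a δ : ℝ} (hδ : 0 < δ) (hδa : δ ≤ |a|)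
    (ha : |a| ≤ 3 / 2) :
    (∫⁻ v : ℝ, ‖g v * cauchyKernel (a + v * I)‖ₑ) ^ 2 ≤
      ENNReal.ofReal (300 / δ ^ 2) *
        ∫⁻ v : ℝ, ‖g v‖ₑ ^ 2 * ENNReal.ofReal (Real.exp (-v ^ 2 / 2)) := by
  have ha0 : a ≠ 0 := fun h => by rw [h, abs_zero] at hδa; linarith
  have hexp : Real.exp (a ^ 2) ≤ 10 := by
    have h1 : a ^ 2 ≤ 9 / 4 := by rw [← sq_abs]; nlinarith [abs_nonneg a]
    have h2 : Real.exp (9 / 4) ^ 4 = Real.exp 1 ^ 9 := by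
      rw [← Real.exp_nat_mul, ← Real.exp_nat_mul]; norm_num
    have h3 : Real.exp 1 ^ 9 ≤ 2.7182818286 ^ 9 := by
      have := Real.exp_one_lt_d9
      gcongr
    refine (Real.exp_le_exp.2 h1).trans ?_
    by_contra h4
    push Not at h4
    have h5 : (10 : ℝ) ^ 4 < Real.exp (9 / 4) ^ 4 :=
      pow_lt_pow_left₀ h4 (by norm_num) (by norm_num)
    rw [h2] at h5
    have h6 := h5.trans_le h3
    norm_num at h6
  have hK : ∀ v : ℝ, ‖cauchyKernel (a + v * I)‖ ≤
      10 / δ * (Real.exp (-v ^ 2 / 4) * Real.exp (-v ^ 2 / 4)) := by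
    intro v
    refine (norm_cauchyKernel_le ha0 v).trans ?_
    rw [← Real.exp_add]
    gcongr
    nlinarith [sq_nonneg v]
  calc (∫⁻ v : ℝ, ‖g v * cauchyKernel (a + v * I)‖ₑ) ^ 2
      ≤ (ENNReal.ofReal (10 / δ) * ∫⁻ v : ℝ, ‖g v‖ₑ * ENNReal.ofReal (Real.exp (-v ^ 2 / 4)) *
          ENNReal.ofReal (Real.exp (-v ^ 2 / 4))) ^ 2 := by
        rw [← lintegral_const_mul _ (by fun_prop)]
        gcongr with v
        simp only [← ofReal_norm, norm_mul]
        rw [← ENNReal.ofReal_mul (by positivity), ← ENNReal.ofReal_mul (by positivity),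
          ← ENNReal.ofReal_mul (by positivity)]
        refine ENNReal.ofReal_le_ofReal ?_
        calc _ ≤ ‖g v‖ * (10 / δ * (Real.exp (-v ^ 2 / 4) * Real.exp (-v ^ 2 / 4))) := by
              gcongr
              exact hK v
          _ = _ := by ring
    _ ≤ ENNReal.ofReal (10 / δ) ^ 2 *
        ((∫⁻ v : ℝ, (‖g v‖ₑ * ENNReal.ofReal (Real.exp (-v ^ 2 / 4))) ^ 2) *
          ∫⁻ v : ℝ, ENNReal.ofReal (Real.exp (-v ^ 2 / 4)) ^ 2) := by
        rw [mul_pow]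
        exact mul_le_mul_right (lintegral_mul_sq_le (by fun_prop) (by fun_prop)) _
    _ = ENNReal.ofReal (10 / δ) ^ 2 *
        ((∫⁻ v : ℝ, ‖g v‖ₑ ^ 2 * ENNReal.ofReal (Real.exp (-v ^ 2 / 2))) *
          ∫⁻ v : ℝ, ENNReal.ofReal (Real.exp (-v ^ 2 / 2))) := by
        have e : ∀ v : ℝ, ENNReal.ofReal (Real.exp (-v ^ 2 / 4)) ^ 2 =
            ENNReal.ofReal (Real.exp (-v ^ 2 / 2)) := by
          intro v
          rw [← ENNReal.ofReal_pow (Real.exp_pos _).le, ← Real.exp_nat_mul]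
          congr 2
          push_cast; ring
        simp_rw [mul_pow, e]
    _ ≤ ENNReal.ofReal (10 / δ) ^ 2 *
        ((∫⁻ v : ℝ, ‖g v‖ₑ ^ 2 * ENNReal.ofReal (Real.exp (-v ^ 2 / 2))) * ENNReal.ofReal 3) :=
        mul_le_mul_right (mul_le_mul_right lintegral_exp_neg_half_sq_le _) _
    _ = _ := by
        rw [mul_comm _ (ENNReal.ofReal 3), ← mul_assoc, ← ENNReal.ofReal_pow (by positivity),
          ← ENNReal.ofReal_mul (by positivity)]
        congr 2
        ring

/-- A point value is controlled by local means over two vertical lines. -/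
lemma enorm_sq_le_of_strip {f : ℂ → ℂ} (hf : Differentiable ℂ f) {M : ℝ}
    (hM : ∀ z : ℂ, 0 ≤ z.re → ‖f z‖ ≤ M) {ρ : ℂ} {σ δ : ℝ} (hσ : 1 / 2 ≤ σ) (hσρ : σ ≤ ρ.re)
    (hρ : ρ.re ≤ 1) (hδ : 0 < δ) (hδ1 : δ ≤ 1 / 4) :
    ‖f ρ‖ₑ ^ 2 ≤ ENNReal.ofReal (1200 / δ ^ 2) *
      ((∫⁻ v : ℝ, ‖f ((2 : ℝ) + (ρ.im + v : ℝ) * I)‖ₑ ^ 2 * ENNReal.ofReal (Real.exp (-v ^ 2 / 2))) +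
      ∫⁻ v : ℝ, ‖f ((σ - δ : ℝ) + (ρ.im + v : ℝ) * I)‖ₑ ^ 2 *
        ENNReal.ofReal (Real.exp (-v ^ 2 / 2))) := by
  set a : ℝ := σ - δ - ρ.re with ha
  set b : ℝ := 2 - ρ.re with hb
  have h := strip_cauchy (f := f) (s := ρ) (a := a) (b := b) (A := 0) (C := M) (by linarith)
    (by linarith) (fun z _ _ => hf _) (fun z h1 _ => by
      rw [zero_mul, Real.exp_zero, mul_one]
      exact hM _ (by rw [add_re]; linarith))
  have ea : ∀ v : ℝ, ρ + (a + v * I) = (σ - δ : ℝ) + (ρ.im + v : ℝ) * I := fun v => by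
    apply Complex.ext <;> simp [ha]
  have eb : ∀ v : ℝ, ρ + (b + v * I) = (2 : ℝ) + (ρ.im + v : ℝ) * I := fun v => by
    apply Complex.ext <;> simp [hb]
  simp_rw [ea, eb] at h
  set ga : ℝ → ℂ := fun v => f ((σ - δ : ℝ) + (ρ.im + v : ℝ) * I) with hga
  set gb : ℝ → ℂ := fun v => f ((2 : ℝ) + (ρ.im + v : ℝ) * I) with hgb
  have hgam : Measurable ga := (hf.continuous.comp (by fun_prop)).measurable
  have hgbm : Measurable gb := (hf.continuous.comp (by fun_prop)).measurable
  have h1 : ‖f ρ‖ₑ ≤ ‖2 * Real.pi * f ρ‖ₑ := by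
    rw [← ofReal_norm, ← ofReal_norm]
    refine ENNReal.ofReal_le_ofReal ?_
    rw [norm_mul, norm_mul, norm_real, Real.norm_of_nonneg Real.pi_pos.le, RCLike.norm_ofNat]
    nlinarith [norm_nonneg (f ρ), Real.pi_gt_three]
  have h2 : ‖f ρ‖ₑ ≤ (∫⁻ v : ℝ, ‖gb v * cauchyKernel (b + v * I)‖ₑ) +
      ∫⁻ v : ℝ, ‖ga v * cauchyKernel (a + v * I)‖ₑ := by
    refine h1.trans ?_
    rw [h]
    exact (enorm_sub_le).trans (add_le_add (enorm_integral_le_lintegral_enorm _)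
      (enorm_integral_le_lintegral_enorm _))
  have hab : |a| = -a := abs_of_neg (by linarith)
  have hbb : |b| = b := abs_of_pos (by linarith)
  have h3 := lintegral_line_sq_le (a := a) hgam hδ (by rw [hab]; linarith) (by rw [hab]; linarith)
  have h4 := lintegral_line_sq_le (a := b) hgbm hδ (by rw [hbb]; linarith) (by rw [hbb]; linarith)
  calc ‖f ρ‖ₑ ^ 2 ≤ _ := pow_le_pow_left' h2 2
    _ ≤ _ := enorm_add_sq_le _ _
    _ ≤ 4 * (_ + _) := mul_le_mul_right (add_le_add h4 h3) _
    _ = _ := by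
        rw [← mul_add, ← mul_assoc, show (4 : ENNReal) = ENNReal.ofReal 4 by norm_num,
          ← ENNReal.ofReal_mul (by norm_num)]
        congr 2
        ring

lemma min_sq_mul_rpow_le {Y n σ σ' δ : ℝ} (hY : 1 ≤ Y) (hn : 1 ≤ n) (hσ : 1 / 2 ≤ σ) (hσ1 : σ ≤ 1)
    (hδ : 0 < δ) (hδ1 : δ ≤ 1 / 4) (hσ' : σ - δ ≤ σ') :
    n * (min 1 (Y / n) ^ 2 * n ^ (-(2 * σ'))) ≤ Y ^ (2 - 2 * σ + 3 * δ) * n ^ (-(1 + δ)) := by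
  have hn0 : 0 < n := by linarith
  have hY0 : 0 < Y := by linarith
  have h1 : n ^ (-(2 * σ')) ≤ n ^ (-(2 * (σ - δ))) :=
    Real.rpow_le_rpow_of_exponent_le hn (by linarith)
  have h2 : n * n ^ (-(2 * (σ - δ))) = n ^ (2 - 2 * σ + 3 * δ) * n ^ (-(1 + δ)) := by
    nth_rewrite 1 [← Real.rpow_one n]
    rw [← Real.rpow_add hn0, ← Real.rpow_add hn0]
    ring_nf
  have hm0 : 0 ≤ min 1 (Y / n) := le_min zero_le_one (by positivity)
  have h3 : min 1 (Y / n) ^ 2 * n ^ (2 - 2 * σ + 3 * δ) ≤ Y ^ (2 - 2 * σ + 3 * δ) := by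
    have hm1 : min 1 (Y / n) ^ (2 : ℝ) ≤ min 1 (Y / n) ^ (2 - 2 * σ + 3 * δ) :=
      Real.rpow_le_rpow_of_exponent_ge (lt_min one_pos (by positivity)) (min_le_left _ _) (by linarith)
    have hm2 : min 1 (Y / n) ^ (2 - 2 * σ + 3 * δ) ≤ (Y / n) ^ (2 - 2 * σ + 3 * δ) :=
      Real.rpow_le_rpow hm0 (min_le_right _ _) (by linarith)
    rw [← Real.rpow_natCast]
    calc _ ≤ (Y / n) ^ (2 - 2 * σ + 3 * δ) * n ^ (2 - 2 * σ + 3 * δ) := by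
          gcongr
          exact_mod_cast hm1.trans hm2
      _ = _ := by rw [← Real.mul_rpow (by positivity) hn0.le, div_mul_cancel₀ _ hn0.ne']
  calc _ ≤ n * (min 1 (Y / n) ^ 2 * n ^ (-(2 * (σ - δ)))) := by gcongr
    _ = (min 1 (Y / n) ^ 2 * n ^ (2 - 2 * σ + 3 * δ)) * n ^ (-(1 + δ)) := by
        rw [mul_left_comm, h2]; ring
    _ ≤ _ := by gcongr

/-- The mean square of the zero detecting sum on a vertical line, over all characters. -/
theorem exists_detSum_mean_le : ∃ C : ℝ, 0 < C ∧ ∀ (q : ℕ) [NeZero q] (T X Y σ σ' δ : ℝ) (i : Bool),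
    2 ≤ T → q * T ≤ X → 1 ≤ Y → 1 / 2 ≤ σ → σ ≤ 1 → 0 < δ → δ ≤ 1 / 4 → σ - δ ≤ σ' →
    ∑ χ : DirichletCharacter ℂ q, ∫⁻ t : ℝ, ‖detSum χ X Y i (σ' + t * I)‖ₑ ^ 2 * expWeight T t ≤
      ENNReal.ofReal (C * (Y ^ (2 - 2 * σ + 3 * δ) * (1 + 1 / δ) ^ 4)) := by
  obtain ⟨C, hC, h⟩ := mean_value_finite
  refine ⟨C * 8, by positivity, fun q _ T X Y σ σ' δ i hT hX hY hσ hσ1 hδ hδ1 hσ' => ?_⟩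
  have hq := one_le_natCast_level q
  have hY0 : 0 < Y := by linarith
  have hpos : ∀ n ∈ detRange X Y, 0 < n := fun n hn => pos_of_mem_detRange hn
  have e : ∀ (χ : DirichletCharacter ℂ q) (t : ℝ), detSum χ X Y i (σ' + t * I) =
      dirichletPoly χ (detRange X Y) (fun n => cutCoeff X Y i n * ((n : ℝ) ^ (-σ') : ℝ)) t :=
    fun χ t => sum_eq_dirichletPoly χ hpos _ σ' t
  simp_rw [e]
  refine (h q T (by linarith) _ hpos _).trans (ENNReal.ofReal_le_ofReal ?_)
  rw [mul_assoc]
  gcongr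
  obtain ⟨hs, hle⟩ := tau_sq_series hδ
  calc _ ≤ ∑ n ∈ detRange X Y, 8 * Y ^ (2 - 2 * σ + 3 * δ) * (tau n ^ 2 * (n : ℝ) ^ (-(1 + δ))) := by
        refine Finset.sum_le_sum fun n hn => ?_
        have hn0 := hpos n hn
        have hn1 : (1 : ℝ) ≤ n := by exact_mod_cast hn0
        have hn2 : (0 : ℝ) < n := by linarith
        have hXn : X < n := (Finset.mem_filter.1 hn).2
        have hm0 : 0 ≤ min 1 (Y / n) := le_min zero_le_one (by positivity)
        have e1 : ((n : ℝ) ^ (-σ')) ^ 2 = (n : ℝ) ^ (-(2 * σ')) := by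
          rw [← Real.rpow_natCast, ← Real.rpow_mul hn2.le]; ring_nf
        rw [norm_mul, norm_real, Real.norm_of_nonneg (by positivity), mul_pow, e1]
        calc _ ≤ (2 * n) * ((2 * tau n * min 1 (Y / n)) ^ 2 * (n : ℝ) ^ (-(2 * σ'))) := by
              gcongr
              · linarith
              · exact norm_cutCoeff_le hY0 i hn0
          _ = 8 * tau n ^ 2 * (n * (min 1 (Y / n) ^ 2 * (n : ℝ) ^ (-(2 * σ')))) := by ring
          _ ≤ 8 * tau n ^ 2 * (Y ^ (2 - 2 * σ + 3 * δ) * (n : ℝ) ^ (-(1 + δ))) :=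
              mul_le_mul_of_nonneg_left (min_sq_mul_rpow_le hY hn1 hσ hσ1 hδ hδ1 hσ') (by positivity)
          _ = _ := by ring
    _ = 8 * Y ^ (2 - 2 * σ + 3 * δ) * ∑ n ∈ detRange X Y, tau n ^ 2 * (n : ℝ) ^ (-(1 + δ)) := by
        rw [Finset.mul_sum]
    _ ≤ 8 * Y ^ (2 - 2 * σ + 3 * δ) * (1 + 1 / δ) ^ 4 := by
        gcongr
        exact (hs.sum_le_tsum _ fun n _ => by positivity).trans hle
    _ = _ := by ring

/-- Zeros at which a long zero detecting sum is large are rare. -/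
theorem exists_card_le_of_large_detSum : ∃ C : ℝ, 0 < C ∧ ∀ (q : ℕ) [NeZero q] (T X Y σ δ : ℝ)
    (i : Bool), 2 ≤ T → q * T ≤ X → 1 ≤ Y → 1 / 2 ≤ σ → σ ≤ 1 → 0 < δ → δ ≤ 1 / 4 →
    ∀ (R : Finset (DirichletCharacter ℂ q × ℤ)) (ρ : DirichletCharacter ℂ q × ℤ → ℂ),
    ZeroFamily R ρ σ T → (∀ r ∈ R, 1 / 12 ≤ ‖detSum r.1 X Y i (ρ r)‖) →
    (R.card : ℝ) ≤ C * (Y ^ (2 - 2 * σ + 3 * δ) * (1 + 1 / δ) ^ 4 / δ ^ 2) := by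
  obtain ⟨C, hC, h⟩ := exists_detSum_mean_le
  refine ⟨144 * (1200 * (4 * Real.exp 5 * (2 * C))), by positivity,
    fun q _ T X Y σ δ i hT hX hY hσ hσ1 hδ hδ1 R ρ hR hlarge => ?_⟩
  have hY0 : 0 < Y := by linarith
  set B := C * (Y ^ (2 - 2 * σ + 3 * δ) * (1 + 1 / δ) ^ 4) with hB
  have hB0 : 0 ≤ B := by positivity
  have hline : ∀ σ' : ℝ, σ - δ ≤ σ' → ∑ r ∈ R, ∫⁻ v : ℝ,
      ‖detSum r.1 X Y i (σ' + ((ρ r).im + v : ℝ) * I)‖ₑ ^ 2 * ENNReal.ofReal (Real.exp (-v ^ 2 / 2)) ≤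
      ENNReal.ofReal (4 * Real.exp 5) * ENNReal.ofReal B := by
    intro σ' hσ'
    refine (hR.wellSpaced.sum_lintegral_le (by linarith) hR.abs_im_le
      (fun χ t => ‖detSum χ X Y i (σ' + t * I)‖ₑ ^ 2) (fun χ => ?_)).trans ?_
    · have : Continuous fun t : ℝ => detSum χ X Y i (σ' + t * I) :=
        (differentiable_detSum χ X Y i).continuous.comp (by fun_prop)
      exact this.enorm.measurable.pow_const 2
    · exact mul_le_mul_right (h q T X Y σ σ' δ i hT hX hY hσ hσ1 hδ hδ1 hσ') _
  have key : ENNReal.ofReal (R.card * (1 / 12) ^ 2) ≤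
      ENNReal.ofReal (1200 / δ ^ 2 * (4 * Real.exp 5 * B + 4 * Real.exp 5 * B)) := by
    calc ENNReal.ofReal (R.card * (1 / 12) ^ 2) = ∑ r ∈ R, ENNReal.ofReal (1 / 12) ^ 2 := by
          rw [Finset.sum_const, nsmul_eq_mul, ENNReal.ofReal_mul (by positivity),
            ENNReal.ofReal_natCast, ENNReal.ofReal_pow (by norm_num)]
      _ ≤ ∑ r ∈ R, ‖detSum r.1 X Y i (ρ r)‖ₑ ^ 2 := by
          refine Finset.sum_le_sum fun r hr => ?_
          rw [← ofReal_norm]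
          exact pow_le_pow_left' (ENNReal.ofReal_le_ofReal (hlarge r hr)) 2
      _ ≤ _ := Finset.sum_le_sum fun r hr => enorm_sq_le_of_strip (differentiable_detSum r.1 X Y i)
          (fun z hz => norm_detSum_le r.1 X Y i hz) hσ (hR.le_re r hr) (hR.re_le r hr) hδ hδ1
      _ ≤ ENNReal.ofReal (1200 / δ ^ 2) * (ENNReal.ofReal (4 * Real.exp 5) * ENNReal.ofReal B +
            ENNReal.ofReal (4 * Real.exp 5) * ENNReal.ofReal B) := by
          rw [← Finset.mul_sum, Finset.sum_add_distrib]
          exact mul_le_mul_right (add_le_add (hline 2 (by linarith)) (hline (σ - δ) le_rfl)) _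
      _ = _ := by
          rw [← ENNReal.ofReal_mul (by positivity), ← ENNReal.ofReal_add (by positivity) (by positivity),
            ← ENNReal.ofReal_mul (by positivity)]
  rw [ENNReal.ofReal_le_ofReal_iff (by positivity)] at key
  calc (R.card : ℝ) = 144 * (R.card * (1 / 12) ^ 2) := by ring
    _ ≤ 144 * (1200 / δ ^ 2 * (4 * Real.exp 5 * B + 4 * Real.exp 5 * B)) := by gcongr
    _ = _ := by rw [hB]; ring

end ZeroDensity

namespace ZeroDensity

open Complex MeasureTheory Set Filter Topology DirichletCharacter

variable {q : ℕ} [NeZero q]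

/-! ### The range `1 / 2 ≤ σ ≤ 4 / 5` -/

lemma two_le_level_mul (q : ℕ) [NeZero q] {T : ℝ} (hT : 2 ≤ T) : 2 ≤ q * T := by
  nlinarith [one_le_natCast_level q]

lemma half_le_log {D : ℝ} (hD : 2 ≤ D) : 1 / 2 ≤ Real.log D := by
  have := Real.log_le_log (by norm_num) hD
  linarith [Real.log_two_gt_d9]

lemma one_le_two_pow_mul {D e : ℝ} (hD : 2 ≤ D) (he : 0 ≤ e) (k : ℕ) :
    1 ≤ 2 ^ k * (D ^ e * Real.log D ^ k) := by
  have h1 : 1 ≤ D ^ e := Real.one_le_rpow (by linarith) he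
  have h2 : 1 ≤ (2 * Real.log D) ^ k := one_le_pow₀ (by linarith [half_le_log hD])
  rw [mul_pow] at h2
  nlinarith [mul_le_mul h1 h2 (by norm_num) (by linarith)]

lemma rpow_div_log {D : ℝ} (hD : 2 ≤ D) (b : ℝ) : D ^ (b / Real.log D) = Real.exp b := by
  have h := half_le_log hD
  rw [Real.rpow_def_of_pos (by linarith), mul_div_cancel₀ _ (by linarith)]

variable {R : Finset (DirichletCharacter ℂ q × ℤ)} {ρ : DirichletCharacter ℂ q × ℤ → ℂ} {σ T : ℝ}

lemma ZeroFamily.card_le_of_le (h : ZeroFamily R ρ σ T) (hT : 2 ≤ T) {M e : ℝ} (hM : q * T ≤ M)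
    (he : 0 ≤ e) (k : ℕ) :
    (R.card : ℝ) ≤ 4 * M * 2 ^ k * ((q * T) ^ e * Real.log (q * T) ^ k) := by
  have hD := two_le_level_mul q hT
  have h2 := one_le_two_pow_mul hD he k
  calc (R.card : ℝ) ≤ 4 * (q * T) := h.card_le hT
    _ ≤ 4 * M * 1 := by linarith
    _ ≤ 4 * M * (2 ^ k * ((q * T) ^ e * Real.log (q * T) ^ k)) := by
        gcongr
        linarith
    _ = _ := by ring

lemma ZeroFamily.card_le_of_zero_detection (h : ZeroFamily R ρ σ T) (hσ : 1 / 2 < σ)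
    {X Y B₁ B₂ : ℝ} (hX : 1 ≤ X) (hY : (400 : ℝ) ^ 4 ≤ Y)
    (h₁ : ∀ (i : Bool), ∀ R' ⊆ R, (∀ r ∈ R', 1 / 12 ≤ ‖detSum r.1 X Y i (ρ r)‖) →
      (R'.card : ℝ) ≤ B₁)
    (h₂ : ∀ R' ⊆ R, (∀ r ∈ R', ENNReal.ofReal (Y ^ (σ - 1 / 2) / (1 + 1 / (σ - 1 / 2))) ≤
      ∫⁻ v : ℝ, ‖LFunction r.1 (1 / 2 + ((ρ r).im + v : ℝ) * I)‖ₑ *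
        ‖mollifier r.1 X (1 / 2 + ((ρ r).im + v : ℝ) * I)‖ₑ * ENNReal.ofReal (Real.exp (-v ^ 2))) →
      (R'.card : ℝ) ≤ B₂) :
    (R.card : ℝ) ≤ 2 * B₁ + B₂ := by
  classical
  set S : Bool → Finset (DirichletCharacter ℂ q × ℤ) := fun i =>
    R.filter fun r => 1 / 12 ≤ ‖detSum r.1 X Y i (ρ r)‖ with hS
  set U := R.filter fun r => ENNReal.ofReal (Y ^ (σ - 1 / 2) / (1 + 1 / (σ - 1 / 2))) ≤
      ∫⁻ v : ℝ, ‖LFunction r.1 (1 / 2 + ((ρ r).im + v : ℝ) * I)‖ₑ *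
        ‖mollifier r.1 X (1 / 2 + ((ρ r).im + v : ℝ) * I)‖ₑ * ENNReal.ofReal (Real.exp (-v ^ 2))
    with hU
  have hsub : R ⊆ S false ∪ S true ∪ U := by
    intro r hr
    rcases zero_detection r.1 hσ (h.le_re r hr) (h.re_le r hr) (h.zero r hr) (h.ne_one r hr)
      (h.one_le_norm r hr) hX hY with ⟨i, hi⟩ | hii
    · cases i
      · exact Finset.mem_union_left _ (Finset.mem_union_left _ (Finset.mem_filter.2 ⟨hr, hi⟩))
      · exact Finset.mem_union_left _ (Finset.mem_union_right _ (Finset.mem_filter.2 ⟨hr, hi⟩))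
    · exact Finset.mem_union_right _ (Finset.mem_filter.2 ⟨hr, hii⟩)
  have hcard : (R.card : ℝ) ≤ (S false).card + (S true).card + U.card := by
    exact_mod_cast (Finset.card_le_card hsub).trans ((Finset.card_union_le _ _).trans
      (Nat.add_le_add_right (Finset.card_union_le _ _) _))
  have hb := fun i => h₁ i (S i) (Finset.filter_subset _ _) fun r hr => (Finset.mem_filter.1 hr).2
  have hu := h₂ U (Finset.filter_subset _ _) fun r hr => (Finset.mem_filter.1 hr).2
  linarith [hb false, hb true]

lemma ZeroFamily.card_le_of_near_half (h : ZeroFamily R ρ σ T) (hT : 2 ≤ T) (hσ : 1 / 2 ≤ σ)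
    (hσ' : σ ≤ 4 / 5) (hnear : σ ≤ 1 / 2 + 1 / Real.log (q * T)) :
    (R.card : ℝ) ≤ 4 * Real.exp 2 * 2 ^ 8 *
      ((q * T) ^ (3 * (1 - σ) / (2 - σ)) * Real.log (q * T) ^ 8) := by
  have hD := two_le_level_mul q hT
  set D : ℝ := q * T
  have hL := half_le_log hD
  have he : 1 ≤ 3 * (1 - σ) / (2 - σ) + 2 / Real.log D := by
    have h1 : 3 * (1 - σ) / (2 - σ) = 1 - (2 * σ - 1) / (2 - σ) := by
      have : 2 - σ ≠ 0 := by linarith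
      field_simp
      ring
    have h2 : (2 * σ - 1) / (2 - σ) ≤ (2 * σ - 1) / 1 :=
      div_le_div_of_nonneg_left (by linarith) (by norm_num) (by linarith)
    have h3 : 2 / Real.log D = 2 * (1 / Real.log D) := by ring
    rw [h1, h3]
    linarith
  have h8 : 1 ≤ 2 ^ 8 * Real.log D ^ 8 := by
    rw [← mul_pow]
    exact one_le_pow₀ (by linarith)
  calc (R.card : ℝ) ≤ 4 * D := h.card_le hT
    _ ≤ 4 * (D ^ (3 * (1 - σ) / (2 - σ)) * Real.exp 2) := by
        gcongr
        rw [← rpow_div_log hD, ← Real.rpow_add (by linarith)]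
        simpa using Real.rpow_le_rpow_of_exponent_le (by linarith) he
    _ ≤ 4 * (D ^ (3 * (1 - σ) / (2 - σ)) * Real.exp 2) * (2 ^ 8 * Real.log D ^ 8) :=
        le_mul_of_one_le_right (by positivity) h8
    _ = _ := by ring

theorem exists_card_le_of_le_four_fifths : ∃ C : ℝ, 0 < C ∧ ∀ (q : ℕ) [NeZero q] (σ T : ℝ),
    1 / 2 ≤ σ → σ ≤ 4 / 5 → 2 ≤ T →
    ∀ (R : Finset (DirichletCharacter ℂ q × ℤ)) (ρ : DirichletCharacter ℂ q × ℤ → ℂ),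
    ZeroFamily R ρ σ T →
    (R.card : ℝ) ≤ C * ((q * T) ^ (3 * (1 - σ) / (2 - σ)) * Real.log (q * T) ^ 8) := by
  obtain ⟨C₁, hC₁, h₁⟩ := exists_card_le_of_large_detSum
  obtain ⟨C₂, hC₂, h₂⟩ := exists_card_le_of_large_product
  refine ⟨4 * 400 ^ 4 * 2 ^ 8 + 4 * Real.exp 2 * 2 ^ 8 +
    (2 * (C₁ * (Real.exp 1 * 21 ^ 4 * 400)) + C₂ * 20), by positivity,
    fun q _ σ T hσ hσ' hT R ρ h => ?_⟩
  have hD2 := two_le_level_mul q hT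
  have hL2 := half_le_log hD2
  have he : 0 ≤ 3 * (1 - σ) / (2 - σ) := div_nonneg (by linarith) (by linarith)
  have hE : 0 ≤ (q * T) ^ (3 * (1 - σ) / (2 - σ)) * Real.log (q * T) ^ 8 := by positivity
  rcases le_or_gt (q * T) ((400 : ℝ) ^ 4) with hsmall | hlarge
  · refine (h.card_le_of_le hT hsmall he 8).trans (mul_le_mul_of_nonneg_right ?_ hE)
    linarith [show 0 ≤ 4 * Real.exp 2 * 2 ^ 8 +
      (2 * (C₁ * (Real.exp 1 * 21 ^ 4 * 400)) + C₂ * 20) by positivity]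
  rcases le_or_gt σ (1 / 2 + 1 / Real.log (q * T)) with hnear | hfar
  · refine (h.card_le_of_near_half hT hσ hσ' hnear).trans (mul_le_mul_of_nonneg_right ?_ hE)
    linarith [show 0 ≤ (2 * (C₁ * (Real.exp 1 * 21 ^ 4 * 400)) + C₂ * 20) by positivity]
  have hgoal : (R.card : ℝ) ≤ (2 * (C₁ * (Real.exp 1 * 21 ^ 4 * 400)) + C₂ * 20) *
      ((q * T) ^ (3 * (1 - σ) / (2 - σ)) * Real.log (q * T) ^ 8) := by
    set D : ℝ := q * T
    have hD0 : 0 < D := by linarith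
    set L := Real.log D with hLdef
    have hL1 : 1 ≤ L := by
      rw [hLdef, Real.le_log_iff_exp_le hD0]
      linarith [Real.exp_one_lt_d9]
    set β : ℝ := 3 / (2 * (2 - σ)) with hβ
    have hβ1 : 1 ≤ β := by rw [hβ, le_div_iff₀ (by linarith)]; linarith
    have hβ2 : β ≤ 5 / 4 := by rw [hβ, div_le_iff₀ (by linarith)]; linarith
    set Y := D ^ β with hY
    have hDY : D ≤ Y := by
      simpa using Real.rpow_le_rpow_of_exponent_le (by linarith : (1 : ℝ) ≤ D) hβ1
    have hσ2 : 1 / 2 < σ := by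
      have : 0 < 1 / L := by positivity
      linarith
    set κ := 1 + 1 / (σ - 1 / 2) with hκ
    have hσ0 : 0 < σ - 1 / 2 := by linarith
    have hκ1 : 1 ≤ κ := by rw [hκ]; linarith [one_div_pos.2 hσ0]
    have hκ2 : κ ≤ 2 * L := by
      have : 1 / (σ - 1 / 2) ≤ L := by
        rw [div_le_comm₀ hσ0 (by linarith)]
        linarith
      linarith
    have hmain := h.card_le_of_zero_detection hσ2 (X := D) (Y := Y)
      (B₁ := C₁ * (Real.exp 1 * 21 ^ 4 * 400) * (D ^ (3 * (1 - σ) / (2 - σ)) * L ^ 8))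
      (B₂ := C₂ * 20 * (D ^ (3 * (1 - σ) / (2 - σ)) * L ^ 8)) (by linarith)
      (by linarith) ?_ ?_
    · linarith
    · intro i R' hR' hlarge'
      have hδ : 0 < 1 / (20 * L) := by positivity
      refine (h₁ q T D Y σ (1 / (20 * L)) i hT le_rfl (by linarith) hσ (by linarith) hδ ?_ R' ρ
        (h.subset hR') hlarge').trans ?_
      · rw [div_le_div_iff₀ (by positivity) (by norm_num)]
        linarith
      have e1 : Y ^ (2 - 2 * σ + 3 * (1 / (20 * L))) ≤
          D ^ (3 * (1 - σ) / (2 - σ)) * Real.exp 1 := by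
        rw [hY, ← Real.rpow_mul hD0.le]
        have e2 : β * (2 - 2 * σ + 3 * (1 / (20 * L))) =
            3 * (1 - σ) / (2 - σ) + (β * 3 / 20) / L := by
          have : 2 - σ ≠ 0 := by linarith
          have : L ≠ 0 := by linarith
          rw [hβ]
          field_simp
        rw [e2, Real.rpow_add hD0, rpow_div_log hD2]
        gcongr
        linarith
      calc C₁ * (Y ^ (2 - 2 * σ + 3 * (1 / (20 * L))) * (1 + 1 / (1 / (20 * L))) ^ 4 /
            (1 / (20 * L)) ^ 2)
          = C₁ * (Y ^ (2 - 2 * σ + 3 * (1 / (20 * L))) * (1 + 20 * L) ^ 4 * (20 * L) ^ 2) := by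
            rw [one_div_one_div, one_div, inv_pow, div_inv_eq_mul]
        _ ≤ C₁ * (D ^ (3 * (1 - σ) / (2 - σ)) * Real.exp 1 * (21 * L) ^ 4 * (20 * L) ^ 2) := by
            gcongr
            linarith
        _ = C₁ * (Real.exp 1 * 21 ^ 4 * 400) * (D ^ (3 * (1 - σ) / (2 - σ)) * L ^ 6) := by ring
        _ ≤ _ := by
            gcongr
            norm_num
    · intro R' hR' hlarge'
      have hA : 0 < Y ^ (σ - 1 / 2) / κ := by positivity
      refine (h₂ q T D (Y ^ (σ - 1 / 2) / κ) hT (by linarith) hA R' (fun r => (ρ r).im)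
        (h.subset hR').wellSpaced (h.subset hR').abs_im_le hlarge').trans ?_
      have e1 : (Y ^ (σ - 1 / 2) / κ) ^ (-(4 / 3) : ℝ) ≤
          D ^ (-(2 * σ - 1) / (2 - σ)) * (2 * L) ^ 2 := by
        rw [Real.div_rpow (by positivity) (by positivity), hY, ← Real.rpow_mul hD0.le,
          ← Real.rpow_mul hD0.le, Real.rpow_neg (by positivity), div_inv_eq_mul]
        gcongr ?_ * ?_
        · refine (congrArg (D ^ ·) ?_).le
          have : 2 - σ ≠ 0 := by linarith
          rw [hβ]
          field_simp
          ring
        · refine (Real.rpow_le_rpow_of_exponent_le hκ1 (by norm_num : (4 / 3 : ℝ) ≤ (2 : ℕ))).trans ?_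
          rw [Real.rpow_natCast]
          gcongr
      have e2 : D * L ^ 6 + (D + D) * (1 + L) ≤ 5 * (D * L ^ 6) := by
        have : L ≤ L ^ 6 := le_self_pow₀ hL1 (by norm_num)
        nlinarith
      calc C₂ * ((Y ^ (σ - 1 / 2) / κ) ^ (-(4 / 3) : ℝ) * (D * L ^ 6 + (D + D) * (1 + L)))
          ≤ C₂ * (D ^ (-(2 * σ - 1) / (2 - σ)) * (2 * L) ^ 2 * (5 * (D * L ^ 6))) := by
            gcongr
        _ = C₂ * 20 * (D ^ (-(2 * σ - 1) / (2 - σ)) * D ^ (1 : ℝ) * L ^ 8) := by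
            rw [Real.rpow_one]
            ring
        _ = _ := by
            rw [← Real.rpow_add hD0]
            congr 4
            have : 2 - σ ≠ 0 := by linarith
            field_simp
            ring
  refine hgoal.trans (mul_le_mul_of_nonneg_right ?_ hE)
  linarith [show 0 ≤ 4 * (400 : ℝ) ^ 4 * 2 ^ 8 + 4 * Real.exp 2 * 2 ^ 8 by positivity]

end ZeroDensity

namespace ZeroDensity

open Complex MeasureTheory Set Filter Topology DirichletCharacter

/-! ### Large values at dyadic scales -/

lemma exists_dyadic_scale {N x : ℝ} (hN : 0 < N) (hx : N ≤ x) :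
    ∃ j : ℕ, 2 ^ j * N ≤ x ∧ x < 2 * (2 ^ j * N) ∧ (j : ℝ) ≤ 2 * Real.log (x / N) := by
  obtain ⟨j, h1, h2⟩ := exists_nat_pow_near ((one_le_div hN).2 hx) (one_lt_two (α := ℝ))
  refine ⟨j, (le_div_iff₀ hN).1 h1, ?_, ?_⟩
  · rw [div_lt_iff₀ hN, pow_succ] at h2
    linarith
  · have h3 := Real.log_le_log (by positivity) h1
    rw [Real.log_pow] at h3
    nlinarith [Real.log_two_gt_d9, (Nat.cast_nonneg j : (0 : ℝ) ≤ j)]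

lemma half_le_logGauss {N x : ℝ} (hN : 0 < N) (h1 : N ≤ x) (h2 : x < 2 * N) :
    1 / 2 ≤ logGauss N x := by
  have h3 : 0 ≤ Real.log (x / N) := Real.log_nonneg ((one_le_div hN).2 h1)
  have h4 : Real.log (x / N) ≤ 1 := by
    have : Real.log (x / N) ≤ Real.log 2 :=
      Real.log_le_log (div_pos (hN.trans_le h1) hN) ((div_le_iff₀ hN).2 h2.le)
    linarith [Real.log_two_lt_d9]
  have h5 := Real.add_one_le_exp (-(Real.log (x / N)) ^ 2 / 4)
  rw [logGauss]
  nlinarith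

lemma le_scaleWeight {J : Finset ℕ} {N u : ℕ → ℝ} (hN : ∀ j ∈ J, 0 < N j) (hu : ∀ j ∈ J, 0 ≤ u j)
    {j n : ℕ} (hj : j ∈ J) (h1 : N j ≤ n) (h2 : (n : ℝ) < 2 * N j) :
    u j * n / 4 ≤ scaleWeight J N u n := by
  have hg := half_le_logGauss (hN j hj) h1 h2
  refine le_trans ?_ (Finset.single_le_sum (f := fun j => u j * N j * logGauss (N j) n)
    (fun i hi => mul_nonneg (mul_nonneg (hu i hi) (hN i hi).le) (logGauss_pos _ _).le) hj)
  calc u j * n / 4 = u j * (n / 2) * (1 / 2) := by ring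
    _ ≤ u j * N j * logGauss (N j) n := by
        have := hu j hj
        have := hN j hj
        gcongr
        linarith

lemma card_le_of_sum_sq_le {ι : Type*} {R : Finset ι} {f : ι → ℝ} {V K a b : ℝ} (hV : 0 < V)
    (ha : 0 ≤ K * a) (hf : ∀ r ∈ R, V ≤ f r)
    (h : (∑ r ∈ R, f r) ^ 2 ≤ K * (R.card * a + (R.card : ℝ) ^ 2 * b)) (hb : 2 * (K * b) ≤ V ^ 2) :
    (R.card : ℝ) ≤ 2 * (K * a) / V ^ 2 := by
  rcases R.eq_empty_or_nonempty with rfl | hR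
  · simp only [Finset.card_empty, CharP.cast_eq_zero]
    positivity
  have hc : (0 : ℝ) < R.card := by exact_mod_cast hR.card_pos
  have h1 : R.card * V ≤ ∑ r ∈ R, f r := by
    simpa using Finset.sum_le_sum hf
  have h2 : (R.card * V) ^ 2 ≤ (∑ r ∈ R, f r) ^ 2 := by gcongr
  rw [le_div_iff₀ (by positivity)]
  have h3 : (R.card : ℝ) * (R.card * V ^ 2) ≤ R.card * (2 * (K * a)) := by
    nlinarith [mul_le_mul_of_nonneg_left hb (sq_nonneg (R.card : ℝ))]
  exact le_of_mul_le_mul_left h3 hc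

theorem exists_card_le_of_large_sum : ∃ K : ℝ, 0 < K ∧ ∀ (q : ℕ) [NeZero q] (σ T : ℝ), 2 ≤ T →
    (400 : ℝ) ^ 4 ≤ q * T → 1 / 2 ≤ σ →
    ∀ (R : Finset (DirichletCharacter ℂ q × ℤ)) (s : DirichletCharacter ℂ q × ℤ → ℂ),
    (∀ r ∈ R, σ ≤ (s r).re ∧ (s r).re ≤ 1 ∧ |(s r).im| ≤ T + 5 * Real.log (q * T)) →
    WellSpaced R (fun r => (s r).im) (6 * Real.log (q * T)) →
    ∀ (J : Finset ℕ) (N u : ℕ → ℝ), (∀ j ∈ J, 1 ≤ N j) → (∀ j ∈ J, 0 ≤ u j) →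
    ∀ (S : Finset ℕ) (c : ℕ → ℂ), (∀ n ∈ S, 0 < scaleWeight J N u n) →
    ∀ V Q B₀ B₁ : ℝ, 0 < V → (∀ r ∈ R, V ≤ ‖∑ n ∈ S, c n * (r.1 n * (n : ℂ) ^ (-s r))‖) →
    ∑ n ∈ S, ‖c n‖ ^ 2 / scaleWeight J N u n ≤ Q →
    ∑ j ∈ J, u j * N j ^ (2 - 2 * σ) ≤ B₀ → ∑ j ∈ J, u j * N j ^ (1 - 2 * σ) ≤ B₁ →
    K * (Q * ((q * T) ^ (1 / 2 : ℝ) * Real.log (q * T) ^ (3 / 2 : ℝ)) * B₁) ≤ V ^ 2 →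
    (R.card : ℝ) ≤ K * (Q * Real.log (q * T) * B₀) / V ^ 2 := by
  classical
  obtain ⟨C, hC, h⟩ := exists_large_values_bound
  refine ⟨96 * Real.exp 2 * C, by positivity, fun q _ σ T hT hD hσ R s hs hsp J N u hN hu S c hS V Q
    B₀ B₁ hV hlarge hQ hB₀ hB₁ hKV => ?_⟩
  have hq := one_le_natCast_level q
  have hD2 := two_le_level_mul q hT
  have hTD : T ≤ q * T := by nlinarith
  have hqD : (q : ℝ) ≤ q * T := by nlinarith
  have hL1 : 2 ≤ Real.log (q * T) := by
    rw [Real.le_log_iff_exp_le (by linarith), show (2 : ℝ) = (2 : ℕ) * 1 by norm_num,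
      Real.exp_nat_mul]
    nlinarith [Real.exp_one_lt_d9, Real.exp_pos 1]
  have hLD : Real.log (q * T) ≤ q * T := (Real.log_le_sub_one_of_pos (by linarith)).trans (by linarith)
  set D : ℝ := q * T with hDdef
  set L := Real.log D with hL
  have hw : ∀ n ∈ S, 0 ≤ ‖c n‖ ^ 2 / scaleWeight J N u n := fun n hn =>
    div_nonneg (sq_nonneg _) (hS n hn).le
  have hQ0 : 0 ≤ Q := (Finset.sum_nonneg hw).trans hQ
  have hu0 : ∀ a : ℝ, 0 ≤ ∑ j ∈ J, u j * N j ^ a := fun a => Finset.sum_nonneg fun j hj =>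
    mul_nonneg (hu j hj) (Real.rpow_nonneg (by linarith [hN j hj]) _)
  have hB₀0 : 0 ≤ B₀ := (hu0 _).trans hB₀
  have hB₁0 : 0 ≤ B₁ := (hu0 _).trans hB₁
  have hexp : ∀ {x b : ℝ}, 0 ≤ x → x ≤ D ^ b → 0 ≤ b → b ≤ 2 → x ^ (1 / (2 * L)) ≤ 3 := by
    intro x b hx hxb hb hb2
    calc x ^ (1 / (2 * L)) ≤ (D ^ b) ^ (1 / (2 * L)) := by gcongr
      _ = D ^ ((b / 2) / L) := by
          rw [← Real.rpow_mul (by linarith)]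
          congr 1
          field_simp
      _ = Real.exp (b / 2) := rpow_div_log hD2 _
      _ ≤ Real.exp 1 := Real.exp_le_exp.2 (by linarith)
      _ ≤ 3 := by linarith [Real.exp_one_lt_d9]
  have hmain := h q R (fun r => r.1) s σ (T + 5 * L) (1 / (2 * L)) (8 * Real.exp 2 * (6 * L)) hσ hs
    (hsp.sum_exp_neg_sq_le (by linarith)) (by positivity)
    (by rw [div_le_div_iff₀ (by positivity) (by norm_num)]; linarith)
    (hexp (b := 1) (by linarith) (by rwa [Real.rpow_one]) (by norm_num) (by norm_num))
    (hexp (b := 2) (by positivity) (by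
      rw [show (2 : ℝ) = (2 : ℕ) by norm_num, Real.rpow_natCast]
      push_cast
      nlinarith) (by norm_num) le_rfl) J N u hN hu S c hS
  have hroot : (q * (2 * (T + 5 * L) + 2)) ^ (1 / 2 : ℝ) / (1 / (2 * L)) ≤
      6 * (D ^ (1 / 2 : ℝ) * L ^ (3 / 2 : ℝ)) := by
    have h1 : q * (2 * (T + 5 * L) + 2) ≤ 3 ^ 2 * (D * L) := by
      have : 2 * (T + 5 * L) + 2 ≤ 9 * (T * L) := by nlinarith
      calc q * (2 * (T + 5 * L) + 2) ≤ q * (9 * (T * L)) := by gcongr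
        _ = _ := by rw [hDdef]; ring
    have h2 : (q * (2 * (T + 5 * L) + 2)) ^ (1 / 2 : ℝ) ≤ 3 * (D ^ (1 / 2 : ℝ) * L ^ (1 / 2 : ℝ)) := by
      calc (q * (2 * (T + 5 * L) + 2)) ^ (1 / 2 : ℝ) ≤ (3 ^ 2 * (D * L)) ^ (1 / 2 : ℝ) := by gcongr
        _ = _ := by
            rw [Real.mul_rpow (by norm_num) (by positivity), Real.mul_rpow (by positivity) (by positivity),
              ← Real.sqrt_eq_rpow (3 ^ 2), Real.sqrt_sq (by norm_num)]
    have h3 : L ^ (3 / 2 : ℝ) = L ^ (1 / 2 : ℝ) * L := by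
      rw [← Real.rpow_add_one (by positivity)]
      norm_num
    rw [div_div_eq_mul_div, div_one, h3]
    calc _ ≤ 3 * (D ^ (1 / 2 : ℝ) * L ^ (1 / 2 : ℝ)) * (2 * L) := by gcongr
      _ = _ := by ring
  have hfin := card_le_of_sum_sq_le (K := C * Q) (a := 8 * Real.exp 2 * (6 * L) * B₀)
    (b := 6 * (D ^ (1 / 2 : ℝ) * L ^ (3 / 2 : ℝ)) * B₁) hV (by positivity) hlarge ?_ ?_
  · refine hfin.trans (le_of_eq ?_)
    ring
  · refine hmain.trans ?_
    have := hu0 (2 - 2 * σ)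
    have := hu0 (1 - 2 * σ)
    calc _ ≤ C * Q * (R.card * (8 * Real.exp 2 * (6 * L)) * B₀ +
          (R.card : ℝ) ^ 2 * (6 * (D ^ (1 / 2 : ℝ) * L ^ (3 / 2 : ℝ))) * B₁) := by gcongr
      _ = _ := by ring
  · have h1 : 1 ≤ Real.exp 2 := Real.one_le_exp (by norm_num)
    have h2 : 0 ≤ C * (Q * (D ^ (1 / 2 : ℝ) * L ^ (3 / 2 : ℝ)) * B₁) := by positivity
    nlinarith

end ZeroDensity

namespace ZeroDensity

open Complex MeasureTheory Set Filter Topology DirichletCharacter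

/-! ### The zero-detecting sums for `σ ≥ 4 / 5` -/

lemma min_one_le_rpow {x a : ℝ} (hx : 0 ≤ x) (ha : 0 ≤ a) (ha1 : a ≤ 1) : min 1 x ≤ x ^ a := by
  rcases le_total 1 x with h | h
  · exact (min_le_left _ _).trans (Real.one_le_rpow h ha)
  · rw [min_eq_right h]
    rcases hx.eq_or_lt with rfl | hx0
    · exact Real.rpow_nonneg le_rfl _
    · simpa using Real.rpow_le_rpow_of_exponent_ge hx0 h ha1

lemma sum_dyadic_rpow_le {X σ : ℝ} (hX : 0 < X) (hσ : 4 / 5 ≤ σ) (k : ℕ) :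
    ∑ j ∈ Finset.range k, ((2 : ℝ) ^ j * X) ^ (1 - 2 * σ) ≤ 4 * X ^ (1 - 2 * σ) := by
  have h2 : (2 : ℝ) ^ (1 - 2 * σ) ≤ 3 / 4 := by
    refine (Real.rpow_le_rpow_of_exponent_le one_le_two
      (by linarith : 1 - 2 * σ ≤ -(3 / 5))).trans ?_
    refine le_of_pow_le_pow_left₀ (n := 5) (by norm_num) (by norm_num) ?_
    rw [← Real.rpow_natCast, ← Real.rpow_mul (by norm_num)]
    norm_num [Real.rpow_neg]
  calc ∑ j ∈ Finset.range k, ((2 : ℝ) ^ j * X) ^ (1 - 2 * σ)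
      = (∑ j ∈ Finset.range k, ((2 : ℝ) ^ (1 - 2 * σ)) ^ j) * X ^ (1 - 2 * σ) := by
        rw [Finset.sum_mul]
        refine Finset.sum_congr rfl fun j _ => ?_
        rw [Real.mul_rpow (by positivity) hX.le, ← Real.rpow_natCast, ← Real.rpow_mul (by norm_num),
          ← Real.rpow_natCast, ← Real.rpow_mul (by norm_num), mul_comm (j : ℝ)]
    _ ≤ (∑ j ∈ Finset.range k, (3 / 4 : ℝ) ^ j) * X ^ (1 - 2 * σ) := by gcongr
    _ ≤ 4 * X ^ (1 - 2 * σ) := by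
        gcongr
        refine (Summable.sum_le_tsum _ (fun j _ => by positivity)
          (summable_geometric_of_lt_one (by norm_num) (by norm_num))).trans ?_
        rw [tsum_geometric_of_lt_one (by norm_num) (by norm_num)]
        norm_num

lemma sum_min_mul_rpow_le {X Y σ : ℝ} (hX : 0 < X) (hY : 0 ≤ Y) (hσ : 1 / 2 ≤ σ) (hσ1 : σ ≤ 1)
    (k : ℕ) :
    ∑ j ∈ Finset.range k, min 1 (Y / (2 ^ j * X)) * ((2 : ℝ) ^ j * X) ^ (2 - 2 * σ) ≤
      k * Y ^ (2 - 2 * σ) := by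
  calc _ ≤ ∑ j ∈ Finset.range k, Y ^ (2 - 2 * σ) := Finset.sum_le_sum fun j _ => ?_
    _ = _ := by simp
  have hN : 0 < (2 : ℝ) ^ j * X := by positivity
  calc _ ≤ (Y / (2 ^ j * X)) ^ (2 - 2 * σ) * ((2 : ℝ) ^ j * X) ^ (2 - 2 * σ) := by
        gcongr
        exact min_one_le_rpow (by positivity) (by linarith) (by linarith)
    _ = Y ^ (2 - 2 * σ) := by
        rw [← Real.mul_rpow (by positivity) hN.le, div_mul_cancel₀ _ hN.ne']

/-- A dyadic scale below each member of the support of the zero-detecting sums. -/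
lemma exists_scale_of_mem_detRange {X Y L : ℝ} (hX : 1 ≤ X) (hY : 1 ≤ Y)
    (hL : Real.log Y ≤ 5 / 4 * L) (hL0 : 0 ≤ L) {n : ℕ} (hn : n ∈ detRange X Y) :
    ∃ j ∈ Finset.range (⌊13 * L⌋₊ + 1), 2 ^ j * X ≤ n ∧ (n : ℝ) < 2 * (2 ^ j * X) := by
  obtain ⟨hn1, hn2⟩ := Finset.mem_filter.1 hn
  obtain ⟨j, h1, h2, h3⟩ := exists_dyadic_scale (by linarith : 0 < X) hn2.le
  refine ⟨j, ?_, h1, h2⟩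
  have h4 : Real.log (n / X) ≤ 5 * Real.log Y := by
    have h5 : (n : ℝ) ≤ Y ^ 5 :=
      (Nat.cast_le.2 (Finset.mem_Icc.1 hn1).2).trans (Nat.floor_le (by positivity))
    rw [← Nat.cast_ofNat, ← Real.log_pow]
    refine Real.log_le_log (by have := pos_of_mem_detRange hn; positivity) ?_
    exact (div_le_self (Nat.cast_nonneg n) hX).trans h5
  refine Finset.mem_range.2 (Nat.lt_succ_of_le (Nat.le_floor ?_))
  linarith

theorem sum_cutCoeff_sq_div_le {X Y L : ℝ} (i : Bool) (hX : 1 ≤ X) (hY : 1 ≤ Y)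
    (hL : Real.log Y ≤ 5 / 4 * L) (hL1 : 1 ≤ L) :
    (∀ n ∈ detRange X Y, 0 < scaleWeight (Finset.range (⌊13 * L⌋₊ + 1)) (fun j => 2 ^ j * X)
      (fun j => min 1 (Y / (2 ^ j * X))) n) ∧
    ∑ n ∈ detRange X Y, ‖cutCoeff X Y i n‖ ^ 2 / scaleWeight (Finset.range (⌊13 * L⌋₊ + 1))
      (fun j => 2 ^ j * X) (fun j => min 1 (Y / (2 ^ j * X))) n ≤
      16 * Real.exp 2 * 16 * L ^ 4 := by
  have hY0 : 0 < Y := by linarith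
  have hw : ∀ n ∈ detRange X Y, min 1 (Y / n) * n / 4 ≤
      scaleWeight (Finset.range (⌊13 * L⌋₊ + 1)) (fun j => 2 ^ j * X)
        (fun j => min 1 (Y / (2 ^ j * X))) n := by
    intro n hn
    have hn0 : (0 : ℝ) < n := Nat.cast_pos.2 (pos_of_mem_detRange hn)
    obtain ⟨j, hj, h1, h2⟩ := exists_scale_of_mem_detRange hX hY hL (by linarith) hn
    refine le_trans ?_ (le_scaleWeight (fun j _ => by positivity)
      (fun j _ => le_min zero_le_one (by positivity)) hj h1 h2)
    gcongr
  have hm : ∀ n ∈ detRange X Y, 0 < min 1 (Y / n) * n / 4 := by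
    intro n hn
    have hn0 : (0 : ℝ) < n := Nat.cast_pos.2 (pos_of_mem_detRange hn)
    have : 0 < min 1 (Y / n) := lt_min one_pos (by positivity)
    positivity
  refine ⟨fun n hn => (hm n hn).trans_le (hw n hn), ?_⟩
  have hL0 : 0 < 1 / L := by positivity
  obtain ⟨hs, hle⟩ := tau_sq_series hL0
  calc _ ≤ ∑ n ∈ detRange X Y, 16 * Y ^ (1 / L) * (tau n ^ 2 * (n : ℝ) ^ (-(1 + 1 / L))) := by
        refine Finset.sum_le_sum fun n hn => ?_
        have hn0 : (0 : ℝ) < n := Nat.cast_pos.2 (pos_of_mem_detRange hn)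
        have hmin : 0 < min 1 (Y / n) := lt_min one_pos (by positivity)
        calc _ ≤ (2 * tau n * min 1 (Y / n)) ^ 2 / (min 1 (Y / n) * n / 4) := by
              have := hm n hn
              gcongr
              · exact norm_cutCoeff_le hY0 i (pos_of_mem_detRange hn)
              · exact hw n hn
          _ = 16 * tau n ^ 2 * (min 1 (Y / n) / n) := by
              field_simp
              ring
          _ ≤ 16 * tau n ^ 2 * ((Y / n) ^ (1 / L) / n) := by
              gcongr
              exact min_one_le_rpow (by positivity) hL0.le (by rwa [div_le_one (by linarith)])
          _ = _ := by
              rw [Real.div_rpow hY0.le hn0.le, Real.rpow_neg hn0.le, Real.rpow_add hn0, Real.rpow_one]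
              field_simp
    _ = 16 * Y ^ (1 / L) * ∑ n ∈ detRange X Y, tau n ^ 2 * (n : ℝ) ^ (-(1 + 1 / L)) := by
        rw [Finset.mul_sum]
    _ ≤ 16 * Real.exp 2 * (2 * L) ^ 4 := by
        gcongr
        · rw [Real.rpow_def_of_pos hY0]
          refine Real.exp_le_exp.2 ?_
          rw [mul_one_div, div_le_iff₀ (by linarith)]
          linarith
        · refine (hs.sum_le_tsum _ fun n _ => by positivity).trans (hle.trans ?_)
          rw [one_div_one_div]
          gcongr
          linarith
    _ = _ := by ring

lemma ZeroFamily.abs_im_le_add {q : ℕ} [NeZero q] {R : Finset (DirichletCharacter ℂ q × ℤ)}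
    {ρ : DirichletCharacter ℂ q × ℤ → ℂ} {σ T : ℝ} (h : ZeroFamily R ρ σ T) {b : ℝ} (hb : 0 ≤ b) :
    ∀ r ∈ R, σ ≤ (ρ r).re ∧ (ρ r).re ≤ 1 ∧ |(ρ r).im| ≤ T + b :=
  fun r hr => ⟨h.le_re r hr, h.re_le r hr, by linarith [h.abs_im_le r hr]⟩

lemma WellSpaced.mono {q : ℕ} {R : Finset (DirichletCharacter ℂ q × ℤ)}
    {γ : DirichletCharacter ℂ q × ℤ → ℝ} {M M' : ℝ} (h : WellSpaced R γ M) (hM : M ≤ M') :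
    WellSpaced R γ M' := fun r hr => (h r hr).trans hM

theorem exists_card_le_of_large_detSum' : ∃ C₀ C : ℝ, 1 ≤ C₀ ∧ 0 < C ∧
    ∀ (q : ℕ) [NeZero q] (T X Y σ : ℝ) (i : Bool), 2 ≤ T → (400 : ℝ) ^ 4 ≤ q * T → 1 ≤ X → 1 ≤ Y →
    Real.log Y ≤ 5 / 4 * Real.log (q * T) → 4 / 5 ≤ σ → σ ≤ 1 →
    C₀ * ((q * T) ^ (1 / 2 : ℝ) * Real.log (q * T) ^ 6) ≤ X ^ (2 * σ - 1) →
    ∀ (R : Finset (DirichletCharacter ℂ q × ℤ)) (ρ : DirichletCharacter ℂ q × ℤ → ℂ),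
    ZeroFamily R ρ σ T → (∀ r ∈ R, 1 / 12 ≤ ‖detSum r.1 X Y i (ρ r)‖) →
    (R.card : ℝ) ≤ C * (Y ^ (2 - 2 * σ) * Real.log (q * T) ^ 6) := by
  obtain ⟨K, hK, h⟩ := exists_card_le_of_large_sum
  set Q : ℝ := 16 * Real.exp 2 * 16 with hQ
  have hQ0 : 0 < Q := by positivity
  refine ⟨1 + K * Q * 4 * 144, K * (Q * 14) * 144, by linarith [show 0 < K * Q * 4 * 144 by positivity],
    by positivity, fun q _ T X Y σ i hT hD hX hY hYD hσ hσ1 hXD R ρ hR hlarge => ?_⟩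
  have hD2 := two_le_level_mul q hT
  set D : ℝ := q * T
  have hX0 : 0 < X := by linarith
  have hL1 : 1 ≤ Real.log D := by
    rw [Real.le_log_iff_exp_le (by linarith)]
    linarith [Real.exp_one_lt_d9]
  set L := Real.log D
  obtain ⟨hw, hsum⟩ := sum_cutCoeff_sq_div_le i hX hY hYD hL1
  have hu : ∀ j : ℕ, 0 ≤ min 1 (Y / (2 ^ j * X)) := fun j => le_min zero_le_one (by positivity)
  refine (h q σ T hT hD (by linarith) R ρ (hR.abs_im_le_add (by positivity))
    (hR.wellSpaced.mono (by linarith)) _ _ _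
    (fun j _ => one_le_mul_of_one_le_of_one_le (one_le_pow₀ one_le_two) hX) (fun j _ => hu j) _ _ hw
    (1 / 12) _ (14 * L * Y ^ (2 - 2 * σ)) (4 * X ^ (1 - 2 * σ)) (by norm_num) hlarge hsum ?_ ?_
    ?_).trans (le_of_eq ?_)
  · refine (sum_min_mul_rpow_le hX0 (by linarith) (by linarith) hσ1 _).trans ?_
    gcongr
    push_cast
    linarith [Nat.floor_le (by positivity : 0 ≤ 13 * L)]
  · refine le_trans (Finset.sum_le_sum fun j _ => ?_) (sum_dyadic_rpow_le hX0 hσ _)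
    exact mul_le_of_le_one_left (by positivity) (min_le_left _ _)
  · have h1 : L ^ (3 / 2 : ℝ) ≤ L ^ 2 := by
      rw [← Real.rpow_natCast]
      exact Real.rpow_le_rpow_of_exponent_le hL1 (by norm_num)
    have h2 : X ^ (1 - 2 * σ) * X ^ (2 * σ - 1) = 1 := by
      rw [← Real.rpow_add hX0]
      norm_num
    calc K * (Q * L ^ 4 * (D ^ (1 / 2 : ℝ) * L ^ (3 / 2 : ℝ)) * (4 * X ^ (1 - 2 * σ)))
        ≤ K * (Q * L ^ 4 * (D ^ (1 / 2 : ℝ) * L ^ 2) * (4 * X ^ (1 - 2 * σ))) := by gcongr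
      _ = (1 / 12) ^ 2 * (X ^ (1 - 2 * σ) * (K * Q * 4 * 144 * (D ^ (1 / 2 : ℝ) * L ^ 6))) := by ring
      _ ≤ (1 / 12) ^ 2 * (X ^ (1 - 2 * σ) * X ^ (2 * σ - 1)) := by
          gcongr
          refine le_trans ?_ hXD
          gcongr
          linarith
      _ = _ := by rw [h2, mul_one]
  · ring

end ZeroDensity

namespace ZeroDensity

open Complex MeasureTheory Set Filter Topology DirichletCharacter

/-! ### Large values of the mollifier -/

lemma sum_Icc_inv_le {X : ℝ} (hX : 1 ≤ X) :
    ∑ n ∈ Finset.Icc 1 ⌊X⌋₊, (n : ℝ)⁻¹ ≤ 1 + Real.log X := by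
  have h1 := harmonic_le_one_add_log ⌊X⌋₊
  have h2 : Real.log ⌊X⌋₊ ≤ Real.log X :=
    Real.log_le_log (by exact_mod_cast Nat.floor_pos.2 hX) (Nat.floor_le (by linarith))
  rw [harmonic_eq_sum_Icc] at h1
  push_cast at h1
  linarith

lemma norm_mollifier_le_self {q : ℕ} (χ : DirichletCharacter ℂ q) {X : ℝ} (hX : 0 ≤ X) {s : ℂ}
    (hs : 0 ≤ s.re) : ‖mollifier χ X s‖ ≤ X := by
  rw [mollifier_eq_sum]
  calc _ ≤ ∑ n ∈ Finset.Icc 1 ⌊X⌋₊, (1 : ℝ) := norm_sum_le_of_le _ fun n hn => ?_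
    _ ≤ X := by simpa using Nat.floor_le hX
  have hn0 : 0 < n := (Finset.mem_Icc.1 hn).1
  have h1 : (n : ℝ) ^ (-s).re ≤ 1 :=
    Real.rpow_le_one_of_one_le_of_nonpos (by exact_mod_cast hn0) (by simpa using hs)
  rw [norm_mul, norm_mul, norm_natCast_cpow hn0, norm_real, Real.norm_eq_abs]
  exact mul_le_one₀ (abs_mobCut_le X n) (by positivity)
    (mul_le_one₀ (χ.norm_le_one n) (by positivity) h1)

lemma natLog_floor_add_one_le {X : ℝ} (hX : 1 ≤ X) :
    ((Nat.log 2 ⌊X⌋₊ + 1 : ℕ) : ℝ) ≤ 2 * Real.log X + 1 := by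
  have h1 : (2 : ℝ) ^ Nat.log 2 ⌊X⌋₊ ≤ X := by
    refine le_trans ?_ (Nat.floor_le (by linarith : 0 ≤ X))
    exact_mod_cast Nat.pow_log_le_self 2 (Nat.floor_pos.2 hX).ne'
  have h2 := Real.log_le_log (by positivity) h1
  rw [Real.log_pow] at h2
  push_cast
  nlinarith [Real.log_two_gt_d9, (Nat.cast_nonneg (Nat.log 2 ⌊X⌋₊) : (0 : ℝ) ≤ _)]

lemma sum_two_pow_le {X : ℝ} (hX : 1 ≤ X) :
    ∑ j ∈ Finset.range (Nat.log 2 ⌊X⌋₊ + 1), (2 : ℝ) ^ j ≤ 2 * X := by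
  have h1 : (2 : ℝ) ^ Nat.log 2 ⌊X⌋₊ ≤ X := by
    refine le_trans ?_ (Nat.floor_le (by linarith : 0 ≤ X))
    exact_mod_cast Nat.pow_log_le_self 2 (Nat.floor_pos.2 hX).ne'
  rw [geom_sum_eq (by norm_num), pow_succ]
  linarith

lemma div_four_le_scaleWeight_two_pow {X : ℝ} {n : ℕ} (hn : n ∈ Finset.Icc 1 ⌊X⌋₊) :
    (n : ℝ) / 4 ≤ scaleWeight (Finset.range (Nat.log 2 ⌊X⌋₊ + 1)) (fun j => 2 ^ j) (fun _ => 1) n := by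
  obtain ⟨h1, h2⟩ := Finset.mem_Icc.1 hn
  refine le_trans (by rw [one_mul]) (le_scaleWeight (j := Nat.log 2 n) (fun j _ => by positivity)
    (fun j _ => zero_le_one) (Finset.mem_range.2 (Nat.lt_succ_of_le (Nat.log_mono_right h2))) ?_ ?_)
  · exact_mod_cast Nat.pow_log_le_self 2 (by omega)
  · have := Nat.lt_pow_succ_log_self one_lt_two n
    rw [pow_succ, mul_comm] at this
    exact_mod_cast this

lemma two_le_log {D : ℝ} (hD : (400 : ℝ) ^ 4 ≤ D) : 2 ≤ Real.log D := by
  rw [Real.le_log_iff_exp_le (by linarith), show (2 : ℝ) = (2 : ℕ) * 1 by norm_num, Real.exp_nat_mul]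
  nlinarith [Real.exp_one_lt_d9, Real.exp_pos 1]

theorem exists_card_le_of_large_mollifier : ∃ C : ℝ, 1 ≤ C ∧ ∀ (q : ℕ) [NeZero q] (T X V : ℝ), 2 ≤ T →
    (400 : ℝ) ^ 4 ≤ q * T → 1 ≤ X → Real.log X ≤ 13 * Real.log (q * T) → 0 < V →
    C * ((q * T) ^ (1 / 2 : ℝ) * Real.log (q * T) ^ (7 / 2 : ℝ)) ≤ V ^ 2 →
    ∀ (R : Finset (DirichletCharacter ℂ q × ℤ)) (γ : DirichletCharacter ℂ q × ℤ → ℝ),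
    (∀ r ∈ R, |γ r| ≤ T + 5 * Real.log (q * T)) → WellSpaced R γ (6 * Real.log (q * T)) →
    (∀ r ∈ R, V ≤ ‖mollifier r.1 X (1 / 2 + γ r * I)‖) →
    (R.card : ℝ) ≤ C * (Real.log (q * T) ^ 2 * X) / V ^ 2 := by
  obtain ⟨K, hK, h⟩ := exists_card_le_of_large_sum
  refine ⟨1 + K * 56 * 27, by linarith [show 0 < K * 56 * 27 by positivity],
    fun q _ T X V hT hD hX hXL hV hVV R γ hγ hsp hlarge => ?_⟩
  have hL2 := two_le_log hD
  set D : ℝ := q * T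
  set L := Real.log D
  have hre : ∀ r, (1 / 2 + γ r * I : ℂ).re = 1 / 2 := fun r => by simp
  have him : ∀ r, (1 / 2 + γ r * I : ℂ).im = γ r := fun r => by simp
  have hw : ∀ n ∈ Finset.Icc 1 ⌊X⌋₊, (0 : ℝ) < n / 4 := fun n hn => by
    have : (0 : ℝ) < n := Nat.cast_pos.2 (Finset.mem_Icc.1 hn).1
    positivity
  have hJ := natLog_floor_add_one_le hX
  refine (h q (1 / 2) T hT hD le_rfl R (fun r => 1 / 2 + γ r * I)
    (fun r hr => ⟨(hre r).ge, by rw [hre]; norm_num, by rw [him]; exact hγ r hr⟩)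
    (by simpa only [him] using hsp) (Finset.range (Nat.log 2 ⌊X⌋₊ + 1)) (fun j => 2 ^ j) (fun _ => 1)
    (fun j _ => one_le_pow₀ one_le_two) (fun _ _ => zero_le_one) (Finset.Icc 1 ⌊X⌋₊)
    (fun n => (mobCut X n : ℂ)) (fun n hn => (hw n hn).trans_le (div_four_le_scaleWeight_two_pow hn))
    V (56 * L) (2 * X) (27 * L) hV
    (fun r hr => by rw [← mollifier_eq_sum]; exact hlarge r hr) ?_ ?_ ?_ ?_).trans ?_
  · calc _ ≤ ∑ n ∈ Finset.Icc 1 ⌊X⌋₊, 4 * (n : ℝ)⁻¹ := by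
          refine Finset.sum_le_sum fun n hn => ?_
          have hn0 := hw n hn
          rw [norm_real, Real.norm_eq_abs]
          calc _ ≤ 1 ^ 2 / ((n : ℝ) / 4) := by
                gcongr
                · exact abs_mobCut_le X n
                · exact div_four_le_scaleWeight_two_pow hn
            _ = _ := by rw [one_pow, one_div_div, div_eq_mul_inv]
      _ ≤ 4 * (1 + Real.log X) := by
          rw [← Finset.mul_sum]
          gcongr
          exact sum_Icc_inv_le hX
      _ ≤ _ := by linarith
  · norm_num
    exact sum_two_pow_le hX
  · norm_num
    push_cast at hJ
    linarith
  · have h1 : L ^ (7 / 2 : ℝ) = L ^ (3 / 2 : ℝ) * L ^ 2 := by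
      rw [← Real.rpow_add_natCast (by positivity)]
      norm_num
    rw [h1] at hVV
    have h2 : 0 ≤ D ^ (1 / 2 : ℝ) * (L ^ (3 / 2 : ℝ) * L ^ 2) := by positivity
    linarith
  · refine div_le_div_of_nonneg_right ?_ (by positivity)
    have : 0 ≤ K * (L ^ 2 * X) := by positivity
    have : 0 ≤ L ^ 2 * X := by positivity
    change K * (56 * L * L * (2 * X)) ≤ _
    linarith

theorem exists_card_le_of_large_product' : ∃ C : ℝ, 0 < C ∧ ∀ (q : ℕ) [NeZero q] (T X A : ℝ), 2 ≤ T →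
    (400 : ℝ) ^ 4 ≤ q * T → 1 ≤ X → Real.log X ≤ 13 * Real.log (q * T) → 0 < A →
    ∀ (R : Finset (DirichletCharacter ℂ q × ℤ)) (γ : DirichletCharacter ℂ q × ℤ → ℝ),
    WellSpaced R γ 1 → (∀ r ∈ R, |γ r| ≤ T) →
    (∀ r ∈ R, ENNReal.ofReal A ≤ ∫⁻ v : ℝ, ‖LFunction r.1 (1 / 2 + (γ r + v : ℝ) * I)‖ₑ *
      ‖mollifier r.1 X (1 / 2 + (γ r + v : ℝ) * I)‖ₑ * ENNReal.ofReal (Real.exp (-v ^ 2))) →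
    (R.card : ℝ) ≤ C * ((A ^ 4)⁻¹ * ((q * T) ^ 2 * Real.log (q * T) ^ 13) +
      X * (q * T) ^ (-(1 / 2) : ℝ)) := by
  classical
  obtain ⟨C₁, hC₁, h₁⟩ := exists_card_le_of_large_mean
  obtain ⟨C₂, hC₂, h₂⟩ := exists_card_le_of_large_mollifier
  refine ⟨C₁ * C₂ ^ 2 + 1, by positivity, fun q _ T X A hT hD hX hXL hA R γ hsp hγ hlarge => ?_⟩
  have hL2 := two_le_log hD
  have hD1 : 1 ≤ q * T := by linarith
  set D : ℝ := q * T
  set L := Real.log D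
  have hE : 1 ≤ D ^ (1 / 2 : ℝ) * L ^ (7 / 2 : ℝ) :=
    one_le_mul_of_one_le_of_one_le (Real.one_le_rpow hD1 (by norm_num))
      (Real.one_le_rpow (by linarith) (by norm_num))
  set W := C₂ * (D ^ (1 / 2 : ℝ) * L ^ (7 / 2 : ℝ)) with hW
  have hW1 : 1 ≤ W := one_le_mul_of_one_le_of_one_le hC₂ hE
  set V := √W with hV
  have hVW : V ^ 2 = W := Real.sq_sqrt (by linarith)
  have hV1 : 1 ≤ V := Real.one_le_sqrt.2 hW1
  set p : DirichletCharacter ℂ q × ℤ → Prop := fun r =>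
    ∀ v : ℝ, ‖mollifier r.1 X (1 / 2 + (γ r + v : ℝ) * I)‖ ≤ V * Real.exp (v ^ 2 / 2) with hp
  have hsplit : (R.card : ℝ) = (R.filter p).card + (R.filter fun r => ¬ p r).card := by
    exact_mod_cast (Finset.card_filter_add_card_filter_not (s := R) p).symm
  have hsmall : ((R.filter p).card : ℝ) ≤ C₁ * C₂ ^ 2 * ((A ^ 4)⁻¹ * (D ^ 2 * L ^ 13)) := by
    refine (h₁ q T (A / V) hT (by positivity) (R.filter p) γ
      (fun r hr => hsp r (Finset.mem_filter.1 hr).1) (fun r hr => hγ r (Finset.mem_filter.1 hr).1)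
      fun r hr => ?_).trans (le_of_eq ?_)
    · obtain ⟨hr1, hr2⟩ := Finset.mem_filter.1 hr
      have h3 : ENNReal.ofReal A ≤ ENNReal.ofReal V * ∫⁻ v : ℝ,
          ‖LFunction r.1 (1 / 2 + (γ r + v : ℝ) * I)‖ₑ * ENNReal.ofReal (Real.exp (-v ^ 2 / 2)) := by
        refine (hlarge r hr1).trans ?_
        rw [← lintegral_const_mul' _ _ ENNReal.ofReal_ne_top]
        refine lintegral_mono fun v => ?_
        simp only [← ofReal_norm]
        rw [← ENNReal.ofReal_mul (by positivity), ← ENNReal.ofReal_mul (by positivity),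
          ← ENNReal.ofReal_mul (by positivity), ← ENNReal.ofReal_mul (by positivity)]
        refine ENNReal.ofReal_le_ofReal ?_
        calc _ ≤ ‖LFunction r.1 (1 / 2 + (γ r + v : ℝ) * I)‖ * (V * Real.exp (v ^ 2 / 2)) *
              Real.exp (-v ^ 2) := by
              gcongr
              exact hr2 v
          _ = V * (‖LFunction r.1 (1 / 2 + (γ r + v : ℝ) * I)‖ *
              (Real.exp (v ^ 2 / 2) * Real.exp (-v ^ 2))) := by ring
          _ = _ := by
              rw [← Real.exp_add]
              ring_nf
      rw [ENNReal.ofReal_div_of_pos (by linarith)]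
      refine ENNReal.div_le_of_le_mul ?_
      rwa [mul_comm]
    · have h4 : V ^ 4 = C₂ ^ 2 * (D * L ^ 7) := by
        have hD' : (D ^ (1 / 2 : ℝ)) ^ 2 = D := by
          rw [← Real.sqrt_eq_rpow, Real.sq_sqrt (by linarith)]
        have hL' : (L ^ (7 / 2 : ℝ)) ^ 2 = L ^ 7 := by
          rw [← Real.rpow_mul_natCast (by linarith), ← Real.rpow_natCast]
          norm_num
        rw [show V ^ 4 = (V ^ 2) ^ 2 by ring, hVW, hW, mul_pow, mul_pow, hD', hL']
      rw [div_pow, inv_div, h4]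
      ring
  have hbig : ((R.filter fun r => ¬ p r).card : ℝ) ≤ X * D ^ (-(1 / 2) : ℝ) := by
    have hex : ∀ r ∈ R.filter fun r => ¬ p r, ∃ v : ℝ, |v| ≤ 5 * L ∧
        V ≤ ‖mollifier r.1 X (1 / 2 + (γ r + v : ℝ) * I)‖ := by
      intro r hr
      have hr2 := (Finset.mem_filter.1 hr).2
      simp only [hp] at hr2
      push Not at hr2
      obtain ⟨v, hv⟩ := hr2
      have he : 1 ≤ Real.exp (v ^ 2 / 2) := Real.one_le_exp (by positivity)
      refine ⟨v, ?_, by nlinarith⟩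
      have h3 : Real.exp (v ^ 2 / 2) ≤ X := by
        have := norm_mollifier_le_self r.1 (by linarith : 0 ≤ X)
          (s := 1 / 2 + (γ r + v : ℝ) * I)
          (by rw [add_re, re_ofReal_mul, I_re, mul_zero]; norm_num)
        nlinarith
      have h4 : v ^ 2 / 2 ≤ Real.log X := (Real.le_log_iff_exp_le (by linarith)).2 h3
      exact abs_le_of_sq_le_sq (by nlinarith) (by linarith)
    choose! v hv1 hv2 using hex
    refine (h₂ q T X V hT hD hX hXL (by linarith) hVW.ge _ (fun r => γ r + v r)
      (fun r hr => ?_) (fun r hr => ?_) fun r hr => by exact_mod_cast hv2 r hr).trans ?_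
    · exact (abs_add_le _ _).trans (add_le_add (hγ r (Finset.mem_filter.1 hr).1) (hv1 r hr))
    · have h3 := hsp r (Finset.mem_filter.1 hr).1
      have h4 : γ r + v r - r.2 = (γ r - r.2) + v r := by ring
      simp only [h4]
      exact (abs_add_le _ _).trans (by linarith [hv1 r hr])
    · rw [hVW, hW, Real.rpow_neg (by linarith), div_le_iff₀ (by positivity)]
      have h3 : L ^ 2 ≤ L ^ (7 / 2 : ℝ) := by
        rw [← Real.rpow_natCast]
        exact Real.rpow_le_rpow_of_exponent_le (by linarith) (by norm_num)
      calc C₂ * (L ^ 2 * X) ≤ C₂ * (L ^ (7 / 2 : ℝ) * X) := by gcongr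
        _ = _ := by
            field_simp
  rw [hsplit]
  have e1 : 0 ≤ (A ^ 4)⁻¹ * (D ^ 2 * L ^ 13) := by positivity
  have e2 : 0 ≤ X * D ^ (-(1 / 2) : ℝ) := by positivity
  have e3 : 0 ≤ C₁ * C₂ ^ 2 := by positivity
  nlinarith [mul_nonneg e3 e2]

end ZeroDensity

namespace ZeroDensity

open Complex MeasureTheory Set Filter Topology DirichletCharacter

/-! ### The range `4 / 5 ≤ σ ≤ 1` -/

theorem exists_card_le_of_four_fifths_le : ∃ C : ℝ, 0 < C ∧ ∀ (q : ℕ) [NeZero q] (σ T : ℝ),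
    4 / 5 ≤ σ → σ ≤ 1 → 2 ≤ T →
    ∀ (R : Finset (DirichletCharacter ℂ q × ℤ)) (ρ : DirichletCharacter ℂ q × ℤ → ℂ),
    ZeroFamily R ρ σ T →
    (R.card : ℝ) ≤ C * ((q * T) ^ (2 * (1 - σ) / σ) * Real.log (q * T) ^ 13) := by
  obtain ⟨C₀, C₁, hC₀, hC₁, h₁⟩ := exists_card_le_of_large_detSum'
  obtain ⟨C₂, hC₂, h₂⟩ := exists_card_le_of_large_product'
  refine ⟨4 * (400 ^ 4 + C₀) * 2 ^ 13 + (2 * C₁ + C₂ * (5 ^ 4 + C₀ ^ 2)), by positivity,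
    fun q _ σ T hσ hσ1 hT R ρ h => ?_⟩
  have hD2 := two_le_level_mul q hT
  have hL2 := half_le_log hD2
  have he : 0 ≤ 2 * (1 - σ) / σ := div_nonneg (by linarith) (by linarith)
  have hE : 0 ≤ (q * T) ^ (2 * (1 - σ) / σ) * Real.log (q * T) ^ 13 := by positivity
  rcases le_or_gt (q * T) ((400 : ℝ) ^ 4 + C₀) with hsmall | hlarge
  · refine (h.card_le_of_le hT hsmall he 13).trans (mul_le_mul_of_nonneg_right ?_ hE)
    linarith [show 0 ≤ 2 * C₁ + C₂ * (5 ^ 4 + C₀ ^ 2) by positivity]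
  have hgoal : (R.card : ℝ) ≤ (2 * C₁ + C₂ * (5 ^ 4 + C₀ ^ 2)) *
      ((q * T) ^ (2 * (1 - σ) / σ) * Real.log (q * T) ^ 13) := by
    have hDbig : (400 : ℝ) ^ 4 ≤ q * T := by linarith
    have hL2 := two_le_log hDbig
    set D : ℝ := q * T
    have hD0 : 0 < D := by linarith
    have hD1 : 1 ≤ D := by linarith
    set L := Real.log D with hLdef
    have hL1 : 1 ≤ L := by linarith
    have hLD : L ≤ D := (Real.log_le_sub_one_of_pos hD0).trans (by linarith)
    have hσ0 : 0 < σ := by linarith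
    have hα0 : 0 < 2 * σ - 1 := by linarith
    set Y := D ^ (1 / σ) with hY
    have hDY : D ≤ Y := by
      conv_lhs => rw [← Real.rpow_one D]
      exact Real.rpow_le_rpow_of_exponent_le hD1 ((one_le_div hσ0).2 hσ1)
    have hYL : Real.log Y ≤ 5 / 4 * L := by
      rw [hY, Real.log_rpow hD0]
      refine mul_le_mul_of_nonneg_right ?_ (by linarith)
      rw [div_le_iff₀ hσ0]
      linarith
    have hY1 : Y ^ (2 - 2 * σ) = D ^ (2 * (1 - σ) / σ) := by
      rw [hY, ← Real.rpow_mul hD0.le]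
      congr 1
      ring
    set α := 1 / (2 * σ - 1) with hα
    have hα1 : 1 ≤ α := by rw [hα, le_div_iff₀ hα0]; linarith
    have hα2 : α ≤ 5 / 3 := by rw [hα, div_le_iff₀ hα0]; linarith
    set G := C₀ * (D ^ (1 / 2 : ℝ) * L ^ 6) with hG
    have hG1 : 1 ≤ G := one_le_mul_of_one_le_of_one_le hC₀
      (one_le_mul_of_one_le_of_one_le (Real.one_le_rpow hD1 (by norm_num)) (one_le_pow₀ hL1))
    set X := G ^ α with hX
    have hX1 : 1 ≤ X := Real.one_le_rpow hG1 (by linarith)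
    have hXα : X ^ (2 * σ - 1) = G := by
      rw [hX, ← Real.rpow_mul (by linarith), hα, one_div_mul_cancel hα0.ne', Real.rpow_one]
    have hXL : Real.log X ≤ 13 * L := by
      have hGD : Real.log G ≤ 15 / 2 * L := by
        rw [hLdef, ← Real.log_rpow hD0]
        refine Real.log_le_log (by linarith) ?_
        calc G ≤ D ^ (1 : ℝ) * (D ^ (1 / 2 : ℝ) * D ^ (6 : ℝ)) := by
              rw [hG, Real.rpow_one]
              gcongr ?_ * (_ * ?_)
              · linarith
              · rw [← Real.rpow_natCast]
                norm_num
                gcongr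
          _ = _ := by
              rw [← Real.rpow_add hD0, ← Real.rpow_add hD0]
              norm_num
      rw [hX, Real.log_rpow (by linarith)]
      calc α * Real.log G ≤ 5 / 3 * (15 / 2 * L) :=
            mul_le_mul hα2 hGD (Real.log_nonneg hG1) (by norm_num)
        _ ≤ 13 * L := by linarith
    have hmain := h.card_le_of_zero_detection (by linarith) (X := X) (Y := Y)
      (B₁ := C₁ * (D ^ (2 * (1 - σ) / σ) * L ^ 13))
      (B₂ := C₂ * (5 ^ 4 + C₀ ^ 2) * (D ^ (2 * (1 - σ) / σ) * L ^ 13)) hX1 (by linarith) ?_ ?_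
    · linarith
    · intro i R' hR' hlarge'
      refine (h₁ q T X Y σ i hT hDbig hX1 (by linarith) hYL hσ hσ1 hXα.ge R' ρ (h.subset hR')
        hlarge').trans ?_
      rw [hY1]
      gcongr
      norm_num
    · intro R' hR' hlarge'
      set κ := 1 + 1 / (σ - 1 / 2) with hκ
      have hσ2 : 0 < σ - 1 / 2 := by linarith
      have hκ0 : 0 < κ := by positivity
      have hκ1 : κ ≤ 5 := by
        have : 1 / (σ - 1 / 2) ≤ 4 := by
          rw [div_le_iff₀ hσ2]
          linarith
        linarith
      refine (h₂ q T X (Y ^ (σ - 1 / 2) / κ) hT hDbig hX1 hXL (by positivity) R' (fun r => (ρ r).im)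
        (h.subset hR').wellSpaced (h.subset hR').abs_im_le hlarge').trans ?_
      have e1 : ((Y ^ (σ - 1 / 2) / κ) ^ 4)⁻¹ * (D ^ 2 * L ^ 13) ≤
          5 ^ 4 * (D ^ (2 * (1 - σ) / σ) * L ^ 13) := by
        have e2 : ((Y ^ (σ - 1 / 2)) ^ 4)⁻¹ * D ^ 2 = D ^ (2 * (1 - σ) / σ) := by
          rw [hY, ← Real.rpow_mul hD0.le, ← Real.rpow_mul_natCast hD0.le, ← Real.rpow_neg hD0.le,
            ← Real.rpow_natCast D, ← Real.rpow_add hD0]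
          congr 1
          field_simp
          push_cast
          ring
        calc _ = κ ^ 4 * (((Y ^ (σ - 1 / 2)) ^ 4)⁻¹ * D ^ 2 * L ^ 13) := by
              rw [div_pow, inv_div]
              ring
          _ ≤ _ := by
              rw [e2]
              gcongr
      have e3 : X * D ^ (-(1 / 2) : ℝ) ≤ C₀ ^ 2 * (D ^ (2 * (1 - σ) / σ) * L ^ 13) := by
        have e4 : X = C₀ ^ α * (D ^ (α / 2) * L ^ (6 * α)) := by
          rw [hX, hG, Real.mul_rpow (by positivity) (by positivity),
            Real.mul_rpow (by positivity) (by positivity), ← Real.rpow_mul hD0.le,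
            ← Real.rpow_natCast L 6, ← Real.rpow_mul (by linarith)]
          congr 3
          ring
        calc X * D ^ (-(1 / 2) : ℝ) = C₀ ^ α * (D ^ (α / 2 + -(1 / 2)) * L ^ (6 * α)) := by
              rw [e4, Real.rpow_add hD0]
              ring
          _ ≤ C₀ ^ ((2 : ℕ) : ℝ) * (D ^ (2 * (1 - σ) / σ) * L ^ ((13 : ℕ) : ℝ)) := by
              gcongr
              · push_cast
                linarith
              · have : α / 2 + -(1 / 2) = (1 - σ) / (2 * σ - 1) := by
                  rw [hα]
                  field_simp
                  ring
                rw [this, div_le_div_iff₀ hα0 hσ0]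
                nlinarith
              · push_cast
                linarith
          _ = _ := by rw [Real.rpow_natCast, Real.rpow_natCast]
      calc _ ≤ C₂ * (5 ^ 4 * (D ^ (2 * (1 - σ) / σ) * L ^ 13) +
            C₀ ^ 2 * (D ^ (2 * (1 - σ) / σ) * L ^ 13)) := by gcongr
        _ = _ := by ring
  refine hgoal.trans (mul_le_mul_of_nonneg_right ?_ hE)
  linarith [show 0 ≤ 4 * ((400 : ℝ) ^ 4 + C₀) * 2 ^ 13 by positivity]

/-! ### From separated families to the counting functions -/

lemma sum_zeroCountingFunction_le_of_card_le {q : ℕ} [NeZero q] {σ T e C C' : ℝ} {k : ℕ}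
    (hT : 2 ≤ T) (he : 0 ≤ e) (hC : 0 < C)
    (h : ∀ B : ℝ, (∀ (R : Finset (DirichletCharacter ℂ q × ℤ)) (ρ : DirichletCharacter ℂ q × ℤ → ℂ),
      ZeroFamily R ρ σ T → (R.card : ℝ) ≤ B) →
      ∑ χ : DirichletCharacter ℂ q, zeroCountingFunction χ σ T ≤
        ENNReal.ofReal (C * Real.log (q * T) * (B + 2)))
    (h' : ∀ (R : Finset (DirichletCharacter ℂ q × ℤ)) (ρ : DirichletCharacter ℂ q × ℤ → ℂ),
      ZeroFamily R ρ σ T → (R.card : ℝ) ≤ C' * ((q * T) ^ e * Real.log (q * T) ^ k)) :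
    ∑ χ : DirichletCharacter ℂ q, zeroCountingFunction χ σ T ≤
      ENNReal.ofReal (C * (C' + 2 * 2 ^ k) * (q * T) ^ e * Real.log (q * T) ^ (k + 1)) := by
  have hD2 := two_le_level_mul q hT
  have hL := half_le_log hD2
  refine (h _ h').trans (ENNReal.ofReal_le_ofReal ?_)
  have h1 := one_le_two_pow_mul hD2 he k
  calc _ ≤ C * Real.log (q * T) * (C' * ((q * T) ^ e * Real.log (q * T) ^ k) +
        2 * (2 ^ k * ((q * T) ^ e * Real.log (q * T) ^ k))) := by
        gcongr
        linarith
    _ = _ := by ring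

end ZeroDensity

/-- Montgomery's zero-density estimate. There is an absolute constant `C > 0`
such that for all `q ≥ 1`, `T ≥ 2` and all real `σ`:
if `1/2 ≤ σ ≤ 4/5` then `∑_{χ mod q} N(σ,T,χ) ≤ C (qT)^{3(1-σ)/(2-σ)} (log qT)^9`, and
if `4/5 ≤ σ ≤ 1` then `∑_{χ mod q} N(σ,T,χ) ≤ C (qT)^{2(1-σ)/σ} (log qT)^{14}`. -/
theorem zero_density_estimate :
    ∃ C : ℝ, 0 < C ∧ ∀ (q : ℕ) [NeZero q], 1 ≤ q → ∀ T : ℝ, 2 ≤ T → ∀ σ : ℝ,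
      (1/2 ≤ σ → σ ≤ 4/5 →
        ∑ χ : DirichletCharacter ℂ q, zeroCountingFunction χ σ T ≤
          ENNReal.ofReal
            (C * ((q : ℝ) * T) ^ (3 * (1 - σ) / (2 - σ)) * Real.log ((q : ℝ) * T) ^ (9 : ℕ))) ∧
      (4/5 ≤ σ → σ ≤ 1 →
        ∑ χ : DirichletCharacter ℂ q, zeroCountingFunction χ σ T ≤
          ENNReal.ofReal
            (C * ((q : ℝ) * T) ^ (2 * (1 - σ) / σ) * Real.log ((q : ℝ) * T) ^ (14 : ℕ))) := by
  obtain ⟨C, hC, h⟩ := ZeroDensity.exists_sum_zeroCountingFunction_le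
  obtain ⟨C₁, hC₁, h₁⟩ := ZeroDensity.exists_card_le_of_le_four_fifths
  obtain ⟨C₂, hC₂, h₂⟩ := ZeroDensity.exists_card_le_of_four_fifths_le
  refine ⟨C * (C₁ + 2 * 2 ^ 8) + C * (C₂ + 2 * 2 ^ 13), by positivity,
    fun q _ _ T hT σ => ⟨fun hσ hσ' => ?_, fun hσ hσ' => ?_⟩⟩
  all_goals
    have hD := ZeroDensity.two_le_level_mul q hT
    have hL := ZeroDensity.half_le_log hD
  · refine (ZeroDensity.sum_zeroCountingFunction_le_of_card_le hT
      (div_nonneg (by linarith) (by linarith)) hC (fun B => h q σ T B hσ hT)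
      (h₁ q σ T hσ hσ' hT)).trans (ENNReal.ofReal_le_ofReal ?_)
    gcongr
    exact le_add_of_nonneg_right (by positivity)
  · refine (ZeroDensity.sum_zeroCountingFunction_le_of_card_le hT
      (div_nonneg (by linarith) (by linarith)) hC (fun B => h q σ T B (by linarith) hT)
      (h₂ q σ T hσ hσ' hT)).trans (ENNReal.ofReal_le_ofReal ?_)
    gcongr
    exact le_add_of_nonneg_left (by positivity)
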